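/- For every positive integer r, there is an integer g(r) such that every loopless 2-connected graph G with |E(G)| ≥ g(r) has, as a cc-minor, a parallel-path extension of a graph having a tree decomposition whose underlying tree is a path on at least r vertices, where each vertex of the path is labeled either by a copy of K_3 or of the bond graph B_3, or by a copy of K_4 in which the basepoints form a matching. -/

import Mathlib

open scoped Classical

noncomputable section

/-- A finite multigraph with vertices and edge names drawn from `ℕ`.
Each edge name `e ∈ E` has a pair of (possibly equal) endpoints `ends e`. -/
structure MGraph where
  V : Finset ℕ
  E : Finset ℕ
  ends : ℕ → Sym2 ℕ
  ends_mem : ∀ e ∈ E, ∀ v ∈ ends e, v ∈ V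

namespace MGraph

/-- Adjacency via some edge. -/
def Adj (G : MGraph) (u v : ℕ) : Prop := ∃ e ∈ G.E, G.ends e = s(u, v)

/-- Reachability. -/
def Reach (G : MGraph) : ℕ → ℕ → Prop := Relation.ReflTransGen G.Adj

/-- A graph is connected if it has a vertex and all vertices are mutually reachable. -/
def Connected (G : MGraph) : Prop :=
  G.V.Nonempty ∧ ∀ u ∈ G.V, ∀ v ∈ G.V, G.Reach u v

/-- Delete a set of edges. -/
def deleteEdges (G : MGraph) (Z : Finset ℕ) : MGraph where
  V := G.V
  E := G.E \ Z
  ends := G.ends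
  ends_mem := fun e he => G.ends_mem e (Finset.mem_sdiff.mp he).1

/-- A graph with at least two vertices is `k`-edge-connected if deleting any
set of fewer than `k` edges leaves it connected. -/
def EdgeConnected (G : MGraph) (k : ℕ) : Prop :=
  2 ≤ G.V.card ∧ ∀ Z ⊆ G.E, Z.card < k → (G.deleteEdges Z).Connected

/-- A graph is loopless if no edge has equal endpoints. -/
def Loopless (G : MGraph) : Prop := ∀ e ∈ G.E, ¬ (G.ends e).IsDiag

/-- The set of vertices met by an edge set. -/
def vertsOf (G : MGraph) (C : Finset ℕ) : Finset ℕ :=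
  G.V.filter (fun v => ∃ e ∈ C, v ∈ G.ends e)

/-- Degree of `v` in the edge set `C` (loops counted twice). -/
def degIn (G : MGraph) (C : Finset ℕ) (v : ℕ) : ℕ :=
  ∑ e ∈ C, (if G.ends e = s(v, v) then 2 else if v ∈ G.ends e then 1 else 0)

/-- `C` is the edge set of a cycle of `G`: a nonempty connected edge set in which
every vertex met has degree exactly two (a loop and a pair of parallel edges are cycles). -/
def IsCycleSet (G : MGraph) (C : Finset ℕ) : Prop :=
  C.Nonempty ∧ C ⊆ G.E ∧
  (∀ v ∈ G.vertsOf C, G.degIn C v = 2) ∧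
  ∀ u ∈ G.vertsOf C, ∀ v ∈ G.vertsOf C,
    Relation.ReflTransGen (fun a b => ∃ e ∈ C, G.ends e = s(a, b)) u v

/-- The vertex map identifying all vertices of `U` (within `G.V`) to a single one. -/
def cmapOn (G : MGraph) (U : Finset ℕ) : ℕ → ℕ :=
  fun v => if v ∈ U ∩ G.V then sInf {w : ℕ | w ∈ U ∩ G.V} else v

/-- Contract the vertex set `U` to a single vertex, deleting the edges of `S` and all
newly created loops (edges with both ends in `U` that were not already loops), while
keeping pre-existing loops not in `S`. -/
def contractOn (G : MGraph) (U S : Finset ℕ) : MGraph where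
  V := G.V.image (G.cmapOn U)
  E := G.E.filter (fun e => ¬ (∀ v ∈ G.ends e, v ∈ U) ∨ ((G.ends e).IsDiag ∧ e ∉ S))
  ends := fun e => (G.ends e).map (G.cmapOn U)
  ends_mem := by
    intro e he v hv
    have he' : e ∈ G.E := (Finset.mem_filter.mp he).1
    rw [Sym2.mem_map] at hv
    obtain ⟨w, hw, rfl⟩ := hv
    have hwV : w ∈ G.V := G.ends_mem e he' w hw
    by_cases h : w ∈ U ∩ G.V
    · have hmem : sInf {x : ℕ | x ∈ U ∩ G.V} ∈ U ∩ G.V := Nat.sInf_mem ⟨w, h⟩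
      refine Finset.mem_image.mpr ⟨sInf {x : ℕ | x ∈ U ∩ G.V},
        (Finset.mem_inter.mp hmem).2, ?_⟩
      simp [cmapOn, h, hmem]
    · exact Finset.mem_image.mpr ⟨w, hwV, by simp [cmapOn, h]⟩

/-- Contract a cycle (given by its edge set), deleting all created loops. -/
def contractCycle (G : MGraph) (C : Finset ℕ) : MGraph :=
  G.contractOn (G.vertsOf C) C

/-- `H` is a cycle-contraction minor (cc-minor) of `G`: `H` is obtained from `G` by
a sequence of cycle contractions (each accompanied by contraction of created loops). -/
def CCMinor (G H : MGraph) : Prop :=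
  Relation.ReflTransGen (fun A B => ∃ C, A.IsCycleSet C ∧ B = A.contractCycle C) G H

/-- Walks: a vertex list together with a matching edge list. -/
inductive IsWalk (G : MGraph) : List ℕ → List ℕ → Prop
  | nil {v : ℕ} (hv : v ∈ G.V) : IsWalk G [v] []
  | cons {u v : ℕ} {e : ℕ} {vs es : List ℕ} (he : e ∈ G.E)
      (hends : G.ends e = s(u, v)) (hw : IsWalk G (v :: vs) es) :
      IsWalk G (u :: v :: vs) (e :: es)

/-- A path from `u` to `v`, given by its vertex list and edge list. -/
def IsPathBetween (G : MGraph) (u v : ℕ) (vs es : List ℕ) : Prop :=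
  G.IsWalk vs es ∧ vs.Nodup ∧ vs.head? = some u ∧ vs.getLast? = some v

/-- `G` is `k`-connected: it has at least `k` vertices and any two distinct vertices are
joined by at least `k` pairwise internally disjoint paths. -/
def KConnected (G : MGraph) (k : ℕ) : Prop :=
  k ≤ G.V.card ∧ ∀ u ∈ G.V, ∀ v ∈ G.V, u ≠ v →
    ∃ P : Fin k → List ℕ × List ℕ,
      (∀ i, G.IsPathBetween u v (P i).1 (P i).2) ∧
      ∀ i j, i ≠ j →
        (∀ x, x ∈ (P i).1 → x ∈ (P j).1 → x = u ∨ x = v) ∧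
        (∀ e, e ∈ (P i).2 → e ∉ (P j).2)

/-- A simple graph: no loops and no parallel edges. -/
def Simple (G : MGraph) : Prop :=
  G.Loopless ∧ ∀ e ∈ G.E, ∀ f ∈ G.E, G.ends e = G.ends f → e = f

/-- Graph isomorphism. -/
def Iso (G H : MGraph) : Prop :=
  ∃ φ ψ : ℕ → ℕ, Set.BijOn φ ↑G.V ↑H.V ∧ Set.BijOn ψ ↑G.E ↑H.E ∧
    ∀ e ∈ G.E, H.ends (ψ e) = (G.ends e).map φ

/-- The bond graph `B n`: two vertices joined by `n` parallel edges. -/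
def IsBondGraph (H : MGraph) (n : ℕ) : Prop :=
  ∃ u v : ℕ, u ≠ v ∧ H.V = {u, v} ∧ H.E.card = n ∧ ∀ e ∈ H.E, H.ends e = s(u, v)

end MGraph

namespace MGraph

/-- `F` is a subgraph of `G`. -/
def IsSubgraph (F G : MGraph) : Prop :=
  F.V ⊆ G.V ∧ F.E ⊆ G.E ∧ ∀ e ∈ F.E, F.ends e = G.ends e

end MGraph

/-- The internal vertices of a path recorded as a pair (vertex list, edge list). -/
def pathInternals (p : List ℕ × List ℕ) : List ℕ := p.1.tail.dropLast

/-- `J` is a parallel-path extension of `K`: `J` is obtained from `K` by, for each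
non-loop edge `e` of `K`, deleting `e` and adding a non-empty set `P e` of internally
disjoint paths, each with at least one edge, connecting the ends of `e`; the internal
vertices of all these paths are new and pairwise distinct. -/
def IsPPE (J K : MGraph) : Prop :=
  K.V ⊆ J.V ∧
  ∃ P : ℕ → Finset (List ℕ × List ℕ),
    (∀ e, (e ∉ K.E ∨ (K.ends e).IsDiag) → P e = ∅) ∧
    (∀ e ∈ K.E, (K.ends e).IsDiag → e ∈ J.E ∧ J.ends e = K.ends e) ∧
    (∀ e ∈ K.E, ¬ (K.ends e).IsDiag → (P e).Nonempty) ∧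
    (∀ e ∈ K.E, ∀ p ∈ P e,
      (∃ x y : ℕ, K.ends e = s(x, y) ∧ J.IsPathBetween x y p.1 p.2) ∧
      p.2 ≠ [] ∧ ∀ w ∈ pathInternals p, w ∉ K.V) ∧
    (∀ e ∈ K.E, ∀ e' ∈ K.E, ∀ p ∈ P e, ∀ p' ∈ P e', (e ≠ e' ∨ p ≠ p') →
      (∀ w ∈ pathInternals p, w ∉ pathInternals p') ∧ (∀ g ∈ p.2, g ∉ p'.2)) ∧
    (J.V = K.V ∪ K.E.biUnion (fun e => (P e).biUnion (fun p => (pathInternals p).toFinset))) ∧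
    (J.E = K.E.filter (fun e => (K.ends e).IsDiag) ∪
      K.E.biUnion (fun e => (P e).biUnion (fun p => p.2.toFinset)))

/-- `b` is a cut edge of `G`. -/
def MGraph.IsCutEdge (G : MGraph) (b : ℕ) : Prop :=
  b ∈ G.E ∧ ∃ x ∈ G.V, ∃ y ∈ G.V, G.Reach x y ∧ ¬ (G.deleteEdges {b}).Reach x y

/-- `G` is the 2-sum of `G₁` and `G₂` with basepoint `b`: the graphs share exactly the
two endpoints of `b` and the edge `b` itself, which is neither a loop nor a cut edge of
either, and `G` is their union with `b` deleted. -/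
def Is2Sum (G G1 G2 : MGraph) (b : ℕ) : Prop :=
  ∃ u v : ℕ, u ≠ v ∧
    G1.V ∩ G2.V = {u, v} ∧ G1.E ∩ G2.E = {b} ∧
    b ∈ G1.E ∧ b ∈ G2.E ∧ G1.ends b = s(u, v) ∧ G2.ends b = s(u, v) ∧
    ¬ G1.IsCutEdge b ∧ ¬ G2.IsCutEdge b ∧
    G.V = G1.V ∪ G2.V ∧ G.E = (G1.E ∪ G2.E) \ {b} ∧
    (∀ e ∈ G1.E, e ≠ b → G.ends e = G1.ends e) ∧
    (∀ e ∈ G2.E, e ≠ b → G.ends e = G2.ends e)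

/-- `L` is (a copy of) the triangle `K₃`. -/
def IsK3 (L : MGraph) : Prop :=
  L.V.card = 3 ∧ L.E.card = 3 ∧ (∀ g ∈ L.E, ¬ (L.ends g).IsDiag) ∧
  ∀ u ∈ L.V, ∀ v ∈ L.V, u ≠ v → ∃ g ∈ L.E, L.ends g = s(u, v)

/-- `L` is (a copy of) the complete graph `K₄`. -/
def IsK4 (L : MGraph) : Prop :=
  L.V.card = 4 ∧ L.E.card = 6 ∧ (∀ g ∈ L.E, ¬ (L.ends g).IsDiag) ∧
  ∀ u ∈ L.V, ∀ v ∈ L.V, u ≠ v → ∃ g ∈ L.E, L.ends g = s(u, v)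

/-- `K` has a tree decomposition whose underlying tree is a path on `m` vertices, with
vertex labels `parts 0, …, parts (m-1)` and basepoints `bp 0, …, bp (m-2)`: consecutive
labels share exactly the corresponding basepoint edge, non-consecutive labels share no
edges, and `K` is obtained by performing the 2-sums across all basepoints. -/
def IsPathDecompChain (K : MGraph) (m : ℕ) (parts : ℕ → MGraph) (bp : ℕ → ℕ) : Prop :=
  1 ≤ m ∧
  (∀ i, i + 1 < m → bp i ∈ (parts i).E ∧ bp i ∈ (parts (i + 1)).E) ∧
  (∀ i j, j < m → i + 1 < j → ∀ e, ¬ (e ∈ (parts i).E ∧ e ∈ (parts j).E)) ∧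
  (∀ i, i + 1 < m → ∀ e, e ∈ (parts i).E → e ∈ (parts (i + 1)).E → e = bp i) ∧
  ∃ L : ℕ → MGraph, L 0 = parts 0 ∧
    (∀ i, i + 1 < m → Is2Sum (L (i + 1)) (L i) (parts (i + 1)) (bp i)) ∧
    K = L (m - 1)

/-- The label of the `i`-th vertex of the path is a copy of `K₃` or of the bond graph
`B₃`, or a copy of `K₄` in which the basepoints form a matching. -/
def GoodLabel (m : ℕ) (parts : ℕ → MGraph) (bp : ℕ → ℕ) (i : ℕ) : Prop :=
  IsK3 (parts i) ∨ (parts i).IsBondGraph 3 ∨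
    (IsK4 (parts i) ∧ (0 < i → i + 1 < m →
      ∀ x, x ∈ (parts i).ends (bp (i - 1)) → x ∉ (parts i).ends (bp i)))

section

namespace MGraph

/-- `a` and `b` are joined by an edge not in `F`. -/
def Ed (G : MGraph) (F : Finset ℕ) (a b : ℕ) : Prop := ∃ e ∈ G.E, e ∉ F ∧ G.ends e = s(a, b)

/-- One step from `a` to `b` inside `X`, along an edge not in `F`. -/
def St (G : MGraph) (F X : Finset ℕ) (a b : ℕ) : Prop := a ∈ X ∧ b ∈ X ∧ G.Ed F a b

/-- `a` and `b` are joined by a walk inside `X` avoiding the edges of `F`. -/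
def Jn (G : MGraph) (F X : Finset ℕ) : ℕ → ℕ → Prop := Relation.ReflTransGen (G.St F X)

/-- `X` induces a connected graph. -/
def ConnS (G : MGraph) (X : Finset ℕ) : Prop :=
  X.Nonempty ∧ ∀ u ∈ X, ∀ v ∈ X, G.Jn ∅ X u v

/-- `X` induces a graph that stays connected after deleting any one edge. -/
def TwoEC (G : MGraph) (X : Finset ℕ) : Prop :=
  X.Nonempty ∧ ∀ g, ∀ u ∈ X, ∀ v ∈ X, G.Jn {g} X u v

/-- The component of `u` in the graph induced by `X`. -/
def Cmp (G : MGraph) (X : Finset ℕ) (u : ℕ) : Finset ℕ := X.filter (G.Jn ∅ X u)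

/-- `X` induces a forest. -/
def Acy (G : MGraph) (X : Finset ℕ) : Prop := ∀ U ⊆ X, G.TwoEC U → U.card ≤ 1

/-- A convenient form of 2-connectedness. -/
structure Conn2 (G : MGraph) : Prop where
  loopless : G.Loopless
  two_le : 2 ≤ G.V.card
  twoEC : G.TwoEC G.V
  erase : ∀ v ∈ G.V, G.ConnS (G.V.erase v)

variable {G : MGraph} {F F' X Y A B U W : Finset ℕ} {a b u v w x e g : ℕ}

theorem Ed.symm (h : G.Ed F a b) : G.Ed F b a := by
  obtain ⟨e, he, hF, h⟩ := h
  exact ⟨e, he, hF, by rw [h, Sym2.eq_swap]⟩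

theorem Ed.mono (h : G.Ed F a b) (hF : F' ⊆ F) : G.Ed F' a b := by
  obtain ⟨e, he, hF', h⟩ := h
  exact ⟨e, he, fun h => hF' (hF h), h⟩

theorem Ed.to_empty (h : G.Ed F a b) : G.Ed ∅ a b := h.mono (by simp)

theorem ed_of_edge (he : e ∈ G.E) (h : G.ends e = s(a, b)) : G.Ed ∅ a b := ⟨e, he, by simp, h⟩

theorem Ed.mem_left (h : G.Ed F a b) : a ∈ G.V := by
  obtain ⟨e, he, -, h⟩ := h
  exact G.ends_mem e he a (by simp [h])

theorem Ed.mem_right (h : G.Ed F a b) : b ∈ G.V := h.symm.mem_left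

theorem Ed.ne (hG : G.Loopless) (h : G.Ed F a b) : a ≠ b := by
  rintro rfl
  obtain ⟨e, he, -, h⟩ := h
  exact hG e he (by simp [h])

theorem Jn.symm (h : G.Jn F X u v) : G.Jn F X v u := by
  induction h with
  | refl => exact .refl
  | tail _ hs ih => exact .head ⟨hs.2.1, hs.1, hs.2.2.symm⟩ ih

theorem Jn.mono (h : G.Jn F X u v) (hF : F' ⊆ F) (hX : X ⊆ Y) : G.Jn F' Y u v := by
  induction h with
  | refl => exact .refl
  | tail _ hs ih => exact ih.tail ⟨hX hs.1, hX hs.2.1, hs.2.2.mono hF⟩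

theorem Jn.trans (h : G.Jn F X u v) (h' : G.Jn F X v w) : G.Jn F X u w :=
  Relation.ReflTransGen.trans h h'

theorem Jn.step (hu : u ∈ X) (hv : v ∈ X) (h : G.Ed F u v) : G.Jn F X u v :=
  .single ⟨hu, hv, h⟩

theorem Jn.mem (h : G.Jn F X u v) (hu : u ∈ X) : v ∈ X := by
  cases h with
  | refl => exact hu
  | tail _ hs => exact hs.2.1

theorem Jn.exit (h : G.Jn F X u v) (P : ℕ → Prop) (hu : P u) (hv : ¬ P v) :
    ∃ a ∈ X, ∃ b ∈ X, P a ∧ ¬ P b ∧ G.Ed F a b := by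
  induction h with
  | refl => exact absurd hu hv
  | @tail b c _ hs ih =>
    by_cases hb : P b
    · exact ⟨b, hs.1, c, hs.2.1, hb, hv, hs.2.2⟩
    · exact ih hb

theorem jn_of_cut (h : ∀ P : ℕ → Prop, ∀ u ∈ X, P u → ∀ v ∈ X, ¬ P v →
      ∃ a ∈ X, ∃ b ∈ X, P a ∧ ¬ P b ∧ G.Ed F a b) (hu : u ∈ X) (hv : v ∈ X) :
    G.Jn F X u v := by
  by_contra hc
  obtain ⟨a, ha, b, hb, h1, h2, h3⟩ := h (G.Jn F X u) u hu .refl v hv hc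
  exact h2 (h1.trans (.step ha hb h3))

theorem connS_of_cut (hX : X.Nonempty) (h : ∀ P : ℕ → Prop, ∀ u ∈ X, P u → ∀ v ∈ X, ¬ P v →
      ∃ a ∈ X, ∃ b ∈ X, P a ∧ ¬ P b ∧ G.Ed ∅ a b) : G.ConnS X :=
  ⟨hX, fun _ hu _ hv => jn_of_cut h hu hv⟩

theorem twoEC_of_cut (hX : X.Nonempty) (h : ∀ g, ∀ P : ℕ → Prop, ∀ u ∈ X, P u → ∀ v ∈ X, ¬ P v →
      ∃ a ∈ X, ∃ b ∈ X, P a ∧ ¬ P b ∧ G.Ed {g} a b) : G.TwoEC X :=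
  ⟨hX, fun g _ hu _ hv => jn_of_cut (h g) hu hv⟩

theorem ConnS.cut (h : G.ConnS X) (P : ℕ → Prop) (hu : u ∈ X) (hPu : P u) (hv : v ∈ X)
    (hPv : ¬ P v) : ∃ a ∈ X, ∃ b ∈ X, P a ∧ ¬ P b ∧ G.Ed ∅ a b :=
  (h.2 u hu v hv).exit P hPu hPv

theorem TwoEC.cut (h : G.TwoEC X) (g : ℕ) (P : ℕ → Prop) (hu : u ∈ X) (hPu : P u) (hv : v ∈ X)
    (hPv : ¬ P v) : ∃ a ∈ X, ∃ b ∈ X, P a ∧ ¬ P b ∧ G.Ed {g} a b :=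
  (h.2 g u hu v hv).exit P hPu hPv

theorem TwoEC.connS (h : G.TwoEC X) : G.ConnS X :=
  ⟨h.1, fun u hu v hv => (h.2 0 u hu v hv).mono (by simp) subset_rfl⟩

theorem connS_singleton (G : MGraph) (x : ℕ) : G.ConnS {x} :=
  ⟨by simp, fun u hu v hv => by
    simp only [Finset.mem_singleton] at hu hv; subst hu; subst hv; exact .refl⟩

theorem twoEC_singleton (G : MGraph) (x : ℕ) : G.TwoEC {x} :=
  ⟨by simp, fun g u hu v hv => by
    simp only [Finset.mem_singleton] at hu hv; subst hu; subst hv; exact .refl⟩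

theorem ConnS.union_edge (hA : G.ConnS A) (hB : G.ConnS B) (ha : a ∈ A) (hb : b ∈ B)
    (h : G.Ed ∅ a b) : G.ConnS (A ∪ B) := by
  have key : ∀ u ∈ A ∪ B, G.Jn ∅ (A ∪ B) u a := by
    intro u hu
    rcases Finset.mem_union.1 hu with hu | hu
    · exact (hA.2 u hu a ha).mono subset_rfl Finset.subset_union_left
    · exact ((hB.2 u hu b hb).mono subset_rfl Finset.subset_union_right).trans
        (.step (by simp [hb]) (by simp [ha]) h.symm)
  exact ⟨⟨a, by simp [ha]⟩, fun u hu v hv => (key u hu).trans (key v hv).symm⟩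

theorem ConnS.union (hA : G.ConnS A) (hB : G.ConnS B) (ha : a ∈ A) (hb : a ∈ B) :
    G.ConnS (A ∪ B) := by
  have key : ∀ u ∈ A ∪ B, G.Jn ∅ (A ∪ B) u a := by
    intro u hu
    rcases Finset.mem_union.1 hu with hu | hu
    · exact (hA.2 u hu a ha).mono subset_rfl Finset.subset_union_left
    · exact (hB.2 u hu a hb).mono subset_rfl Finset.subset_union_right
  exact ⟨⟨a, by simp [ha]⟩, fun u hu v hv => (key u hu).trans (key v hv).symm⟩

theorem TwoEC.union (hA : G.TwoEC A) (hB : G.TwoEC B) (ha : a ∈ A) (hb : a ∈ B) :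
    G.TwoEC (A ∪ B) := by
  have key : ∀ g, ∀ u ∈ A ∪ B, G.Jn {g} (A ∪ B) u a := by
    intro g u hu
    rcases Finset.mem_union.1 hu with hu | hu
    · exact (hA.2 g u hu a ha).mono subset_rfl Finset.subset_union_left
    · exact (hB.2 g u hu a hb).mono subset_rfl Finset.subset_union_right
  exact ⟨⟨a, by simp [ha]⟩, fun g u hu v hv => (key g u hu).trans (key g v hv).symm⟩

theorem ConnS.subset_V (h : G.ConnS X) (hX : 2 ≤ X.card) : X ⊆ G.V := by
  intro x hx
  obtain ⟨y, hy, hne⟩ := Finset.exists_mem_ne (show 1 < X.card by omega) x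
  obtain ⟨a, _, b, _, rfl, _, hab⟩ := h.cut (fun z => z = x) hx rfl hy hne
  exact hab.mem_left

theorem mem_Cmp : v ∈ G.Cmp X u ↔ v ∈ X ∧ G.Jn ∅ X u v := by simp [Cmp]

theorem self_mem_Cmp (hu : u ∈ X) : u ∈ G.Cmp X u := mem_Cmp.2 ⟨hu, .refl⟩

theorem Cmp_subset : G.Cmp X u ⊆ X := Finset.filter_subset _ _

theorem Cmp_closed (ha : a ∈ G.Cmp X u) (hb : b ∈ X) (h : G.Ed F a b) : b ∈ G.Cmp X u := by
  rw [mem_Cmp] at ha ⊢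
  exact ⟨hb, ha.2.trans (.step ha.1 hb h.to_empty)⟩

theorem ConnS.subset_Cmp (h : G.ConnS Y) (hYX : Y ⊆ X) (hy : a ∈ Y) (ha : a ∈ G.Cmp X u) :
    Y ⊆ G.Cmp X u := by
  intro z hz
  exact mem_Cmp.2 ⟨hYX hz, (mem_Cmp.1 ha).2.trans ((h.2 a hy z hz).mono subset_rfl hYX)⟩

theorem connS_Cmp (hu : u ∈ X) : G.ConnS (G.Cmp X u) := by
  refine ⟨⟨u, self_mem_Cmp hu⟩, ?_⟩
  have key : ∀ v, G.Jn ∅ X u v → G.Jn ∅ (G.Cmp X u) u v := by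
    intro v hv
    induction hv with
    | refl => exact .refl
    | tail h hs ih =>
      exact ih.tail ⟨mem_Cmp.2 ⟨hs.1, h⟩, mem_Cmp.2 ⟨hs.2.1, h.tail hs⟩, hs.2.2⟩
  intro v hv w hw
  exact (key v (mem_Cmp.1 hv).2).symm.trans (key w (mem_Cmp.1 hw).2)

theorem Cmp_eq (h : v ∈ G.Cmp X u) : G.Cmp X v = G.Cmp X u := by
  have h' := (mem_Cmp.1 h).2
  ext w
  rw [mem_Cmp, mem_Cmp]
  exact ⟨fun hw => ⟨hw.1, h'.trans hw.2⟩, fun hw => ⟨hw.1, h'.symm.trans hw.2⟩⟩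

/-- A component of `V \ X` sends an edge to `X`. -/
theorem Cmp_exit (hV : G.ConnS Y) (hXY : X ⊆ Y) (hX : X.Nonempty) (hu : u ∈ Y \ X) :
    ∃ a ∈ G.Cmp (Y \ X) u, ∃ b ∈ X, G.Ed ∅ a b := by
  obtain ⟨x, hx⟩ := hX
  have hx' : x ∉ G.Cmp (Y \ X) u := fun h => (Finset.mem_sdiff.1 (Cmp_subset h)).2 hx
  obtain ⟨a, _, b, hb, h1, h2, h3⟩ := hV.cut (· ∈ G.Cmp (Y \ X) u)
    (Finset.mem_sdiff.1 hu).1 (self_mem_Cmp hu) (hXY hx) hx'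
  refine ⟨a, h1, b, ?_, h3⟩
  by_contra hbX
  exact h2 (Cmp_closed h1 (Finset.mem_sdiff.2 ⟨hb, hbX⟩) h3)

theorem connS_sdiff_Cmp (hV : G.ConnS Y) (hX : G.ConnS X) (hXY : X ⊆ Y) (w : ℕ) :
    G.ConnS (Y \ G.Cmp (Y \ X) w) := by
  have hsub : X ⊆ Y \ G.Cmp (Y \ X) w := fun x hx => Finset.mem_sdiff.2
    ⟨hXY hx, fun h => (Finset.mem_sdiff.1 (Cmp_subset h)).2 hx⟩
  obtain ⟨x, hx⟩ := hX.1
  have key : ∀ u ∈ Y \ G.Cmp (Y \ X) w, G.Jn ∅ (Y \ G.Cmp (Y \ X) w) u x := by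
    intro u hu
    have hu' := Finset.mem_sdiff.1 hu
    by_cases huX : u ∈ X
    · exact (hX.2 u huX x hx).mono subset_rfl hsub
    · have huYX : u ∈ Y \ X := Finset.mem_sdiff.2 ⟨hu'.1, huX⟩
      obtain ⟨a, ha, b, hb, hab⟩ := Cmp_exit hV hXY ⟨x, hx⟩ huYX
      have hCs : G.Cmp (Y \ X) u ⊆ Y \ G.Cmp (Y \ X) w := by
        intro z hz
        refine Finset.mem_sdiff.2 ⟨(Finset.mem_sdiff.1 (Cmp_subset hz)).1, fun hzw => hu'.2 ?_⟩
        rw [← Cmp_eq hzw, Cmp_eq hz]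
        exact self_mem_Cmp huYX
      exact (((connS_Cmp huYX).2 u (self_mem_Cmp huYX) a ha).mono subset_rfl hCs).trans
        ((Jn.step (hCs ha) (hsub hb) hab).trans ((hX.2 b hb x hx).mono subset_rfl hsub))
  exact ⟨⟨x, hsub hx⟩, fun u hu v hv => (key u hu).trans (key v hv).symm⟩

theorem twoEC_sdiff_Cmp (hV : G.TwoEC Y) (hX : G.TwoEC X) (hXY : X ⊆ Y) (w : ℕ) :
    G.TwoEC (Y \ G.Cmp (Y \ X) w) := by
  have hsub : X ⊆ Y \ G.Cmp (Y \ X) w := fun x hx => Finset.mem_sdiff.2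
    ⟨hXY hx, fun h => (Finset.mem_sdiff.1 (Cmp_subset h)).2 hx⟩
  have key : ∀ g, ∀ P : ℕ → Prop, (∀ x ∈ X, ¬ P x) → ∀ u ∈ Y \ G.Cmp (Y \ X) w, P u →
      ∃ a ∈ Y \ G.Cmp (Y \ X) w, ∃ b ∈ Y \ G.Cmp (Y \ X) w, P a ∧ ¬ P b ∧ G.Ed {g} a b := by
    intro g P hP u hu hPu
    obtain ⟨x, hx⟩ := hX.1
    obtain ⟨a, ha, b, hb, h1, h2, h3⟩ := hV.cut g
      (fun z => P z ∧ z ∈ Y \ G.Cmp (Y \ X) w) (Finset.mem_sdiff.1 hu).1 ⟨hPu, hu⟩ (hXY hx)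
      (fun h => hP x hx h.1)
    have hbY : b ∈ Y \ G.Cmp (Y \ X) w := by
      refine Finset.mem_sdiff.2 ⟨hb, fun hbw => ?_⟩
      exact (Finset.mem_sdiff.1 h1.2).2
        (Cmp_closed hbw (Finset.mem_sdiff.2 ⟨ha, fun haX => hP a haX h1.1⟩) h3.symm)
    exact ⟨a, h1.2, b, hbY, h1.1, fun h => h2 ⟨h, hbY⟩, h3⟩
  refine twoEC_of_cut (hX.1.mono hsub) ?_
  intro g P u hu hPu v hv hPv
  by_cases h1 : ∀ x ∈ X, ¬ P x
  · exact key g P h1 u hu hPu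
  by_cases h2 : ∀ x ∈ X, P x
  · obtain ⟨a, ha, b, hb, h3, h4, h5⟩ := key g (fun z => ¬ P z) (by simpa using h2) v hv hPv
    exact ⟨b, hb, a, ha, not_not.1 h4, h3, h5.symm⟩
  push Not at h1 h2
  obtain ⟨x, hx, hPx⟩ := h1
  obtain ⟨y, hy, hPy⟩ := h2
  obtain ⟨a, ha, b, hb, h⟩ := hX.cut g P hx hPx hy hPy
  exact ⟨a, hsub ha, b, hsub hb, h⟩

/-- An edge whose ends remain joined after its deletion lies in a 2-edge-connected set. -/
theorem exists_twoEC_of_edge (hg : g ∈ G.E) (hends : G.ends g = s(u, v)) (hu : u ∈ X)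
    (hv : v ∈ X) (h : G.Jn {g} X u v) : ∃ U ⊆ X, u ∈ U ∧ v ∈ U ∧ G.TwoEC U := by
  obtain ⟨U, hU⟩ := Finset.exists_minimal
    (s := X.powerset.filter fun U => u ∈ U ∧ v ∈ U ∧ G.Jn {g} U u v)
    ⟨X, by simp [hu, hv, h]⟩
  obtain ⟨hUm, hmin⟩ := hU
  simp only [Finset.mem_filter, Finset.mem_powerset] at hUm hmin
  obtain ⟨hUX, huU, hvU, hJ⟩ := hUm
  have key : ∀ g', ∀ P : ℕ → Prop, ¬ P u → ¬ P v → ∀ x ∈ U, P x →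
      ∃ a ∈ U, ∃ b ∈ U, P a ∧ ¬ P b ∧ G.Ed {g'} a b := by
    intro g' P hPu hPv x hx hPx
    by_contra hc
    push Not at hc
    have hc' : ∀ e ∈ G.E, ∀ a ∈ U, ∀ b ∈ U, P a → ¬ P b → G.ends e = s(a, b) → e = g' := by
      intro e he a ha b hb h1 h2 h3
      by_contra h4
      exact hc a ha b hb h1 h2 ⟨e, he, by simpa using h4, h3⟩
    have hz : ∃ z, ∀ a ∈ U, ∀ b ∈ U, P a → ¬ P b → G.Ed {g} a b → b = z := by
      by_cases h0 : ∃ a ∈ U, ∃ b ∈ U, P a ∧ ¬ P b ∧ G.Ed {g} a b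
      · obtain ⟨a, ha, b, hb, h1, h2, e, he, h3, h4⟩ := h0
        refine ⟨b, fun a' ha' b' hb' h1' h2' h0' => ?_⟩
        obtain ⟨e', he', h3', h4'⟩ := h0'
        rw [hc' e he a ha b hb h1 h2 h4] at h4
        rw [hc' e' he' a' ha' b' hb' h1' h2' h4', h4] at h4'
        rcases Sym2.eq_iff.1 h4' with h | h
        · exact h.2.symm
        · exact absurd (h.1 ▸ h1) h2'
      · push Not at h0
        exact ⟨0, fun a ha b hb h1 h2 h3 => absurd h3 (h0 a ha b hb h1 h2)⟩
    obtain ⟨z, hz⟩ := hz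
    let ρ : ℕ → ℕ := fun y => if P y then z else y
    have hret : ∀ y, G.Jn {g} U u y → G.Jn {g} (U.filter fun y => ¬ P y) u (ρ y) := by
      intro y hy
      induction hy with
      | refl => simp only [ρ, hPu, if_false]; exact .refl
      | @tail b c _ hs ih =>
        obtain ⟨hb, hc, hbc⟩ := hs
        by_cases h1 : P b <;> by_cases h2 : P c <;> simp only [ρ, h1, h2, if_true, if_false] at ih ⊢
        · exact ih
        · rw [hz b hb c hc h1 h2 hbc]; exact ih
        · rw [← hz c hc b hb h2 h1 hbc.symm]; exact ih
        · exact ih.tail ⟨by simp [hb, h1], by simp [hc, h2], hbc⟩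
    have h1 := hret v hJ
    simp only [ρ, hPv, if_false] at h1
    have h2 := hmin ⟨(Finset.filter_subset _ _).trans hUX, by simp [huU, hPu], by simp [hvU, hPv], h1⟩
      (Finset.filter_subset _ _) hx
    exact (Finset.mem_filter.1 h2).2 hPx
  have sep : ∀ g', ∀ P : ℕ → Prop, P u → ¬ P v →
      ∃ a ∈ U, ∃ b ∈ U, P a ∧ ¬ P b ∧ G.Ed {g'} a b := by
    intro g' P hPu hPv
    by_cases hgg : g = g'
    · subst hgg; exact hJ.exit P hPu hPv
    · exact ⟨u, huU, v, hvU, hPu, hPv, g, hg, by simpa using hgg, hends⟩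
  refine ⟨U, hUX, huU, hvU, twoEC_of_cut ⟨u, huU⟩ ?_⟩
  intro g' P x hx hPx y hy hPy
  have flip : (∃ a ∈ U, ∃ b ∈ U, ¬ P a ∧ ¬ ¬ P b ∧ G.Ed {g'} a b) →
      ∃ a ∈ U, ∃ b ∈ U, P a ∧ ¬ P b ∧ G.Ed {g'} a b := by
    rintro ⟨a, ha, b, hb, h1, h2, h3⟩
    exact ⟨b, hb, a, ha, not_not.1 h2, h1, h3.symm⟩
  by_cases h1 : P u <;> by_cases h2 : P v
  · exact flip (key g' (fun z => ¬ P z) (by simpa) (by simpa) y hy hPy)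
  · exact sep g' P h1 h2
  · exact flip (sep g' (fun z => ¬ P z) h1 (by simpa))
  · exact key g' P h1 h2 x hx hPx

end MGraph

end

section

namespace MGraph

/-- A path `p 0, …, p n` with edges `pe 0, …, pe (n-1)`. -/
structure FP (G : MGraph) (n : ℕ) (p pe : ℕ → ℕ) : Prop where
  edge : ∀ i < n, pe i ∈ G.E
  ends : ∀ i < n, G.ends (pe i) = s(p i, p (i + 1))
  inj : ∀ i ≤ n, ∀ j ≤ n, p i = p j → i = j
  mem : ∀ i ≤ n, p i ∈ G.V

/-- The map sending `U` to `u0` and fixing everything else. -/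
def mapf (U : Finset ℕ) (u0 : ℕ) (v : ℕ) : ℕ := if v ∈ U then u0 else v

/-- `H` arises from `G` by contracting the fibres of `φ`, which are 2-edge-connected. -/
structure Contr (G H : MGraph) (φ : ℕ → ℕ) : Prop where
  V : H.V = G.V.image φ
  E : ∀ e, e ∈ H.E ↔ e ∈ G.E ∧ ¬ ((G.ends e).map φ).IsDiag
  ends : ∀ e ∈ H.E, H.ends e = (G.ends e).map φ
  fib : ∀ x ∈ H.V, G.TwoEC (G.V.filter (φ · = x))
  cc : G.CCMinor H

variable {G H H' : MGraph} {φ ψ p pe : ℕ → ℕ} {n : ℕ} {F F' X Y A B U W : Finset ℕ}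
  {a b u v w x y e g : ℕ}

theorem Jn.exists_walk (h : G.Jn F X u v) : ∃ n, ∃ p pe : ℕ → ℕ, p 0 = u ∧ p n = v ∧
    ∀ i < n, p i ∈ X ∧ p (i + 1) ∈ X ∧ pe i ∈ G.E ∧ pe i ∉ F ∧ G.ends (pe i) = s(p i, p (i + 1)) := by
  induction h with
  | refl => exact ⟨0, fun _ => u, fun _ => 0, rfl, rfl, by simp⟩
  | @tail b c _ hs ih =>
    obtain ⟨n, p, pe, h0, hn, h⟩ := ih
    obtain ⟨hb, hc, e, he, heF, hends⟩ := hs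
    refine ⟨n + 1, fun i => if i ≤ n then p i else c, fun i => if i < n then pe i else e,
      by simp [h0], by simp, ?_⟩
    intro i hi
    rcases Nat.lt_succ_iff_lt_or_eq.1 hi with hi | rfl
    · have := h i hi
      simp [hi.le, hi, this]
    · simp [hn, hb, hc, he, heF, hends]

theorem Jn.exists_fp (h : G.Jn F X u v) (hu : u ∈ X) (hX : X ⊆ G.V) :
    ∃ n p pe, G.FP n p pe ∧ p 0 = u ∧ p n = v ∧ (∀ i ≤ n, p i ∈ X) ∧ ∀ i < n, pe i ∉ F := by
  have hex := h.exists_walk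
  obtain ⟨p, pe, h0, hn, hw⟩ := Nat.find_spec hex
  have hmin := fun m hm => Nat.find_min hex (m := m) hm
  set n := Nat.find hex with hn_def
  have hmem : ∀ i ≤ n, p i ∈ X := by
    intro i hi
    rcases Nat.eq_zero_or_pos i with rfl | hpos
    · rw [h0]; exact hu
    · have := (hw (i - 1) (by omega)).2.1
      rwa [Nat.sub_add_cancel hpos] at this
  have key : ∀ i j, i < j → j ≤ n → p i ≠ p j := by
    intro i j hij hj heq
    refine hmin (n - (j - i)) (by omega) ⟨fun a => if a ≤ i then p a else p (a + (j - i)),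
      fun a => if a < i then pe a else pe (a + (j - i)), by simp [h0], ?_, ?_⟩
    · by_cases hle : n - (j - i) ≤ i
      · have h1 : n = j := by omega
        have h2 : n - (j - i) = i := by omega
        simp only [h2, le_refl, if_true]
        rw [heq, ← h1, hn]
      · simp only [hle, if_false]
        rw [show n - (j - i) + (j - i) = n by omega, hn]
    · intro a ha
      by_cases h1 : a < i
      · simp only [h1.le, h1, show a + 1 ≤ i by omega, if_true]
        exact hw a (by omega)
      · have h3 := hw (a + (j - i)) (by omega)
        have h4 : (if a ≤ i then p a else p (a + (j - i))) = p (a + (j - i)) := by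
          split_ifs with h5
          · have : a = i := by omega
            subst this
            rw [heq]; congr 1; omega
          · rfl
        beta_reduce
        rw [h4]
        simp only [h1, show ¬ a + 1 ≤ i by omega, if_false]
        rw [show a + 1 + (j - i) = a + (j - i) + 1 by omega]
        exact h3
  refine ⟨n, p, pe, ⟨fun i hi => (hw i hi).2.2.1, fun i hi => (hw i hi).2.2.2.2, ?_,
    fun i hi => hX (hmem i hi)⟩, h0, hn, hmem, fun i hi => (hw i hi).2.2.2.1⟩
  intro i hi j hj hij
  rcases lt_trichotomy i j with h | h | h
  · exact absurd hij (key i j h hj)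
  · exact h
  · exact absurd hij.symm (key j i h hi)

theorem FP.jn (h : G.FP n p pe) (hab : a ≤ b) (hb : b ≤ n) (hX : ∀ i, a ≤ i → i ≤ b → p i ∈ X)
    (hF : ∀ i, a ≤ i → i < b → pe i ∉ F) : G.Jn F X (p a) (p b) := by
  induction b, hab using Nat.le_induction with
  | base => exact .refl
  | succ c hac ih =>
    exact (ih (by omega) (fun i h1 h2 => hX i h1 (by omega)) (fun i h1 h2 => hF i h1 (by omega))).tail
      ⟨hX c hac (by omega), hX (c + 1) (by omega) le_rfl,
        pe c, h.edge c (by omega), hF c hac (by omega), h.ends c (by omega)⟩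

theorem FP.edge_inj (h : G.FP n p pe) {i j : ℕ} (hi : i < n) (hj : j < n) (hij : pe i = pe j) :
    i = j := by
  have h1 := h.ends i hi
  rw [hij, h.ends j hj] at h1
  rcases Sym2.eq_iff.1 h1 with h2 | h2
  · exact (h.inj j hj.le i hi.le h2.1).symm
  · have := h.inj _ hj.le _ (show i + 1 ≤ n by omega) h2.1
    have := h.inj _ (show j + 1 ≤ n by omega) _ hi.le h2.2
    omega

theorem FP.vertsOf (h : G.FP n p pe) (hn : 1 ≤ n) (hg : G.ends g = s(p n, p 0)) :
    G.vertsOf (insert g ((Finset.range n).image pe)) = (Finset.range (n + 1)).image p := by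
  ext v
  simp only [MGraph.vertsOf, Finset.mem_filter, Finset.mem_insert, Finset.mem_image,
    Finset.mem_range]
  constructor
  · rintro ⟨-, e, rfl | ⟨i, hi, rfl⟩, hv⟩
    · rw [hg, Sym2.mem_iff] at hv
      rcases hv with rfl | rfl
      · exact ⟨n, by omega, rfl⟩
      · exact ⟨0, by omega, rfl⟩
    · rw [h.ends i hi, Sym2.mem_iff] at hv
      rcases hv with rfl | rfl
      · exact ⟨i, by omega, rfl⟩
      · exact ⟨i + 1, by omega, rfl⟩
  · rintro ⟨i, hi, rfl⟩
    refine ⟨h.mem i (by omega), ?_⟩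
    by_cases hin : i = n
    · exact ⟨g, .inl rfl, by simp [hg, hin]⟩
    · exact ⟨pe i, .inr ⟨i, by omega, rfl⟩, by simp [h.ends i (by omega)]⟩

theorem FP.isCycleSet (h : G.FP n p pe) (hL : G.Loopless) (hn : 1 ≤ n) (hgE : g ∈ G.E)
    (hg : G.ends g = s(p n, p 0)) (hgp : ∀ i < n, pe i ≠ g) :
    G.IsCycleSet (insert g ((Finset.range n).image pe)) := by
  have hsub : insert g ((Finset.range n).image pe) ⊆ G.E := by
    intro e he
    simp only [Finset.mem_insert, Finset.mem_image, Finset.mem_range] at he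
    rcases he with rfl | ⟨i, hi, rfl⟩
    · exact hgE
    · exact h.edge i hi
  refine ⟨by simp, hsub, ?_, ?_⟩
  · rw [h.vertsOf hn hg]
    intro v hv
    simp only [Finset.mem_image, Finset.mem_range] at hv
    obtain ⟨j, hj, rfl⟩ := hv
    have h1 : G.degIn (insert g ((Finset.range n).image pe)) (p j) =
        ∑ e ∈ insert g ((Finset.range n).image pe), if p j ∈ G.ends e then 1 else 0 := by
      refine Finset.sum_congr rfl fun e he => ?_
      rw [if_neg]
      intro h2
      exact hL e (hsub he) (by rw [h2]; simp)
    have hgn : g ∉ (Finset.range n).image pe := by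
      simp only [Finset.mem_image, Finset.mem_range, not_exists, not_and]
      exact hgp
    rw [h1, Finset.sum_insert hgn, Finset.sum_image]
    swap
    · intro a ha b hb hab
      exact h.edge_inj (by simpa using ha) (by simpa using hb) hab
    have h2 : ∀ i ∈ Finset.range n, (if p j ∈ G.ends (pe i) then 1 else 0) =
        (if i = j then 1 else 0) + (if i + 1 = j then 1 else 0) := by
      intro i hi
      have hi := Finset.mem_range.1 hi
      have e1 : p j = p i ↔ i = j := ⟨fun h' => (h.inj j (by omega) i (by omega) h').symm, by rintro rfl; rfl⟩
      have e2 : p j = p (i + 1) ↔ i + 1 = j :=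
        ⟨fun h' => (h.inj j (by omega) _ (by omega) h').symm, by rintro rfl; rfl⟩
      simp only [h.ends i hi, Sym2.mem_iff, e1, e2]
      split_ifs <;> omega
    rw [Finset.sum_congr rfl h2, Finset.sum_add_distrib, Finset.sum_ite_eq']
    have h3 : ∑ i ∈ Finset.range n, (if i + 1 = j then 1 else 0) = if 0 < j then 1 else 0 := by
      rcases j with _ | j
      · simp
      · simp only [Nat.add_right_cancel_iff, Finset.sum_ite_eq', Finset.mem_range]
        rw [if_pos (by omega), if_pos (by omega)]
    have e1 : p j = p n ↔ j = n := ⟨fun h' => h.inj j (by omega) n (by omega) h', by rintro rfl; rfl⟩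
    have e2 : p j = p 0 ↔ j = 0 := ⟨fun h' => h.inj j (by omega) 0 (by omega) h', by rintro rfl; rfl⟩
    rw [h3]
    simp only [hg, Sym2.mem_iff, e1, e2, Finset.mem_range]
    split_ifs <;> omega
  · rw [h.vertsOf hn hg]
    set R := Relation.ReflTransGen
      (fun a b => ∃ e ∈ insert g ((Finset.range n).image pe), G.ends e = s(a, b)) with hR
    have hsym : ∀ a b, R a b → R b a := by
      intro a b hab
      induction hab with
      | refl => exact .refl
      | tail _ hs ih =>
        obtain ⟨e, he, h'⟩ := hs
        exact .head ⟨e, he, by rw [h', Sym2.eq_swap]⟩ ih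
    have key : ∀ i ≤ n, R (p 0) (p i) := by
      intro i
      induction i with
      | zero => intro; exact .refl
      | succ i ih =>
        intro hi
        exact (ih (by omega)).tail ⟨pe i, Finset.mem_insert_of_mem
          (Finset.mem_image_of_mem _ (by simpa using hi)), h.ends i (by omega)⟩
    intro u hu v hv
    simp only [Finset.mem_image, Finset.mem_range] at hu hv
    obtain ⟨i, hi, rfl⟩ := hu
    obtain ⟨j, hj, rfl⟩ := hv
    exact (hsym _ _ (key i (by omega))).trans (key j (by omega))

theorem FP.twoEC_cycle (h : G.FP n p pe) (hgE : g ∈ G.E)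
    (hg : G.ends g = s(p n, p 0)) (hgp : ∀ i < n, pe i ≠ g) :
    G.TwoEC ((Finset.range (n + 1)).image p) := by
  set X := (Finset.range (n + 1)).image p with hX
  have hpX : ∀ i ≤ n, p i ∈ X := fun i hi => Finset.mem_image_of_mem _ (by simp; omega)
  have key : ∀ g', ∀ i ≤ n, G.Jn {g'} X (p i) (p 0) := by
    intro g' i hi
    by_cases hk : ∃ k < n, pe k = g'
    · obtain ⟨k, hk, rfl⟩ := hk
      by_cases hik : i ≤ k
      · refine (h.jn (Nat.zero_le i) hi (fun j _ h2 => hpX j (by omega)) ?_).symm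
        intro j _ h2 h3
        have := h.edge_inj (i := j) (by omega) hk (by simpa using h3)
        omega
      · refine (h.jn (b := n) hi le_rfl (fun j _ h2 => hpX j (by omega)) ?_).trans
          (.step (hpX n le_rfl) (hpX 0 (by omega)) ⟨g, hgE, by simpa using (hgp k hk).symm, hg⟩)
        intro j h2 h2' h3
        have := h.edge_inj (i := j) (by omega) hk (by simpa using h3)
        omega
    · push Not at hk
      refine (h.jn (Nat.zero_le i) hi (fun j _ h2 => hpX j (by omega)) ?_).symm
      intro j _ h2 h3
      exact hk j (by omega) (by simpa using h3)
  refine ⟨⟨p 0, hpX 0 (by omega)⟩, fun g' u hu v hv => ?_⟩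
  simp only [hX, Finset.mem_image, Finset.mem_range] at hu hv
  obtain ⟨i, hi, rfl⟩ := hu
  obtain ⟨j, hj, rfl⟩ := hv
  exact (key g' i (by omega)).trans (key g' j (by omega)).symm

theorem TwoEC.exists_cycle (hU : G.TwoEC U) (hL : G.Loopless) (hc : 2 ≤ U.card) :
    ∃ C, G.IsCycleSet C ∧ G.vertsOf C ⊆ U ∧ 2 ≤ (G.vertsOf C).card ∧ G.TwoEC (G.vertsOf C) := by
  have hUV := hU.connS.subset_V hc
  obtain ⟨x, hx⟩ := hU.1
  obtain ⟨y, hy, hne⟩ := Finset.exists_mem_ne (show 1 < U.card by omega) x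
  obtain ⟨a, ha, b, hb, -, -, hab⟩ := hU.cut 0 (fun z => z = x) hx rfl hy hne
  have hne := hab.ne hL
  obtain ⟨g, hg, -, hends⟩ := hab
  obtain ⟨n, p, pe, hp, h0, hn, hpU, hpe⟩ := (hU.2 g b hb a ha).exists_fp hb hUV
  have hn1 : 1 ≤ n := by
    rcases Nat.eq_zero_or_pos n with rfl | h
    · exact absurd (hn.symm.trans h0) hne
    · exact h
  have hg' : G.ends g = s(p n, p 0) := by rw [hends, h0, hn]
  have hgp : ∀ i < n, pe i ≠ g := fun i hi => by simpa using hpe i hi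
  refine ⟨_, hp.isCycleSet hL hn1 hg hg' hgp, ?_⟩
  rw [hp.vertsOf hn1 hg']
  refine ⟨?_, ?_, hp.twoEC_cycle hg hg' hgp⟩
  · intro v hv
    simp only [Finset.mem_image, Finset.mem_range] at hv
    obtain ⟨i, hi, rfl⟩ := hv
    exact hpU i (by omega)
  · rw [Finset.card_image_of_injOn]
    · simp; omega
    · intro i hi j hj hij
      simp only [Finset.coe_range, Set.mem_Iio] at hi hj
      exact hp.inj i (by omega) j (by omega) hij

theorem sym2_map_eq {s : Sym2 ℕ} (h : s.map φ = s(x, y)) :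
    ∃ a b, s = s(a, b) ∧ φ a = x ∧ φ b = y := by
  induction s using Sym2.ind with
  | _ a b =>
    rw [Sym2.map_mk] at h
    rcases Sym2.eq_iff.1 h with h | h
    · exact ⟨a, b, rfl, h.1, h.2⟩
    · exact ⟨b, a, Sym2.eq_swap, h.2, h.1⟩

theorem Contr.ed (h : G.Contr H φ) (he : G.Ed F a b) (hne : φ a ≠ φ b) : H.Ed F (φ a) (φ b) := by
  obtain ⟨e, he, heF, hends⟩ := he
  have : e ∈ H.E := (h.E e).2 ⟨he, by simpa [hends] using hne⟩
  exact ⟨e, this, heF, by simp [h.ends e this, hends]⟩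

theorem Contr.ed_lift (h : G.Contr H φ) (he : H.Ed F x y) :
    ∃ a b, φ a = x ∧ φ b = y ∧ G.Ed F a b := by
  obtain ⟨e, he, heF, hends⟩ := he
  rw [h.ends e he] at hends
  obtain ⟨a, b, h1, h2, h3⟩ := sym2_map_eq hends
  exact ⟨a, b, h2, h3, e, ((h.E e).1 he).1, heF, h1⟩

theorem Contr.jn (h : G.Contr H φ) (hj : G.Jn F X u v) : H.Jn F (X.image φ) (φ u) (φ v) := by
  induction hj with
  | refl => exact .refl
  | @tail b c _ hs ih =>
    by_cases hbc : φ b = φ c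
    · rwa [← hbc]
    · exact ih.tail ⟨Finset.mem_image_of_mem _ hs.1, Finset.mem_image_of_mem _ hs.2.1, h.ed hs.2.2 hbc⟩

theorem Contr.connS_image (h : G.Contr H φ) (hX : G.ConnS X) : H.ConnS (X.image φ) := by
  refine ⟨hX.1.image _, fun u hu v hv => ?_⟩
  obtain ⟨u, hu', rfl⟩ := Finset.mem_image.1 hu
  obtain ⟨v, hv', rfl⟩ := Finset.mem_image.1 hv
  exact h.jn (hX.2 u hu' v hv')

theorem Contr.twoEC_image (h : G.Contr H φ) (hX : G.TwoEC X) : H.TwoEC (X.image φ) := by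
  refine ⟨hX.1.image _, fun g u hu v hv => ?_⟩
  obtain ⟨u, hu', rfl⟩ := Finset.mem_image.1 hu
  obtain ⟨v, hv', rfl⟩ := Finset.mem_image.1 hv
  exact h.jn (hX.2 g u hu' v hv')

theorem Contr.jn_pre (h : G.Contr H φ) (hJ : ∀ u ∈ X, ∀ v ∈ X, H.Jn F X u v)
    (hfib : ∀ x ∈ X, ∀ u ∈ G.V.filter (φ · = x), ∀ v ∈ G.V.filter (φ · = x),
      G.Jn F (G.V.filter (φ · = x)) u v) :
    ∀ u ∈ G.V.filter (φ · ∈ X), ∀ v ∈ G.V.filter (φ · ∈ X), G.Jn F (G.V.filter (φ · ∈ X)) u v := by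
  intro u hu v hv
  refine jn_of_cut ?_ hu hv
  intro P u hu hPu v hv hPv
  have hsub : ∀ x ∈ X, G.V.filter (φ · = x) ⊆ G.V.filter (φ · ∈ X) := by
    intro x hx z hz
    simp only [Finset.mem_filter] at hz ⊢
    exact ⟨hz.1, hz.2 ▸ hx⟩
  by_cases hsp : ∃ a ∈ G.V.filter (φ · ∈ X), ∃ b ∈ G.V.filter (φ · ∈ X), φ a = φ b ∧ P a ∧ ¬ P b
  · obtain ⟨a, ha, b, hb, hab, hPa, hPb⟩ := hsp
    simp only [Finset.mem_filter] at ha hb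
    obtain ⟨c, hc, d, hd, h'⟩ := (hfib (φ a) ha.2 a (by simp [ha.1]) b (by simp [hb.1, hab])).exit P hPa hPb
    exact ⟨c, hsub _ ha.2 hc, d, hsub _ ha.2 hd, h'⟩
  · push Not at hsp
    simp only [Finset.mem_filter] at hu hv
    obtain ⟨x, hx, y, hy, ⟨a, ha, rfl, hPa⟩, hny, hxy⟩ := (hJ _ hu.2 _ hv.2).exit
      (fun z => ∃ a ∈ G.V, φ a = z ∧ P a) ⟨u, hu.1, rfl, hPu⟩
      (by
        rintro ⟨a, ha, hav, hPa⟩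
        exact hPv (hsp a (by simp [ha, hav, hv.2]) v (by simp [hv]) hav hPa))
    obtain ⟨c, d, hc, rfl, hcd⟩ := h.ed_lift hxy
    have hcm : c ∈ G.V.filter (φ · ∈ X) := by simp [hcd.mem_left, hc, hx]
    exact ⟨c, hcm, d, by simp [hcd.mem_right, hy],
      hsp a (by simp [ha, hx]) c hcm hc.symm hPa, fun hPd => hny ⟨d, hcd.mem_right, rfl, hPd⟩, hcd⟩

theorem Contr.pre_nonempty (h : G.Contr H φ) (hX : X ⊆ H.V) (hne : X.Nonempty) :
    (G.V.filter (φ · ∈ X)).Nonempty := by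
  obtain ⟨x, hx⟩ := hne
  have := hX hx
  rw [h.V, Finset.mem_image] at this
  obtain ⟨a, ha, rfl⟩ := this
  exact ⟨a, by simp [ha, hx]⟩

theorem Contr.pre_twoEC (h : G.Contr H φ) (hX : X ⊆ H.V) (hT : H.TwoEC X) :
    G.TwoEC (G.V.filter (φ · ∈ X)) :=
  ⟨h.pre_nonempty hX hT.1, fun g => h.jn_pre (hT.2 g) fun x hx => (h.fib x (hX hx)).2 g⟩

theorem Contr.pre_connS (h : G.Contr H φ) (hX : X ⊆ H.V) (hT : H.ConnS X) :
    G.ConnS (G.V.filter (φ · ∈ X)) :=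
  ⟨h.pre_nonempty hX hT.1, h.jn_pre hT.2 fun x hx => (h.fib x (hX hx)).connS.2⟩

theorem Contr.loopless (h : G.Contr H φ) : H.Loopless := by
  intro e he
  rw [h.ends e he]
  exact ((h.E e).1 he).2

theorem Contr.refl (hL : G.Loopless) : G.Contr G id where
  V := by simp
  E e := by simpa using hL e
  ends e _ := by simp
  fib x hx := by
    have : G.V.filter (id · = x) = {x} := by
      ext z; simp only [Finset.mem_filter, id, Finset.mem_singleton]
      exact ⟨fun h => h.2, by rintro rfl; exact ⟨hx, rfl⟩⟩
    rw [this]; exact twoEC_singleton G x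
  cc := .refl

theorem Contr.trans (h : G.Contr H φ) (h' : H.Contr H' ψ) : G.Contr H' (ψ ∘ φ) where
  V := by rw [h'.V, h.V, Finset.image_image]
  E e := by
    rw [h'.E, h.E]
    constructor
    · rintro ⟨h1, h2⟩
      refine ⟨h1.1, ?_⟩
      rwa [h.ends e ((h.E e).2 h1), Sym2.map_map] at h2
    · rintro ⟨h1, h2⟩
      have h3 : ¬ ((G.ends e).map φ).IsDiag := by
        intro h3
        apply h2
        rw [← Sym2.map_map]
        exact h3.map
      refine ⟨⟨h1, h3⟩, ?_⟩
      rwa [h.ends e ((h.E e).2 ⟨h1, h3⟩), Sym2.map_map]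
  ends e he := by rw [h'.ends e he, h.ends e ((h'.E e).1 he).1, Sym2.map_map]
  fib x hx := by
    have := h.pre_twoEC (Finset.filter_subset _ _) (h'.fib x hx)
    convert this using 1
    ext z
    simp only [Finset.mem_filter, Function.comp]
    constructor
    · rintro ⟨h1, h2⟩; exact ⟨h1, by rw [h.V]; exact Finset.mem_image_of_mem _ h1, h2⟩
    · rintro ⟨h1, _, h2⟩; exact ⟨h1, h2⟩
  cc := h.cc.trans h'.cc

theorem mapf_singleton (u : ℕ) : mapf {u} u = id := by
  ext v
  simp only [mapf, Finset.mem_singleton, id]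
  split_ifs with h
  · exact h.symm
  · rfl

theorem mapf_diag {u0 : ℕ} (h0 : u0 ∈ U) (hab : a ≠ b) :
    mapf U u0 a = mapf U u0 b ↔ a ∈ U ∧ b ∈ U := by
  unfold mapf
  split_ifs with h1 h2 h2
  · simp [h1, h2]
  · simp only [h2, and_false, iff_false]; rintro rfl; exact h2 h0
  · simp only [h1, false_and, iff_false]; rintro rfl; exact h1 h0
  · simp [h1, hab]

theorem image_mapf {u0 : ℕ} (h0 : u0 ∈ U) (hUX : U ⊆ X) :
    X.image (mapf U u0) = insert u0 (X \ U) := by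
  ext v
  simp only [Finset.mem_image, Finset.mem_insert, Finset.mem_sdiff, mapf]
  constructor
  · rintro ⟨a, ha, rfl⟩
    split_ifs with h <;> simp [h, ha]
  · rintro (rfl | ⟨h1, h2⟩)
    · exact ⟨v, hUX h0, by simp⟩
    · exact ⟨v, h1, by simp [h2]⟩

theorem IsCycleSet.contr {C : Finset ℕ} (hC : G.IsCycleSet C) (hL : G.Loopless)
    (hT : G.TwoEC (G.vertsOf C)) :
    ∃ u0 ∈ G.vertsOf C, G.Contr (G.contractCycle C) (mapf (G.vertsOf C) u0) := by
  set X := G.vertsOf C with hX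
  have hXV : X ⊆ G.V := Finset.filter_subset _ _
  have hXi : X ∩ G.V = X := Finset.inter_eq_left.2 hXV
  obtain ⟨z, hz⟩ := hT.1
  have h0 : sInf {w : ℕ | w ∈ X} ∈ X := Nat.sInf_mem (s := {w : ℕ | w ∈ X}) ⟨z, hz⟩
  have hmap : G.cmapOn X = mapf X (sInf {w : ℕ | w ∈ X}) := by
    ext v; simp only [cmapOn, mapf, hXi]
  refine ⟨sInf {w : ℕ | w ∈ X}, h0, ?_⟩
  have hE : ∀ e, e ∈ (G.contractCycle C).E ↔ e ∈ G.E ∧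
      ¬ ((G.ends e).map (mapf X (sInf {w : ℕ | w ∈ X}))).IsDiag := by
    intro e
    simp only [contractCycle, contractOn, Finset.mem_filter, ← hX]
    refine and_congr_right fun he => ?_
    have hnd := hL e he
    induction hs : G.ends e using Sym2.ind with
    | _ a b =>
      rw [hs] at hnd
      have hab : a ≠ b := by simpa using hnd
      simp only [hnd, false_and, or_false, Sym2.map_mk, Sym2.mk_isDiag_iff,
        mapf_diag h0 hab]
      simp
  refine ⟨by simp only [contractCycle, contractOn, ← hX, hmap], hE, ?_, ?_, .single ⟨C, hC, rfl⟩⟩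
  · intro e _
    simp only [contractCycle, contractOn, ← hX, hmap]
  · intro x hx
    by_cases hxX : x = sInf {w : ℕ | w ∈ X}
    · convert hT using 1
      ext v
      simp only [Finset.mem_filter]
      simp only [mapf]
      constructor
      · rintro ⟨h1, h2⟩
        split_ifs at h2 with h3
        · exact h3
        · rw [h2, hxX]; exact h0
      · intro h; exact ⟨hXV h, by simp [h, hxX]⟩
    · simp only [contractCycle, contractOn, ← hX, hmap, Finset.mem_image] at hx
      obtain ⟨a, ha, rfl⟩ := hx
      have haX : a ∉ X := fun h => hxX (by simp [mapf, h])
      convert twoEC_singleton G a using 1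
      ext v
      simp only [Finset.mem_filter, mapf, haX, if_false, Finset.mem_singleton]
      constructor
      · rintro ⟨h1, h2⟩
        split_ifs at h2 with h3
        · exact absurd (h2 ▸ h0) haX
        · exact h2
      · rintro rfl; exact ⟨ha, by simp [haX]⟩

theorem TwoEC.exists_contr (hL : G.Loopless) (hU : G.TwoEC U) (hUV : U ⊆ G.V) :
    ∃ H, ∃ u0 ∈ U, G.Contr H (mapf U u0) := by
  induction hk : U.card using Nat.strong_induction_on generalizing G U with
  | _ k ih =>
    by_cases hc : 2 ≤ U.card
    · obtain ⟨C, hC, hCU, hC2, hCT⟩ := hU.exists_cycle hL hc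
      obtain ⟨x0, hx0, h1⟩ := hC.contr hL hCT
      have himg := image_mapf hx0 hCU
      have hU' := h1.twoEC_image hU
      rw [himg] at hU'
      have hcard : (insert x0 (U \ G.vertsOf C)).card < k := by
        have h3 := Finset.card_insert_le x0 (U \ G.vertsOf C)
        have h4 := Finset.card_sdiff_add_card_eq_card hCU
        omega
      have hsub : insert x0 (U \ G.vertsOf C) ⊆ (G.contractCycle C).V := by
        rw [h1.V, ← himg]; exact Finset.image_subset_image hUV
      obtain ⟨H, u0, hu0, h2⟩ := ih _ hcard h1.loopless hU' hsub rfl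
      refine ⟨H, u0, ?_, ?_⟩
      · rcases Finset.mem_insert.1 hu0 with rfl | h
        · exact hCU hx0
        · exact (Finset.mem_sdiff.1 h).1
      · convert h1.trans h2 using 1
        ext v
        simp only [Function.comp, mapf]
        by_cases hvC : v ∈ G.vertsOf C
        · simp [hvC, hCU hvC]
        · by_cases hvU : v ∈ U
          · simp [hvC, hvU]
          · simp only [hvC, hvU, if_false, Finset.mem_insert, Finset.mem_sdiff, false_and, or_false]
            rw [if_neg]; rintro rfl; exact hvC hx0
    · obtain ⟨u, hu⟩ : ∃ u, U = {u} := Finset.card_eq_one.1 (by have := hU.1.card_pos; omega)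
      subst hu
      exact ⟨G, u, by simp, by rw [mapf_singleton]; exact .refl hL⟩

theorem Conn2.exists_contr (hG : G.Conn2) (hU : G.TwoEC U) (hUV : U ⊆ G.V)
    (hc : G.ConnS (G.V \ U)) : ∃ H, ∃ u0 ∈ U, G.Contr H (mapf U u0) ∧ H.Conn2 ∧
      H.V = insert u0 (G.V \ U) := by
  obtain ⟨H, u0, hu0, h⟩ := hU.exists_contr hG.loopless hUV
  have hV : H.V = insert u0 (G.V \ U) := by rw [h.V, image_mapf hu0 hUV]
  refine ⟨H, u0, hu0, h, ⟨h.loopless, ?_, ?_, ?_⟩, hV⟩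
  · rw [hV, Finset.card_insert_of_notMem (by simp [hu0])]
    have := hc.1.card_pos
    omega
  · rw [h.V]; exact h.twoEC_image hG.twoEC
  · intro v hv
    by_cases hvu : v = u0
    · subst hvu
      convert h.connS_image hc using 1
      rw [hV, Finset.erase_insert (by simp [hu0])]
      ext z
      simp only [Finset.mem_image, mapf]
      constructor
      · intro hz; exact ⟨z, hz, by simp [(Finset.mem_sdiff.1 hz).2]⟩
      · rintro ⟨a, ha, rfl⟩; simpa [(Finset.mem_sdiff.1 ha).2] using Finset.mem_sdiff.1 ha
    · have hv' : v ∈ G.V \ U := by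
        rw [hV, Finset.mem_insert] at hv; exact hv.resolve_left hvu
      rw [Finset.mem_sdiff] at hv'
      convert h.connS_image (hG.erase v hv'.1) using 1
      rw [image_mapf hu0 (fun z hz => Finset.mem_erase.2 ⟨by rintro rfl; exact hv'.2 hz, hUV hz⟩), hV]
      ext z
      simp only [Finset.mem_erase, Finset.mem_insert, Finset.mem_sdiff]
      constructor
      · rintro ⟨h1, h2 | h2⟩
        · exact .inl h2
        · exact .inr ⟨⟨h1, h2.1⟩, h2.2⟩
      · rintro (rfl | h2)
        · exact ⟨fun h => hvu h.symm, .inl rfl⟩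
        · exact ⟨h2.1.1, .inr ⟨h2.1.2, h2.2⟩⟩

/-- The conclusion of the main theorem. -/
def Good (r : ℕ) (G : MGraph) : Prop :=
  ∃ H K m parts bp, G.CCMinor H ∧ IsPPE H K ∧ r ≤ m ∧
    IsPathDecompChain K m parts bp ∧ ∀ i < m, GoodLabel m parts bp i

theorem Good.of_contr {r : ℕ} (h : G.Contr H φ) (hg : Good r H) : Good r G := by
  obtain ⟨H', K, m, parts, bp, h1, h2⟩ := hg
  exact ⟨H', K, m, parts, bp, h.cc.trans h1, h2⟩

end MGraph

end

section

namespace MGraph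

/-- Add a new edge `c` with ends `x` and `y`. -/
def addE (B : MGraph) (x y c : ℕ) : MGraph where
  V := insert x (insert y B.V)
  E := insert c B.E
  ends := fun e => if e = c then s(x, y) else B.ends e
  ends_mem := by
    intro e he v hv
    by_cases h : e = c
    · simp only [h, if_true, Sym2.mem_iff] at hv
      rcases hv with rfl | rfl <;> simp
    · simp only [h, if_false] at hv
      have := B.ends_mem e (by simpa [h] using he) v hv
      simp [this]

/-- A chain decomposition of `L` into `m` good labels, with an edge `b` of the last label, not
yet used as a basepoint, available for a further 2-sum. -/
structure Ch (m : ℕ) (L : MGraph) (parts : ℕ → MGraph) (bp : ℕ → ℕ) (b x y N : ℕ) : Prop where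
  chain : IsPathDecompChain L m parts bp
  bp_last : bp (m - 1) = b
  mem_last : b ∈ (parts (m - 1)).E
  mem : b ∈ L.E
  ends : L.ends b = s(x, y)
  notMem : ∀ i, i + 1 < m → b ∉ (parts i).E
  good : ∀ i < m, GoodLabel (m + 1) parts bp i
  reach : (L.deleteEdges {b}).Reach x y
  bound : ∀ i < m, ∀ e ∈ (parts i).E, e < N
  bound' : ∀ e ∈ L.E, e < N

/-- `B` is obtained from a chain of `m` good labels by deleting the free basepoint, whose ends are
`x` and `y`; for `m = 0` it is a single edge. -/
def Base (m : ℕ) (B : MGraph) (x y : ℕ) : Prop :=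
  x ≠ y ∧ ((m = 0 ∧ ∃ c, B.V = {x, y} ∧ B.E = {c} ∧ B.ends c = s(x, y)) ∨
    (1 ≤ m ∧ ∃ L parts bp b N, Ch m L parts bp b x y N ∧ B.V = L.V ∧ B.E = L.E \ {b} ∧
      ∀ e ∈ B.E, B.ends e = L.ends e))

/-- `Q` can be used as a label between basepoints `b` and `b'`. -/
def Label (Q : MGraph) (b b' : ℕ) : Prop :=
  IsK3 Q ∨ Q.IsBondGraph 3 ∨ (IsK4 Q ∧ ∀ z ∈ Q.ends b, z ∉ Q.ends b')

theorem Reach.symm {G : MGraph} {u v : ℕ} (h : G.Reach u v) : G.Reach v u := by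
  induction h with
  | refl => exact .refl
  | tail _ hs ih =>
    obtain ⟨e, he, h⟩ := hs
    exact .head ⟨e, he, by rw [h, Sym2.eq_swap]⟩ ih

theorem not_isCutEdge {G : MGraph} {b x y : ℕ} (hb : G.ends b = s(x, y))
    (h : (G.deleteEdges {b}).Reach x y) : ¬ G.IsCutEdge b := by
  rintro ⟨-, u, -, v, -, huv, hn⟩
  apply hn
  clear hn
  induction huv with
  | refl => exact .refl
  | @tail c d _ hs ih =>
    refine Relation.ReflTransGen.trans ih ?_
    obtain ⟨e, he, hcd⟩ := hs
    by_cases heb : e = b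
    · subst heb
      rw [hb] at hcd
      rcases Sym2.eq_iff.1 hcd with ⟨rfl, rfl⟩ | ⟨rfl, rfl⟩
      · exact h
      · exact Reach.symm h
    · exact .single ⟨e, by simp [deleteEdges, he, heb], hcd⟩

theorem Base.swap {m : ℕ} {B : MGraph} {x y : ℕ} (h : Base m B x y) : Base m B y x := by
  obtain ⟨hne, ⟨hm, c, h1, h2, h3⟩ | ⟨hm, L, parts, bp, b, N, hC, h⟩⟩ := h
  · exact ⟨hne.symm, .inl ⟨hm, c, by rw [h1, Finset.pair_comm], h2, by rw [h3, Sym2.eq_swap]⟩⟩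
  · exact ⟨hne.symm, .inr ⟨hm, L, parts, bp, b, N, ⟨hC.chain, hC.bp_last, hC.mem_last, hC.mem,
      by rw [hC.ends, Sym2.eq_swap], hC.notMem, hC.good, Reach.symm hC.reach, hC.bound, hC.bound'⟩, h⟩⟩

theorem Label.goodLabel {Q : MGraph} {b b' m i : ℕ} {parts : ℕ → MGraph} {bp : ℕ → ℕ}
    (h : Label Q b b') (hQ : parts i = Q) (hb : 0 < i → bp (i - 1) = b) (hb' : bp i = b') :
    GoodLabel m parts bp i := by
  unfold GoodLabel
  rw [hQ, hb']
  rcases h with h | h | ⟨h, h'⟩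
  · exact .inl h
  · exact .inr (.inl h)
  · exact .inr (.inr ⟨h, fun hi _ => by rw [hb hi]; exact h'⟩)

theorem Ch.ext {m : ℕ} {L : MGraph} {parts : ℕ → MGraph} {bp : ℕ → ℕ} {b x y N : ℕ}
    (hm : 1 ≤ m) (h : Ch m L parts bp b x y N) (hxy : x ≠ y) {Q : MGraph} {b' x' y' N' : ℕ}
    (hQ : Label Q b b') (hb : b ∈ Q.E) (hbe : Q.ends b = s(x, y)) (hb' : b' ∈ Q.E)
    (hbe' : Q.ends b' = s(x', y')) (hV : L.V ∩ Q.V = {x, y})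
    (hE : ∀ e ∈ Q.E, e ≠ b → N ≤ e) (hb'b : b' ≠ b) (hN' : ∀ e ∈ Q.E, e < N') (hNN : N ≤ N')
    (hr : (Q.deleteEdges {b}).Reach x y) (hr' : (Q.deleteEdges {b'}).Reach x' y') :
    ∃ L' parts' bp', Ch (m + 1) L' parts' bp' b' x' y' N' ∧ L'.V = L.V ∪ Q.V ∧
      L'.E = (L.E ∪ Q.E) \ {b} ∧ (∀ e ∈ Q.E, L'.ends e = Q.ends e) ∧
      ∀ e ∈ L.E, L'.ends e = L.ends e := by
  have hLQ : ∀ e ∈ L.E, e ∈ Q.E → e = b := by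
    intro e he heQ
    by_contra hne
    have := hE e heQ hne
    have := h.bound' e he
    omega
  have hends : ∀ e ∈ L.E, (if e ∈ Q.E then Q.ends e else L.ends e) = L.ends e := by
    intro e he
    split_ifs with heQ
    · rw [hLQ e he heQ, hbe, h.ends]
    · rfl
  let L' : MGraph :=
    { V := L.V ∪ Q.V
      E := (L.E ∪ Q.E) \ {b}
      ends := fun e => if e ∈ Q.E then Q.ends e else L.ends e
      ends_mem := by
        intro e he v hv
        simp only [Finset.mem_sdiff, Finset.mem_union, Finset.mem_singleton] at he
        rw [Finset.mem_union]
        by_cases heQ : e ∈ Q.E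
        · rw [if_pos heQ] at hv; exact .inr (Q.ends_mem e heQ v hv)
        · rw [if_neg heQ] at hv; exact .inl (L.ends_mem e (he.1.resolve_right heQ) v hv) }
  obtain ⟨-, hc1, hc2, hc3, S, hS0, hS, hSL⟩ := h.chain
  let parts' : ℕ → MGraph := Function.update parts m Q
  let bp' : ℕ → ℕ := Function.update bp m b'
  have hpm : parts' m = Q := by simp [parts']
  have hpi : ∀ i, i ≠ m → parts' i = parts i := fun i hi => by simp [parts', hi]
  have hbm : bp' m = b' := by simp [bp']
  have hbi : ∀ i, i ≠ m → bp' i = bp i := fun i hi => by simp [bp', hi]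
  have hcase : ∀ i, i + 1 < m + 1 → i + 1 < m ∨ i = m - 1 := by intro i hi; omega
  have hm1 : m - 1 + 1 = m := by omega
  have hsum : Is2Sum L' L Q b := by
    refine ⟨x, y, hxy, hV, ?_, h.mem, hb, h.ends, hbe, not_isCutEdge h.ends h.reach,
      not_isCutEdge hbe hr, rfl, rfl, fun e he _ => hends e he, fun e he _ => if_pos he⟩
    ext e
    simp only [Finset.mem_inter, Finset.mem_singleton]
    exact ⟨fun he => hLQ e he.1 he.2, by rintro rfl; exact ⟨h.mem, hb⟩⟩
  refine ⟨L', parts', bp', ⟨⟨by omega, ?_, ?_, ?_, Function.update S m L', ?_, ?_, ?_⟩, ?_, ?_, ?_,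
    ?_, ?_, ?_, ?_, ?_, ?_⟩, rfl, rfl, fun e he => if_pos he, hends⟩
  · intro i hi
    rcases hcase i hi with h1 | rfl
    · rw [hpi i (by omega), hpi (i + 1) (by omega), hbi i (by omega)]
      exact hc1 i h1
    · rw [hm1, hpm, hpi _ (by omega), hbi _ (by omega), h.bp_last]
      exact ⟨h.mem_last, hb⟩
  · intro i j hj hij e he
    rw [hpi i (by omega)] at he
    rcases Nat.lt_succ_iff_lt_or_eq.1 hj with hj | rfl
    · rw [hpi j (by omega)] at he
      exact hc2 i j hj hij e he
    · rw [hpm] at he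
      by_cases heb : e = b
      · exact h.notMem i hij (heb ▸ he.1)
      · have := h.bound i (by omega) e he.1
        have := hE e he.2 heb
        omega
  · intro i hi e
    rcases hcase i hi with h1 | rfl
    · rw [hpi i (by omega), hpi (i + 1) (by omega), hbi i (by omega)]
      exact hc3 i h1 e
    · rw [hm1, hpm, hpi _ (by omega), hbi _ (by omega), h.bp_last]
      intro he heQ
      by_contra heb
      have := h.bound _ (by omega) e he
      have := hE e heQ heb
      omega
  · rw [hpi 0 (by omega), Function.update_of_ne (by omega), hS0]
  · intro i hi
    rcases hcase i hi with h1 | rfl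
    · rw [hpi (i + 1) (by omega), hbi i (by omega), Function.update_of_ne (by omega),
        Function.update_of_ne (by omega)]
      exact hS i h1
    · rw [hm1, hpm, hbi _ (by omega), h.bp_last, Function.update_self,
        Function.update_of_ne (by omega), ← hSL]
      exact hsum
  · simp
  · simp [hbm]
  · simp [hpm, hb']
  · simp [L', hb', hb'b]
  · simp only [L', hb', if_true, hbe']
  · intro i hi hbi'
    rw [hpi i (by omega)] at hbi'
    have := h.bound i (by omega) _ hbi'
    have := hE _ hb' hb'b
    omega
  · intro i hi
    by_cases him : i = m
    · subst him
      exact hQ.goodLabel hpm (fun h0 => by rw [hbi _ (by omega), h.bp_last]) hbm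
    · have h1 := h.good i (by omega)
      unfold GoodLabel at h1 ⊢
      rw [hpi i him, hbi i him, hbi (i - 1) (by omega)]
      rcases h1 with h1 | h1 | h1
      · exact .inl h1
      · exact .inr (.inl h1)
      · exact .inr (.inr ⟨h1.1, fun h2 _ => h1.2 h2 (by omega)⟩)
  · have hL : (L'.deleteEdges {b'}).Reach x y := by
      refine Relation.ReflTransGen.mono ?_ _ _ h.reach
      rintro c d ⟨e, he, hcd⟩
      simp only [deleteEdges, Finset.mem_sdiff, Finset.mem_singleton] at he
      refine ⟨e, ?_, (hends e he.1).trans hcd⟩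
      simp only [deleteEdges, L', Finset.mem_sdiff, Finset.mem_singleton, Finset.mem_union]
      refine ⟨⟨.inl he.1, he.2⟩, ?_⟩
      rintro rfl
      have := hE _ hb' hb'b
      have := h.bound' _ he.1
      omega
    have key : ∀ z, (Q.deleteEdges {b'}).Reach x' z → (L'.deleteEdges {b'}).Reach x' z := by
      intro z hz
      induction hz with
      | refl => exact .refl
      | @tail c d _ hs ih =>
        refine Relation.ReflTransGen.trans ih ?_
        obtain ⟨e, he, hcd⟩ := hs
        simp only [deleteEdges, Finset.mem_sdiff, Finset.mem_singleton] at he hcd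
        by_cases heb : e = b
        · subst heb
          rw [hbe] at hcd
          rcases Sym2.eq_iff.1 hcd with ⟨rfl, rfl⟩ | ⟨rfl, rfl⟩
          · exact hL
          · exact Reach.symm hL
        · refine .single ⟨e, by simp [deleteEdges, L', he, heb], ?_⟩
          simp only [deleteEdges, L', he.1, if_true, hcd]
    exact key _ hr'
  · intro i hi e he
    by_cases him : i = m
    · rw [him, hpm] at he; exact hN' e he
    · rw [hpi i him] at he
      have := h.bound i (by omega) e he
      omega
  · intro e he
    simp only [L', Finset.mem_sdiff, Finset.mem_union] at he
    rcases he.1 with h1 | h1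
    · have := h.bound' e h1; omega
    · exact hN' e h1

theorem Base.ext {m : ℕ} {B : MGraph} {x y : ℕ} (h : Base m B x y) :
    ∃ b N, b < N ∧ (∀ e ∈ B.E, e < N) ∧ ∀ Q : MGraph, ∀ b' x' y' : ℕ, Label Q b b' →
      b ∈ Q.E → Q.ends b = s(x, y) → b' ∈ Q.E → Q.ends b' = s(x', y') → x' ≠ y' →
      B.V ∩ Q.V = {x, y} → (∀ e ∈ Q.E, e ≠ b → N ≤ e) → b' ≠ b →
      (Q.deleteEdges {b}).Reach x y → (Q.deleteEdges {b'}).Reach x' y' →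
      ∀ B' : MGraph, B'.V = B.V ∪ Q.V → B'.E = B.E ∪ (Q.E \ {b, b'}) →
        (∀ e ∈ B.E, B'.ends e = B.ends e) → (∀ e ∈ Q.E, e ≠ b → e ≠ b' → B'.ends e = Q.ends e) →
        Base (m + 1) B' x' y' := by
  obtain ⟨hne, ⟨hm, c, h1, h2, h3⟩ | ⟨hm, L, parts, bp, b, N, hC, h1, h2, h3⟩⟩ := h
  · refine ⟨c, c + 1, by omega, by simp [h2], ?_⟩
    intro Q b' x' y' hQ hb hbe hb' hbe' hne' hV hE hb'b hr hr' B' hB1 hB2 hB3 hB4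
    subst hm
    have hVQ : B.V ∪ Q.V = Q.V := by
      have h4 : ({x, y} : Finset ℕ) ⊆ Q.V := by rw [← hV]; exact Finset.inter_subset_right
      rw [h1]
      exact Finset.union_eq_right.2 h4
    obtain ⟨M, hM⟩ : ∃ M, ∀ e ∈ Q.E, e < M := ⟨Q.E.sup id + 1, fun e he => Nat.lt_succ_of_le (Finset.le_sup (f := id) he)⟩
    refine ⟨hne', .inr ⟨by omega, Q, fun _ => Q, fun _ => b', b', M, ⟨⟨by omega, ?_, ?_, ?_,
      fun _ => Q, rfl, ?_, rfl⟩, rfl, hb', hb', hbe', ?_, ?_, hr', fun _ _ => hM, hM⟩, ?_, ?_, ?_⟩⟩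
    · intro i hi; omega
    · intro i j hj hij; omega
    · intro i hi; omega
    · intro i hi; omega
    · intro i hi; omega
    · intro i hi
      obtain rfl : i = 0 := by omega
      exact hQ.goodLabel rfl (fun h => absurd h (lt_irrefl _)) rfl
    · rw [hB1, hVQ]
    · rw [hB2, h2]
      ext e
      simp only [Finset.mem_union, Finset.mem_singleton, Finset.mem_sdiff, Finset.mem_insert]
      constructor
      · rintro (rfl | h)
        · exact ⟨hb, hb'b.symm⟩
        · exact ⟨h.1, fun h' => h.2 (.inr h')⟩
      · rintro ⟨h, h'⟩
        by_cases hec : e = c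
        · exact .inl hec
        · exact .inr ⟨h, by rintro (h | h) <;> contradiction⟩
    · intro e he
      by_cases hec : e = c
      · subst hec
        rw [hB3 e (by simp [h2]), h3, hbe]
      · rw [hB2, h2] at he
        simp only [Finset.mem_union, Finset.mem_singleton, Finset.mem_sdiff, Finset.mem_insert, hec, false_or] at he
        exact hB4 e he.1 hec he.2
  · refine ⟨b, N, hC.bound' b hC.mem, fun e he => hC.bound' e (by rw [h2] at he; exact (Finset.mem_sdiff.1 he).1), ?_⟩
    intro Q b' x' y' hQ hb hbe hb' hbe' hne' hV hE hb'b hr hr' B' hB1 hB2 hB3 hB4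
    obtain ⟨M, hM⟩ : ∃ M, ∀ e ∈ Q.E, e < M := ⟨Q.E.sup id + 1, fun e he => Nat.lt_succ_of_le (Finset.le_sup (f := id) he)⟩
    obtain ⟨L', parts', bp', hC', hV', hE', he1, he2⟩ := hC.ext hm hne (N' := N + M) hQ hb hbe hb' hbe'
      (by rw [← h1]; exact hV) hE hb'b (fun e he => by have := hM e he; omega) (by omega) hr hr'
    have hb'L : b' ∉ L.E := fun h => by
      have := hC.bound' _ h
      have := hE _ hb' hb'b
      omega
    refine ⟨hne', .inr ⟨by omega, L', parts', bp', b', N + M, hC', by rw [hB1, hV', h1], ?_, ?_⟩⟩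
    · rw [hB2, hE', h2]
      ext e
      simp only [Finset.mem_union, Finset.mem_singleton, Finset.mem_sdiff, Finset.mem_insert]
      constructor
      · rintro (h | h)
        · exact ⟨⟨.inl h.1, h.2⟩, by rintro rfl; exact hb'L h.1⟩
        · exact ⟨⟨.inr h.1, fun h' => h.2 (.inl h')⟩, fun h' => h.2 (.inr h')⟩
      · rintro ⟨⟨h | h, h'⟩, h''⟩
        · exact .inl ⟨h, h'⟩
        · exact .inr ⟨h, by rintro (h | h) <;> contradiction⟩
    · intro e he
      rw [hB2] at he
      rcases Finset.mem_union.1 he with h | h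
      · rw [hB3 e h, h3 e h, he2 e (by rw [h2] at h; exact (Finset.mem_sdiff.1 h).1)]
      · simp only [Finset.mem_sdiff, Finset.mem_insert, Finset.mem_singleton, not_or] at h
        rw [hB4 e h.1 h.2.1 h.2.2, he1 e h.1]

end MGraph

end

section

namespace MGraph

variable {m : ℕ} {B H : MGraph} {x y x' y' : ℕ}

theorem Base.mem (h : Base m B x y) : x ∈ B.V ∧ y ∈ B.V := by
  obtain ⟨hne, ⟨hm, c, h1, h2, h3⟩ | ⟨hm, L, parts, bp, b, N, hC, h1, h2, h3⟩⟩ := h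
  · simp [h1]
  · rw [h1]
    exact ⟨L.ends_mem b hC.mem x (by simp [hC.ends]), L.ends_mem b hC.mem y (by simp [hC.ends])⟩

theorem reach_edge {G : MGraph} {e u v : ℕ} (he : e ∈ G.E) (h : G.ends e = s(u, v)) : G.Reach u v :=
  .single ⟨e, he, h⟩

theorem Base.rung (h : Base m B x y) : ∃ c, c ∉ B.E ∧ Base (m + 1) (addE B x y c) x y := by
  have hne := h.1
  have hmem := h.mem
  obtain ⟨b, N, hbN, hN, hext⟩ := h.ext
  let Q : MGraph := ⟨{x, y}, {b, N, N + 1}, fun _ => s(x, y), by simp⟩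
  refine ⟨N, fun h => lt_irrefl _ (hN N h), hext Q (N + 1) x y (.inr (.inl ⟨x, y, hne, rfl, ?_, fun _ _ => rfl⟩))
    (by simp [Q]) rfl (by simp [Q]) rfl hne ?_ ?_ (by omega) ?_ ?_ _ ?_ ?_ ?_ ?_⟩
  · simp only [Q]
    rw [Finset.card_insert_of_notMem (by simp; omega), Finset.card_insert_of_notMem (by simp)]
    rfl
  · exact Finset.inter_eq_right.2 (by intro z; simp only [Q, Finset.mem_insert, Finset.mem_singleton]; rintro (rfl | rfl); exacts [hmem.1, hmem.2])
  · intro e he hne'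
    simp only [Q, Finset.mem_insert, Finset.mem_singleton] at he
    omega
  · exact reach_edge (e := N) (by simp [Q, deleteEdges]; omega) rfl
  · exact reach_edge (e := N) (by simp [Q, deleteEdges]) rfl
  · ext z
    simp only [addE, Q, Finset.mem_insert, Finset.mem_union, Finset.mem_singleton]
    tauto
  · ext z
    simp only [addE, Q, Finset.mem_insert, Finset.mem_union, Finset.mem_singleton, Finset.mem_sdiff]
    constructor
    · rintro (rfl | h)
      · right; omega
      · exact .inl h
    · rintro (h | h)
      · exact .inr h
      · left; omega
  · intro e he
    have := hN e he
    simp only [addE]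
    rw [if_neg (by omega)]
  · intro e he h1 h2
    simp only [Q, Finset.mem_insert, Finset.mem_singleton] at he
    simp only [addE, Q]
    rw [if_pos (by omega)]

theorem Base.slide (h : Base m B x y) (hx' : x' ∉ B.V) :
    ∃ c, c ∉ B.E ∧ Base (m + 1) (addE B x x' c) x' y := by
  have hne := h.1
  have hmem := h.mem
  have hxx' : x ≠ x' := by rintro rfl; exact hx' hmem.1
  have hyx' : y ≠ x' := by rintro rfl; exact hx' hmem.2
  obtain ⟨b, N, hbN, hN, hext⟩ := h.ext
  let Q : MGraph := ⟨{x, y, x'}, {b, N, N + 1},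
    fun e => if e = b then s(x, y) else if e = N then s(x, x') else s(x', y), by
      intro e _ v hv
      split_ifs at hv <;> simp only [Sym2.mem_iff] at hv <;> rcases hv with rfl | rfl <;> simp⟩
  have hQb : Q.ends b = s(x, y) := by simp [Q]
  have hQN : Q.ends N = s(x, x') := by
    change (if N = b then _ else if N = N then _ else _) = _
    rw [if_neg (by omega), if_pos rfl]
  have hQN' : Q.ends (N + 1) = s(x', y) := by
    simp only [Q]; rw [if_neg (by omega), if_neg (by omega)]
  have hK3 : IsK3 Q := by
    refine ⟨?_, ?_, ?_, ?_⟩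
    · simp only [Q]
      rw [Finset.card_insert_of_notMem (by simp [hne, hxx']), Finset.card_insert_of_notMem (by simp [hyx'])]
      rfl
    · simp only [Q]
      rw [Finset.card_insert_of_notMem (by simp; omega), Finset.card_insert_of_notMem (by simp)]
      rfl
    · intro g hg
      simp only [Q, Finset.mem_insert, Finset.mem_singleton] at hg
      rcases hg with rfl | rfl | rfl
      · simp [hQb, hne]
      · simp [hQN, hxx']
      · simp [hQN', hyx'.symm]
    · intro u hu v hv huv
      simp only [Q, Finset.mem_insert, Finset.mem_singleton] at hu hv
      have mb : b ∈ Q.E := by simp [Q]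
      have mN : N ∈ Q.E := by simp [Q]
      have mN' : N + 1 ∈ Q.E := by simp [Q]
      rcases hu with rfl | rfl | rfl <;> rcases hv with rfl | rfl | rfl
      · exact absurd rfl huv
      · exact ⟨b, mb, hQb⟩
      · exact ⟨N, mN, hQN⟩
      · exact ⟨b, mb, by rw [hQb, Sym2.eq_swap]⟩
      · exact absurd rfl huv
      · exact ⟨N + 1, mN', by rw [hQN', Sym2.eq_swap]⟩
      · exact ⟨N, mN, by rw [hQN, Sym2.eq_swap]⟩
      · exact ⟨N + 1, mN', hQN'⟩
      · exact absurd rfl huv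
  refine ⟨N, fun h => lt_irrefl _ (hN N h), hext Q (N + 1) x' y (.inl hK3)
    (by simp [Q]) hQb (by simp [Q]) hQN' hyx'.symm ?_ ?_ (by omega) ?_ ?_ _ ?_ ?_ ?_ ?_⟩
  · ext z
    simp only [Q, Finset.mem_inter, Finset.mem_insert, Finset.mem_singleton]
    constructor
    · rintro ⟨h1, h2 | h2 | h2⟩
      · exact .inl h2
      · exact .inr h2
      · exact absurd (h2 ▸ h1) hx'
    · rintro (rfl | rfl)
      · exact ⟨hmem.1, by simp⟩
      · exact ⟨hmem.2, by simp⟩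
  · intro e he hne'
    simp only [Q, Finset.mem_insert, Finset.mem_singleton] at he
    omega
  · exact (reach_edge (G := Q.deleteEdges {b}) (e := N) (by simp [Q, deleteEdges]; omega) hQN).trans
      (reach_edge (G := Q.deleteEdges {b}) (e := N + 1) (by simp [Q, deleteEdges]; omega) hQN')
  · exact (reach_edge (G := Q.deleteEdges {N + 1}) (e := N) (by simp [Q, deleteEdges])
      (by rw [Sym2.eq_swap]; exact hQN)).trans
      (reach_edge (G := Q.deleteEdges {N + 1}) (e := b) (by simp [Q, deleteEdges]; omega) hQb)
  · ext z
    simp only [addE, Q, Finset.mem_insert, Finset.mem_union, Finset.mem_singleton]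
    constructor
    · rintro (h | h | h) <;> simp [h]
    · rintro (h | h | rfl | h)
      · simp [h]
      · simp [h]
      · simp [hmem.2]
      · simp [h]
  · ext z
    simp only [addE, Q, Finset.mem_insert, Finset.mem_union, Finset.mem_singleton, Finset.mem_sdiff]
    constructor
    · rintro (rfl | h)
      · right; omega
      · exact .inl h
    · rintro (h | h)
      · exact .inr h
      · left; omega
  · intro e he
    have := hN e he
    simp only [addE]
    rw [if_neg (by omega)]
  · intro e he h1 h2
    simp only [Q, Finset.mem_insert, Finset.mem_singleton] at he
    obtain rfl : e = N := by omega
    rw [hQN]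
    simp [addE]

set_option maxHeartbeats 800000 in
theorem Base.k4 (h : Base m B x y) (hx' : x' ∉ B.V) (hy' : y' ∉ B.V) (hxy' : x' ≠ y') :
    ∃ c, (∀ e ∈ B.E, e < c) ∧
      Base (m + 1) (addE (addE (addE (addE B x x' c) y y' (c + 1)) x y' (c + 2)) x' y (c + 3)) x' y' := by
  have hne := h.1
  have hmem := h.mem
  have hxx' : x ≠ x' := by rintro rfl; exact hx' hmem.1
  have hyx' : y ≠ x' := by rintro rfl; exact hx' hmem.2
  have hx'y' : x ≠ y' := by rintro rfl; exact hy' hmem.1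
  have hyy' : y ≠ y' := by rintro rfl; exact hy' hmem.2
  obtain ⟨b, N, hbN, hN, hext⟩ := h.ext
  let Q : MGraph := ⟨{x, y, x', y'}, {b, N, N + 1, N + 2, N + 3, N + 4},
    fun e => if e = b then s(x, y) else if e = N then s(x, x') else if e = N + 1 then s(y, y')
      else if e = N + 2 then s(x, y') else if e = N + 3 then s(x', y) else s(x', y'), by
      intro e _ v hv
      split_ifs at hv <;> simp only [Sym2.mem_iff] at hv <;> rcases hv with rfl | rfl <;> simp⟩
  have h0 : Q.ends b = s(x, y) := by simp [Q]
  have h1 : Q.ends N = s(x, x') := by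
    change (if N = b then _ else if N = N then _ else _) = _
    rw [if_neg (by omega), if_pos rfl]
  have h2 : Q.ends (N + 1) = s(y, y') := by
    simp only [Q]; rw [if_neg (by omega), if_neg (by omega), if_pos True.intro]
  have h3 : Q.ends (N + 2) = s(x, y') := by
    simp only [Q]; rw [if_neg (by omega), if_neg (by omega), if_neg (by omega), if_pos True.intro]
  have h4 : Q.ends (N + 3) = s(x', y) := by
    simp only [Q]
    rw [if_neg (by omega), if_neg (by omega), if_neg (by omega), if_neg (by omega), if_pos True.intro]
  have h5 : Q.ends (N + 4) = s(x', y') := by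
    simp only [Q]
    rw [if_neg (by omega), if_neg (by omega), if_neg (by omega), if_neg (by omega), if_neg (by omega)]
  have m0 : b ∈ Q.E := by simp [Q]
  have m1 : N ∈ Q.E := by simp [Q]
  have m2 : N + 1 ∈ Q.E := by simp [Q]
  have m3 : N + 2 ∈ Q.E := by simp [Q]
  have m4 : N + 3 ∈ Q.E := by simp [Q]
  have m5 : N + 4 ∈ Q.E := by simp [Q]
  have hK4 : IsK4 Q := by
    refine ⟨?_, ?_, ?_, ?_⟩
    · simp only [Q]
      rw [Finset.card_insert_of_notMem (by simp [hne, hxx', hx'y']),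
        Finset.card_insert_of_notMem (by simp [hyx', hyy']), Finset.card_insert_of_notMem (by simp [hxy'])]
      rfl
    · simp only [Q]
      rw [Finset.card_insert_of_notMem (by simp; omega), Finset.card_insert_of_notMem (by simp),
        Finset.card_insert_of_notMem (by simp), Finset.card_insert_of_notMem (by simp),
        Finset.card_insert_of_notMem (by simp)]
      rfl
    · intro g hg
      simp only [Q, Finset.mem_insert, Finset.mem_singleton] at hg
      rcases hg with rfl | rfl | rfl | rfl | rfl | rfl
      · simp [h0, hne]
      · simp [h1, hxx']
      · simp [h2, hyy']
      · simp [h3, hx'y']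
      · simp [h4, hyx'.symm]
      · simp [h5, hxy']
    · intro u hu v hv huv
      simp only [Q, Finset.mem_insert, Finset.mem_singleton] at hu hv
      have key : (∃ g ∈ Q.E, Q.ends g = s(v, u)) → ∃ g ∈ Q.E, Q.ends g = s(u, v) := by
        rintro ⟨g, hg, h⟩; exact ⟨g, hg, by rw [h, Sym2.eq_swap]⟩
      rcases hu with rfl | rfl | rfl | rfl <;> rcases hv with rfl | rfl | rfl | rfl
      · exact absurd rfl huv
      · exact ⟨b, m0, h0⟩
      · exact ⟨N, m1, h1⟩
      · exact ⟨_, m3, h3⟩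
      · exact key ⟨b, m0, h0⟩
      · exact absurd rfl huv
      · exact key ⟨_, m4, h4⟩
      · exact ⟨_, m2, h2⟩
      · exact key ⟨_, m1, h1⟩
      · exact ⟨_, m4, h4⟩
      · exact absurd rfl huv
      · exact ⟨_, m5, h5⟩
      · exact key ⟨_, m3, h3⟩
      · exact key ⟨_, m2, h2⟩
      · exact key ⟨_, m5, h5⟩
      · exact absurd rfl huv
  refine ⟨N, hN, hext Q (N + 4) x' y' (.inr (.inr ⟨hK4, ?_⟩)) m0 h0 m5 h5 hxy'
    ?_ ?_ (by omega) ?_ ?_ _ ?_ ?_ ?_ ?_⟩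
  · intro z hz
    rw [h0, Sym2.mem_iff] at hz
    rw [h5, Sym2.mem_iff]
    rcases hz with rfl | rfl <;> simp [*]
  · ext z
    simp only [Q, Finset.mem_inter, Finset.mem_insert, Finset.mem_singleton]
    constructor
    · rintro ⟨h1, h2 | h2 | h2 | h2⟩
      · exact .inl h2
      · exact .inr h2
      · exact absurd (h2 ▸ h1) hx'
      · exact absurd (h2 ▸ h1) hy'
    · rintro (rfl | rfl)
      · exact ⟨hmem.1, by simp⟩
      · exact ⟨hmem.2, by simp⟩
  · intro e he hne'
    simp only [Q, Finset.mem_insert, Finset.mem_singleton] at he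
    omega
  · exact (reach_edge (G := Q.deleteEdges {b}) (e := N) (by simp [deleteEdges, m1]; omega) h1).trans
      (reach_edge (G := Q.deleteEdges {b}) (e := N + 3) (by simp [deleteEdges, m4]; omega) h4)
  · exact (reach_edge (G := Q.deleteEdges {N + 4}) (e := N + 3) (by simp [deleteEdges, m4]) h4).trans
      (reach_edge (G := Q.deleteEdges {N + 4}) (e := N + 1) (by simp [deleteEdges, m2]) h2)
  · ext z
    simp only [addE, Q, Finset.mem_insert, Finset.mem_union, Finset.mem_singleton]
    constructor
    · rintro (h | h | h | h | h | h | h | h | h) <;> simp [h]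
    · rintro (h | h | h | h | h) <;> simp [h]
  · ext z
    simp only [addE, Q, Finset.mem_insert, Finset.mem_union, Finset.mem_singleton, Finset.mem_sdiff]
    constructor
    · rintro (h | h | h | h | h)
      · right; omega
      · right; omega
      · right; omega
      · right; omega
      · exact .inl h
    · rintro (h | h)
      · simp [h]
      · have : z = N + 3 ∨ z = N + 2 ∨ z = N + 1 ∨ z = N := by omega
        rcases this with h | h | h | h <;> simp [h]
  · intro e he
    have := hN e he
    simp only [addE]
    rw [if_neg (by omega), if_neg (by omega), if_neg (by omega), if_neg (by omega)]
  · intro e he hb hb'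
    simp only [Q, Finset.mem_insert, Finset.mem_singleton] at he
    rcases he with rfl | rfl | rfl | rfl | rfl | rfl
    · exact absurd rfl hb
    · rw [h1]; simp [addE]
    · rw [h2]; simp [addE]
    · rw [h3]; simp [addE]
    · rw [h4]; simp [addE]
    · exact absurd rfl hb'

/-- A set of internally disjoint `x`-`y` paths of `H` with internal vertices `I` and edges `D`. -/
def Bdl (H : MGraph) (x y : ℕ) (I D : Finset ℕ) : Prop :=
  ∃ Bs : Finset (List ℕ × List ℕ), Bs.Nonempty ∧
    (∀ p ∈ Bs, H.IsPathBetween x y p.1 p.2 ∧ p.2 ≠ []) ∧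
    (∀ p ∈ Bs, ∀ q ∈ Bs, p ≠ q →
      (∀ w ∈ pathInternals p, w ∉ pathInternals q) ∧ ∀ g ∈ p.2, g ∉ q.2) ∧
    I = Bs.biUnion (fun p => (pathInternals p).toFinset) ∧ D = Bs.biUnion (fun p => p.2.toFinset)

/-- The vertices used by a system of paths replacing the edges of `B`. -/
def usedV (B : MGraph) (P : ℕ → Finset (List ℕ × List ℕ)) : Finset ℕ :=
  B.V ∪ B.E.biUnion (fun e => (P e).biUnion (fun p => (pathInternals p).toFinset))

/-- The edges used by a system of paths replacing the edges of `B`. -/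
def usedE (B : MGraph) (P : ℕ → Finset (List ℕ × List ℕ)) : Finset ℕ :=
  B.E.biUnion (fun e => (P e).biUnion (fun p => p.2.toFinset))

/-- Replacing the edges of `B` by the paths `P` gives a subgraph of `H`. -/
structure Emb (H B : MGraph) (P : ℕ → Finset (List ℕ × List ℕ)) : Prop where
  sub : B.V ⊆ H.V
  loopless : B.Loopless
  ne : ∀ e ∈ B.E, (P e).Nonempty
  path : ∀ e ∈ B.E, ∀ p ∈ P e,
    (∃ x y : ℕ, B.ends e = s(x, y) ∧ H.IsPathBetween x y p.1 p.2) ∧ p.2 ≠ [] ∧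
      ∀ w ∈ pathInternals p, w ∉ B.V
  disj : ∀ e ∈ B.E, ∀ e' ∈ B.E, ∀ p ∈ P e, ∀ p' ∈ P e', (e ≠ e' ∨ p ≠ p') →
    (∀ w ∈ pathInternals p, w ∉ pathInternals p') ∧ (∀ g ∈ p.2, g ∉ p'.2)

theorem Emb.add {P : ℕ → Finset (List ℕ × List ℕ)} {c : ℕ} {I D : Finset ℕ} (h : Emb H B P)
    (hc : c ∉ B.E) (hxy : x ≠ y) (hxH : x ∈ H.V) (hyH : y ∈ H.V)
    (hx : x ∈ usedV B P → x ∈ B.V) (hy : y ∈ usedV B P → y ∈ B.V) (hB : Bdl H x y I D)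
    (hxI : x ∉ I) (hyI : y ∉ I)
    (hI : Disjoint (usedV B P) I) (hD : Disjoint (usedE B P) D) :
    ∃ P', Emb H (addE B x y c) P' ∧ usedV (addE B x y c) P' = usedV B P ∪ {x, y} ∪ I ∧
      usedE (addE B x y c) P' = usedE B P ∪ D := by
  obtain ⟨Bs, hne, hpath, hdisj, rfl, rfl⟩ := hB
  have hce : ∀ e ∈ B.E, e ≠ c := by rintro e he rfl; exact hc he
  rw [Finset.disjoint_left] at hI hD
  simp only [usedV, usedE, Finset.mem_union, Finset.mem_biUnion, List.mem_toFinset, not_exists,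
    not_and] at hx hy hxI hyI hI hD
  have hold : ∀ e ∈ B.E, (if e = c then Bs else P e) = P e := fun e he => if_neg (hce e he)
  refine ⟨fun e => if e = c then Bs else P e, ⟨?_, ?_, ?_, ?_, ?_⟩, ?_, ?_⟩
  · intro v hv
    simp only [addE, Finset.mem_insert] at hv
    rcases hv with rfl | rfl | hv
    · exact hxH
    · exact hyH
    · exact h.sub hv
  · intro e he
    simp only [addE, Finset.mem_insert] at he ⊢
    by_cases hec : e = c
    · simp [hec, hxy]
    · rw [if_neg hec]; exact h.loopless e (he.resolve_left hec)
  · intro e he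
    simp only [addE, Finset.mem_insert] at he ⊢
    by_cases hec : e = c
    · rw [if_pos hec]; exact hne
    · rw [if_neg hec]; exact h.ne e (he.resolve_left hec)
  · intro e he p hp
    simp only [addE, Finset.mem_insert] at he hp ⊢
    by_cases hec : e = c
    · rw [if_pos hec] at hp
      refine ⟨⟨x, y, by simp [hec], (hpath p hp).1⟩, (hpath p hp).2, ?_⟩
      rintro w hw (rfl | rfl | hwB)
      · exact hxI p hp hw
      · exact hyI p hp hw
      · exact hI (.inl hwB) p hp hw
    · rw [if_neg hec] at hp
      have he := he.resolve_left hec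
      obtain ⟨h1, h2, h3⟩ := h.path e he p hp
      refine ⟨by simpa [hec] using h1, h2, ?_⟩
      rintro w hw (rfl | rfl | hwB)
      · exact h3 _ hw (hx (.inr ⟨e, he, p, hp, hw⟩))
      · exact h3 _ hw (hy (.inr ⟨e, he, p, hp, hw⟩))
      · exact h3 w hw hwB
  · intro e he e' he' p hp p' hp' hor
    simp only [addE, Finset.mem_insert] at he he' hp hp'
    by_cases hec : e = c <;> by_cases hec' : e' = c
    · rw [if_pos hec] at hp
      rw [if_pos hec'] at hp'
      exact hdisj p hp p' hp' (hor.resolve_left (by rw [hec, hec']; simp))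
    · rw [if_pos hec] at hp
      rw [if_neg hec'] at hp'
      have he' := he'.resolve_left hec'
      exact ⟨fun w hw hw' => hI (.inr ⟨e', he', p', hp', hw'⟩) p hp hw,
        fun g hg hg' => hD ⟨e', he', p', hp', hg'⟩ p hp hg⟩
    · rw [if_neg hec] at hp
      rw [if_pos hec'] at hp'
      have he := he.resolve_left hec
      exact ⟨fun w hw hw' => hI (.inr ⟨e, he, p, hp, hw⟩) p' hp' hw',
        fun g hg hg' => hD ⟨e, he, p, hp, hg⟩ p' hp' hg'⟩
    · rw [if_neg hec] at hp
      rw [if_neg hec'] at hp'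
      exact h.disj e (he.resolve_left hec) e' (he'.resolve_left hec') p hp p' hp' hor
  · unfold usedV
    simp only [addE, Finset.biUnion_insert, if_true]
    have hcg : B.E.biUnion (fun e => (if e = c then Bs else P e).biUnion
        (fun p => (pathInternals p).toFinset)) = B.E.biUnion (fun e => (P e).biUnion
        (fun p => (pathInternals p).toFinset)) :=
      Finset.biUnion_congr rfl (fun e he => by rw [hold e he])
    rw [hcg]
    ext z
    simp only [Finset.mem_union, Finset.mem_insert, Finset.mem_singleton]
    tauto
  · unfold usedE
    simp only [addE, Finset.biUnion_insert, if_true]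
    have hcg : B.E.biUnion (fun e => (if e = c then Bs else P e).biUnion
        (fun p => p.2.toFinset)) = B.E.biUnion (fun e => (P e).biUnion
        (fun p => p.2.toFinset)) :=
      Finset.biUnion_congr rfl (fun e he => by rw [hold e he])
    rw [hcg, Finset.union_comm]

theorem Emb.congr {B' : MGraph} {P : ℕ → Finset (List ℕ × List ℕ)} (h : Emb H B P) (hV : B'.V = B.V)
    (hE : B'.E = B.E) (he : ∀ e ∈ B.E, B'.ends e = B.ends e) : Emb H B' P where
  sub := hV ▸ h.sub
  loopless := fun e hm => by rw [hE] at hm; rw [he e hm]; exact h.loopless e hm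
  ne := hE ▸ h.ne
  path := fun e hm p hp => by rw [hE] at hm; rw [he e hm, hV]; exact h.path e hm p hp
  disj := hE ▸ h.disj

theorem Emb.isPPE {P : ℕ → Finset (List ℕ × List ℕ)} (h : Emb H B P) (hV : usedV B P = H.V)
    (hE : usedE B P = H.E) : IsPPE H B := by
  obtain ⟨P', hold, hempty⟩ : ∃ P' : ℕ → Finset (List ℕ × List ℕ),
      (∀ e ∈ B.E, P' e = P e) ∧ ∀ e ∉ B.E, P' e = ∅ :=
    ⟨fun e => if e ∈ B.E then P e else ∅, fun e he => if_pos he, fun e he => if_neg he⟩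
  refine ⟨h.sub, P', ?_, ?_, ?_, ?_, ?_, ?_, ?_⟩
  · rintro e (he | he)
    · exact hempty e he
    · by_cases heB : e ∈ B.E
      · exact absurd he (h.loopless e heB)
      · exact hempty e heB
  · intro e he hd; exact absurd hd (h.loopless e he)
  · intro e he _; rw [hold e he]; exact h.ne e he
  · intro e he p hp; rw [hold e he] at hp; exact h.path e he p hp
  · intro e he e' he' p hp p' hp'
    rw [hold e he] at hp; rw [hold e' he'] at hp'
    exact h.disj e he e' he' p hp p' hp'
  · rw [← hV, usedV]
    congr 1
    exact Finset.biUnion_congr rfl (fun e he => by rw [hold e he])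
  · rw [Finset.filter_false_of_mem (fun e he => h.loopless e he), Finset.empty_union, ← hE, usedE]
    exact Finset.biUnion_congr rfl (fun e he => by rw [hold e he])

theorem Bdl.swap_walk {vs es : List ℕ} (h : H.IsWalk vs es) : H.IsWalk vs.reverse es.reverse := by
  have app : ∀ {vs es : List ℕ} {u v e : ℕ}, H.IsWalk (vs ++ [u]) es → e ∈ H.E → H.ends e = s(u, v) →
      H.IsWalk (vs ++ [u] ++ [v]) (es ++ [e]) := by
    intro vs
    induction vs with
    | nil =>
      intro es u v e hw he hends
      cases hw
      exact .cons he hends (.nil (H.ends_mem e he v (by simp [hends])))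
    | cons a vs ih =>
      intro es u v e hw he hends
      cases vs with
      | nil =>
        cases hw with
        | cons h1 h2 h3 => exact .cons h1 h2 (ih h3 he hends)
      | cons b vs =>
        cases hw with
        | cons h1 h2 h3 => exact .cons h1 h2 (ih h3 he hends)
  induction h with
  | nil hv => exact .nil hv
  | @cons u v e vs es he hends _ ih =>
    simp only [List.reverse_cons] at ih ⊢
    exact app ih he (by rw [hends, Sym2.eq_swap])

end MGraph

end

section

namespace MGraph

variable {m : ℕ} {B H : MGraph} {x y z x' y' e : ℕ} {I I' D D' : Finset ℕ}

/-- `I` and `D` are the sets of internal vertices and edges of an `x`-`y` path of `H`. -/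
def Pth (H : MGraph) (x y : ℕ) (I D : Finset ℕ) : Prop :=
  ∃ t es, H.IsWalk (x :: (t ++ [y])) es ∧ (x :: (t ++ [y])).Nodup ∧ I = t.toFinset ∧ D = es.toFinset

theorem IsWalk.mem_V {vs es : List ℕ} (h : H.IsWalk vs es) : ∀ v ∈ vs, v ∈ H.V := by
  induction h with
  | nil hv => simpa using hv
  | @cons u v e vs es he hends _ ih =>
    intro z hz
    rcases List.mem_cons.1 hz with rfl | hz
    · exact H.ends_mem e he z (by simp [hends])
    · exact ih z hz

theorem IsWalk.mem_E {vs es : List ℕ} (h : H.IsWalk vs es) : ∀ e ∈ es, e ∈ H.E := by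
  induction h with
  | nil hv => simp
  | cons he hends _ ih =>
    intro z hz
    rcases List.mem_cons.1 hz with rfl | hz
    · exact he
    · exact ih z hz

theorem Pth.sub (h : Pth H x y I D) : x ∈ H.V ∧ y ∈ H.V ∧ I ⊆ H.V ∧ D ⊆ H.E := by
  obtain ⟨t, es, h1, h2, rfl, rfl⟩ := h
  refine ⟨h1.mem_V _ (by simp), h1.mem_V _ (by simp), fun z hz => h1.mem_V _ ?_,
    fun z hz => h1.mem_E _ (by simpa using hz)⟩
  have : z ∈ t := by simpa using hz
  simp [this]

theorem Pth.ne (h : Pth H x y I D) : x ≠ y ∧ x ∉ I ∧ y ∉ I := by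
  obtain ⟨t, es, h1, h2, rfl, rfl⟩ := h
  simp only [List.nodup_cons, List.mem_append, List.mem_singleton, List.nodup_append] at h2
  refine ⟨fun h => h2.1 (.inr h), fun h => h2.1 (.inl (by simpa using h)), fun h => ?_⟩
  exact h2.2.2.2 y (by simpa using h) y rfl rfl

theorem Pth.edge (he : e ∈ H.E) (h : H.ends e = s(x, y)) (hne : x ≠ y) : Pth H x y ∅ {e} :=
  ⟨[], [e], .cons he h (.nil (H.ends_mem e he y (by simp [h]))), by simpa using hne, rfl, rfl⟩

theorem Pth.cons (he : e ∈ H.E) (h : H.ends e = s(x, y)) (hne : x ≠ y) (hxz : x ≠ z) (hp : Pth H y z I D)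
    (hx : x ∉ I) : Pth H x z (insert y I) (insert e D) := by
  obtain ⟨t, es, h1, h2, rfl, rfl⟩ := hp
  refine ⟨y :: t, e :: es, .cons he h h1, ?_, by simp, by simp⟩
  rw [List.cons_append, List.nodup_cons]
  exact ⟨by simpa [hne, hxz] using hx, h2⟩

theorem Pth.symm (h : Pth H x y I D) : Pth H y x I D := by
  obtain ⟨t, es, h1, h2, rfl, rfl⟩ := h
  have he : (x :: (t ++ [y])).reverse = y :: (t.reverse ++ [x]) := by simp
  refine ⟨t.reverse, es.reverse, ?_, ?_, by simp, by simp⟩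
  · rw [← he]; exact Bdl.swap_walk h1
  · rw [← he]; exact List.nodup_reverse.2 h2

theorem Pth.nonempty (h : Pth H x y I D) : D.Nonempty := by
  obtain ⟨t, es, h1, h2, rfl, rfl⟩ := h
  cases t with
  | nil => cases h1; simp
  | cons a t => cases h1; simp

theorem Pth.bdl (h : Pth H x y I D) : Bdl H x y I D := by
  have hne := h.nonempty
  obtain ⟨t, es, h1, h2, rfl, rfl⟩ := h
  refine ⟨{(x :: (t ++ [y]), es)}, by simp, ?_, ?_, ?_, by simp⟩
  · intro p hp
    rw [Finset.mem_singleton.1 hp]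
    refine ⟨⟨h1, h2, by simp, ?_⟩, by simpa using hne⟩
    rw [← List.cons_append, List.getLast?_append]
    simp
  · intro p hp q hq hpq
    rw [Finset.mem_singleton.1 hp, Finset.mem_singleton.1 hq] at hpq
    exact absurd rfl hpq
  · simp [pathInternals]

/-- A bundle: a non-empty set of internally disjoint paths between distinct vertices of `H`. -/
structure Bn (H : MGraph) (x y : ℕ) (I D : Finset ℕ) : Prop where
  bdl : Bdl H x y I D
  ne : x ≠ y ∧ x ∉ I ∧ y ∉ I
  mem : x ∈ H.V ∧ y ∈ H.V

theorem Pth.bn (h : Pth H x y I D) : Bn H x y I D := ⟨h.bdl, h.ne, h.sub.1, h.sub.2.1⟩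

theorem Bn.insert_pth (h : Bn H x y I D) (hp : Pth H x y I' D') (hI : Disjoint I I') (hD : Disjoint D D') :
    Bn H x y (I ∪ I') (D ∪ D') := by
  obtain ⟨⟨Bs, hne, hpath, hdisj, rfl, rfl⟩, ⟨hxy, hx, hy⟩, hm⟩ := h
  obtain ⟨⟨Cs, hne', hpath', hdisj', rfl, rfl⟩, ⟨-, hx', hy'⟩, -⟩ := hp.bn
  refine ⟨⟨Bs ∪ Cs, hne.mono Finset.subset_union_left, ?_, ?_, ?_, ?_⟩, ⟨hxy, ?_, ?_⟩, hm⟩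
  · intro p hp
    rcases Finset.mem_union.1 hp with hp | hp
    exacts [hpath p hp, hpath' p hp]
  · have key : ∀ p ∈ Bs, ∀ q ∈ Cs, (∀ w ∈ pathInternals p, w ∉ pathInternals q) ∧ ∀ g ∈ p.2, g ∉ q.2 := by
      intro p hp q hq
      rw [Finset.disjoint_left] at hI hD
      refine ⟨fun w hw hw' => hI (a := w) ?_ ?_, fun w hw hw' => hD (a := w) ?_ ?_⟩
      · exact Finset.mem_biUnion.2 ⟨p, hp, by simpa using hw⟩
      · exact Finset.mem_biUnion.2 ⟨q, hq, by simpa using hw'⟩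
      · exact Finset.mem_biUnion.2 ⟨p, hp, by simpa using hw⟩
      · exact Finset.mem_biUnion.2 ⟨q, hq, by simpa using hw'⟩
    intro p hp q hq hpq
    rcases Finset.mem_union.1 hp with hp | hp <;> rcases Finset.mem_union.1 hq with hq | hq
    · exact hdisj p hp q hq hpq
    · exact key p hp q hq
    · exact ⟨fun w hw hw' => (key q hq p hp).1 w hw' hw, fun w hw hw' => (key q hq p hp).2 w hw' hw⟩
    · exact hdisj' p hp q hq hpq
  · rw [Finset.union_biUnion]
  · rw [Finset.union_biUnion]
  · simp only [Finset.mem_union, not_or]; exact ⟨hx, hx'⟩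
  · simp only [Finset.mem_union, not_or]; exact ⟨hy, hy'⟩

/-- A partial chain of `m` labels realised in `H`, using the vertices `I` and the edges `D`, whose
free basepoint has ends `x` and `y`. -/
def Lad (H : MGraph) (m : ℕ) (I D : Finset ℕ) (x y : ℕ) : Prop :=
  ∃ B P, Base m B x y ∧ Emb H B P ∧ usedV B P = I ∧ usedE B P = D

theorem subset_usedV {P : ℕ → Finset (List ℕ × List ℕ)} : B.V ⊆ usedV B P := Finset.subset_union_left

theorem Lad.swap (h : Lad H m I D x y) : Lad H m I D y x := by
  obtain ⟨B, P, hB, h⟩ := h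
  exact ⟨B, P, hB.swap, h⟩

theorem Lad.init (h : Bn H x y I D) : Lad H 0 ({x, y} ∪ I) D x y := by
  obtain ⟨hx, hy⟩ := h.mem
  obtain ⟨hne, hxI, hyI⟩ := h.ne
  let B : MGraph := ⟨{x, y}, ∅, fun _ => s(x, y), by simp⟩
  have hE : Emb H B (fun _ => ∅) :=
    ⟨by intro z; simp only [B, Finset.mem_insert, Finset.mem_singleton]; rintro (rfl | rfl) <;> assumption,
      by simp [Loopless, B], by simp [B], by simp [B], by simp [B]⟩
  have hU : usedV B (fun _ => ∅) = {x, y} := by simp [usedV, B]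
  have hU' : usedE B (fun _ => ∅) = ∅ := by simp [usedE, B]
  obtain ⟨P', h1, h2, h3⟩ := hE.add (c := 0) (by simp [B]) hne hx hy (by simp [B]) (by simp [B]) h.bdl
    hxI hyI (by rw [hU]; simp [hxI, hyI]) (by rw [hU']; simp)
  refine ⟨addE B x y 0, P', ⟨hne, .inl ⟨rfl, 0, by simp [addE, B], by simp [addE, B], by simp [addE]⟩⟩, h1, ?_, ?_⟩
  · rw [h2, hU]; simp
  · rw [h3, hU']; simp

theorem Lad.rung (h : Lad H m I D x y) (hp : Pth H x y I' D') (hI : Disjoint I I') (hD : Disjoint D D') :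
    Lad H (m + 1) (I ∪ I') (D ∪ D') x y := by
  obtain ⟨B, P, hB, hE, rfl, rfl⟩ := h
  obtain ⟨c, hc, hB'⟩ := hB.rung
  obtain ⟨P', h1, h2, h3⟩ := hE.add hc hp.ne.1 hp.sub.1 hp.sub.2.1 (fun _ => hB.mem.1) (fun _ => hB.mem.2)
    hp.bdl hp.ne.2.1 hp.ne.2.2 hI hD
  refine ⟨_, P', hB', h1, ?_, h3⟩
  rw [h2]
  congr 1
  rw [Finset.union_eq_left]
  intro z; simp only [Finset.mem_insert, Finset.mem_singleton]
  rintro (rfl | rfl)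
  exacts [subset_usedV hB.mem.1, subset_usedV hB.mem.2]

theorem Lad.slide (h : Lad H m I D x y) (hx' : x' ∉ I) (hp : Bn H x x' I' D') (hI : Disjoint I I')
    (hD : Disjoint D D') : Lad H (m + 1) (insert x' (I ∪ I')) (D ∪ D') x' y := by
  obtain ⟨B, P, hB, hE, rfl, rfl⟩ := h
  obtain ⟨c, hc, hB'⟩ := hB.slide (fun h => hx' (subset_usedV h))
  obtain ⟨P', h1, h2, h3⟩ := hE.add hc hp.ne.1 hp.mem.1 hp.mem.2 (fun _ => hB.mem.1)
    (fun h => absurd h hx') hp.bdl hp.ne.2.1 hp.ne.2.2 hI hD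
  refine ⟨_, P', hB', h1, ?_, h3⟩
  rw [h2]
  have := subset_usedV (P := P) hB.mem.1
  ext z
  simp only [Finset.mem_union, Finset.mem_insert, Finset.mem_singleton]
  constructor
  · rintro ((h | rfl | h) | h) <;> simp [*]
  · rintro (h | h | h) <;> simp [*]

theorem Lad.k4 {I₁ I₂ I₃ I₄ D₁ D₂ D₃ D₄ : Finset ℕ} (h : Lad H m I D x y) (hx' : x' ∉ I) (hy' : y' ∉ I)
    (hp₁ : Pth H x x' I₁ D₁) (hp₂ : Pth H y y' I₂ D₂) (hp₃ : Pth H x y' I₃ D₃) (hp₄ : Pth H x' y I₄ D₄)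
    (hxy' : x' ≠ y') (hy₁ : y' ∉ I₁) (hx₂ : x' ∉ I₂) (hx₃ : x' ∉ I₃) (hy₄ : y' ∉ I₄)
    (hI₁ : Disjoint I I₁) (hI₂ : Disjoint (I ∪ I₁) I₂) (hI₃ : Disjoint (I ∪ I₁ ∪ I₂) I₃)
    (hI₄ : Disjoint (I ∪ I₁ ∪ I₂ ∪ I₃) I₄)
    (hD₁ : Disjoint D D₁) (hD₂ : Disjoint (D ∪ D₁) D₂) (hD₃ : Disjoint (D ∪ D₁ ∪ D₂) D₃)
    (hD₄ : Disjoint (D ∪ D₁ ∪ D₂ ∪ D₃) D₄) :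
    Lad H (m + 1) (insert x' (insert y' (I ∪ I₁ ∪ I₂ ∪ I₃ ∪ I₄))) (D ∪ D₁ ∪ D₂ ∪ D₃ ∪ D₄) x' y' := by
  obtain ⟨B, P, hB, hE, rfl, rfl⟩ := h
  obtain ⟨c, hc, hB'⟩ := hB.k4 (fun h => hx' (subset_usedV h)) (fun h => hy' (subset_usedV h)) hxy'
  have hcB : ∀ k, c + k ∉ B.E := fun k hk => by have := hc _ hk; omega
  have hxB := hB.mem.1
  have hyB := hB.mem.2
  have hxU := subset_usedV (P := P) hxB
  have hyU := subset_usedV (P := P) hyB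
  obtain ⟨P₁, a₁, b₁, c₁⟩ := hE.add (hcB 0) hp₁.ne.1 hp₁.sub.1 hp₁.sub.2.1 (fun _ => hB.mem.1)
    (fun h => absurd h hx') hp₁.bdl hp₁.ne.2.1 hp₁.ne.2.2 hI₁ hD₁
  rw [add_zero] at a₁ b₁ c₁
  have e₁ : usedV (addE B x x' c) P₁ = insert x' (usedV B P ∪ I₁) := by
    rw [b₁]
    ext z
    simp only [Finset.mem_union, Finset.mem_insert, Finset.mem_singleton]
    constructor
    · rintro ((h | rfl | h) | h) <;> simp [*]
    · rintro (h | h | h) <;> simp [*]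
  obtain ⟨P₂, a₂, b₂, c₂⟩ := a₁.add (c := c + 1) (by simpa [addE] using hcB 1) hp₂.ne.1 hp₂.sub.1 hp₂.sub.2.1
    (fun _ => by simp [addE, hyB])
    (fun h => by rw [e₁] at h; simp [hxy'.symm, hy', hy₁] at h) hp₂.bdl hp₂.ne.2.1 hp₂.ne.2.2
    (by rw [e₁, Finset.disjoint_insert_left]; exact ⟨hx₂, hI₂⟩) (by rw [c₁]; exact hD₂)
  have e₂ : usedV (addE (addE B x x' c) y y' (c + 1)) P₂ = insert x' (insert y' (usedV B P ∪ I₁ ∪ I₂)) := by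
    rw [b₂, e₁]
    ext z
    simp only [Finset.mem_union, Finset.mem_insert, Finset.mem_singleton]
    constructor
    · rintro (((h | h | h) | rfl | h) | h) <;> simp [*]
    · rintro (h | h | (h | h) | h) <;> simp [*]
  obtain ⟨P₃, a₃, b₃, c₃⟩ := a₂.add (c := c + 2) (by simpa [addE] using hcB 2) hp₃.ne.1 hp₃.sub.1 hp₃.sub.2.1
    (fun _ => by simp [addE, hxB]) (fun _ => by simp [addE]) hp₃.bdl hp₃.ne.2.1 hp₃.ne.2.2
    (by rw [e₂, Finset.disjoint_insert_left, Finset.disjoint_insert_left]; exact ⟨hx₃, hp₃.ne.2.2, hI₃⟩)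
    (by rw [c₂, c₁]; exact hD₃)
  have e₃ : usedV (addE (addE (addE B x x' c) y y' (c + 1)) x y' (c + 2)) P₃ =
      insert x' (insert y' (usedV B P ∪ I₁ ∪ I₂ ∪ I₃)) := by
    rw [b₃, e₂]
    ext z
    simp only [Finset.mem_union, Finset.mem_insert, Finset.mem_singleton]
    constructor
    · rintro (((h | h | (h | h) | h) | rfl | h) | h) <;> simp [*]
    · rintro (h | h | ((h | h) | h) | h) <;> simp [*]
  obtain ⟨P₄, a₄, b₄, c₄⟩ := a₃.add (c := c + 3) (by simpa [addE] using hcB 3) hp₄.ne.1 hp₄.sub.1 hp₄.sub.2.1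
    (fun _ => by simp [addE]) (fun _ => by simp [addE, hyB]) hp₄.bdl hp₄.ne.2.1 hp₄.ne.2.2
    (by rw [e₃, Finset.disjoint_insert_left, Finset.disjoint_insert_left]; exact ⟨hp₄.ne.2.1, hy₄, hI₄⟩)
    (by rw [c₃, c₂, c₁]; exact hD₄)
  refine ⟨_, P₄, hB', a₄, ?_, by rw [c₄, c₃, c₂, c₁]⟩
  rw [b₄, e₃]
  ext z
  simp only [Finset.mem_union, Finset.mem_insert, Finset.mem_singleton]
  constructor
  · rintro (((h | h | ((h | h) | h) | h) | rfl | rfl) | h) <;> simp [*]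
  · rintro (h | h | (((h | h) | h) | h) | h) <;> simp [*]

theorem Lad.finish {r : ℕ} (h : Lad H m I D x y) (hm : 1 ≤ m) (hp : Bn H x y I' D') (hI : Disjoint I I')
    (hD : Disjoint D D') (hV : I ∪ I' = H.V) (hE' : D ∪ D' = H.E) (hr : r ≤ m) : Good r H := by
  obtain ⟨B, P, hB, hE, rfl, rfl⟩ := h
  have hxB := hB.mem.1
  have hyB := hB.mem.2
  obtain ⟨hne, ⟨h0, -⟩ | ⟨-, L, parts, bp, b, N, hC, hBV, hBE, hBe⟩⟩ := hB
  · omega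
  have hb : b ∉ B.E := by simp [hBE]
  obtain ⟨P', h1, h2, h3⟩ := hE.add hb hp.ne.1 hp.mem.1 hp.mem.2 (fun _ => hxB)
    (fun _ => hyB) hp.bdl hp.ne.2.1 hp.ne.2.2 hI hD
  have hxy : usedV B P ∪ {x, y} = usedV B P := by
    rw [Finset.union_eq_left]
    intro z; simp only [Finset.mem_insert, Finset.mem_singleton]
    rintro (rfl | rfl)
    exacts [subset_usedV hxB, subset_usedV hyB]
  have hLV : L.V = (addE B x y b).V := by
    simp [addE, ← hBV, hxB, hyB]
  have hLE : L.E = (addE B x y b).E := by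
    simp [addE, hBE, hC.mem]
  have hEm : Emb H L P' := h1.congr hLV hLE (by
    intro e he
    simp only [addE, Finset.mem_insert] at he ⊢
    by_cases heb : e = b
    · simp [heb, hC.ends]
    · rw [if_neg heb, hBe e (he.resolve_left heb)])
  have hPPE : IsPPE H L := hEm.isPPE
    (by have : usedV L P' = usedV (addE B x y b) P' := by simp [usedV, hLV, hLE]
        rw [this, h2, hxy, hV])
    (by have : usedE L P' = usedE (addE B x y b) P' := by simp [usedE, hLE]
        rw [this, h3, hE'])
  refine ⟨H, L, m, parts, bp, .refl, hPPE, hr, hC.chain, fun i hi => ?_⟩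
  rcases hC.good i hi with h | h | ⟨h, h'⟩
  · exact .inl h
  · exact .inr (.inl h)
  · exact .inr (.inr ⟨h, fun h0 h1 => h' h0 (by omega)⟩)

end MGraph

end

section

namespace MGraph

variable {H : MGraph} {p pe q qe ci cj : ℕ → ℕ} {k l : ℕ} {Δ : Finset ℕ} {cI cD : ℕ → Finset ℕ}

theorem FP.ne_succ (h : FP H k p pe) {i : ℕ} (hi : i < k) : p i ≠ p (i + 1) := fun he => by
  have := h.inj i hi.le (i + 1) hi he; omega

theorem FP.pth (h : FP H k p pe) {i : ℕ} (d : ℕ) (hd : i + d + 1 ≤ k) :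
    Pth H (p i) (p (i + d + 1)) ((Finset.Ioo i (i + d + 1)).image p)
      ((Finset.Ico i (i + d + 1)).image pe) := by
  induction d generalizing i with
  | zero =>
    have h1 : Finset.Ioo i (i + 0 + 1) = ∅ := by ext; simp
    have h2 : Finset.Ico i (i + 0 + 1) = {i} := by ext; simp
    rw [h1, h2, Finset.image_empty, Finset.image_singleton]
    exact .edge (h.edge i (by omega)) (h.ends i (by omega)) (h.ne_succ (by omega))
  | succ d ih =>
    have h3 := ih (i := i + 1) (by omega)
    have e : i + 1 + d + 1 = i + (d + 1) + 1 := by omega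
    rw [e] at h3
    have h1 : Finset.Ioo i (i + (d + 1) + 1) = insert (i + 1) (Finset.Ioo (i + 1) (i + (d + 1) + 1)) := by
      ext z; simp only [Finset.mem_insert, Finset.mem_Ioo]; omega
    have h2 : Finset.Ico i (i + (d + 1) + 1) = insert i (Finset.Ico (i + 1) (i + (d + 1) + 1)) := by
      ext z; simp only [Finset.mem_insert, Finset.mem_Ico]; omega
    rw [h1, h2, Finset.image_insert, Finset.image_insert]
    refine .cons (h.edge i (by omega)) (h.ends i (by omega)) (h.ne_succ (by omega)) ?_ h3 ?_
    · intro he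
      have := h.inj _ (by omega) _ (by omega) he
      omega
    · simp only [Finset.mem_image, Finset.mem_Ioo, not_exists, not_and]
      intro j hj he
      have := h.inj _ (by omega) _ (by omega) he
      omega

theorem FP.pth' (h : FP H k p pe) {i a : ℕ} (hi : i < a) (ha : a ≤ k) :
    Pth H (p i) (p a) ((Finset.Ioo i a).image p) ((Finset.Ico i a).image pe) := by
  obtain ⟨d, rfl⟩ := Nat.exists_eq_add_of_lt hi
  exact h.pth d ha

theorem FP.pe_inj (h : FP H k p pe) {i j : ℕ} (hi : i < k) (hj : j < k) (he : pe i = pe j) : i = j := by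
  have h1 := h.ends i hi
  rw [he, h.ends j hj] at h1
  rcases Sym2.eq_iff.1 h1 with ⟨h1, -⟩ | ⟨h1, h2⟩
  · exact (h.inj _ (by omega) _ (by omega) h1).symm
  · have := h.inj _ (by omega) _ (by omega) h1
    have := h.inj _ (by omega) _ (by omega) h2
    omega

/-- Two disjoint paths `p` and `q` together with disjoint chords between them, making up the whole
of `H`. -/
structure Shape (H : MGraph) (k : ℕ) (p pe : ℕ → ℕ) (l : ℕ) (q qe : ℕ → ℕ) (Δ : Finset ℕ)
    (ci cj : ℕ → ℕ) (cI cD : ℕ → Finset ℕ) : Prop where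
  P : FP H k p pe
  Q : FP H l q qe
  disj : ∀ i ≤ k, ∀ j ≤ l, p i ≠ q j
  ci_le : ∀ g ∈ Δ, ci g ≤ k
  cj_le : ∀ g ∈ Δ, cj g ≤ l
  pth : ∀ g ∈ Δ, Pth H (p (ci g)) (q (cj g)) (cI g) (cD g)
  P_cI : ∀ g ∈ Δ, ∀ i ≤ k, p i ∉ cI g
  Q_cI : ∀ g ∈ Δ, ∀ j ≤ l, q j ∉ cI g
  pe_cD : ∀ g ∈ Δ, ∀ i < k, pe i ∉ cD g
  qe_cD : ∀ g ∈ Δ, ∀ j < l, qe j ∉ cD g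
  cI_disj : ∀ g ∈ Δ, ∀ g' ∈ Δ, g ≠ g' → Disjoint (cI g) (cI g')
  cD_disj : ∀ g ∈ Δ, ∀ g' ∈ Δ, g ≠ g' → Disjoint (cD g) (cD g')
  V : ∀ v ∈ H.V, (∃ i ≤ k, p i = v) ∨ (∃ j ≤ l, q j = v) ∨ ∃ g ∈ Δ, v ∈ cI g
  E : ∀ e ∈ H.E, (∃ i < k, pe i = e) ∨ (∃ j < l, qe j = e) ∨ ∃ g ∈ Δ, e ∈ cD g

theorem Shape.swap (h : Shape H k p pe l q qe Δ ci cj cI cD) : Shape H l q qe k p pe Δ cj ci cI cD where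
  P := h.Q
  Q := h.P
  disj := fun i hi j hj he => h.disj j hj i hi he.symm
  ci_le := h.cj_le
  cj_le := h.ci_le
  pth := fun g hg => (h.pth g hg).symm
  P_cI := h.Q_cI
  Q_cI := h.P_cI
  pe_cD := h.qe_cD
  qe_cD := h.pe_cD
  cI_disj := h.cI_disj
  cD_disj := h.cD_disj
  V := fun v hv => (h.V v hv).elim (fun h => .inr (.inl h)) fun h => h.elim .inl fun h => .inr (.inr h)
  E := fun v hv => (h.E v hv).elim (fun h => .inr (.inl h)) fun h => h.elim .inl fun h => .inr (.inr h)

theorem disjoint_image_of_ne {f g : ℕ → ℕ} {s t : Finset ℕ} (h : ∀ i ∈ s, ∀ j ∈ t, f i ≠ g j) :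
    Disjoint (s.image f) (t.image g) := by
  rw [Finset.disjoint_left]
  simp only [Finset.mem_image]
  rintro _ ⟨i, hi, rfl⟩ ⟨j, hj, he⟩
  exact h i hi j hj he.symm

theorem disjoint_image_right {f : ℕ → ℕ} {s t : Finset ℕ} (h : ∀ i ∈ t, f i ∉ s) :
    Disjoint s (t.image f) := by
  rw [Finset.disjoint_right]
  simp only [Finset.mem_image]
  rintro _ ⟨i, hi, rfl⟩
  exact h i hi

theorem Shape.pe_ne_qe (h : Shape H k p pe l q qe Δ ci cj cI cD) {i j : ℕ} (hi : i < k) (hj : j < l) :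
    pe i ≠ qe j := by
  intro he
  have h1 := h.P.ends i hi
  rw [he, h.Q.ends j hj] at h1
  rcases Sym2.eq_iff.1 h1 with ⟨h1, -⟩ | ⟨h1, -⟩
  · exact h.disj _ (by omega) _ (by omega) h1.symm
  · exact h.disj _ (by omega) _ (by omega) h1.symm

/-- The vertices on the initial segments of the two paths and on the chords in `S`. -/
def VS (p q : ℕ → ℕ) (cI : ℕ → Finset ℕ) (i j : ℕ) (S : Finset ℕ) : Finset ℕ :=
  (Finset.range (i + 1)).image p ∪ (Finset.range (j + 1)).image q ∪ S.biUnion cI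

/-- The edges on the initial segments of the two paths and on the chords in `S`. -/
def ES (pe qe : ℕ → ℕ) (cD : ℕ → Finset ℕ) (i j : ℕ) (S : Finset ℕ) : Finset ℕ :=
  (Finset.range i).image pe ∪ (Finset.range j).image qe ∪ S.biUnion cD

theorem VS_comm (i j : ℕ) (S : Finset ℕ) : VS p q cI i j S = VS q p cI j i S := by
  unfold VS; rw [Finset.union_comm (Finset.image p _)]

theorem ES_comm (i j : ℕ) (S : Finset ℕ) : ES pe qe cD i j S = ES qe pe cD j i S := by
  unfold ES; rw [Finset.union_comm (Finset.image pe _)]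


theorem Shape.VS_chord (h : Shape H k p pe l q qe Δ ci cj cI cD) {i j g : ℕ} {S : Finset ℕ}
    (hi : i ≤ k) (hj : j ≤ l) (hS : S ⊆ Δ) (hg : g ∈ Δ) (hgS : g ∉ S) : Disjoint (VS p q cI i j S) (cI g) := by
  unfold VS
  rw [Finset.disjoint_union_left, Finset.disjoint_union_left, Finset.disjoint_biUnion_left]
  refine ⟨⟨(disjoint_image_right ?_).symm, (disjoint_image_right ?_).symm⟩, ?_⟩
  · intro i' hi'; exact h.P_cI g hg i' (by simp at hi'; omega)
  · intro i' hi'; exact h.Q_cI g hg i' (by simp at hi'; omega)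
  · intro g' hg'; exact h.cI_disj _ (hS hg') _ hg (by rintro rfl; exact hgS hg')

theorem Shape.ES_chord (h : Shape H k p pe l q qe Δ ci cj cI cD) {i j g : ℕ} {S : Finset ℕ}
    (hi : i ≤ k) (hj : j ≤ l) (hS : S ⊆ Δ) (hg : g ∈ Δ) (hgS : g ∉ S) : Disjoint (ES pe qe cD i j S) (cD g) := by
  unfold ES
  rw [Finset.disjoint_union_left, Finset.disjoint_union_left, Finset.disjoint_biUnion_left]
  refine ⟨⟨(disjoint_image_right ?_).symm, (disjoint_image_right ?_).symm⟩, ?_⟩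
  · intro i' hi'; exact h.pe_cD g hg i' (by simp at hi'; omega)
  · intro i' hi'; exact h.qe_cD g hg i' (by simp at hi'; omega)
  · intro g' hg'; exact h.cD_disj _ (hS hg') _ hg (by rintro rfl; exact hgS hg')

theorem Shape.VS_P (h : Shape H k p pe l q qe Δ ci cj cI cD) {i j : ℕ} {S T : Finset ℕ}
    (hj : j ≤ l) (hS : S ⊆ Δ) (hT : ∀ a ∈ T, i < a ∧ a ≤ k) :
    Disjoint (VS p q cI i j S) (T.image p) := by
  unfold VS
  rw [Finset.disjoint_union_left, Finset.disjoint_union_left, Finset.disjoint_biUnion_left]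
  refine ⟨⟨disjoint_image_of_ne ?_, disjoint_image_of_ne ?_⟩, ?_⟩
  · intro a ha b hb he
    have := hT b hb
    have := h.P.inj a (by simp at ha; omega) b (by omega) he
    simp at ha; omega
  · intro a ha b hb he
    exact h.disj b (hT b hb).2 a (by simp at ha; omega) he.symm
  · intro g hg; exact disjoint_image_right fun a ha => h.P_cI g (hS hg) a (hT a ha).2

theorem Shape.ES_P (h : Shape H k p pe l q qe Δ ci cj cI cD) {i j : ℕ} {S T : Finset ℕ}
    (hj : j ≤ l) (hS : S ⊆ Δ) (hT : ∀ a ∈ T, i ≤ a ∧ a < k) :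
    Disjoint (ES pe qe cD i j S) (T.image pe) := by
  unfold ES
  rw [Finset.disjoint_union_left, Finset.disjoint_union_left, Finset.disjoint_biUnion_left]
  refine ⟨⟨disjoint_image_of_ne ?_, disjoint_image_of_ne ?_⟩, ?_⟩
  · intro a ha b hb he
    have := hT b hb
    have := h.P.pe_inj (by simp at ha; omega) (by omega) he
    simp at ha; omega
  · intro a ha b hb he
    exact h.pe_ne_qe (hT b hb).2 (by simp at ha; omega) he.symm
  · intro g hg; exact disjoint_image_right fun a ha => h.pe_cD g (hS hg) a (hT a ha).2

/-- A state of the building process. -/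
structure BState (H : MGraph) (k : ℕ) (p pe : ℕ → ℕ) (l : ℕ) (q qe : ℕ → ℕ) (Δ : Finset ℕ)
    (ci cj : ℕ → ℕ) (cI cD : ℕ → Finset ℕ) (gf i j : ℕ) (S : Finset ℕ) (m : ℕ) : Prop where
  i_le : i ≤ k
  j_le : j ≤ l
  S_sub : S ⊆ Δ
  gf : gf ∉ S
  ge : ∀ g ∈ Δ, g ∉ S → i ≤ ci g ∧ j ≤ cj g
  lad : Lad H m (VS p q cI i j S) (ES pe qe cD i j S) (p i) (q j)
  card : S.card ≤ 2 * m + 1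

theorem BState.swap {gf i j m : ℕ} {S : Finset ℕ} (h : BState H k p pe l q qe Δ ci cj cI cD gf i j S m) :
    BState H l q qe k p pe Δ cj ci cI cD gf j i S m where
  i_le := h.j_le
  j_le := h.i_le
  S_sub := h.S_sub
  gf := h.gf
  ge := fun g hg hgS => (h.ge g hg hgS).symm
  lad := by rw [VS_comm, ES_comm]; exact h.lad.swap
  card := h.card

theorem BState.rung (hS : Shape H k p pe l q qe Δ ci cj cI cD) {gf i j m g : ℕ} {S : Finset ℕ}
    (h : BState H k p pe l q qe Δ ci cj cI cD gf i j S m) (hg : g ∈ Δ) (hgS : g ∉ S) (hgf : g ≠ gf)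
    (hi : ci g = i) (hj : cj g = j) :
    BState H k p pe l q qe Δ ci cj cI cD gf i j (insert g S) (m + 1) where
  i_le := h.i_le
  j_le := h.j_le
  S_sub := Finset.insert_subset hg h.S_sub
  gf := by simp [hgf.symm, h.gf]
  ge := fun g hg hgS => h.ge g hg (fun h => hgS (by simp [h]))
  lad := by
    have hp := hS.pth g hg
    rw [hi, hj] at hp
    have := h.lad.rung hp (hS.VS_chord h.i_le h.j_le h.S_sub hg hgS) (hS.ES_chord h.i_le h.j_le h.S_sub hg hgS)
    convert this using 1
    · unfold VS; rw [Finset.biUnion_insert, Finset.union_comm (cI g), Finset.union_assoc _ _ (cI g)]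
    · unfold ES; rw [Finset.biUnion_insert, Finset.union_comm (cD g), Finset.union_assoc _ _ (cD g)]
  card := by rw [Finset.card_insert_of_notMem hgS]; have := h.card; omega

theorem Shape.notMem_VS (h : Shape H k p pe l q qe Δ ci cj cI cD) {i j a : ℕ} {S : Finset ℕ}
    (hj : j ≤ l) (hS : S ⊆ Δ) (ha : i < a) (hak : a ≤ k) : p a ∉ VS p q cI i j S := by
  have := h.VS_P (i := i) (T := {a}) hj hS (by simp [ha, hak])
  simpa using this

theorem BState.slide (hS : Shape H k p pe l q qe Δ ci cj cI cD) {gf i j m : ℕ} {S : Finset ℕ}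
    (h : BState H k p pe l q qe Δ ci cj cI cD gf i j S m) (hi : i < k)
    (hgt : ∀ g ∈ Δ, g ∉ S → i < ci g) :
    BState H k p pe l q qe Δ ci cj cI cD gf (i + 1) j S (m + 1) where
  i_le := hi
  j_le := h.j_le
  S_sub := h.S_sub
  gf := h.gf
  ge := fun g hg hgS => ⟨hgt g hg hgS, (h.ge g hg hgS).2⟩
  lad := by
    have := h.lad.slide (hS.notMem_VS h.j_le h.S_sub (Nat.lt_succ_self i) hi)
      (Pth.edge (hS.P.edge i hi) (hS.P.ends i hi) (hS.P.ne_succ hi)).bn (by simp)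
      (by simpa using hS.ES_P (T := {i}) h.j_le h.S_sub (by simp [hi]))
    convert this using 1
    · unfold VS; rw [Finset.range_add_one (n := i + 1), Finset.image_insert]; simp
    · unfold ES; rw [Finset.range_add_one (n := i), Finset.image_insert]
      ext z; simp only [Finset.mem_union, Finset.mem_insert, Finset.mem_singleton]; tauto
  card := by have := h.card; omega

theorem BState.k4 (hS : Shape H k p pe l q qe Δ ci cj cI cD) {gf i j m g g' : ℕ} {S : Finset ℕ}
    (h : BState H k p pe l q qe Δ ci cj cI cD gf i j S m) (hg : g ∈ Δ) (hgS : g ∉ S) (hgf : g ≠ gf)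
    (hg' : g' ∈ Δ) (hgS' : g' ∉ S) (hgf' : g' ≠ gf) (hi : ci g = i) (hj : j < cj g) (hi' : i < ci g')
    (hj' : cj g' = j)
    (hge : ∀ g₁ ∈ Δ, g₁ ∉ S → g₁ ≠ g → g₁ ≠ g' → ci g' ≤ ci g₁ ∧ cj g ≤ cj g₁) :
    BState H k p pe l q qe Δ ci cj cI cD gf (ci g') (cj g) (insert g (insert g' S)) (m + 1) where
  i_le := hS.ci_le _ hg'
  j_le := hS.cj_le _ hg
  S_sub := Finset.insert_subset hg (Finset.insert_subset hg' h.S_sub)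
  gf := by simp [hgf.symm, hgf'.symm, h.gf]
  ge := fun g₁ hg₁ hgS₁ => by
    simp only [Finset.mem_insert, not_or] at hgS₁
    exact hge g₁ hg₁ hgS₁.2.2 hgS₁.1 hgS₁.2.1
  lad := by
    have hgg' : g ≠ g' := by rintro rfl; omega
    have hp := hS.pth g hg
    have hp' := hS.pth g' hg'
    rw [hi] at hp
    rw [hj'] at hp'
    have hak := hS.ci_le _ hg'
    have hbl := hS.cj_le _ hg
    set a := ci g'
    set b := cj g
    have hP : ∀ x ∈ Finset.Ioo i a, i < x ∧ x ≤ k := by intro x hx; simp at hx; omega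
    have hQ : ∀ x ∈ Finset.Ioo j b, j < x ∧ x ≤ l := by intro x hx; simp at hx; omega
    have hP' : ∀ x ∈ Finset.Ico i a, i ≤ x ∧ x < k := by intro x hx; simp at hx; omega
    have hQ' : ∀ x ∈ Finset.Ico j b, j ≤ x ∧ x < l := by intro x hx; simp at hx; omega
    have hw := hS.swap
    have d1 := hS.VS_P h.j_le h.S_sub hP
    have d2 := hw.VS_P h.i_le h.S_sub hQ
    rw [VS_comm] at d2
    have d3 := hS.VS_chord h.i_le h.j_le h.S_sub hg hgS
    have d4 := hS.VS_chord h.i_le h.j_le h.S_sub hg' hgS'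
    have f1 := hS.ES_P h.j_le h.S_sub hP'
    have f2 := hw.ES_P h.i_le h.S_sub hQ'
    rw [ES_comm] at f2
    have f3 := hS.ES_chord h.i_le h.j_le h.S_sub hg hgS
    have f4 := hS.ES_chord h.i_le h.j_le h.S_sub hg' hgS'
    have := h.lad.k4 (hS.notMem_VS h.j_le h.S_sub hi' hak)
      (by rw [VS_comm]; exact hw.notMem_VS h.i_le h.S_sub hj hbl)
      (hS.P.pth' hi' hak) (hS.Q.pth' hj hbl) hp hp' (hS.disj _ hak _ hbl)
      (by simp only [Finset.mem_image, not_exists, not_and]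
          exact fun x hx he => hS.disj x (hP x hx).2 _ hbl he)
      (by simp only [Finset.mem_image, not_exists, not_and]
          exact fun x hx he => hS.disj _ hak x (hQ x hx).2 he.symm)
      (hS.P_cI g hg _ hak) (hS.Q_cI g' hg' _ hbl) d1
      (by
        rw [Finset.disjoint_union_left]
        exact ⟨d2, disjoint_image_of_ne fun x hx y hy => hS.disj x (hP x hx).2 y (hQ y hy).2⟩)
      (by
        rw [Finset.disjoint_union_left, Finset.disjoint_union_left]
        exact ⟨⟨d3, (disjoint_image_right fun x hx => hS.P_cI g hg x (hP x hx).2).symm⟩,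
          (disjoint_image_right fun x hx => hS.Q_cI g hg x (hQ x hx).2).symm⟩)
      (by
        rw [Finset.disjoint_union_left, Finset.disjoint_union_left, Finset.disjoint_union_left]
        exact ⟨⟨⟨d4, (disjoint_image_right fun x hx => hS.P_cI g' hg' x (hP x hx).2).symm⟩,
          (disjoint_image_right fun x hx => hS.Q_cI g' hg' x (hQ x hx).2).symm⟩,
          hS.cI_disj g hg g' hg' hgg'⟩)
      f1
      (by
        rw [Finset.disjoint_union_left]
        exact ⟨f2, disjoint_image_of_ne fun x hx y hy => hS.pe_ne_qe (hP' x hx).2 (hQ' y hy).2⟩)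
      (by
        rw [Finset.disjoint_union_left, Finset.disjoint_union_left]
        exact ⟨⟨f3, (disjoint_image_right fun x hx => hS.pe_cD g hg x (hP' x hx).2).symm⟩,
          (disjoint_image_right fun x hx => hS.qe_cD g hg x (hQ' x hx).2).symm⟩)
      (by
        rw [Finset.disjoint_union_left, Finset.disjoint_union_left, Finset.disjoint_union_left]
        exact ⟨⟨⟨f4, (disjoint_image_right fun x hx => hS.pe_cD g' hg' x (hP' x hx).2).symm⟩,
          (disjoint_image_right fun x hx => hS.qe_cD g' hg' x (hQ' x hx).2).symm⟩,
          hS.cD_disj g hg g' hg' hgg'⟩)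
    have r1 : Finset.range (a + 1) = insert a (Finset.range (i + 1) ∪ Finset.Ioo i a) := by
      ext; simp; omega
    have r2 : Finset.range (b + 1) = insert b (Finset.range (j + 1) ∪ Finset.Ioo j b) := by
      ext; simp; omega
    have r3 : Finset.range a = Finset.range i ∪ Finset.Ico i a := by ext; simp; omega
    have r4 : Finset.range b = Finset.range j ∪ Finset.Ico j b := by ext; simp; omega
    convert this using 1
    · unfold VS
      rw [r1, r2, Finset.image_insert, Finset.image_insert, Finset.image_union, Finset.image_union,
        Finset.biUnion_insert, Finset.biUnion_insert]
      ext z; simp only [Finset.mem_union, Finset.mem_insert]; tauto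
    · unfold ES
      rw [r3, r4, Finset.image_union, Finset.image_union, Finset.biUnion_insert, Finset.biUnion_insert]
      ext z; simp only [Finset.mem_union]; tauto
  card := by
    have := h.card
    have := Finset.card_insert_le g (insert g' S)
    have := Finset.card_insert_le g' S
    omega

end MGraph

end

section

namespace MGraph

variable {H : MGraph} {p pe q qe ci cj : ℕ → ℕ} {k l : ℕ} {Δ : Finset ℕ} {cI cD : ℕ → Finset ℕ}

/-- No two chords cross a third one in the same direction. -/
def NoTriple (Δ : Finset ℕ) (ci cj : ℕ → ℕ) : Prop :=
  ∀ g₁ ∈ Δ, ∀ g₂ ∈ Δ, ∀ g₃ ∈ Δ, g₁ ≠ g₂ → ci g₃ < ci g₁ → ci g₃ < ci g₂ → cj g₁ < cj g₃ → cj g₂ < cj g₃ → False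

theorem BState.exists_k4 {gf i j m g g' : ℕ} {S : Finset ℕ}
    (h : BState H k p pe l q qe Δ ci cj cI cD gf i j S m)
    (hJ : NoTriple Δ ci cj) (hJ' : NoTriple Δ cj ci)
    (hfi : ci gf = k) (hfj : cj gf = l)
    (hno : ∀ g ∈ Δ, g ∉ S → g ≠ gf → ci g = i → cj g = j → False)
    (hg : g ∈ Δ) (hg' : g' ∈ Δ) (hi : ci g = i) (hj : j < cj g) (hi' : i < ci g')
    (hj' : cj g' = j) (hil : i < k) :
    ∀ g₁ ∈ Δ, g₁ ∉ S → g₁ ≠ g → g₁ ≠ g' → ci g' ≤ ci g₁ ∧ cj g ≤ cj g₁ := by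
  intro g₁ hg₁ hgS₁ hne hne'
  obtain ⟨h1, h2⟩ := h.ge g₁ hg₁ hgS₁
  have hnf : ¬ (ci g₁ = i ∧ cj g₁ = j) := fun ⟨a, b⟩ => by
    refine hno g₁ hg₁ hgS₁ ?_ a b
    rintro rfl; omega
  constructor
  · by_contra hlt
    rcases Nat.lt_or_ge j (cj g₁) with h3 | h3
    · exact hJ' g₁ hg₁ g hg g' hg' hne (by omega) (by omega) (by omega) (by omega)
    · exact hJ g₁ hg₁ g' hg' g hg hne' (by omega) (by omega) (by omega) (by omega)
  · by_contra hlt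
    rcases Nat.lt_or_ge i (ci g₁) with h3 | h3
    · exact hJ g₁ hg₁ g' hg' g hg hne' (by omega) (by omega) (by omega) (by omega)
    · exact hJ' g₁ hg₁ g hg g' hg' hne (by omega) (by omega) (by omega) (by omega)

theorem measure_lt {i a k j b l c c' n : ℕ} (h1 : i < a) (h2 : a ≤ k) (h3 : j < b) (h4 : b ≤ l) (h5 : c' ≤ c)
    (h6 : k - i + (l - j) + c = n) : k - a + (l - b) + c' < n := by omega

theorem Shape.good {r g0 gf : ℕ} (hS : Shape H k p pe l q qe Δ ci cj cI cD) (hr : 1 ≤ r)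
    (hJ : NoTriple Δ ci cj) (hJ' : NoTriple Δ cj ci) (hg0 : g0 ∈ Δ) (hgf : gf ∈ Δ) (hne : g0 ≠ gf)
    (h0i : ci g0 = 0) (h0j : cj g0 = 0) (hfi : ci gf = k) (hfj : cj gf = l)
    (hcard : 2 * r + 2 ≤ Δ.card ∨ l = 0 ∧ r ≤ k) : Good r H := by
  have key : ∀ n i j S m, (k - i) + (l - j) + (Δ \ S).card = n →
      BState H k p pe l q qe Δ ci cj cI cD gf i j S m → (l = 0 → i ≤ m) → Good r H := by
    intro n
    induction n using Nat.strong_induction_on with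
    | _ n ih =>
    intro i j S m hn h hm
    have hii := h.i_le
    have hjj := h.j_le
    have hgfm : gf ∈ Δ \ S := by simp [hgf, h.gf]
    by_cases hA : ∀ g ∈ Δ, g ∉ S → g ≠ gf → ci g = i → cj g = j → False
    swap
    · push Not at hA
      obtain ⟨g, hg, hgS, hgf', hi, hj, -⟩ := hA
      refine ih _ ?_ _ _ _ _ rfl (h.rung hS hg hgS hgf' hi hj) (fun h => by have := hm h; omega)
      have : (Δ \ insert g S).card < (Δ \ S).card := by
        refine Finset.card_lt_card ⟨fun z => by simp; tauto, fun h => ?_⟩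
        have := h (show g ∈ Δ \ S by simp [hg, hgS])
        simp at this
      omega
    by_cases hB : i < k ∧ ∀ g ∈ Δ, g ∉ S → i < ci g
    · exact ih _ (by omega) _ _ _ _ rfl (h.slide hS hB.1 hB.2) (fun h => by have := hm h; omega)
    by_cases hC : j < l ∧ ∀ g ∈ Δ, g ∉ S → j < cj g
    · exact ih _ (by omega) _ _ _ _ rfl (h.swap.slide hS.swap hC.1 hC.2).swap (fun h => by omega)
    have hB' : i < k → ∃ g ∈ Δ, g ∉ S ∧ ci g = i ∧ j < cj g := by
      intro hik
      push Not at hB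
      obtain ⟨g, hg, hgS, hle⟩ := hB hik
      have := h.ge g hg hgS
      refine ⟨g, hg, hgS, by omega, ?_⟩
      by_contra hlt
      exact hA g hg hgS (by rintro rfl; omega) (by omega) (by omega)
    have hC' : j < l → ∃ g ∈ Δ, g ∉ S ∧ cj g = j ∧ i < ci g := by
      intro hik
      push Not at hC
      obtain ⟨g, hg, hgS, hle⟩ := hC hik
      have := h.ge g hg hgS
      refine ⟨g, hg, hgS, by omega, ?_⟩
      by_contra hlt
      exact hA g hg hgS (by rintro rfl; omega) (by omega) (by omega)
    by_cases hD : i = k ∧ j = l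
    · obtain ⟨rfl, rfl⟩ := hD
      have hSe : Δ = insert gf S := by
        ext g
        simp only [Finset.mem_insert]
        constructor
        · intro hg
          by_contra hcon
          push Not at hcon
          have := h.ge g hg hcon.2
          exact hA g hg hcon.2 hcon.1 (by have := hS.ci_le g hg; omega) (by have := hS.cj_le g hg; omega)
        · rintro (rfl | hg)
          exacts [hgf, h.S_sub hg]
      have hp := hS.pth gf hgf
      rw [hfi, hfj] at hp
      have hc : Δ.card = S.card + 1 := by rw [hSe, Finset.card_insert_of_notMem h.gf]
      have hmr : r ≤ m := by
        rcases hcard with hc' | ⟨h1, h2⟩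
        · have := h.card; omega
        · have := hm h1; omega
      refine h.lad.finish (by omega) hp.bn (hS.VS_chord le_rfl le_rfl h.S_sub hgf h.gf)
        (hS.ES_chord le_rfl le_rfl h.S_sub hgf h.gf) ?_ ?_ hmr
      · refine Finset.Subset.antisymm ?_ ?_
        · refine Finset.union_subset (Finset.union_subset (Finset.union_subset ?_ ?_) ?_) hp.sub.2.2.1
          · intro z hz
            simp only [Finset.mem_image, Finset.mem_range] at hz
            obtain ⟨a, ha, rfl⟩ := hz
            exact hS.P.mem a (by omega)
          · intro z hz
            simp only [Finset.mem_image, Finset.mem_range] at hz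
            obtain ⟨a, ha, rfl⟩ := hz
            exact hS.Q.mem a (by omega)
          · rw [Finset.biUnion_subset]
            exact fun g hg => (hS.pth g (h.S_sub hg)).sub.2.2.1
        · intro v hv
          simp only [VS, Finset.mem_union, Finset.mem_image, Finset.mem_range, Finset.mem_biUnion]
          rcases hS.V v hv with ⟨a, ha, rfl⟩ | ⟨a, ha, rfl⟩ | ⟨g, hg, hv⟩
          · exact .inl (.inl (.inl ⟨a, by omega, rfl⟩))
          · exact .inl (.inl (.inr ⟨a, by omega, rfl⟩))
          · rw [hSe, Finset.mem_insert] at hg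
            rcases hg with rfl | hg
            · exact .inr hv
            · exact .inl (.inr ⟨g, hg, hv⟩)
      · refine Finset.Subset.antisymm ?_ ?_
        · refine Finset.union_subset (Finset.union_subset (Finset.union_subset ?_ ?_) ?_) hp.sub.2.2.2
          · intro z hz
            simp only [Finset.mem_image, Finset.mem_range] at hz
            obtain ⟨a, ha, rfl⟩ := hz
            exact hS.P.edge a (by omega)
          · intro z hz
            simp only [Finset.mem_image, Finset.mem_range] at hz
            obtain ⟨a, ha, rfl⟩ := hz
            exact hS.Q.edge a (by omega)
          · rw [Finset.biUnion_subset]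
            exact fun g hg => (hS.pth g (h.S_sub hg)).sub.2.2.2
        · intro v hv
          simp only [ES, Finset.mem_union, Finset.mem_image, Finset.mem_range, Finset.mem_biUnion]
          rcases hS.E v hv with ⟨a, ha, rfl⟩ | ⟨a, ha, rfl⟩ | ⟨g, hg, hv⟩
          · exact .inl (.inl (.inl ⟨a, by omega, rfl⟩))
          · exact .inl (.inl (.inr ⟨a, by omega, rfl⟩))
          · rw [hSe, Finset.mem_insert] at hg
            rcases hg with rfl | hg
            · exact .inr hv
            · exact .inl (.inr ⟨g, hg, hv⟩)
    · have hij : i < k ∧ j < l := by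
        by_cases hik : i < k
        · obtain ⟨g, hg, hgS, -, hlt⟩ := hB' hik
          have := hS.cj_le g hg
          omega
        · obtain ⟨g, hg, hgS, -, hlt⟩ := hC' (by omega)
          have := hS.ci_le g hg
          omega
      obtain ⟨g, hg, hgS, hi, hj⟩ := hB' hij.1
      obtain ⟨g', hg', hgS', hj', hi'⟩ := hC' hij.2
      have := h.exists_k4 hJ hJ' hfi hfj hA hg hg' hi hj hi' hj' hij.1
      refine ih _ ?_ _ _ _ _ rfl (h.k4 hS hg hgS ?_ hg' hgS' ?_ hi hj hi' hj' this) ?_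
      · have h1 : (Δ \ insert g (insert g' S)).card ≤ (Δ \ S).card :=
          Finset.card_le_card (fun z => by simp; tauto)
        exact measure_lt hi' (hS.ci_le g' hg') hj (hS.cj_le g hg) h1 hn
      · rintro rfl; omega
      · rintro rfl; omega
      · intro h; omega
  refine key _ 0 0 {g0} 0 rfl ⟨by omega, by omega, by simpa using hg0, by simpa using hne.symm,
    fun _ _ _ => ⟨by omega, by omega⟩, ?_, by simp⟩ (fun _ => le_rfl)
  have hp := hS.pth g0 hg0
  rw [h0i, h0j] at hp
  convert Lad.init hp.bn using 1
  · unfold VS; ext z; simp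
  · unfold ES; ext z; simp

end MGraph

end

section

namespace MGraph

variable {G H : MGraph} {F X Z A B P R T I D : Finset ℕ} {a b u v x y e e' g n : ℕ} {p pe : ℕ → ℕ}

theorem IsWalk.jn {vs es : List ℕ} (h : H.IsWalk vs es) (hF : ∀ e ∈ es, e ∉ F) :
    ∀ a ∈ vs, ∀ b ∈ vs, H.Jn F vs.toFinset a b := by
  induction h with
  | nil hv =>
    intro a ha b hb
    simp only [List.mem_singleton] at ha hb
    subst ha; subst hb; exact .refl
  | @cons u v e vs es he hends _ ih =>
    have ih := ih (fun e he => hF e (List.mem_cons_of_mem _ he))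
    have key : ∀ a ∈ u :: v :: vs, H.Jn F (u :: v :: vs).toFinset a v := by
      intro a ha
      rcases List.mem_cons.1 ha with rfl | ha
      · exact .step (by simp) (by simp) ⟨e, he, hF e (by simp), hends⟩
      · refine (ih a ha v (by simp)).mono subset_rfl ?_
        intro z hz
        simp only [List.mem_toFinset] at hz ⊢
        exact List.mem_cons_of_mem _ hz
    exact fun a ha b hb => (key a ha).trans (key b hb).symm

theorem Pth.first (h : Pth H x y I D) (hF : ∀ e ∈ D, e ∉ F) :
    ∃ e ∈ D, ∃ v ∈ insert y I, H.ends e = s(x, v) ∧ H.Jn F (insert y I) v y := by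
  obtain ⟨t, es, h1, h2, rfl, rfl⟩ := h
  have key : ∀ z t', t ++ [y] = z :: t' → ∃ e ∈ es.toFinset, ∃ v ∈ insert y t.toFinset,
      H.ends e = s(x, v) ∧ H.Jn F (insert y t.toFinset) v y := by
    intro z t' ht
    have hset : insert y t.toFinset = (z :: t').toFinset := by
      rw [← ht]; ext; simp
    have hy : y ∈ z :: t' := by rw [← ht]; simp
    rw [hset]
    rw [ht] at h1
    cases h1 with
    | @cons _ _ e _ es he hends hw =>
      refine ⟨e, by simp, z, by simp, hends, ?_⟩
      exact hw.jn (fun e' he' => hF e' (by simp [he'])) z (by simp) y hy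
  cases t with
  | nil => exact key y [] rfl
  | cons z t => exact key z (t ++ [y]) rfl

theorem Pth.jn (h : Pth H x y I D) (hF : ∀ e ∈ D, e ∉ F) : H.Jn F (insert x (insert y I)) x y := by
  obtain ⟨e, he, v, hv, hends, hJ⟩ := h.first hF
  refine Jn.trans (.step (by simp) (Finset.mem_insert_of_mem hv)
    ⟨e, h.sub.2.2.2 he, hF e he, hends⟩) (hJ.mono subset_rfl (Finset.subset_insert _ _))

theorem Jn.avoid (h : G.Jn ∅ A u v) (he : ∀ x ∈ A, ∀ y ∈ A, G.ends e ≠ s(x, y)) :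
    G.Jn {e} A u v := by
  induction h with
  | refl => exact .refl
  | tail _ hs ih =>
    obtain ⟨ha, hb, e', he', _, hends⟩ := hs
    refine ih.tail ⟨ha, hb, e', he', ?_, hends⟩
    rw [Finset.mem_singleton]
    rintro rfl
    exact he _ ha _ hb hends

theorem Acy.mono (h : G.Acy A) (hB : B ⊆ A) : G.Acy B := fun U hU => h U (hU.trans hB)

theorem Acy.edge (hA : G.Acy Z) (he : e ∈ G.E) (hends : G.ends e = s(u, v)) (hne : u ≠ v)
    (hu : u ∈ Z) (hv : v ∈ Z) (h : G.Jn {e} Z u v) : False := by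
  obtain ⟨U, hU, h1, h2, h3⟩ := exists_twoEC_of_edge he hends hu hv h
  have := hA U hU h3
  exact hne (Finset.card_le_one.1 this u h1 v h2)

theorem Acy.two_edges (hZ : G.Acy Z) (hAZ : A ⊆ Z) (hBZ : B ⊆ Z) (hAB : Disjoint A B)
    (hA : G.ConnS A) (hB : G.ConnS B) (he : e ∈ G.E) (he' : e' ∈ G.E) (hne : e ≠ e')
    {a' b' : ℕ} (ha : a ∈ A) (hb : b ∈ B) (ha' : a' ∈ A) (hb' : b' ∈ B)
    (h : G.ends e = s(a, b)) (h' : G.ends e' = s(a', b')) : False := by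
  have hd := Finset.disjoint_left.1 hAB
  refine hZ.edge he h (fun h => hd ha (h ▸ hb)) (hAZ ha) (hBZ hb) ?_
  have h1 : G.Jn {e} A a a' := (hA.2 a ha a' ha').avoid (by
    intro x hx y hy hxy
    rw [h] at hxy
    rcases Sym2.eq_iff.1 hxy with ⟨-, rfl⟩ | ⟨-, rfl⟩
    · exact hd hy hb
    · exact hd hx hb)
  have h2 : G.Jn {e} B b' b := (hB.2 b' hb' b hb).avoid (by
    intro x hx y hy hxy
    rw [h] at hxy
    rcases Sym2.eq_iff.1 hxy with ⟨rfl, -⟩ | ⟨rfl, -⟩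
    · exact hd ha hx
    · exact hd ha hy)
  exact (h1.mono subset_rfl hAZ).trans (Jn.trans (.step (hAZ ha') (hBZ hb')
    ⟨e', he', by simpa using hne.symm, h'⟩) (h2.mono subset_rfl hBZ))

theorem FP.image_connS (h : G.FP n p pe) : G.ConnS ((Finset.range (n + 1)).image p) := by
  refine ⟨⟨p 0, Finset.mem_image_of_mem _ (by simp)⟩, ?_⟩
  have key : ∀ u ∈ (Finset.range (n + 1)).image p, G.Jn ∅ ((Finset.range (n + 1)).image p) (p 0) u := by
    intro u hu
    obtain ⟨i, hi, rfl⟩ := Finset.mem_image.1 hu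
    rw [Finset.mem_range] at hi
    exact h.jn (Nat.zero_le i) (by omega)
      (fun j _ hj => Finset.mem_image_of_mem _ (Finset.mem_range.2 (by omega))) (by simp)
  exact fun u hu v hv => (key u hu).symm.trans (key v hv)

theorem FP.chord_free (h : G.FP n p pe) (hL : G.Loopless)
    (hA : G.Acy ((Finset.range (n + 1)).image p)) (he : e ∈ G.E) {i j : ℕ} (hi : i ≤ n) (hj : j ≤ n)
    (hends : G.ends e = s(p i, p j)) : ∃ m < n, pe m = e := by
  by_contra hc
  push Not at hc
  have hm : ∀ i, i ≤ n → p i ∈ (Finset.range (n + 1)).image p := fun i hi =>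
    Finset.mem_image_of_mem _ (Finset.mem_range.2 (by omega))
  have hne : p i ≠ p j := fun h => hL e he (by rw [hends, h]; simp)
  have key : ∀ i j, i ≤ j → j ≤ n → G.Jn {e} ((Finset.range (n + 1)).image p) (p i) (p j) :=
    fun i j hij hj => h.jn hij hj (fun a _ ha => hm a (by omega)) (fun a _ ha => by
      simpa using hc a (by omega))
  refine hA.edge he hends hne (hm i hi) (hm j hj) ?_
  rcases le_total i j with hij | hij
  · exact key i j hij hj
  · exact (key j i hij hi).symm

theorem Conn2.two_exits (hG : G.Conn2) (hT : T ⊆ G.V) (hTn : T.Nonempty) (hx : x ∈ G.V) (hxT : x ∉ T) :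
    ∃ e ∈ G.E, ∃ e' ∈ G.E, e ≠ e' ∧ (∃ a ∈ T, ∃ b, b ∉ T ∧ G.ends e = s(a, b)) ∧
      ∃ a ∈ T, ∃ b, b ∉ T ∧ G.ends e' = s(a, b) := by
  obtain ⟨t, ht⟩ := hTn
  obtain ⟨a, -, b, -, ha, hb, e, he, -, h⟩ := hG.twoEC.cut 0 (· ∈ T) (hT ht) ht hx hxT
  obtain ⟨a', -, b', -, ha', hb', e', he', hne, h'⟩ := hG.twoEC.cut e (· ∈ T) (hT ht) ht hx hxT
  exact ⟨e, he, e', he', fun h => hne (by simp [h]), ⟨a, ha, b, hb, h⟩, ⟨a', ha', b', hb', h'⟩⟩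

/-- A connected set attached to `P` and `R` by trees is a path from `P` to `R`. -/
theorem Conn2.chord (hG : G.Conn2) (hP : G.ConnS P) (hR : G.ConnS R) (hT : G.ConnS T)
    (hPV : P ⊆ G.V) (hTV : T ⊆ G.V) (hPR : Disjoint P R) (hPT : Disjoint P T)
    (hRT : Disjoint R T) (hcl : ∀ x ∈ T, ∀ y, G.Ed ∅ x y → y ∈ P ∨ y ∈ R ∨ y ∈ T)
    (h1 : G.Acy (T ∪ P)) (h2 : G.Acy (T ∪ R)) :
    ∃ g a b D, g ∈ G.E ∧ a ∈ P ∧ b ∈ R ∧ (∃ x ∈ T, G.ends g = s(a, x)) ∧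
      (∀ e ∈ G.E, ∀ c ∈ P, ∀ x ∈ T, G.ends e = s(c, x) → e = g) ∧ Pth G a b T D ∧
      ∀ e, e ∈ D ↔ e ∈ G.E ∧ ∃ v ∈ G.ends e, v ∈ T := by
  have dPT := Finset.disjoint_left.1 hPT
  have dRT := Finset.disjoint_left.1 hRT
  have dPR := Finset.disjoint_left.1 hPR
  have uniq : ∀ S, Disjoint S T → G.ConnS S → G.Acy (T ∪ S) → ∀ e ∈ G.E, ∀ e' ∈ G.E,
      ∀ a ∈ T, ∀ b ∈ S, ∀ a' ∈ T, ∀ b' ∈ S, G.ends e = s(a, b) → G.ends e' = s(a', b') → e = e' := by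
    intro S hST hS hA e he e' he' a ha b hb a' ha' b' hb' h h'
    by_contra hne
    exact hA.two_edges Finset.subset_union_left Finset.subset_union_right hST.symm hT hS he he' hne
      ha hb ha' hb' h h'
  obtain ⟨p0, hp0⟩ := hP.1
  obtain ⟨g, hg, g', hg', a, ha, b, hb, x, hx, y, hy, hag, hbg'⟩ : ∃ g ∈ G.E, ∃ g' ∈ G.E, ∃ a ∈ P,
      ∃ b ∈ R, ∃ x ∈ T, ∃ y ∈ T, G.ends g = s(x, a) ∧ G.ends g' = s(y, b) := by
    obtain ⟨e, he, e', he', hne, ⟨a, ha, b, hb, h⟩, a', ha', b', hb', h'⟩ :=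
      hG.two_exits hTV hT.1 (hPV hp0) (dPT hp0)
    have hb2 : b ∈ P ∨ b ∈ R := by
      rcases hcl a ha b (ed_of_edge he h) with h | h | h
      exacts [.inl h, .inr h, absurd h hb]
    have hb2' : b' ∈ P ∨ b' ∈ R := by
      rcases hcl a' ha' b' (ed_of_edge he' h') with h | h | h
      exacts [.inl h, .inr h, absurd h hb']
    rcases hb2 with hb2 | hb2 <;> rcases hb2' with hb2' | hb2'
    · exact absurd (uniq P hPT hP h1 e he e' he' a ha b hb2 a' ha' b' hb2' h h') hne
    · exact ⟨e, he, e', he', b, hb2, b', hb2', a, ha, a', ha', h, h'⟩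
    · exact ⟨e', he', e, he, b', hb2', b, hb2, a', ha', a, ha, h', h⟩
    · exact absurd (uniq R hRT hR h2 e he e' he' a ha b hb2 a' ha' b' hb2' h h') hne
  have hgu : ∀ e ∈ G.E, ∀ c ∈ P, ∀ x ∈ T, G.ends e = s(c, x) → e = g := fun e he c hc z hz h =>
    uniq P hPT hP h1 e he g hg z hz c hc x hx a ha (by rw [h, Sym2.eq_swap]) hag
  have hgu' : ∀ e ∈ G.E, ∀ c ∈ R, ∀ x ∈ T, G.ends e = s(c, x) → e = g' := fun e he c hc z hz h =>
    uniq R hRT hR h2 e he g' hg' z hz c hc y hy b hb (by rw [h, Sym2.eq_swap]) hbg'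
  obtain ⟨n, p, pe, hp, hp0, hpn, hpT, -⟩ := (hT.2 x hx y hy).exists_fp hx hTV
  set Q := (Finset.range (n + 1)).image p with hQ
  have hQm : ∀ i ≤ n, p i ∈ Q := fun i hi => Finset.mem_image_of_mem _ (Finset.mem_range.2 (by omega))
  have hQT : Q ⊆ T := by
    intro z hz
    obtain ⟨i, hi, rfl⟩ := Finset.mem_image.1 hz
    exact hpT i (by simpa [Nat.lt_succ_iff] using hi)
  have hQc : G.ConnS Q := hp.image_connS
  have hxQ : x ∈ Q := hp0 ▸ hQm 0 (by omega)
  have hyQ : y ∈ Q := hpn ▸ hQm n le_rfl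
  have hTQ : Q = T := by
    refine Finset.Subset.antisymm hQT fun t ht => ?_
    by_contra htQ
    have ht' : t ∈ T \ Q := Finset.mem_sdiff.2 ⟨ht, htQ⟩
    have hCT : G.Cmp (T \ Q) t ⊆ T := Cmp_subset.trans Finset.sdiff_subset
    have hdis : Disjoint (G.Cmp (T \ Q) t) Q :=
      Finset.disjoint_left.2 fun z hz => (Finset.mem_sdiff.1 (Cmp_subset hz)).2
    have ex : ∀ e ∈ G.E, ∀ c ∈ G.Cmp (T \ Q) t, ∀ d, d ∉ G.Cmp (T \ Q) t → G.ends e = s(c, d) →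
        d ∈ Q := by
      intro e he c hc d hd h
      have hcQ := Finset.disjoint_left.1 hdis hc
      rcases hcl c (hCT hc) d (ed_of_edge he h) with hd' | hd' | hd'
      · have h' : G.ends e = s(d, c) := by rw [h, Sym2.eq_swap]
        have := hgu e he d hd' c (hCT hc) h'
        rw [this, hag] at h
        rcases Sym2.eq_iff.1 h with ⟨rfl, -⟩ | ⟨rfl, -⟩
        · exact absurd hxQ hcQ
        · exact absurd hx (dPT hd')
      · have h' : G.ends e = s(d, c) := by rw [h, Sym2.eq_swap]
        have := hgu' e he d hd' c (hCT hc) h'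
        rw [this, hbg'] at h
        rcases Sym2.eq_iff.1 h with ⟨rfl, -⟩ | ⟨rfl, -⟩
        · exact absurd hyQ hcQ
        · exact absurd hy (dRT hd')
      · by_contra hdQ
        exact hd (Cmp_closed hc (Finset.mem_sdiff.2 ⟨hd', hdQ⟩) (ed_of_edge he h))
    obtain ⟨e, he, e', he', hne, ⟨c, hc, d, hd, h⟩, c', hc', d', hd', h'⟩ :=
      hG.two_exits (hCT.trans hTV) ⟨t, self_mem_Cmp ht'⟩ (hTV hx)
        (fun h => Finset.disjoint_left.1 hdis h hxQ)
    exact (h1.mono Finset.subset_union_left).two_edges hCT hQT hdis (connS_Cmp ht') hQc he he' hne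
      hc (ex e he c hc d hd h) hc' (ex e' he' c' hc' d' hd' h') h h'
  have hgx : G.ends g = s(a, x) := by rw [hag, Sym2.eq_swap]
  have hgy : G.ends g' = s(b, y) := by rw [hbg', Sym2.eq_swap]
  have ne : ∀ c d, c ∉ T → d ∈ T → c ≠ d := fun c d hc hd h => hc (h ▸ hd)
  have hbx : b ≠ x := ne _ _ (dRT hb) hx
  have hby : b ≠ y := ne _ _ (dRT hb) hy
  have hax : a ≠ x := ne _ _ (dPT ha) hx
  have hab : a ≠ b := fun h => dPR ha (h ▸ hb)
  have hD : ∃ I D, Pth G x b I D ∧ insert x I = T ∧ ∀ e, e ∈ D ↔ e = g' ∨ ∃ i < n, pe i = e := by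
    rcases Nat.eq_zero_or_pos n with rfl | hn
    · have hxy : x = y := by rw [← hp0, hpn]
      refine ⟨∅, {g'}, .edge hg' (by rw [hbg', hxy]) hbx.symm, ?_, by simp⟩
      rw [← hTQ, hQ, ← hp0]; rfl
    · have h3 := hp.pth' hn le_rfl
      rw [hp0, hpn] at h3
      refine ⟨_, _, (Pth.cons hg' hgy hby hbx h3.symm ?_).symm, ?_, ?_⟩
      · intro h
        obtain ⟨i, hi, rfl⟩ := Finset.mem_image.1 h
        exact dRT hb (hpT i (Finset.mem_Ioo.1 hi).2.le)
      · rw [← hTQ]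
        ext z
        simp only [Finset.mem_insert, Finset.mem_image, Finset.mem_Ioo, hQ, Finset.mem_range]
        constructor
        · rintro (rfl | rfl | ⟨i, hi, rfl⟩)
          · exact ⟨0, by omega, hp0⟩
          · exact ⟨n, by omega, hpn⟩
          · exact ⟨i, by omega, rfl⟩
        · rintro ⟨i, hi, rfl⟩
          rcases Nat.eq_zero_or_pos i with rfl | h0
          · exact .inl hp0
          · rcases Nat.lt_succ_iff_lt_or_eq.1 hi with h | rfl
            · exact .inr (.inr ⟨i, ⟨h0, h⟩, rfl⟩)
            · exact .inr (.inl hpn)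
      · intro e
        simp
  obtain ⟨I, D, hpth, hI, hD⟩ := hD
  refine ⟨g, a, b, insert g D, hg, ha, hb, ⟨x, hx, hgx⟩, hgu, ?_, ?_⟩
  · have := Pth.cons hg hgx hax hab hpth (fun h => dPT ha (hI ▸ Finset.mem_insert_of_mem h))
    rwa [hI] at this
  · intro e
    rw [Finset.mem_insert, hD]
    constructor
    · rintro (rfl | rfl | ⟨i, hi, rfl⟩)
      · exact ⟨hg, x, by simp [hgx], hx⟩
      · exact ⟨hg', y, by simp [hgy], hy⟩
      · exact ⟨hp.edge i hi, p i, by simp [hp.ends i hi], hpT i hi.le⟩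
    · rintro ⟨he, c, hc, hcT⟩
      obtain ⟨d, hd⟩ := hc
      have hd' : G.ends e = s(d, c) := by rw [hd, Sym2.eq_swap]
      rcases hcl c hcT d (ed_of_edge he hd) with h | h | h
      · exact .inl (hgu e he d h c hcT hd')
      · exact .inr (.inl (hgu' e he d h c hcT hd'))
      · right; right
        rw [← hTQ] at hcT h
        obtain ⟨i, hi, rfl⟩ := Finset.mem_image.1 hcT
        obtain ⟨j, hj, rfl⟩ := Finset.mem_image.1 h
        rw [Finset.mem_range] at hi hj
        exact hp.chord_free hG.loopless (h1.mono (hTQ ▸ Finset.subset_union_left)) he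
          (by omega) (by omega) hd

end MGraph

end

section

namespace MGraph

variable {G H : MGraph} {X : Finset ℕ} {a b u v x y e g k l n : ℕ} {p pe q qe : ℕ → ℕ}

/-- The vertex set of the path `p 0, …, p n`. -/
def vset (p : ℕ → ℕ) (n : ℕ) : Finset ℕ := (Finset.range (n + 1)).image p

theorem mem_vset : x ∈ vset p n ↔ ∃ i ≤ n, p i = x := by
  simp [vset]

theorem vset_mem {i : ℕ} (hi : i ≤ n) : p i ∈ vset p n := mem_vset.2 ⟨i, hi, rfl⟩

theorem FP.vset_sub (h : G.FP n p pe) : vset p n ⊆ G.V := fun z hz => by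
  obtain ⟨i, hi, rfl⟩ := mem_vset.1 hz
  exact h.mem i hi

theorem FP.vset_connS (h : G.FP n p pe) : G.ConnS (vset p n) := h.image_connS

/-- The edges with exactly one end in `X`. -/
def bdry (G : MGraph) (X : Finset ℕ) : Finset ℕ :=
  G.E.filter fun e => ∃ a ∈ X, ∃ b, b ∉ X ∧ G.ends e = s(a, b)

theorem mem_bdry : e ∈ G.bdry X ↔ e ∈ G.E ∧ ∃ a ∈ X, ∃ b, b ∉ X ∧ G.ends e = s(a, b) := by
  simp [bdry]

theorem Conn2.exists_chord (hG : G.Conn2) (hP : FP G k p pe) (hQ : FP G l q qe)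
    (hd : ∀ i ≤ k, ∀ j ≤ l, p i ≠ q j) (hA1 : G.Acy (G.V \ vset p k))
    (hA2 : G.Acy (G.V \ vset q l)) (hX : X = (G.V \ vset p k) \ vset q l) (hx : x ∈ X) :
    ∃ g a b D, g ∈ G.E ∧ a ∈ vset p k ∧ b ∈ vset q l ∧ (∃ z ∈ G.Cmp X x, G.ends g = s(a, z)) ∧
      (∀ e ∈ G.E, ∀ c ∈ vset p k, ∀ z ∈ G.Cmp X x, G.ends e = s(c, z) → e = g) ∧
      Pth G a b (G.Cmp X x) D ∧ ∀ e, e ∈ D ↔ e ∈ G.E ∧ ∃ v ∈ G.ends e, v ∈ G.Cmp X x := by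
  have hT : ∀ z ∈ G.Cmp X x, z ∈ G.V ∧ z ∉ vset p k ∧ z ∉ vset q l := fun z hz => by
    have := Cmp_subset hz
    rw [hX, Finset.mem_sdiff, Finset.mem_sdiff] at this
    exact ⟨this.1.1, this.1.2, this.2⟩
  have hdis : Disjoint (vset p k) (vset q l) := Finset.disjoint_left.2 fun z hz hz' => by
    obtain ⟨i, hi, rfl⟩ := mem_vset.1 hz
    obtain ⟨j, hj, h⟩ := mem_vset.1 hz'
    exact hd i hi j hj h.symm
  refine hG.chord hP.vset_connS hQ.vset_connS (connS_Cmp hx) hP.vset_sub (fun z hz => (hT z hz).1) hdis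
    (Finset.disjoint_right.2 fun z hz => (hT z hz).2.1)
    (Finset.disjoint_right.2 fun z hz => (hT z hz).2.2) ?_ (hA2.mono ?_) (hA1.mono ?_)
  · intro z hz y hzy
    by_contra hc
    push Not at hc
    refine hc.2.2 (Cmp_closed hz ?_ hzy)
    rw [hX, Finset.mem_sdiff, Finset.mem_sdiff]
    exact ⟨⟨hzy.mem_right, hc.1⟩, hc.2.1⟩
  · exact Finset.union_subset (fun z hz => Finset.mem_sdiff.2 ⟨(hT z hz).1, (hT z hz).2.2⟩)
      fun z hz => Finset.mem_sdiff.2 ⟨hP.vset_sub hz, Finset.disjoint_left.1 hdis hz⟩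
  · exact Finset.union_subset (fun z hz => Finset.mem_sdiff.2 ⟨(hT z hz).1, (hT z hz).2.1⟩)
      fun z hz => Finset.mem_sdiff.2 ⟨hQ.vset_sub hz, Finset.disjoint_right.1 hdis hz⟩

theorem Conn2.chord_data (hG : G.Conn2) (hP : FP G k p pe) (hQ : FP G l q qe)
    (hd : ∀ i ≤ k, ∀ j ≤ l, p i ≠ q j) (hA1 : G.Acy (G.V \ vset p k))
    (hA2 : G.Acy (G.V \ vset q l)) (hX : X = (G.V \ vset p k) \ vset q l)
    (hg : g ∈ G.bdry (vset p k)) :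
    ∃ i j I D, i ≤ k ∧ j ≤ l ∧ p i ∈ G.ends g ∧ Pth G (p i) (q j) I D ∧
      (∀ x ∈ I, x ∈ X ∧ I = G.Cmp X x) ∧ (∀ e, e ∈ D ↔ e ∈ G.E ∧ (e = g ∨ ∃ v ∈ G.ends e, v ∈ I)) ∧
      (∀ e ∈ G.bdry (vset p k), (∃ v ∈ G.ends e, v ∈ I) → e = g) ∧
      (∀ v ∈ G.ends g, v ∈ X → v ∈ I) ∧ (∀ v ∈ G.ends g, v ∈ vset q l → v = q j) ∧
      (∀ x ∈ I, ∃ v ∈ G.ends g, v ∈ I) := by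
  obtain ⟨hgE, c, hc, d, hdP, hends⟩ := mem_bdry.1 hg
  have hcX : c ∉ X := fun h => by
    rw [hX] at h
    exact (Finset.mem_sdiff.1 (Finset.mem_sdiff.1 h).1).2 hc
  have hcQ : c ∉ vset q l := fun h => by
    obtain ⟨i, hi, rfl⟩ := mem_vset.1 hc
    obtain ⟨j, hj, h⟩ := mem_vset.1 h
    exact hd i hi j hj h.symm
  by_cases hdQ : d ∈ vset q l
  · obtain ⟨i, hi, rfl⟩ := mem_vset.1 hc
    obtain ⟨j, hj, rfl⟩ := mem_vset.1 hdQ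
    have hdX : q j ∉ X := fun h => by
      rw [hX] at h
      exact (Finset.mem_sdiff.1 h).2 hdQ
    refine ⟨i, j, ∅, {g}, hi, hj, by simp [hends], .edge hgE hends (hd i hi j hj), by simp, ?_, by simp,
      ?_, ?_, by simp⟩
    · intro e
      simp only [Finset.mem_singleton, Finset.notMem_empty, and_false, exists_false, or_false]
      exact ⟨fun h => ⟨h ▸ hgE, h⟩, fun h => h.2⟩
    · intro v hv hvX
      rw [hends, Sym2.mem_iff] at hv
      rcases hv with rfl | rfl
      exacts [absurd hvX hcX, absurd hvX hdX]
    · intro v hv hvQ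
      rw [hends, Sym2.mem_iff] at hv
      rcases hv with rfl | rfl
      exacts [absurd hvQ hcQ, rfl]
  · have hdX : d ∈ X := by
      rw [hX, Finset.mem_sdiff, Finset.mem_sdiff]
      exact ⟨⟨G.ends_mem g hgE d (by simp [hends]), hdP⟩, hdQ⟩
    obtain ⟨g', a, b, D, hg', ha, hb, ⟨z, hz, hgz⟩, hu, hpth, hD⟩ :=
      hG.exists_chord hP hQ hd hA1 hA2 hX hdX
    have hgg : g = g' := hu g hgE c hc d (self_mem_Cmp hdX) hends
    subst hgg
    obtain ⟨i, hi, rfl⟩ := mem_vset.1 ha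
    obtain ⟨j, hj, rfl⟩ := mem_vset.1 hb
    refine ⟨i, j, _, D, hi, hj, by simp [hgz], hpth, fun x hx => ⟨Cmp_subset hx, (Cmp_eq hx).symm⟩,
      ?_, ?_, ?_, ?_, fun x _ => ⟨z, by simp [hgz], hz⟩⟩
    · intro e
      rw [hD]
      refine and_congr_right fun _ => ⟨.inr, ?_⟩
      rintro (rfl | h)
      exacts [⟨z, by simp [hgz], hz⟩, h]
    · rintro e he ⟨v, hv, hvI⟩
      obtain ⟨heE, a', ha', b', hb', h'⟩ := mem_bdry.1 he
      rw [h', Sym2.mem_iff] at hv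
      have hvX := Cmp_subset hvI
      rcases hv with rfl | rfl
      · rw [hX] at hvX
        exact absurd ha' (Finset.mem_sdiff.1 (Finset.mem_sdiff.1 hvX).1).2
      · exact hu e heE a' ha' v hvI h'
    · intro v hv hvX
      rw [hends, Sym2.mem_iff] at hv
      rcases hv with rfl | rfl
      exacts [absurd hvX hcX, self_mem_Cmp hdX]
    · intro v hv hvQ
      rw [hends, Sym2.mem_iff] at hv
      rcases hv with rfl | rfl
      exacts [absurd hvQ hcQ, absurd hvQ hdQ]

theorem Conn2.exists_shape (hG : G.Conn2) (hP : FP G k p pe) (hQ : FP G l q qe)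
    (hd : ∀ i ≤ k, ∀ j ≤ l, p i ≠ q j) (hA1 : G.Acy (G.V \ vset p k))
    (hA2 : G.Acy (G.V \ vset q l)) :
    ∃ ci cj cI cD, Shape G k p pe l q qe (G.bdry (vset p k)) ci cj cI cD ∧
      (∀ g ∈ G.bdry (vset p k), p (ci g) ∈ G.ends g) ∧
      (∀ g ∈ G.bdry (vset p k), ∀ i ≤ k, p i ∈ G.ends g → ci g = i) ∧
      (∀ g ∈ G.bdry (vset p k), ∀ j ≤ l, q j ∈ G.ends g → cj g = j) := by
  have main := fun g => hG.chord_data (g := g) hP hQ hd hA1 hA2 rfl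
  set X := (G.V \ vset p k) \ vset q l with hX
  have hXP : ∀ x ∈ X, x ∉ vset p k := fun x hx => (Finset.mem_sdiff.1 (Finset.mem_sdiff.1 hx).1).2
  have hXQ : ∀ x ∈ X, x ∉ vset q l := fun x hx => (Finset.mem_sdiff.1 hx).2
  choose! ci cj cI cD h1 h2 h3 h4 h5 h6 h7 h8 h9 h10 using main
  have hcI : ∀ g ∈ G.bdry (vset p k), ∀ g' ∈ G.bdry (vset p k), ∀ x ∈ cI g, x ∈ cI g' → g = g' := by
    intro g hg g' hg' x hx hx'
    obtain ⟨v, hv, hvI⟩ := h10 g hg x hx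
    refine h7 g' hg' g hg ⟨v, hv, ?_⟩
    rw [(h5 g' hg' x hx').2, ← (h5 g hg x hx).2]
    exact hvI
  have hV : ∀ v ∈ X, ∃ g ∈ G.bdry (vset p k), v ∈ cI g := by
    intro v hv
    obtain ⟨g, a, b, D, hg, ha, hb, ⟨z, hz, hgz⟩, -⟩ := hG.exists_chord hP hQ hd hA1 hA2 hX hv
    have hzX := Cmp_subset hz
    have hgΔ : g ∈ G.bdry (vset p k) := mem_bdry.2 ⟨hg, a, ha, z, hXP z hzX, hgz⟩
    refine ⟨g, hgΔ, ?_⟩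
    have := h8 g hgΔ z (by simp [hgz]) hzX
    rw [(h5 g hgΔ z this).2, Cmp_eq hz]
    exact self_mem_Cmp hv
  have hpe : ∀ g ∈ G.bdry (vset p k), ∀ i < k, pe i ∉ cD g := by
    intro g hg i hi he
    obtain ⟨-, rfl | ⟨v, hv, hvI⟩⟩ := (h6 g hg _).1 he
    · obtain ⟨-, a, ha, b, hb, h⟩ := mem_bdry.1 hg
      rw [hP.ends i hi] at h
      rcases Sym2.eq_iff.1 h with ⟨-, rfl⟩ | ⟨rfl, -⟩
      exacts [hb (vset_mem hi), hb (vset_mem hi.le)]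
    · rw [hP.ends i hi, Sym2.mem_iff] at hv
      have := hXP v (h5 g hg v hvI).1
      rcases hv with rfl | rfl
      exacts [this (vset_mem hi.le), this (vset_mem hi)]
  have hqe : ∀ g ∈ G.bdry (vset p k), ∀ j < l, qe j ∉ cD g := by
    intro g hg i hi he
    obtain ⟨-, rfl | ⟨v, hv, hvI⟩⟩ := (h6 g hg _).1 he
    · have h := h3 _ hg
      rw [hQ.ends i hi, Sym2.mem_iff] at h
      rcases h with h | h
      exacts [hd _ (h1 _ hg) _ hi.le h, hd _ (h1 _ hg) _ hi h]
    · rw [hQ.ends i hi, Sym2.mem_iff] at hv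
      have := hXQ v (h5 g hg v hvI).1
      rcases hv with rfl | rfl
      exacts [this (vset_mem hi.le), this (vset_mem hi)]
  refine ⟨ci, cj, cI, cD, ⟨hP, hQ, hd, h1, h2, h4, ?_, ?_, hpe, hqe, ?_, ?_, ?_, ?_⟩, h3, ?_, ?_⟩
  · exact fun g hg i hi h => hXP _ (h5 g hg _ h).1 (vset_mem hi)
  · exact fun g hg i hi h => hXQ _ (h5 g hg _ h).1 (vset_mem hi)
  · exact fun g hg g' hg' hne => Finset.disjoint_left.2 fun x hx hx' => hne (hcI g hg g' hg' x hx hx')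
  · intro g hg g' hg' hne
    rw [Finset.disjoint_left]
    intro e he he'
    obtain ⟨heE, he⟩ := (h6 g hg e).1 he
    obtain ⟨-, he'⟩ := (h6 g' hg' e).1 he'
    rcases he with rfl | ⟨v, hv, hvI⟩
    · rcases he' with h | h
      exacts [hne h, hne (h7 g' hg' e hg h)]
    · rcases he' with rfl | ⟨w, hw, hwI⟩
      · exact hne (h7 g hg e hg' ⟨v, hv, hvI⟩).symm
      · refine hne (hcI g hg g' hg' w ?_ hwI)
        by_cases hvw : v = w
        · exact hvw ▸ hvI
        · have hends : G.ends e = s(v, w) := ((Sym2.mem_and_mem_iff hvw).1 ⟨hv, hw⟩)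
          rw [(h5 g hg v hvI).2]
          exact Cmp_closed (self_mem_Cmp (h5 g hg v hvI).1) (h5 g' hg' w hwI).1 (ed_of_edge heE hends)
  · intro v hv
    by_cases hvP : v ∈ vset p k
    · exact .inl (mem_vset.1 hvP)
    by_cases hvQ : v ∈ vset q l
    · exact .inr (.inl (mem_vset.1 hvQ))
    · exact .inr (.inr (hV v (by simp [hX, hv, hvP, hvQ])))
  · intro e he
    have hsub : vset p k ⊆ G.V \ vset q l := fun z hz => Finset.mem_sdiff.2 ⟨hP.vset_sub hz, fun hz' => by
      obtain ⟨i, hi, rfl⟩ := mem_vset.1 hz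
      obtain ⟨j, hj, h⟩ := mem_vset.1 hz'
      exact hd i hi j hj h.symm⟩
    have hsub' : vset q l ⊆ G.V \ vset p k := fun z hz => Finset.mem_sdiff.2 ⟨hQ.vset_sub hz, fun hz' =>
      (Finset.mem_sdiff.1 (hsub hz')).2 hz⟩
    obtain ⟨a, b, hends⟩ : ∃ a b, G.ends e = s(a, b) := by
      induction h : G.ends e using Sym2.ind with
      | _ a b => exact ⟨a, b, rfl⟩
    have hbd : ∀ a ∈ vset p k, ∀ b, b ∉ vset p k → G.ends e = s(a, b) →
        ∃ g ∈ G.bdry (vset p k), e ∈ cD g := by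
      intro a ha b hb h
      have he' : e ∈ G.bdry (vset p k) := mem_bdry.2 ⟨he, a, ha, b, hb, h⟩
      exact ⟨e, he', (h6 e he' e).2 ⟨he, .inl rfl⟩⟩
    have hbX : ∀ a ∈ G.ends e, a ∉ vset p k → a ∉ vset q l → ∃ g ∈ G.bdry (vset p k), e ∈ cD g := by
      intro a ha h h'
      obtain ⟨g, hg, hag⟩ := hV a (by simp [hX, G.ends_mem e he a ha, h, h'])
      exact ⟨g, hg, (h6 g hg e).2 ⟨he, .inr ⟨a, ha, hag⟩⟩⟩
    by_cases ha : a ∈ vset p k <;> by_cases hb : b ∈ vset p k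
    · obtain ⟨i, hi, rfl⟩ := mem_vset.1 ha
      obtain ⟨j, hj, rfl⟩ := mem_vset.1 hb
      exact .inl (hP.chord_free hG.loopless (hA2.mono hsub) he hi hj hends)
    · exact .inr (.inr (hbd a ha b hb hends))
    · exact .inr (.inr (hbd b hb a ha (by rw [hends, Sym2.eq_swap])))
    · by_cases ha' : a ∈ vset q l
      · by_cases hb' : b ∈ vset q l
        · obtain ⟨i, hi, rfl⟩ := mem_vset.1 ha'
          obtain ⟨j, hj, rfl⟩ := mem_vset.1 hb'
          exact .inr (.inl (hQ.chord_free hG.loopless (hA1.mono hsub') he hi hj hends))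
        · exact .inr (.inr (hbX b (by simp [hends]) hb hb'))
      · exact .inr (.inr (hbX a (by simp [hends]) ha ha'))
  · intro g hg i hi h
    obtain ⟨-, a, ha, b, hb, h'⟩ := mem_bdry.1 hg
    have key : ∀ i ≤ k, p i ∈ G.ends g → p i = a := by
      intro i hi h
      rw [h', Sym2.mem_iff] at h
      rcases h with h | h
      exacts [h, absurd (h ▸ vset_mem hi) hb]
    exact hP.inj _ (h1 g hg) _ hi ((key _ (h1 g hg) (h3 g hg)).trans (key i hi h).symm)
  · intro g hg j hj h
    exact hQ.inj _ (h2 g hg) _ hj (h9 g hg _ h (vset_mem hj)).symm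

end MGraph

end

section

namespace MGraph

variable {G H : MGraph} {A F U W X Y Z : Finset ℕ} {a b u v w x y e g k l n r t u0 : ℕ}
  {p pe q qe φ : ℕ → ℕ}

theorem filter_mapf (h0 : u0 ∈ W) (hY : Y ⊆ G.V) (hd : Disjoint W Y) :
    G.V.filter (mapf W u0 · ∈ Y) = Y := by
  have hd := Finset.disjoint_left.1 hd
  ext z
  rw [Finset.mem_filter]
  by_cases hz : z ∈ W
  · simp only [mapf, hz, if_true]
    exact ⟨fun h => absurd h.2 (hd h0), fun h => absurd h (hd hz)⟩
  · simp only [mapf, hz, if_false]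
    exact ⟨fun h => h.2, fun h => ⟨hY h, h⟩⟩

theorem filter_mapf_insert (hWV : W ⊆ G.V) (hY : Y ⊆ G.V) (hd : Disjoint W Y) (h0 : u0 ∈ W) :
    G.V.filter (mapf W u0 · ∈ insert u0 Y) = W ∪ Y := by
  have hd := Finset.disjoint_left.1 hd
  ext z
  rw [Finset.mem_filter, Finset.mem_union, Finset.mem_insert]
  by_cases hz : z ∈ W
  · simp [mapf, hz, hWV hz]
  · simp only [mapf, hz, if_false, false_or]
    exact ⟨fun h => h.2.resolve_left (fun h' => hz (h' ▸ h0)), fun h => ⟨hY h, .inr h⟩⟩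

theorem Contr.acy (h : G.Contr H φ) (hY : Y ⊆ H.V) (hA : G.Acy (G.V.filter (φ · ∈ Y))) : H.Acy Y := by
  intro U hU hUT
  have h1 := hA _ (fun z hz => by
    rw [Finset.mem_filter] at hz ⊢
    exact ⟨hz.1, hU hz.2⟩) (h.pre_twoEC (hU.trans hY) hUT)
  have h2 : U ⊆ (G.V.filter (φ · ∈ U)).image φ := by
    intro x hx
    have := hY (hU hx)
    rw [h.V, Finset.mem_image] at this
    obtain ⟨a, ha, rfl⟩ := this
    exact Finset.mem_image_of_mem _ (Finset.mem_filter.2 ⟨ha, hx⟩)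
  exact ((Finset.card_le_card h2).trans Finset.card_image_le).trans h1

theorem Contr.bdry (h : G.Contr H φ) (X : Finset ℕ) :
    H.bdry X = G.bdry (G.V.filter (φ · ∈ X)) := by
  ext e
  rw [mem_bdry, mem_bdry]
  constructor
  · rintro ⟨he, x, hx, y, hy, hxy⟩
    have heG := ((h.E e).1 he).1
    rw [h.ends e he] at hxy
    obtain ⟨a, b, hab, rfl, rfl⟩ := sym2_map_eq hxy
    refine ⟨heG, a, ?_, b, ?_, hab⟩
    · exact Finset.mem_filter.2 ⟨G.ends_mem e heG a (by simp [hab]), hx⟩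
    · exact fun hb => hy (Finset.mem_filter.1 hb).2
  · rintro ⟨he, a, ha, b, hb, hab⟩
    rw [Finset.mem_filter] at ha hb
    have hb' : φ b ∉ X := fun h => hb ⟨G.ends_mem e he b (by simp [hab]), h⟩
    have heH : e ∈ H.E := (h.E e).2 ⟨he, by
      rw [hab, Sym2.map_mk]
      exact fun hd => hb' ((Sym2.mk_isDiag_iff.1 hd) ▸ ha.2)⟩
    exact ⟨heH, φ a, ha.2, φ b, hb', by rw [h.ends e heH, hab, Sym2.map_mk]⟩

/-- Contracting a 2-edge-connected set disjoint from the connected set `A`. -/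
theorem Conn2.shrink (hG : G.Conn2) (hU : G.TwoEC U) (hUV : U ⊆ G.V) (h2 : 2 ≤ U.card)
    (hA : G.ConnS A) (hAV : A ⊆ G.V) (hd : Disjoint U A) :
    ∃ H W u0, U ⊆ W ∧ W ⊆ G.V ∧ Disjoint W A ∧ u0 ∈ W ∧ G.Contr H (mapf W u0) ∧ H.Conn2 ∧
      H.V = insert u0 (G.V \ W) ∧ H.V.card < G.V.card := by
  obtain ⟨a, ha⟩ := hA.1
  have hAU : A ⊆ G.V \ U := fun z hz =>
    Finset.mem_sdiff.2 ⟨hAV hz, fun h => Finset.disjoint_left.1 hd h hz⟩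
  have hCV : G.Cmp (G.V \ U) a ⊆ G.V := Cmp_subset.trans Finset.sdiff_subset
  have hc : G.V \ (G.V \ G.Cmp (G.V \ U) a) = G.Cmp (G.V \ U) a := by
    rw [Finset.sdiff_sdiff_eq_self hCV]
  obtain ⟨H, u0, hu0, h1, h2', h3⟩ := hG.exists_contr (twoEC_sdiff_Cmp hG.twoEC hU hUV a)
    Finset.sdiff_subset (by rw [hc]; exact connS_Cmp (hAU ha))
  have hUW : U ⊆ G.V \ G.Cmp (G.V \ U) a := fun z hz => Finset.mem_sdiff.2 ⟨hUV hz, fun h =>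
    (Finset.mem_sdiff.1 (Cmp_subset h)).2 hz⟩
  refine ⟨H, _, u0, hUW, Finset.sdiff_subset, ?_, hu0, h1, h2', h3, ?_⟩
  · exact Finset.disjoint_left.2 fun z hz hzA => (Finset.mem_sdiff.1 hz).2
      (hA.subset_Cmp hAU ha (self_mem_Cmp (hAU ha)) hzA)
  · have h4 := Finset.card_le_card hUW
    have h5 := Finset.card_sdiff_add_card_eq_card (s := G.V \ G.Cmp (G.V \ U) a) (t := G.V)
      Finset.sdiff_subset
    have h6 := Finset.card_insert_le u0 (G.V \ (G.V \ G.Cmp (G.V \ U) a))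
    rw [← h3] at h6
    omega

theorem FP.contr (h : G.FP n p pe) (hc : G.Contr H (mapf W u0)) (hd : Disjoint W (vset p n)) :
    H.FP n p pe := by
  have hid : ∀ i ≤ n, mapf W u0 (p i) = p i := fun i hi => by
    rw [mapf, if_neg (Finset.disjoint_right.1 hd (vset_mem hi))]
  have he : ∀ i < n, pe i ∈ H.E := fun i hi => (hc.E _).2 ⟨h.edge i hi, by
    rw [h.ends i hi, Sym2.map_mk, hid i hi.le, hid _ hi, Sym2.mk_isDiag_iff]
    exact h.ne_succ hi⟩
  refine ⟨he, fun i hi => ?_, h.inj, fun i hi => ?_⟩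
  · rw [hc.ends _ (he i hi), h.ends i hi, Sym2.map_mk, hid i hi.le, hid _ hi]
  · rw [hc.V, ← hid i hi]
    exact Finset.mem_image_of_mem _ (h.mem i hi)

theorem Acy.exists_of_not (h : ¬ G.Acy Z) : ∃ U ⊆ Z, G.TwoEC U ∧ 2 ≤ U.card := by
  unfold Acy at h
  push Not at h
  obtain ⟨U, h1, h2, h3⟩ := h
  exact ⟨U, h1, h2, h3⟩

/-- A long or thick fan of chords from a path to a vertex. -/
theorem Conn2.good_fan (hG : G.Conn2) (hr : 1 ≤ r) (hP : FP G k p pe) (hv : v ∈ G.V)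
    (hvP : v ∉ vset p k) (hA1 : G.Acy (G.V \ vset p k)) (hA2 : G.Acy (G.V \ {v}))
    (hcard : 2 * r + 2 ≤ (G.bdry (vset p k)).card ∨ r ≤ k) : Good r G := by
  have hQ : FP G 0 (fun _ => v) pe := ⟨by simp, by simp, by intros; omega, fun _ _ => hv⟩
  have hQs : vset (fun _ => v) 0 = {v} := by simp [vset]
  obtain ⟨ci, cj, cI, cD, hS, h1, h2, -⟩ := hG.exists_shape hP hQ
    (fun i hi j _ h => hvP (h ▸ vset_mem hi)) hA1 (by rwa [hQs])
  have hj : ∀ g ∈ G.bdry (vset p k), cj g = 0 := fun g hg => Nat.le_zero.1 (hS.cj_le g hg)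
  have corner : ∀ i ≤ k, ∀ e₀, (∀ m < k, m = i ∨ m + 1 = i → pe m = e₀) →
      ∃ g ∈ G.bdry (vset p k), g ≠ e₀ ∧ ci g = i := by
    intro i hi e₀ he₀
    obtain ⟨a, -, b, -, rfl, hb, e, he, hne, hends⟩ := hG.twoEC.cut e₀ (· = p i) (hP.mem i hi) rfl hv
      (fun h => hvP (h ▸ vset_mem hi))
    have hbP : b ∉ vset p k := by
      intro hbP
      obtain ⟨j, hj, rfl⟩ := mem_vset.1 hbP
      obtain ⟨m, hm, rfl⟩ := hP.chord_free hG.loopless (hA2.mono fun z hz => Finset.mem_sdiff.2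
        ⟨hP.vset_sub hz, fun h => hvP (Finset.mem_singleton.1 h ▸ hz)⟩) he hi hj hends
      have : p i ∈ G.ends (pe m) := by simp [hends]
      rw [hP.ends m hm, Sym2.mem_iff] at this
      have : m = i ∨ m + 1 = i := by
        rcases this with h | h
        · exact .inl (hP.inj _ hi _ hm.le h).symm
        · exact .inr (hP.inj _ hi _ hm h).symm
      exact hne (by simp [he₀ m hm this])
    have heΔ : e ∈ G.bdry (vset p k) := mem_bdry.2 ⟨he, _, vset_mem hi, b, hbP, hends⟩
    exact ⟨e, heΔ, by simpa using hne, h2 e heΔ i hi (by simp [hends])⟩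
  have hc2 : 2 * r + 2 ≤ (G.bdry (vset p k)).card ∨ 0 = 0 ∧ r ≤ k := by simpa using hcard
  have hJ : NoTriple (G.bdry (vset p k)) ci cj := by
    intro g₁ hg₁ g₂ _ g₃ hg₃ _ _ _ h
    rw [hj g₁ hg₁, hj g₃ hg₃] at h
    exact absurd h (lt_irrefl _)
  have hJ' : NoTriple (G.bdry (vset p k)) cj ci := by
    intro g₁ hg₁ g₂ _ g₃ hg₃ _ h
    rw [hj g₁ hg₁, hj g₃ hg₃] at h
    exact absurd h (lt_irrefl _)
  rcases Nat.eq_zero_or_pos k with rfl | hk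
  · obtain ⟨g0, hg0, -, h0⟩ := corner 0 le_rfl 0 (by simp)
    obtain ⟨gf, hgf, hne, hf⟩ := corner 0 le_rfl g0 (by simp)
    exact hS.good hr hJ hJ' hg0 hgf hne.symm h0 (hj _ hg0) hf (hj _ hgf) hc2
  · obtain ⟨g0, hg0, -, h0⟩ := corner 0 (by omega) (pe 0) (fun m _ hm => by
      rcases hm with rfl | hm
      · rfl
      · omega)
    obtain ⟨gf, hgf, -, hf⟩ := corner k le_rfl (pe (k - 1)) (fun m hm h => by
      rcases h with rfl | rfl
      · omega
      · rfl)
    exact hS.good hr hJ hJ' hg0 hgf (by rintro rfl; omega) h0 (hj _ hg0) hf (hj _ hgf) hc2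

theorem Conn2.connS_compl (hG : G.Conn2) (hv : v ∈ G.V) : G.ConnS (G.V \ {v}) := by
  rw [Finset.sdiff_singleton_eq_erase]; exact hG.erase v hv

theorem good_of_long_path (hr : 1 ≤ r) (hk : r ≤ k) (n : ℕ) : ∀ (G : MGraph) (v : ℕ), G.V.card = n →
    G.Conn2 → v ∈ G.V → G.Acy (G.V \ {v}) → FP G k p pe → v ∉ vset p k → Good r G := by
  induction n using Nat.strong_induction_on with
  | _ n ih =>
    rintro G v rfl hG hv hA hP hvP
    by_cases h : G.Acy (G.V \ vset p k)
    · exact hG.good_fan hr hP hv hvP h hA (.inr hk)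
    obtain ⟨U, hU, hUT, hU2⟩ := Acy.exists_of_not h
    have hUV := hU.trans Finset.sdiff_subset
    obtain ⟨H, W, u0, hUW, hWV, hWd, hu0, hc, hH, hHV, hlt⟩ := hG.shrink hUT hUV hU2 hP.vset_connS
      hP.vset_sub (Finset.disjoint_left.2 fun z hz => (Finset.mem_sdiff.1 (hU hz)).2)
    have hvW : v ∈ W := by
      by_contra hvW
      have := hA U (fun z hz => Finset.mem_sdiff.2 ⟨hUV hz, fun h =>
        hvW (hUW (Finset.mem_singleton.1 h ▸ hz))⟩) hUT
      omega
    have hHu : H.V \ {u0} = G.V \ W := by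
      rw [hHV, Finset.sdiff_singleton_eq_erase, Finset.erase_insert (by simp [hu0])]
    refine Good.of_contr hc (ih _ hlt H u0 rfl hH (by simp [hHV]) ?_ (hP.contr hc hWd)
      (Finset.disjoint_left.1 hWd hu0))
    refine hc.acy Finset.sdiff_subset ?_
    rw [hHu, filter_mapf hu0 Finset.sdiff_subset Finset.disjoint_sdiff]
    exact hA.mono (Finset.sdiff_subset_sdiff subset_rfl (by simpa using hvW))

theorem good_of_two_hubs (hr : 1 ≤ r) (n : ℕ) : ∀ (G : MGraph) (v t : ℕ), G.V.card = n →
    G.Conn2 → v ∈ G.V → t ∈ G.V → v ≠ t → G.Acy (G.V \ {v}) → 2 * r + 2 ≤ (G.bdry {t}).card →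
    Good r G := by
  induction n using Nat.strong_induction_on with
  | _ n ih =>
    rintro G v t rfl hG hv ht hvt hA hdeg
    have hP : FP G 0 (fun _ => t) (fun _ => 0) := ⟨by simp, by simp, by intros; omega, fun _ _ => ht⟩
    have hPs : vset (fun _ => t) 0 = {t} := by simp [vset]
    by_cases h : G.Acy (G.V \ {t})
    · exact hG.good_fan hr hP hv (by simpa [hPs] using hvt) (by rwa [hPs]) hA (.inl (by rwa [hPs]))
    obtain ⟨U, hU, hUT, hU2⟩ := Acy.exists_of_not h
    have hUV := hU.trans Finset.sdiff_subset
    obtain ⟨H, W, u0, hUW, hWV, hWd, hu0, hc, hH, hHV, hlt⟩ := hG.shrink hUT hUV hU2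
      (connS_singleton G t) (by simpa using ht)
      (Finset.disjoint_left.2 fun z hz => (Finset.mem_sdiff.1 (hU hz)).2)
    have hvW : v ∈ W := by
      by_contra hvW
      have := hA U (fun z hz => Finset.mem_sdiff.2 ⟨hUV hz, fun h =>
        hvW (hUW (Finset.mem_singleton.1 h ▸ hz))⟩) hUT
      omega
    have htW : t ∉ W := Finset.disjoint_right.1 hWd (by simp)
    have hHu : H.V \ {u0} = G.V \ W := by
      rw [hHV, Finset.sdiff_singleton_eq_erase, Finset.erase_insert (by simp [hu0])]
    refine Good.of_contr hc (ih _ hlt H u0 t rfl hH (by simp [hHV]) (by simp [hHV, ht, htW])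
      (fun h => htW (h ▸ hu0)) ?_ ?_)
    · refine hc.acy Finset.sdiff_subset ?_
      rw [hHu, filter_mapf hu0 Finset.sdiff_subset Finset.disjoint_sdiff]
      exact hA.mono (Finset.sdiff_subset_sdiff subset_rfl (by simpa using hvW))
    · rwa [hc.bdry, filter_mapf hu0 (by simpa using ht) hWd]

/-- The neighbours of `x`. -/
def nb (G : MGraph) (x : ℕ) : Finset ℕ := G.V.filter (G.Ed ∅ x)

theorem mem_nb : y ∈ G.nb x ↔ G.Ed ∅ x y := by
  simp only [nb, Finset.mem_filter, and_iff_right_iff_imp]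
  exact Ed.mem_right

theorem card_nb_le (hL : G.Loopless) : (G.nb x).card ≤ (G.bdry {x}).card := by
  have : ∀ y ∈ G.nb x, ∃ e ∈ G.E, G.ends e = s(x, y) := fun y hy => by
    obtain ⟨e, he, -, h⟩ := mem_nb.1 hy
    exact ⟨e, he, h⟩
  choose! f hf hf' using this
  refine Finset.card_le_card_of_injOn f (fun y hy => ?_) ?_
  · have hne := (mem_nb.1 hy).ne hL
    exact mem_bdry.2 ⟨hf y hy, x, by simp, y, by simpa using hne.symm, hf' y hy⟩
  · intro y hy z hz hyz
    have h := hf' y hy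
    rw [hyz, hf' z hz] at h
    rcases Sym2.eq_iff.1 h with ⟨-, h⟩ | ⟨h1, h2⟩
    · exact h.symm
    · rw [← h1, ← h2]

/-- One step of ball growth with respect to the sets `N x`. -/
def grow (N : ℕ → Finset ℕ) (X : Finset ℕ) : Finset ℕ := X ∪ X.biUnion N

theorem card_grow_iterate {N : ℕ → Finset ℕ} {d : ℕ} (hN : ∀ x, (N x).card ≤ d) (n : ℕ) (X : Finset ℕ) :
    ((grow N)^[n] X).card ≤ X.card * (d + 1) ^ n := by
  induction n with
  | zero => simp
  | succ n ih =>
    rw [Function.iterate_succ_apply', pow_succ, ← mul_assoc]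
    generalize (grow N)^[n] X = Y at ih
    have h1 : (Y.biUnion N).card ≤ Y.card * d := Finset.card_biUnion_le_card_mul _ _ _ fun x _ => hN x
    have h2 := Finset.card_union_le Y (Y.biUnion N)
    have h3 : (grow N Y).card ≤ Y.card * (d + 1) := by
      rw [mul_add, mul_one]; unfold grow; omega
    exact h3.trans (Nat.mul_le_mul_right _ ih)

theorem Conn2.good_of_degree_acy (hG : G.Conn2) (hr : 1 ≤ r) (hv : v ∈ G.V) (hA : G.Acy (G.V \ {v}))
    (hdeg : (2 * r + 2) * (2 * r + 3) ^ r < (G.bdry {v}).card) : Good r G := by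
  by_contra hgood
  have hd : ∀ t ∈ G.V, t ≠ v → (G.bdry {t}).card ≤ 2 * r + 2 := by
    intro t ht htv
    by_contra h
    exact hgood (good_of_two_hubs hr _ G v t rfl hG hv ht htv.symm hA (by omega))
  have hcon := hG.connS_compl hv
  have hbig : (2 * r + 3) ^ r < (G.V \ {v}).card := by
    have h1 : G.bdry {v} ⊆ (G.V \ {v}).biUnion fun t => G.bdry {t} := by
      intro e he
      obtain ⟨he, a, ha, b, hb, h⟩ := mem_bdry.1 he
      refine Finset.mem_biUnion.2 ⟨b, Finset.mem_sdiff.2 ⟨G.ends_mem e he b (by simp [h]), hb⟩, ?_⟩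
      refine mem_bdry.2 ⟨he, b, by simp, a, ?_, by rw [h, Sym2.eq_swap]⟩
      simp only [Finset.mem_singleton] at ha hb ⊢
      rintro rfl; exact hb ha
    have h2 := (Finset.card_le_card h1).trans (Finset.card_biUnion_le_card_mul _ _ (2 * r + 2)
      fun t ht => hd t (Finset.mem_sdiff.1 ht).1 (by simpa using (Finset.mem_sdiff.1 ht).2))
    by_contra h3
    have := Nat.mul_le_mul_left (2 * r + 2) (not_lt.1 h3)
    rw [mul_comm] at h2
    omega
  obtain ⟨t0, ht0⟩ := hcon.1
  let N : ℕ → Finset ℕ := fun x => if x ∈ G.V ∧ x ≠ v then G.nb x else ∅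
  have hN : ∀ x, (N x).card ≤ 2 * r + 2 := by
    intro x
    by_cases hx : x ∈ G.V ∧ x ≠ v
    · simp only [N, if_pos hx]
      exact (card_nb_le hG.loopless).trans (hd x hx.1 hx.2)
    · simp [N, if_neg hx]
  have hball := card_grow_iterate hN r {t0}
  have : ¬ (G.V \ {v}) ⊆ (grow N)^[r] {t0} := fun h => by
    have := Finset.card_le_card h
    rw [Finset.card_singleton, one_mul, show 2 * r + 2 + 1 = 2 * r + 3 from rfl] at hball
    omega
  refine this fun x hx => ?_
  obtain ⟨n, p, pe, hP, h0, hn, hpX, -⟩ := (hcon.2 t0 ht0 x hx).exists_fp ht0 Finset.sdiff_subset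
  have hnr : n ≤ r := by
    by_contra h
    refine hgood (good_of_long_path hr (le_of_not_ge h) _ G v rfl hG hv hA hP ?_)
    intro hv'
    obtain ⟨i, hi, h'⟩ := mem_vset.1 hv'
    have := hpX i hi
    simp [h'] at this
  have hmono : ∀ m X, X ⊆ (grow N)^[m] X := by
    intro m X
    induction m with
    | zero => simp
    | succ m ih =>
      rw [Function.iterate_succ_apply']
      exact ih.trans Finset.subset_union_left
  have hin : ∀ i ≤ n, p i ∈ (grow N)^[i] {t0} := by
    intro i
    induction i with
    | zero => simp [h0]
    | succ i ih =>
      intro hi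
      rw [Function.iterate_succ_apply']
      refine Finset.mem_union_right _ (Finset.mem_biUnion.2 ⟨p i, ih (by omega), ?_⟩)
      have := hpX i (by omega)
      rw [Finset.mem_sdiff, Finset.mem_singleton] at this
      simp only [N, if_pos this]
      exact mem_nb.2 (ed_of_edge (hP.edge i (by omega)) (hP.ends i (by omega)))
  rw [← hn]
  have := hin n le_rfl
  rw [show r = (r - n) + n by omega, Function.iterate_add_apply]
  exact hmono _ _ this

/-- The degree that forces a good minor. -/
def Dg (r : ℕ) : ℕ := (2 * r + 2) * (2 * r + 3) ^ r + 1

theorem good_of_degree (hr : 1 ≤ r) (n : ℕ) : ∀ (G : MGraph) (v : ℕ), G.V.card = n → G.Conn2 →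
    v ∈ G.V → Dg r ≤ (G.bdry {v}).card → Good r G := by
  induction n using Nat.strong_induction_on with
  | _ n ih =>
    rintro G v rfl hG hv hdeg
    by_cases h : G.Acy (G.V \ {v})
    · exact hG.good_of_degree_acy hr hv h hdeg
    obtain ⟨U, hU, hUT, hU2⟩ := Acy.exists_of_not h
    obtain ⟨H, W, u0, hUW, hWV, hWd, hu0, hc, hH, hHV, hlt⟩ := hG.shrink hUT
      (hU.trans Finset.sdiff_subset) hU2 (connS_singleton G v) (by simpa using hv)
      (Finset.disjoint_left.2 fun z hz => (Finset.mem_sdiff.1 (hU hz)).2)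
    refine Good.of_contr hc (ih _ hlt H v rfl hH ?_ ?_)
    · simp [hHV, hv, Finset.disjoint_right.1 hWd (Finset.mem_singleton_self v)]
    · rwa [hc.bdry, filter_mapf hu0 (by simpa using hv) hWd]

theorem Conn2.bdry_lt (hG : G.Conn2) (hr : 1 ≤ r) (hgood : ¬ Good r G) (hU : G.TwoEC U) (hUV : U ⊆ G.V)
    (hc : G.ConnS (G.V \ U)) : (G.bdry U).card < Dg r := by
  by_contra h
  obtain ⟨H, u0, hu0, h1, h2, h3⟩ := hG.exists_contr hU hUV hc
  refine hgood (Good.of_contr h1 (good_of_degree hr _ H u0 rfl h2 (by simp [h3]) ?_))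
  have h4 := filter_mapf_insert (Y := ∅) hUV (by simp) (by simp) hu0
  rw [h1.bdry, show ({u0} : Finset ℕ) = insert u0 ∅ from rfl, h4, Finset.union_empty]
  omega

end MGraph

end

section

namespace MGraph

variable {G H : MGraph} {A B D F I U W X Y Z I' D' : Finset ℕ} {a b u v w w' x y e g i j k l m n r t u0 q' : ℕ}
  {p pe q qe φ : ℕ → ℕ}

/-- The edges with an end in `X`. -/
def inc (G : MGraph) (X : Finset ℕ) : Finset ℕ := G.E.filter (fun e => ∃ v ∈ G.ends e, v ∈ X)

theorem mem_inc : e ∈ G.inc X ↔ e ∈ G.E ∧ ∃ v ∈ G.ends e, v ∈ X := by simp [inc]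

theorem inc_union : G.inc (X ∪ Y) = G.inc X ∪ G.inc Y := by
  ext e
  simp only [mem_inc, Finset.mem_union]
  constructor
  · rintro ⟨he, v, hv, h | h⟩
    exacts [.inl ⟨he, v, hv, h⟩, .inr ⟨he, v, hv, h⟩]
  · rintro (⟨he, v, hv, h⟩ | ⟨he, v, hv, h⟩)
    exacts [⟨he, v, hv, .inl h⟩, ⟨he, v, hv, .inr h⟩]

theorem Bn.insert_pth' (h : (I = ∅ ∧ D = ∅) ∨ Bn G x y I D) (hp : Pth G x y I' D') (hI : Disjoint I I')
    (hD : Disjoint D D') : Bn G x y (I ∪ I') (D ∪ D') := by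
  rcases h with ⟨rfl, rfl⟩ | h
  · simpa using hp.bn
  · exact h.insert_pth hp hI hD

theorem bundle_edges (hww : w ≠ w') (hF : ∀ e ∈ F, e ∈ G.E ∧ G.ends e = s(w, w')) :
    (F = ∅) ∨ Bn G w w' ∅ F := by
  induction F using Finset.induction_on with
  | empty => exact .inl rfl
  | insert e F he ih =>
    right
    obtain ⟨h1, h2⟩ := hF e (by simp)
    have := Bn.insert_pth' (G := G) (x := w) (y := w') (I := ∅) (D := F) (I' := ∅) (D' := {e})
      ((ih fun e' he' => hF e' (by simp [he'])).imp_left fun h => ⟨rfl, h⟩) (Pth.edge h1 h2 hww) (by simp)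
      (by simpa using he)
    rwa [Finset.union_empty, Finset.union_comm, ← Finset.insert_eq] at this

theorem Conn2.bundle (hG : G.Conn2) (hww : w ≠ w') (hw : w ∈ G.V) (hF : ∀ e ∈ F, e ∈ G.E ∧ G.ends e = s(w, w'))
    (hB : B ⊆ G.V) (hwB : w ∉ B) (hwB' : w' ∉ B)
    (hcl : ∀ x ∈ B, ∀ y, G.Ed ∅ x y → y = w ∨ y = w' ∨ y ∈ B) (h1 : G.Acy (insert w B))
    (h2 : G.Acy (insert w' B)) : (B = ∅ ∧ F ∪ G.inc B = ∅) ∨ Bn G w w' B (F ∪ G.inc B) := by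
  induction hn : B.card using Nat.strong_induction_on generalizing B with
  | _ n ih =>
    obtain rfl | ⟨t, ht⟩ := B.eq_empty_or_nonempty
    · have h0 : F ∪ G.inc ∅ = F := by simp [inc]
      rw [h0]
      exact (bundle_edges hww hF).imp_left fun h => ⟨rfl, h⟩
    · right
      set T := G.Cmp B t with hT
      have hTB : T ⊆ B := Cmp_subset
      have htT : t ∈ T := self_mem_Cmp ht
      have hBT : B \ T ∪ T = B := Finset.sdiff_union_of_subset hTB
      have hTcl : ∀ x ∈ T, ∀ y, G.Ed ∅ x y → y = w ∨ y = w' ∨ y ∈ T := by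
        intro x hx y hxy
        rcases hcl x (hTB hx) y hxy with h | h | h
        · exact .inl h
        · exact .inr (.inl h)
        · exact .inr (.inr (Cmp_closed hx h hxy))
      obtain ⟨g, a, b, D, -, ha, hb, -, -, hp, hD⟩ := hG.chord (P := {w}) (R := {w'}) (T := T)
        (connS_singleton G w) (connS_singleton G w') (connS_Cmp ht) (by simpa using hw) (hTB.trans hB)
        (by simpa using hww) (by simpa using fun h => hwB (hTB h)) (by simpa using fun h => hwB' (hTB h))
        (by simpa using hTcl)
        (h1.mono (by rw [Finset.union_comm, ← Finset.insert_eq]; exact Finset.insert_subset_insert _ hTB))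
        (h2.mono (by rw [Finset.union_comm, ← Finset.insert_eq]; exact Finset.insert_subset_insert _ hTB))
      obtain rfl := Finset.mem_singleton.1 ha
      obtain rfl := Finset.mem_singleton.1 hb
      have hDi : D = G.inc T := by ext e; rw [hD, mem_inc]
      have hrec := ih (B \ T).card (by
          rw [← hn]; exact Finset.card_lt_card (Finset.sdiff_ssubset hTB ⟨t, htT⟩))
        (B := B \ T) (Finset.sdiff_subset.trans hB) (fun h => hwB (Finset.sdiff_subset h))
        (fun h => hwB' (Finset.sdiff_subset h)) (by
          intro x hx y hxy
          have hx := Finset.mem_sdiff.1 hx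
          rcases hcl x hx.1 y hxy with h | h | h
          · exact .inl h
          · exact .inr (.inl h)
          · exact .inr (.inr (Finset.mem_sdiff.2 ⟨h, fun hy => hx.2 (Cmp_closed hy hx.1 hxy.symm)⟩)))
        (h1.mono (Finset.insert_subset_insert _ Finset.sdiff_subset))
        (h2.mono (Finset.insert_subset_insert _ Finset.sdiff_subset)) rfl
      have := Bn.insert_pth' hrec hp Finset.sdiff_disjoint (by
        rw [Finset.disjoint_left]
        intro e he heD
        obtain ⟨heE, v, hv, hvT⟩ := (hD e).1 heD
        rcases Finset.mem_union.1 he with he | he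
        · rw [(hF e he).2, Sym2.mem_iff] at hv
          rcases hv with rfl | rfl
          exacts [hwB (hTB hvT), hwB' (hTB hvT)]
        · obtain ⟨-, v', hv', hvT'⟩ := mem_inc.1 he
          have hvT' := Finset.mem_sdiff.1 hvT'
          have hne : v ≠ v' := by rintro rfl; exact hvT'.2 hvT
          have hee : G.ends e = s(v, v') := ((Sym2.mem_and_mem_iff hne).1 ⟨hv, hv'⟩)
          exact hvT'.2 (Cmp_closed hvT hvT'.1 (ed_of_edge heE hee)))
      rw [hBT, hDi, Finset.union_assoc, ← inc_union, hBT] at this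
      exact this

/-- The cyclic successor of `i` below `q`. -/
def nx (q i : ℕ) : ℕ := if i + 1 = q then 0 else i + 1

theorem nx_lt (hi : i < q') : nx q' i < q' := by unfold nx; split <;> omega

/-- A cyclic decomposition of `G` into hubs `U i` and blobs `B i`. -/
structure Ring (G : MGraph) (q' : ℕ) (U B : ℕ → Finset ℕ) : Prop where
  two : ∀ i < q', G.TwoEC (U i)
  sub : ∀ i < q', U i ⊆ G.V
  cc : ∀ i < q', G.ConnS (G.V \ U i)
  dU : ∀ i < q', ∀ j < q', i ≠ j → Disjoint (U i) (U j)
  dB : ∀ i < q', ∀ j < q', i ≠ j → Disjoint (B i) (B j)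
  dUB : ∀ i < q', ∀ j < q', Disjoint (U i) (B j)
  bsub : ∀ i < q', B i ⊆ G.V
  cover : ∀ v ∈ G.V, ∃ i < q', v ∈ U i ∨ v ∈ B i
  edge : ∀ a b, G.Ed ∅ a b → ∃ i < q', a ∈ U i ∪ B i ∪ U (nx q' i) ∧ b ∈ U i ∪ B i ∪ U (nx q' i)
  pass : ∀ i < q', ∃ S ⊆ U i ∪ B i ∪ U (nx q' i), G.ConnS S ∧ (∃ a ∈ S, a ∈ U i) ∧
    ∃ b ∈ S, b ∈ U (nx q' i)

theorem mapf_eq_mapf (hu : u0 ∈ W) (h : mapf W u0 a = mapf W u0 b) : a = b ∨ a ∈ W ∧ b ∈ W := by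
  unfold mapf at h
  by_cases ha : a ∈ W <;> by_cases hb : b ∈ W
  · exact .inr ⟨ha, hb⟩
  · rw [if_pos ha, if_neg hb] at h; exact absurd (h ▸ hu) hb
  · rw [if_neg ha, if_pos hb] at h; exact absurd (h ▸ hu) ha
  · rw [if_neg ha, if_neg hb] at h; exact .inl h

theorem Ring.nbr {U B : ℕ → Finset ℕ} (h : Ring G q' U B) (hi : i < q') (ha : a ∈ B i) (hab : G.Ed ∅ a b) :
    b ∈ U i ∪ B i ∪ U (nx q' i) := by
  obtain ⟨j, hj, h1, h2⟩ := h.edge a b hab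
  have hji : j = i := by
    by_contra hne
    simp only [Finset.mem_union] at h1
    rcases h1 with (h1 | h1) | h1
    · exact Finset.disjoint_left.1 (h.dUB j hj i hi) h1 ha
    · exact Finset.disjoint_left.1 (h.dB j hj i hi hne) h1 ha
    · exact Finset.disjoint_left.1 (h.dUB _ (nx_lt hj) i hi) h1 ha
  exact hji ▸ h2

theorem Ring.contr {U B : ℕ → Finset ℕ} (h : Ring G q' U B) (hH : G.Contr H (mapf W u0)) (hc : H.Conn2)
    (hu : u0 ∈ W) (hi : i < q') (hm : m = i ∨ m = nx q' i) (hW : W ⊆ B i ∪ U m)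
    (hWU : Disjoint W (U m) ∨ U m ⊆ W) : ∃ U' B', Ring H q' U' B' := by
  have hmq : m < q' := by rcases hm with rfl | rfl; exacts [hi, nx_lt hi]
  set φ := mapf W u0 with hφ
  have hWj : ∀ j < q', ∀ c ∈ W, c ∈ U j → j = m := by
    intro j hj c hcW hcU
    by_contra hne
    rcases Finset.mem_union.1 (hW hcW) with h' | h'
    · exact Finset.disjoint_left.1 (h.dUB j hj i hi) hcU h'
    · exact Finset.disjoint_left.1 (h.dU j hj m hmq hne) hcU h'
  have hWB : ∀ j < q', ∀ c ∈ W, c ∈ B j → j = i := by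
    intro j hj c hcW hcU
    by_contra hne
    rcases Finset.mem_union.1 (hW hcW) with h' | h'
    · exact Finset.disjoint_left.1 (h.dB j hj i hi hne) hcU h'
    · exact Finset.disjoint_left.1 (h.dUB m hmq j hj) h' hcU
  have hWsub : ∀ j < q', ∀ c ∈ W, c ∈ U j → U j ⊆ W := by
    intro j hj c hcW hcU
    obtain rfl := hWj j hj c hcW hcU
    rcases hWU with h' | h'
    · exact absurd hcU (Finset.disjoint_left.1 h' hcW)
    · exact h'
  have key : ∀ k < q', ∀ a, φ a ∈ (U k).image φ → a ∈ U k ∨ a ∈ W ∧ U k ⊆ W ∧ k = m := by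
    intro k hk a ha
    obtain ⟨c, hcU, hca⟩ := Finset.mem_image.1 ha
    rcases mapf_eq_mapf hu hca with rfl | ⟨h1, h2⟩
    · exact .inl hcU
    · exact .inr ⟨h2, hWsub k hk c h1 hcU, hWj k hk c h1 hcU⟩
  set N := (Finset.range q').biUnion (fun k => (U k).image φ) with hN
  have hNm : ∀ x, x ∈ N ↔ ∃ k < q', x ∈ (U k).image φ := fun x => by simp [hN]
  have himg : ∀ j < q', ∀ z, z ∈ U j ∪ B j ∪ U (nx q' j) →
      φ z ∈ (U j).image φ ∪ ((B j).image φ \ N) ∪ (U (nx q' j)).image φ := by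
    intro j hj z hz
    simp only [Finset.mem_union, Finset.mem_sdiff] at hz ⊢
    rcases hz with (hz | hz) | hz
    · exact .inl (.inl (Finset.mem_image_of_mem _ hz))
    · by_cases hzN : φ z ∈ N
      · obtain ⟨k, hk, hzk⟩ := (hNm _).1 hzN
        rcases key k hk z hzk with h' | ⟨h1, h2, rfl⟩
        · exact absurd hz (Finset.disjoint_left.1 (h.dUB k hk j hj) h')
        · obtain rfl := hWB j hj z h1 hz
          rcases hm with rfl | rfl
          · exact .inl (.inl hzk)
          · exact .inr hzk
      · exact .inl (.inr ⟨Finset.mem_image_of_mem _ hz, hzN⟩)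
    · exact .inr (Finset.mem_image_of_mem _ hz)
  refine ⟨fun j => (U j).image φ, fun j => (B j).image φ \ N, ⟨fun j hj => hH.twoEC_image (h.two j hj),
    fun j hj => by rw [hH.V]; exact Finset.image_subset_image (h.sub j hj), ?_, ?_, ?_, ?_, ?_, ?_, ?_, ?_⟩⟩
  · intro j hj
    by_cases hd : ∃ c ∈ W, c ∈ U j
    · obtain ⟨c, hcW, hcU⟩ := hd
      have hs := hWsub j hj c hcW hcU
      have h1 : (U j).image φ = {φ c} := by
        ext x
        simp only [Finset.mem_image, Finset.mem_singleton]
        constructor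
        · rintro ⟨d, hd, rfl⟩; simp [hφ, mapf, hs hd, hcW]
        · rintro rfl; exact ⟨c, hcU, rfl⟩
      show H.ConnS (H.V \ (U j).image φ)
      rw [h1, Finset.sdiff_singleton_eq_erase]
      exact hc.erase _ (by rw [hH.V]; exact Finset.mem_image_of_mem _ (h.sub j hj hcU))
    · push Not at hd
      show H.ConnS (H.V \ (U j).image φ)
      have h1 : H.V \ (U j).image φ = (G.V \ U j).image φ := by
        rw [hH.V]
        ext x
        simp only [Finset.mem_sdiff, Finset.mem_image]
        constructor
        · rintro ⟨⟨a, ha, rfl⟩, hx⟩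
          exact ⟨a, ⟨ha, fun h' => hx ⟨a, h', rfl⟩⟩, rfl⟩
        · rintro ⟨a, ⟨ha, haU⟩, rfl⟩
          refine ⟨⟨a, ha, rfl⟩, ?_⟩
          rintro ⟨c, hcU, hca⟩
          rcases mapf_eq_mapf hu hca with rfl | ⟨h1, -⟩
          exacts [haU hcU, hd c h1 hcU]
      rw [h1]
      exact hH.connS_image (h.cc j hj)
  · intro j hj k hk hjk
    rw [Finset.disjoint_left]
    intro x hx hx'
    obtain ⟨a, ha, rfl⟩ := Finset.mem_image.1 hx
    rcases key k hk a hx' with h' | ⟨h1, h2, rfl⟩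
    · exact Finset.disjoint_left.1 (h.dU j hj k hk hjk) ha h'
    · exact hjk (hWj j hj a h1 ha)
  · intro j hj k hk hjk
    rw [Finset.disjoint_left]
    intro x hx hx'
    obtain ⟨a, ha, rfl⟩ := Finset.mem_image.1 (Finset.mem_sdiff.1 hx).1
    obtain ⟨b, hb, hab⟩ := Finset.mem_image.1 (Finset.mem_sdiff.1 hx').1
    rcases mapf_eq_mapf hu hab with rfl | ⟨h1, h2⟩
    · exact Finset.disjoint_left.1 (h.dB j hj k hk hjk) ha hb
    · exact hjk ((hWB j hj a h2 ha).trans (hWB k hk b h1 hb).symm)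
  · intro j hj k hk
    rw [Finset.disjoint_left]
    intro x hx hx'
    exact (Finset.mem_sdiff.1 hx').2 ((hNm x).2 ⟨j, hj, hx⟩)
  · intro j hj
    rw [hH.V]
    exact Finset.sdiff_subset.trans (Finset.image_subset_image (h.bsub j hj))
  · intro v hv
    rw [hH.V] at hv
    obtain ⟨a, ha, rfl⟩ := Finset.mem_image.1 hv
    by_cases hvN : φ a ∈ N
    · obtain ⟨k, hk, hx⟩ := (hNm _).1 hvN
      exact ⟨k, hk, .inl hx⟩
    · obtain ⟨j, hj, h' | h'⟩ := h.cover a ha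
      · exact ⟨j, hj, .inl (Finset.mem_image_of_mem _ h')⟩
      · exact ⟨j, hj, .inr (Finset.mem_sdiff.2 ⟨Finset.mem_image_of_mem _ h', hvN⟩)⟩
  · intro x y hxy
    obtain ⟨a, b, rfl, rfl, hab⟩ := hH.ed_lift hxy
    obtain ⟨j, hj, h1, h2⟩ := h.edge a b hab
    exact ⟨j, hj, himg j hj a h1, himg j hj b h2⟩
  · intro j hj
    obtain ⟨S, hS, hSc, ⟨a, ha, ha'⟩, b, hb, hb'⟩ := h.pass j hj
    refine ⟨S.image φ, ?_, hH.connS_image hSc, ⟨φ a, Finset.mem_image_of_mem _ ha, Finset.mem_image_of_mem _ ha'⟩,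
      φ b, Finset.mem_image_of_mem _ hb, Finset.mem_image_of_mem _ hb'⟩
    intro x hx
    obtain ⟨z, hz, rfl⟩ := Finset.mem_image.1 hx
    exact himg j hj z (hS hz)

end MGraph

end

section

namespace MGraph

variable {G H : MGraph} {X W Y Z : Finset ℕ} {U B : ℕ → Finset ℕ} {w : ℕ → ℕ}
  {a b u v x y e g i j k l m n r t u0 q : ℕ}

theorem nx_ne (hq : 2 ≤ q) : nx q i ≠ i := by
  unfold nx; split <;> omega

/-- Removing a blob together with one of its hubs leaves a connected graph. -/
theorem Ring.connS_compl (h : Ring G q U B) (hq : 3 ≤ q) (hi : i < q) (hm : m < q) (hm' : n < q)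
    (hmn : (m = i ∧ n = nx q i) ∨ (m = nx q i ∧ n = i)) (hw : U n = {u}) :
    G.ConnS (G.V \ (B i ∪ U m)) := by
  have hmn' : m ≠ n := by
    rintro rfl
    have := nx_ne (i := i) (show 2 ≤ q by omega)
    rcases hmn with ⟨h1, h2⟩ | ⟨h1, h2⟩ <;> exact this (by omega)
  have huV : u ∈ G.V := h.sub n hm' (by simp [hw])
  have huB : u ∉ B i := Finset.disjoint_left.1 (h.dUB n hm' i hi) (by simp [hw])
  have hum : u ∉ U m := Finset.disjoint_left.1 (h.dU n hm' m hm hmn'.symm) (by simp [hw])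
  have hnb : ∀ a ∈ B i, ∀ b, G.Ed ∅ a b → b ∈ B i ∨ b ∈ U m ∨ b = u := by
    intro a ha b hab
    have := h.nbr hi ha hab
    simp only [Finset.mem_union] at this
    have hbn : b ∈ U n → b = u := by rw [hw]; simp
    rcases hmn with ⟨rfl, rfl⟩ | ⟨rfl, rfl⟩
    · rcases this with (h' | h') | h'
      exacts [.inr (.inl h'), .inl h', .inr (.inr (hbn h'))]
    · rcases this with (h' | h') | h'
      exacts [.inr (.inr (hbn h')), .inl h', .inr (.inl h')]
  refine connS_of_cut ⟨u, Finset.mem_sdiff.2 ⟨huV, by simp [huB, hum]⟩⟩ ?_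
  intro P a ha hPa b hb hPb
  simp only [Finset.mem_sdiff, Finset.mem_union, not_or] at ha hb ⊢
  obtain ⟨c, hc, d, hd, h1, h2, h3⟩ := (h.cc m hm).cut (fun z => if z ∈ B i then P u else P z)
    (u := a) (Finset.mem_sdiff.2 ⟨ha.1, ha.2.2⟩) (by simpa [ha.2.1] using hPa)
    (v := b) (Finset.mem_sdiff.2 ⟨hb.1, hb.2.2⟩) (by simpa [hb.2.1] using hPb)
  rw [Finset.mem_sdiff] at hc hd
  by_cases hcB : c ∈ B i <;> by_cases hdB : d ∈ B i
  · simp only [hcB, hdB, if_true] at h1 h2; exact absurd h1 h2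
  · simp only [hcB, hdB, if_true, if_false] at h1 h2
    rcases hnb c hcB d h3 with h' | h' | rfl
    exacts [absurd h' hdB, absurd h' hd.2, absurd h1 h2]
  · simp only [hcB, hdB, if_true, if_false] at h1 h2
    rcases hnb d hdB c h3.symm with h' | h' | rfl
    exacts [absurd h' hcB, absurd h' hc.2, absurd h1 h2]
  · simp only [hcB, hdB, if_false] at h1 h2
    exact ⟨c, ⟨hc.1, hcB, hc.2⟩, d, ⟨hd.1, hdB, hd.2⟩, h1, h2, h3⟩

/-- The edges of the `i`-th link of a ring whose hubs are the single vertices `w i`. -/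
def link (G : MGraph) (q : ℕ) (B : ℕ → Finset ℕ) (w : ℕ → ℕ) (i : ℕ) : Finset ℕ :=
  G.E.filter (fun e => G.ends e = s(w i, w (nx q i))) ∪ G.inc (B i)

theorem Ring.link_disj (h : Ring G q U B) (hq : 3 ≤ q) (hU : ∀ i < q, U i = {w i}) (hi : i < q) (hj : j < q)
    (hij : i ≠ j) : Disjoint (link G q B w i) (link G q B w j) := by
  have hwB : ∀ i < q, ∀ j < q, w i ∉ B j := fun i hi j hj =>
    Finset.disjoint_left.1 (h.dUB i hi j hj) (by simp [hU i hi])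
  have hw : ∀ i < q, ∀ j < q, w i = w j → i = j := by
    intro i hi j hj hw
    by_contra hne
    exact Finset.disjoint_left.1 (h.dU i hi j hj hne) (show w i ∈ U i by simp [hU i hi]) (by simp [hU j hj, hw])
  rw [Finset.disjoint_left]
  intro e he he'
  have key : ∀ i < q, ∀ j < q, e ∈ G.E.filter (fun e => G.ends e = s(w i, w (nx q i))) → e ∉ G.inc (B j) := by
    intro i hi j hj he he'
    obtain ⟨-, v, hv, hvB⟩ := mem_inc.1 he'
    rw [(Finset.mem_filter.1 he).2, Sym2.mem_iff] at hv
    rcases hv with rfl | rfl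
    exacts [hwB i hi j hj hvB, hwB _ (nx_lt hi) j hj hvB]
  rcases Finset.mem_union.1 he with he | he <;> rcases Finset.mem_union.1 he' with he' | he'
  · have h1 := (Finset.mem_filter.1 he).2
    rw [(Finset.mem_filter.1 he').2, Sym2.eq_iff] at h1
    rcases h1 with ⟨h1, -⟩ | ⟨h1, h2⟩
    · exact hij (hw j hj i hi h1).symm
    · have e1 := hw _ hj _ (nx_lt hi) h1
      have e2 := hw _ (nx_lt hj) _ hi h2
      unfold nx at e1 e2
      split at e1 <;> split at e2 <;> omega
  · exact key i hi j hj he he'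
  · exact key j hj i hi he' he
  · obtain ⟨heE, a, ha, haB⟩ := mem_inc.1 he
    obtain ⟨-, b, hb, hbB⟩ := mem_inc.1 he'
    have hab : a ≠ b := by
      rintro rfl; exact Finset.disjoint_left.1 (h.dB i hi j hj hij) haB hbB
    have := h.nbr hi haB (ed_of_edge heE ((Sym2.mem_and_mem_iff hab).1 ⟨ha, hb⟩))
    simp only [Finset.mem_union] at this
    rcases this with (h' | h') | h'
    · exact Finset.disjoint_left.1 (h.dUB i hi j hj) h' hbB
    · exact Finset.disjoint_left.1 (h.dB i hi j hj hij) h' hbB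
    · exact Finset.disjoint_left.1 (h.dUB _ (nx_lt hi) j hj) h' hbB

theorem Ring.link_bn (hG : G.Conn2) (h : Ring G q U B) (hq : 3 ≤ q) (hU : ∀ i < q, U i = {w i}) (hi : i < q)
    (h1 : G.Acy (insert (w i) (B i))) (h2 : G.Acy (insert (w (nx q i)) (B i))) :
    Bn G (w i) (w (nx q i)) (B i) (link G q B w i) := by
  have hi' := nx_lt hi
  have hwB : ∀ i < q, ∀ j < q, w i ∉ B j := fun i hi j hj =>
    Finset.disjoint_left.1 (h.dUB i hi j hj) (by simp [hU i hi])
  have hww : w i ≠ w (nx q i) := by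
    intro hw
    exact Finset.disjoint_left.1 (h.dU i hi _ hi' (nx_ne (by omega)).symm) (show w i ∈ U i by simp [hU i hi])
      (by simp [hU _ hi', hw])
  have := hG.bundle (F := G.E.filter (fun e => G.ends e = s(w i, w (nx q i)))) hww
    (h.sub i hi (by simp [hU i hi])) (fun e he => Finset.mem_filter.1 he) (h.bsub i hi) (hwB i hi i hi)
    (hwB _ hi' i hi) (fun x hx y hxy => by
      have := h.nbr hi hx hxy
      simp only [Finset.mem_union, hU i hi, hU _ hi', Finset.mem_singleton] at this
      tauto) h1 h2
  refine this.resolve_left ?_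
  rintro ⟨hB, hE⟩
  obtain ⟨S, hS, hSc, ⟨a, ha, haU⟩, b, hb, hbU⟩ := h.pass i hi
  rw [hU i hi, Finset.mem_singleton] at haU
  rw [hU _ hi', Finset.mem_singleton] at hbU
  subst haU hbU
  obtain ⟨c, hc, d, hd, h3, h4, e, he, -, hends⟩ := hSc.cut (· = w i) ha rfl hb hww.symm
  have hd' := hS hd
  simp only [hB, hU i hi, hU _ hi', Finset.mem_union, Finset.mem_singleton, Finset.notMem_empty, or_false] at hd'
  obtain rfl := hd'.resolve_left h4
  have : e ∈ (∅ : Finset ℕ) := by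
    rw [← hE]
    exact Finset.mem_union_left _ (Finset.mem_filter.2 ⟨he, by rw [hends, h3]⟩)
  simp at this

theorem Ring.good_of_acy (hG : G.Conn2) (h : Ring G q U B) (hr : 1 ≤ r) (hq : r + 2 ≤ q)
    (hU : ∀ i < q, U i = {w i}) (h1 : ∀ i < q, G.Acy (insert (w i) (B i)))
    (h2 : ∀ i < q, G.Acy (insert (w (nx q i)) (B i))) : Good r G := by
  have hbn := fun i (hi : i < q) => h.link_bn hG (by omega) hU hi (h1 i hi) (h2 i hi)
  have hdl := fun i (hi : i < q) j (hj : j < q) => h.link_disj (by omega) hU hi hj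
  have hw : ∀ i < q, ∀ j < q, w i = w j → i = j := by
    intro i hi j hj hw
    by_contra hne
    exact Finset.disjoint_left.1 (h.dU i hi j hj hne) (show w i ∈ U i by simp [hU i hi]) (by simp [hU j hj, hw])
  have hwB : ∀ i < q, ∀ j < q, w i ∉ B j := fun i hi j hj =>
    Finset.disjoint_left.1 (h.dUB i hi j hj) (by simp [hU i hi])
  let IS : ℕ → Finset ℕ := fun t => (Finset.range (t + 2)).image w ∪ (Finset.range (t + 1)).biUnion B
  let DS : ℕ → Finset ℕ := fun t => (Finset.range (t + 1)).biUnion (link G q B w)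
  have dI : ∀ t, t + 2 ≤ q → ∀ i < q, t < i → Disjoint (IS t) (B i) := by
    intro t ht i hi hti
    rw [Finset.disjoint_left]
    intro z hz hzi
    simp only [IS, Finset.mem_union, Finset.mem_image, Finset.mem_biUnion, Finset.mem_range] at hz
    rcases hz with ⟨j, hj, rfl⟩ | ⟨j, hj, hz⟩
    · exact hwB j (by omega) i hi hzi
    · exact Finset.disjoint_left.1 (h.dB j (by omega) i hi (by omega)) hz hzi
  have dD : ∀ t, t + 2 ≤ q → ∀ i < q, t < i → Disjoint (DS t) (link G q B w i) := by
    intro t ht i hi hti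
    rw [Finset.disjoint_biUnion_left]
    intro j hj
    rw [Finset.mem_range] at hj
    exact hdl j (by omega) i hi (by omega)
  have hlad : ∀ t, t + 1 < q → Lad G t (IS t) (DS t) (w (t + 1)) (w 0) := by
    intro t
    induction t with
    | zero =>
      intro ht
      have := hbn 0 (by omega)
      rw [show nx q 0 = 1 by unfold nx; split <;> omega] at this
      convert (Lad.init this).swap using 1
      · simp only [IS]
        ext z; simp [Finset.range_add_one]; tauto
      · simp [DS]
    | succ t ih =>
      intro ht
      have hb := hbn (t + 1) (by omega)
      rw [show nx q (t + 1) = t + 1 + 1 by unfold nx; split <;> omega] at hb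
      have := (ih (by omega)).slide ?_ hb (dI t (by omega) _ (by omega) (by omega))
        (dD t (by omega) _ (by omega) (by omega))
      · convert this using 1
        · simp only [IS]
          rw [Finset.range_add_one (n := t + 1 + 1), Finset.range_add_one (n := t + 1), Finset.image_insert,
            Finset.biUnion_insert]
          ext z; simp only [Finset.mem_union, Finset.mem_insert]; tauto
        · simp only [DS]
          rw [Finset.range_add_one (n := t + 1), Finset.biUnion_insert, Finset.union_comm]
      · simp only [IS, Finset.mem_union, Finset.mem_image, Finset.mem_biUnion, Finset.mem_range]
        rintro (⟨j, hj, hjw⟩ | ⟨j, hj, hz⟩)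
        · have := hw j (by omega) _ ht hjw; omega
        · exact hwB _ ht j (by omega) hz
  obtain ⟨s, rfl⟩ : ∃ s, q = s + 2 := ⟨q - 2, by omega⟩
  have hb := hbn (s + 1) (by omega)
  rw [show nx (s + 2) (s + 1) = 0 by simp [nx]] at hb
  refine (hlad s (by omega)).finish (by omega) hb (dI s le_rfl _ (by omega) (by omega))
    (dD s le_rfl _ (by omega) (by omega)) ?_ ?_ (by omega)
  · refine Finset.Subset.antisymm (Finset.union_subset (Finset.union_subset ?_ ?_) (h.bsub _ (by omega))) ?_
    · intro z hz
      obtain ⟨j, hj, rfl⟩ := Finset.mem_image.1 hz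
      have hj := Finset.mem_range.1 hj
      exact h.sub j hj (by simp [hU j hj])
    · exact Finset.biUnion_subset.2 fun j hj => h.bsub j (by have := Finset.mem_range.1 hj; omega)
    · intro v hv
      simp only [IS, Finset.mem_union, Finset.mem_image, Finset.mem_biUnion, Finset.mem_range]
      obtain ⟨j, hj, h' | h'⟩ := h.cover v hv
      · rw [hU j hj, Finset.mem_singleton] at h'
        exact .inl (.inl ⟨j, hj, h'.symm⟩)
      · rcases Nat.lt_or_ge j (s + 1) with hj' | hj'
        · exact .inl (.inr ⟨j, hj', h'⟩)
        · obtain rfl : j = s + 1 := by omega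
          exact .inr h'
  · have hls : ∀ j, link G (s + 2) B w j ⊆ G.E := fun j =>
      Finset.union_subset (Finset.filter_subset _ _) (Finset.filter_subset _ _)
    refine Finset.Subset.antisymm (Finset.union_subset (Finset.biUnion_subset.2 fun j _ => hls j) (hls _)) ?_
    intro e he
    have hex : ∃ j < s + 2, e ∈ link G (s + 2) B w j := by
      obtain ⟨a, b, hab⟩ : ∃ a b, G.ends e = s(a, b) := by
        induction G.ends e using Sym2.ind with | _ a b => exact ⟨a, b, rfl⟩
      obtain ⟨k, hk, ha, hb⟩ := h.edge a b (ed_of_edge he hab)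
      have hne := (ed_of_edge he hab).ne hG.loopless
      refine ⟨k, hk, ?_⟩
      simp only [hU k hk, hU _ (nx_lt hk), Finset.mem_union, Finset.mem_singleton] at ha hb
      unfold link
      rw [Finset.mem_union, mem_inc, Finset.mem_filter]
      by_cases haB : a ∈ B k
      · exact .inr ⟨he, a, by simp [hab], haB⟩
      by_cases hbB : b ∈ B k
      · exact .inr ⟨he, b, by simp [hab], hbB⟩
      refine .inl ⟨he, ?_⟩
      rw [hab]
      simp only [haB, hbB, or_false] at ha hb
      rcases ha with rfl | rfl <;> rcases hb with rfl | rfl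
      · exact absurd rfl hne
      · rfl
      · exact Sym2.eq_swap
      · exact absurd rfl hne
    obtain ⟨j, hj, hej⟩ := hex
    simp only [DS, Finset.mem_union, Finset.mem_biUnion, Finset.mem_range]
    rcases Nat.lt_or_ge j (s + 1) with hj' | hj'
    · exact .inl ⟨j, hj', hej⟩
    · obtain rfl : j = s + 1 := by omega
      exact .inr hej

theorem card_insert_sdiff_lt (hW : W ⊆ G.V) (h2 : 2 ≤ W.card) : (insert u0 (G.V \ W)).card < G.V.card := by
  have h1 := Finset.card_insert_le u0 (G.V \ W)
  have h3 := Finset.card_sdiff_add_card_eq_card hW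
  omega

theorem Ring.good (hG : G.Conn2) (h : Ring G q U B) (hr : 1 ≤ r) (hq : r + 2 ≤ q) : Good r G := by
  induction hn : G.V.card using Nat.strong_induction_on generalizing G U B with
  | _ n ih =>
    by_cases hbig : ∃ i < q, 2 ≤ (U i).card
    · obtain ⟨i, hi, h2⟩ := hbig
      obtain ⟨H, u0, hu0, hH, hHc, hHV⟩ := hG.exists_contr (h.two i hi) (h.sub i hi) (h.cc i hi)
      obtain ⟨U', B', hR⟩ := h.contr hH hHc hu0 hi (.inl rfl) Finset.subset_union_right (.inr le_rfl)
      exact Good.of_contr hH (ih H.V.card (by rw [hHV, ← hn]; exact card_insert_sdiff_lt (h.sub i hi) h2)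
        hHc hR rfl)
    · push Not at hbig
      have hone : ∀ i < q, ∃ a, U i = {a} := fun i hi => by
        rw [← Finset.card_eq_one]
        have := (h.two i hi).1.card_pos
        have := hbig i hi
        omega
      choose! w hU using hone
      by_cases hac : ∀ i < q, ∀ m, m = i ∨ m = nx q i → G.Acy (insert (w m) (B i))
      · exact h.good_of_acy hG hr hq hU (fun i hi => hac i hi i (.inl rfl)) (fun i hi => hac i hi _ (.inr rfl))
      · push Not at hac
        obtain ⟨i, hi, m, hm, hac⟩ := hac
        obtain ⟨Z, hZ, hZ2, hZc⟩ := Acy.exists_of_not hac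
        have hmq : m < q := by rcases hm with rfl | rfl; exacts [hi, nx_lt hi]
        rw [Finset.insert_eq, ← hU m hmq, Finset.union_comm] at hZ
        have hsub : B i ∪ U m ⊆ G.V := Finset.union_subset (h.bsub i hi) (h.sub m hmq)
        have hA : G.ConnS (G.V \ (B i ∪ U m)) := by
          rcases hm with rfl | rfl
          · exact h.connS_compl (by omega) hi hi (nx_lt hi) (.inl ⟨rfl, rfl⟩) (hU _ (nx_lt hi))
          · exact h.connS_compl (by omega) hi (nx_lt hi) hi (.inr ⟨rfl, rfl⟩) (hU _ hi)
        obtain ⟨H, W, u0, -, hWV, hWA, hu0, hH, hHc, hHV, hlt⟩ := hG.shrink hZ2 (hZ.trans hsub) hZc hA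
          Finset.sdiff_subset (by
            rw [Finset.disjoint_left]; exact fun z hz hz' => (Finset.mem_sdiff.1 hz').2 (hZ hz))
        obtain ⟨U', B', hR⟩ := h.contr hH hHc hu0 hi hm (fun z hz => by
          by_contra hz'
          exact Finset.disjoint_left.1 hWA hz (Finset.mem_sdiff.2 ⟨hWV hz, hz'⟩)) (by
          rw [hU m hmq]
          simp only [Finset.disjoint_singleton_right, Finset.singleton_subset_iff]
          tauto)
        exact Good.of_contr hH (ih H.V.card (by omega) hHc hR rfl)

end MGraph

end

section

namespace MGraph

variable {G H : MGraph} {A C O S T X W Y Z : Finset ℕ} {L U B : ℕ → Finset ℕ}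
  {a b c d u v x y e f g i j k l m n r t q : ℕ}

/-- The vertices that no single edge separates from `u` lie in a common set that stays connected
after deleting any one edge. -/
theorem exists_twoEC_class (hu : u ∈ X) :
    ∃ W ⊆ X, G.TwoEC W ∧ ∀ z ∈ X, (∀ g, G.Jn {g} X u z) → z ∈ W := by
  induction hn : X.card using Nat.strong_induction_on generalizing X with
  | _ n ih =>
    by_cases hX : G.TwoEC X
    · exact ⟨X, le_rfl, hX, fun z hz _ => hz⟩
    · obtain ⟨g, s, hs, t, ht, hst⟩ : ∃ g, ∃ s ∈ X, ∃ t ∈ X, ¬ G.Jn {g} X s t := by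
        by_contra hc
        push Not at hc
        exact hX ⟨⟨u, hu⟩, hc⟩
      set Y := X.filter (G.Jn {g} X u) with hY
      have hYX : Y ⊆ X := Finset.filter_subset _ _
      have huY : u ∈ Y := Finset.mem_filter.2 ⟨hu, .refl⟩
      have hlt : Y.card < n := by
        rw [← hn]
        refine Finset.card_lt_card (Finset.ssubset_iff_subset_ne.2 ⟨hYX, fun h => hst ?_⟩)
        rw [← h] at hs ht
        exact (Finset.mem_filter.1 hs).2.symm.trans (Finset.mem_filter.1 ht).2
      have hcl : ∀ a ∈ Y, ∀ b ∈ X, G.Ed {g} a b → b ∈ Y := fun a ha b hb hab =>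
        Finset.mem_filter.2 ⟨hb, (Finset.mem_filter.1 ha).2.trans (.step (hYX ha) hb hab)⟩
      obtain ⟨W, hWY, hW, hWc⟩ := ih Y.card hlt huY rfl
      refine ⟨W, hWY.trans hYX, hW, fun z hz hzc => hWc z (Finset.mem_filter.2 ⟨hz, hzc g⟩) fun g' => ?_⟩
      by_contra hnj
      -- the vertices outside `Y` hang off the end `α` of `g`
      set P : ℕ → Prop := G.Jn {g'} Y u with hP
      have hcross : ∀ a ∈ Y, ∀ b ∈ Y, P a → ¬ P b → ¬ G.Ed {g'} a b := fun a ha b hb h1 h2 h3 =>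
        h2 (h1.trans (.step ha hb h3))
      have hout : ∀ a ∈ Y, ∀ b ∈ X, b ∉ Y → G.Ed {g'} a b → ∃ e ∈ G.E, G.ends e = s(a, b) ∧ e = g := by
        rintro a ha b hb hbY ⟨e, he, -, hends⟩
        refine ⟨e, he, hends, ?_⟩
        by_contra hne
        exact hbY (hcl a ha b hb ⟨e, he, by simpa using hne, hends⟩)
      obtain ⟨a, ha, b, hb, h1, h2, h3⟩ := (hzc g').exit
        (fun w => if w ∈ Y then P w else ∃ α ∈ Y, α ∈ G.ends g ∧ P α) (by simp [huY, hP, Jn, Relation.ReflTransGen.refl])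
        (by simpa [show z ∈ Y from Finset.mem_filter.2 ⟨hz, hzc g⟩] using hnj)
      by_cases haY : a ∈ Y <;> by_cases hbY : b ∈ Y
      · simp only [haY, hbY, if_true] at h1 h2
        exact hcross a haY b hbY h1 h2 h3
      · simp only [haY, hbY, if_true, if_false] at h1 h2
        obtain ⟨e, he, hends, rfl⟩ := hout a haY b hb hbY h3
        exact h2 ⟨a, haY, by simp [hends], h1⟩
      · simp only [haY, hbY, if_true, if_false] at h1 h2
        obtain ⟨e, he, hends, rfl⟩ := hout b hbY a ha haY h3.symm
        obtain ⟨α, hα, hαe, hPα⟩ := h1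
        rw [hends, Sym2.mem_iff] at hαe
        rcases hαe with rfl | rfl
        exacts [h2 hPα, haY hα]
      · simp only [haY, hbY, if_false] at h1 h2
        exact h2 h1

theorem jn_class_aux (hA : G.ConnS A) (hC : G.ConnS C) (hd : Disjoint A C) (ha : a ∈ A) (hc : c ∈ C)
    (ha' : x ∈ A) (hc' : y ∈ C) (he : e ∈ G.E) (he' : f ∈ G.E) (h : G.ends e = s(a, c))
    (h' : G.ends f = s(x, y)) (hef : e ≠ f) (g : ℕ) :
    G.Jn {g} (A ∪ C) a x ∧ G.Jn {g} (A ∪ C) a c := by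
  have hd := Finset.disjoint_left.1 hd
  have hAu : A ⊆ A ∪ C := Finset.subset_union_left
  have hCu : C ⊆ A ∪ C := Finset.subset_union_right
  have jA : (∀ p ∈ A, ∀ q ∈ A, G.ends g ≠ s(p, q)) → G.Jn {g} (A ∪ C) a x := fun hg =>
    ((hA.2 a ha x ha').avoid hg).mono le_rfl hAu
  have jC : (∀ p ∈ C, ∀ q ∈ C, G.ends g ≠ s(p, q)) → G.Jn {g} (A ∪ C) y c := fun hg =>
    ((hC.2 y hc' c hc).avoid hg).mono le_rfl hCu
  have s1 : e ≠ g → G.Jn {g} (A ∪ C) a c := fun hne =>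
    .step (hAu ha) (hCu hc) ⟨e, he, by simpa using hne, h⟩
  have s2 : f ≠ g → G.Jn {g} (A ∪ C) x y := fun hne =>
    .step (hAu ha') (hCu hc') ⟨f, he', by simpa using hne, h'⟩
  have hnA : ∀ e, ∀ a ∈ A, ∀ c ∈ C, G.ends e = s(a, c) → ∀ p ∈ A, ∀ q ∈ A, G.ends e ≠ s(p, q) := by
    intro e a ha c hc h p hp q hq h2
    have : c ∈ G.ends e := by simp [h]
    rw [h2, Sym2.mem_iff] at this
    rcases this with rfl | rfl
    exacts [hd hp hc, hd hq hc]
  have hnC : ∀ e, ∀ a ∈ A, G.ends e = s(a, c) → ∀ p ∈ C, ∀ q ∈ C, G.ends e ≠ s(p, q) := by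
    intro e a ha h p hp q hq h2
    have : a ∈ G.ends e := by simp [h]
    rw [h2, Sym2.mem_iff] at this
    rcases this with rfl | rfl
    exacts [hd ha hp, hd ha hq]
  by_cases hg : ∀ p ∈ A, ∀ q ∈ A, G.ends g ≠ s(p, q)
  · refine ⟨jA hg, ?_⟩
    by_cases heg : e = g
    · subst heg
      exact (jA hg).trans ((s2 hef.symm).trans (jC (hnC e a ha h)))
    · exact s1 heg
  · have h1 : e ≠ g := by rintro rfl; exact hg (hnA e a ha c hc h)
    have h2 : f ≠ g := by rintro rfl; exact hg (hnA f x ha' y hc' h')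
    refine ⟨(s1 h1).trans ((jC ?_).symm.trans (s2 h2).symm), s1 h1⟩
    push Not at hg
    obtain ⟨p, hp, q, hq, hpq⟩ := hg
    intro p' hp' q' hq' h3
    have : p ∈ G.ends g := by simp [hpq]
    rw [h3, Sym2.mem_iff] at this
    rcases this with rfl | rfl
    exacts [hd hp hp', hd hp hq']

/-- A hub for two adjacent connected sets whose complement is connected. -/
structure Hub (G : MGraph) (A C U : Finset ℕ) : Prop where
  sub : U ⊆ A ∪ C
  two : G.TwoEC U
  cc : G.ConnS (G.V \ U)
  sep : ∀ a ∈ A, ∀ c ∈ C, G.Ed ∅ a c → a ∈ U ∨ c ∈ U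
  left : ∃ S ⊆ A ∪ U, A ⊆ S ∧ G.ConnS S ∧ ∃ x ∈ S, x ∈ U
  right : ∃ S ⊆ C ∪ U, C ⊆ S ∧ G.ConnS S ∧ ∃ x ∈ S, x ∈ U

theorem Conn2.exists_hub (hG : G.Conn2) (hA : G.ConnS A) (hC : G.ConnS C) (hAV : A ⊆ G.V) (hCV : C ⊆ G.V)
    (hd : Disjoint A C) (hR : G.ConnS (G.V \ (A ∪ C))) (ha : a ∈ A) (hc : c ∈ C) (hac : G.Ed ∅ a c) :
    ∃ U, G.Hub A C U := by
  obtain ⟨g, hg, -, hends⟩ := hac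
  by_cases hone : ∀ x ∈ A, ∀ y ∈ C, ∀ e ∈ G.E, G.ends e = s(x, y) → e = g
  · refine ⟨{a}, by simp [ha], twoEC_singleton G a, ?_, ?_, ⟨A, by simp, le_rfl, hA, a, ha, by simp⟩, ⟨insert a C, ?_, by simp, ?_, a, by simp⟩⟩
    · rw [Finset.sdiff_singleton_eq_erase]; exact hG.erase a (hAV ha)
    · rintro x hx y hy ⟨e, he, -, hxy⟩
      left
      obtain rfl := hone x hx y hy e he hxy
      have : a ∈ G.ends e := by simp [hends]
      rw [hxy, Sym2.mem_iff] at this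
      rcases this with rfl | rfl
      · simp
      · exact absurd hy (Finset.disjoint_left.1 hd ha)
    · rw [Finset.insert_eq, Finset.union_comm]
    · rw [Finset.insert_eq]
      exact (connS_singleton G a).union_edge hC (by simp) hc ⟨g, hg, by simp, hends⟩
  · push Not at hone
    obtain ⟨x, hx, y, hy, f, hf, hfe, hfg⟩ := hone
    have hXV : A ∪ C ⊆ G.V := Finset.union_subset hAV hCV
    obtain ⟨W, hW, hW2, hWc⟩ := exists_twoEC_class (G := G) (u := a) (X := A ∪ C) (Finset.mem_union_left _ ha)
    have hall : ∀ x ∈ A, ∀ y ∈ C, G.Ed ∅ x y → x ∈ W ∧ y ∈ W := by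
      rintro x' hx' y' hy' ⟨h, hh, -, hhe⟩
      have key : ∀ g', G.Jn {g'} (A ∪ C) a x' ∧ G.Jn {g'} (A ∪ C) x' y' := by
        intro g'
        by_cases hhg : h = g
        · subst hhg
          have hxx : x' = a ∧ y' = c := by
            rw [hends, Sym2.eq_iff] at hhe
            rcases hhe with ⟨h1, h2⟩ | ⟨h1, h2⟩
            · exact ⟨h1.symm, h2.symm⟩
            · exact absurd (h1 ▸ hy') (Finset.disjoint_left.1 hd ha)
          rw [hxx.1, hxx.2]
          exact ⟨.refl, (jn_class_aux hA hC hd ha hc hx hy hg hf hends hfe hfg.symm g').2⟩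
        · exact ⟨(jn_class_aux hA hC hd ha hc hx' hy' hg hh hends hhe (Ne.symm hhg) g').1,
            (jn_class_aux hA hC hd hx' hy' ha hc hh hg hhe hends hhg g').2⟩
      exact ⟨hWc x' (Finset.mem_union_left _ hx') fun g' => (key g').1,
        hWc y' (Finset.mem_union_right _ hy') fun g' => (key g').1.trans (key g').2⟩
    obtain ⟨o, ho⟩ := hR.1
    have hoW : o ∈ G.V \ W := Finset.sdiff_subset_sdiff le_rfl hW ho
    have hRC : G.V \ (A ∪ C) ⊆ G.Cmp (G.V \ W) o :=
      hR.subset_Cmp (Finset.sdiff_subset_sdiff le_rfl hW) ho (self_mem_Cmp hoW)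
    have hCV' : G.Cmp (G.V \ W) o ⊆ G.V := Cmp_subset.trans Finset.sdiff_subset
    have hWU : W ⊆ G.V \ G.Cmp (G.V \ W) o := fun z hz => Finset.mem_sdiff.2 ⟨hXV (hW hz), fun h =>
      (Finset.mem_sdiff.1 (Cmp_subset h)).2 hz⟩
    have hac := hall a ha c hc ⟨g, hg, by simp, hends⟩
    refine ⟨G.V \ G.Cmp (G.V \ W) o, ?_, twoEC_sdiff_Cmp hG.twoEC hW2 (hW.trans hXV) o, ?_,
      fun x hx y hy hxy => .inl (hWU (hall x hx y hy hxy).1),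
      ⟨A, Finset.subset_union_left, le_rfl, hA, a, ha, hWU hac.1⟩,
      ⟨C, Finset.subset_union_left, le_rfl, hC, c, hc, hWU hac.2⟩⟩
    · intro z hz
      have hz := Finset.mem_sdiff.1 hz
      by_contra hzn
      exact hz.2 (hRC (Finset.mem_sdiff.2 ⟨hz.1, hzn⟩))
    · rw [Finset.sdiff_sdiff_eq_self hCV']
      exact connS_Cmp hoW

end MGraph

end

section

namespace MGraph

variable {G H : MGraph} {A C O S T X W Y Z : Finset ℕ} {L U B : ℕ → Finset ℕ}
  {a b c d u v x y e f g i j k l m n r t q : ℕ}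

/-- A long linear strand of connected levels whose two ends are attached to the connected set `O`. -/
structure Strand (G : MGraph) (q : ℕ) (O : Finset ℕ) (L : ℕ → Finset ℕ) : Prop where
  connO : G.ConnS O
  conn : ∀ k < 2 * q, G.ConnS (L k)
  subO : O ⊆ G.V
  sub : ∀ k < 2 * q, L k ⊆ G.V
  dL : ∀ k < 2 * q, ∀ l < 2 * q, k ≠ l → Disjoint (L k) (L l)
  dO : ∀ k < 2 * q, Disjoint O (L k)
  cover : ∀ v ∈ G.V, v ∈ O ∨ ∃ k < 2 * q, v ∈ L k
  lip : ∀ k < 2 * q, ∀ l < 2 * q, ∀ a ∈ L k, ∀ b ∈ L l, G.Ed ∅ a b → l ≤ k + 1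
  step : ∀ k, k + 1 < 2 * q → ∃ a ∈ L k, ∃ b ∈ L (k + 1), G.Ed ∅ a b
  attach : ∀ a ∈ O, ∀ k < 2 * q, ∀ b ∈ L k, G.Ed ∅ a b → k = 0 ∨ k + 1 = 2 * q
  bot : ∃ a ∈ O, ∃ b ∈ L 0, G.Ed ∅ a b
  top : ∃ a ∈ O, ∃ b ∈ L (2 * q - 1), G.Ed ∅ a b

theorem Strand.lower (h : Strand G q O L) (k : ℕ) (hk : k ≤ 2 * q) :
    G.ConnS (O ∪ (Finset.range k).biUnion L) := by
  induction k with
  | zero => simpa using h.connO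
  | succ k ih =>
    have hex : ∃ a ∈ O ∪ (Finset.range k).biUnion L, ∃ b ∈ L k, G.Ed ∅ a b := by
      cases k with
      | zero => simpa using h.bot
      | succ k =>
        obtain ⟨a, ha, b, hb, hab⟩ := h.step k (by omega)
        exact ⟨a, Finset.mem_union_right _ (Finset.mem_biUnion.2 ⟨k, by simp, ha⟩), b, hb, hab⟩
    obtain ⟨a, ha, b, hb, hab⟩ := hex
    have := (ih (by omega)).union_edge (h.conn k (by omega)) ha hb hab
    rwa [Finset.range_add_one, Finset.biUnion_insert, Finset.union_comm (L k), ← Finset.union_assoc]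

theorem Strand.upper (h : Strand G q O L) (k : ℕ) (hk : k ≤ 2 * q) :
    G.ConnS (O ∪ (Finset.Ico (2 * q - k) (2 * q)).biUnion L) := by
  induction k with
  | zero => simpa using h.connO
  | succ k ih =>
    have hex : ∃ a ∈ O ∪ (Finset.Ico (2 * q - k) (2 * q)).biUnion L, ∃ b ∈ L (2 * q - (k + 1)), G.Ed ∅ a b := by
      cases k with
      | zero => simpa using h.top
      | succ k =>
        obtain ⟨a, ha, b, hb, hab⟩ := h.step (2 * q - (k + 1 + 1)) (by omega)
        rw [show 2 * q - (k + 1 + 1) + 1 = 2 * q - (k + 1) by omega] at hb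
        exact ⟨b, Finset.mem_union_right _ (Finset.mem_biUnion.2 ⟨_, by simp; omega, hb⟩), a, ha, hab.symm⟩
    obtain ⟨a, ha, b, hb, hab⟩ := hex
    have := (ih (by omega)).union_edge (h.conn (2 * q - (k + 1)) (by omega)) ha hb hab
    have e1 : Finset.Ico (2 * q - (k + 1)) (2 * q) = insert (2 * q - (k + 1)) (Finset.Ico (2 * q - k) (2 * q)) := by
      ext z; simp only [Finset.mem_Ico, Finset.mem_insert]; omega
    rwa [e1, Finset.biUnion_insert, Finset.union_comm (L _), ← Finset.union_assoc]

theorem Strand.eq_level (h : Strand G q O L) (hk : k < 2 * q) (hl : l < 2 * q) (h1 : v ∈ L k) (h2 : v ∈ L l) :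
    k = l := by
  by_contra hne
  exact Finset.disjoint_left.1 (h.dL k hk l hl hne) h1 h2

theorem Strand.connS_compl (h : Strand G q O L) (hj : j < q) :
    G.ConnS (G.V \ (L (2 * j) ∪ L (2 * j + 1))) := by
  obtain ⟨o, ho⟩ := h.connO.1
  have := (h.lower (2 * j) (by omega)).union (h.upper (2 * q - (2 * j + 2)) (by omega))
    (Finset.mem_union_left _ ho) (Finset.mem_union_left _ ho)
  convert this using 1
  ext z
  simp only [Finset.mem_sdiff, Finset.mem_union, Finset.mem_biUnion, Finset.mem_range, Finset.mem_Ico, not_or]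
  constructor
  · rintro ⟨hz, h1, h2⟩
    rcases h.cover z hz with hz | ⟨k, hk, hz⟩
    · exact .inl (.inl hz)
    · have : k ≠ 2 * j := by rintro rfl; exact h1 hz
      have : k ≠ 2 * j + 1 := by rintro rfl; exact h2 hz
      rcases Nat.lt_or_ge k (2 * j) with h' | h'
      · exact .inl (.inr ⟨k, h', hz⟩)
      · exact .inr (.inr ⟨k, ⟨by omega, by omega⟩, hz⟩)
  · have hO : ∀ k < 2 * q, z ∈ O → z ∉ L k := fun k hk hz => Finset.disjoint_left.1 (h.dO k hk) hz
    have hL : ∀ k < 2 * q, ∀ l < 2 * q, k ≠ l → z ∈ L k → z ∉ L l := fun k hk l hl hne hz =>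
      Finset.disjoint_left.1 (h.dL k hk l hl hne) hz
    rintro ((hz | ⟨k, hk, hz⟩) | (hz | ⟨k, hk, hz⟩))
    · exact ⟨h.subO hz, hO _ (by omega) hz, hO _ (by omega) hz⟩
    · exact ⟨h.sub k (by omega) hz, hL k (by omega) _ (by omega) (by omega) hz,
        hL k (by omega) _ (by omega) (by omega) hz⟩
    · exact ⟨h.subO hz, hO _ (by omega) hz, hO _ (by omega) hz⟩
    · exact ⟨h.sub k (by omega) hz, hL k (by omega) _ (by omega) (by omega) hz,
        hL k (by omega) _ (by omega) (by omega) hz⟩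

theorem nx_inj (h : nx q i = nx q j) : i = j := by
  unfold nx at h; split at h <;> split at h <;> omega

theorem exists_nx (hj : j < q) : ∃ i < q, nx q i = j := by
  by_cases h0 : j = 0
  · exact ⟨q - 1, by omega, by unfold nx; split <;> omega⟩
  · exact ⟨j - 1, by omega, by unfold nx; split <;> omega⟩

/-- The blob between consecutive hubs of a strand. -/
def blob (q : ℕ) (O : Finset ℕ) (L U : ℕ → Finset ℕ) (i : ℕ) : Finset ℕ :=
  (if i + 1 = q then O else ∅) ∪ (L (2 * i + 1) \ U i ∪ L (2 * nx q i) \ U (nx q i))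

theorem Strand.ring (h : Strand G q O L) (hq : 2 ≤ q)
    (hU : ∀ j < q, G.Hub (L (2 * j)) (L (2 * j + 1)) (U j)) : Ring G q U (blob q O L U) := by
  have hmO : ∀ z, (∃ i < q, z ∈ (if i + 1 = q then O else ∅)) → z ∈ O := by
    rintro z ⟨i, hi, hz⟩; split at hz
    exacts [hz, absurd hz (by simp)]
  have hUL : ∀ j < q, ∀ z ∈ U j, z ∈ L (2 * j) ∨ z ∈ L (2 * j + 1) := fun j hj z hz => by
    simpa using (hU j hj).sub hz
  have hOL : ∀ z ∈ O, ∀ k < 2 * q, z ∉ L k := fun z hz k hk => Finset.disjoint_left.1 (h.dO k hk) hz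
  have hlev : ∀ k < 2 * q, ∀ l < 2 * q, ∀ z, z ∈ L k → z ∈ L l → k = l := fun k hk l hl z => h.eq_level hk hl
  have hnx : ∀ i < q, nx q i < q := fun i hi => nx_lt hi
  have mem_blob : ∀ i z, z ∈ blob q O L U i ↔ (i + 1 = q ∧ z ∈ O) ∨ (z ∈ L (2 * i + 1) ∧ z ∉ U i) ∨
      (z ∈ L (2 * nx q i) ∧ z ∉ U (nx q i)) := by
    intro i z
    unfold blob
    simp only [Finset.mem_union, Finset.mem_sdiff]
    split <;> simp [*]
  have mO : ∀ z ∈ O, z ∈ blob q O L U (q - 1) := fun z hz => (mem_blob _ _).2 (.inl ⟨by omega, hz⟩)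
  have mR : ∀ j, ∀ z ∈ L (2 * j + 1), z ∈ U j ∨ z ∈ blob q O L U j := fun j z hz => by
    by_cases hzU : z ∈ U j
    · exact .inl hzU
    · exact .inr ((mem_blob _ _).2 (.inr (.inl ⟨hz, hzU⟩)))
  have mL : ∀ i, ∀ z ∈ L (2 * nx q i), z ∈ blob q O L U i ∨ z ∈ U (nx q i) := fun i z hz => by
    by_cases hzU : z ∈ U (nx q i)
    · exact .inr hzU
    · exact .inl ((mem_blob _ _).2 (.inr (.inr ⟨hz, hzU⟩)))
  refine ⟨fun j hj => (hU j hj).two, fun j hj => (hU j hj).sub.trans (Finset.union_subset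
    (h.sub _ (by omega)) (h.sub _ (by omega))), fun j hj => (hU j hj).cc, ?_, ?_, ?_, ?_, ?_, ?_, ?_⟩
  · intro i hi j hj hij
    rw [Finset.disjoint_left]
    intro z h1 h2
    rcases hUL i hi z h1 with h1 | h1 <;> rcases hUL j hj z h2 with h2 | h2
    all_goals
      have := hlev _ (by omega) _ (by omega) z h1 h2
      omega
  · intro i hi j hj hij
    rw [Finset.disjoint_left]
    intro z h1 h2
    rw [mem_blob] at h1 h2
    have hi' := hnx i hi
    have hj' := hnx j hj
    rcases h1 with ⟨h0, h1⟩ | ⟨h1, -⟩ | ⟨h1, -⟩ <;> rcases h2 with ⟨h0', h2⟩ | ⟨h2, -⟩ | ⟨h2, -⟩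
    · omega
    · exact hOL z h1 _ (by omega) h2
    · exact hOL z h1 _ (by omega) h2
    · exact hOL z h2 _ (by omega) h1
    · have := hlev _ (by omega) _ (by omega) z h1 h2; omega
    · have := hlev _ (by omega) _ (by omega) z h1 h2; omega
    · exact hOL z h2 _ (by omega) h1
    · have := hlev _ (by omega) _ (by omega) z h1 h2; omega
    · have := hlev _ (by omega) _ (by omega) z h1 h2
      exact hij (nx_inj (q := q) (by omega))
  · intro i hi j hj
    rw [Finset.disjoint_left]
    intro z h1 h2
    rw [mem_blob] at h2
    have hj' := hnx j hj
    rcases h2 with ⟨h0, h2⟩ | ⟨h2, h3⟩ | ⟨h2, h3⟩ <;> rcases hUL i hi z h1 with h4 | h4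
    · exact hOL z h2 _ (by omega) h4
    · exact hOL z h2 _ (by omega) h4
    · have := hlev _ (by omega) _ (by omega) z h4 h2; omega
    · have := hlev _ (by omega) _ (by omega) z h4 h2
      obtain rfl : i = j := by omega
      exact h3 h1
    · have := hlev _ (by omega) _ (by omega) z h4 h2
      obtain rfl : i = nx q j := by omega
      exact h3 h1
    · have := hlev _ (by omega) _ (by omega) z h4 h2; omega
  · intro i hi z hz
    have hi' := hnx i hi
    rw [mem_blob] at hz
    rcases hz with ⟨-, hz⟩ | ⟨hz, -⟩ | ⟨hz, -⟩
    exacts [h.subO hz, h.sub _ (by omega) hz, h.sub _ (by omega) hz]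
  · intro v hv
    rcases h.cover v hv with hv | ⟨k, hk, hv⟩
    · exact ⟨q - 1, by omega, .inr (mO v hv)⟩
    · rcases Nat.even_or_odd' k with ⟨j, rfl | rfl⟩
      · obtain ⟨i, hi, rfl⟩ := exists_nx (q := q) (j := j) (by omega)
        rcases mL i v hv with h' | h'
        exacts [⟨i, hi, .inr h'⟩, ⟨_, hnx i hi, .inl h'⟩]
      · exact ⟨j, by omega, mR j v hv⟩
  · have hOe : ∀ a ∈ O, ∀ b, G.Ed ∅ a b →
        b ∈ U (q - 1) ∪ blob q O L U (q - 1) ∪ U (nx q (q - 1)) := by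
      intro a ha b hab
      simp only [Finset.mem_union]
      rcases h.cover b hab.mem_right with hb | ⟨l, hl, hb⟩
      · exact .inl (.inr (mO b hb))
      · rcases h.attach a ha l hl b hb hab with rfl | hl'
        · rcases mL (q - 1) b (by rwa [show nx q (q - 1) = 0 by unfold nx; split <;> omega]) with h' | h'
          exacts [.inl (.inr h'), .inr h']
        · obtain rfl : l = 2 * (q - 1) + 1 := by omega
          exact .inl (mR _ b hb)
    have hLe : ∀ k < 2 * q, ∀ l < 2 * q, k ≤ l → ∀ a ∈ L k, ∀ b ∈ L l, G.Ed ∅ a b → ∃ i < q,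
        a ∈ U i ∪ blob q O L U i ∪ U (nx q i) ∧ b ∈ U i ∪ blob q O L U i ∪ U (nx q i) := by
      intro k hk l hl hkl a ha b hb hab
      have hlip := h.lip k hk l hl a ha b hb hab
      simp only [Finset.mem_union]
      rcases Nat.even_or_odd' k with ⟨j, rfl | rfl⟩
      · obtain ⟨i, hi, rfl⟩ := exists_nx (q := q) (j := j) (by omega)
        have hor : ∀ z ∈ L (2 * nx q i), (z ∈ U i ∨ z ∈ blob q O L U i) ∨ z ∈ U (nx q i) := fun z hz => by
          rcases mL i z hz with h' | h'
          exacts [.inl (.inr h'), .inr h']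
        obtain rfl | rfl : l = 2 * nx q i ∨ l = 2 * nx q i + 1 := by omega
        · exact ⟨i, hi, hor a ha, hor b hb⟩
        · rcases (hU _ (hnx i hi)).sep a ha b hb hab with haU | hbU
          · exact ⟨_, hnx i hi, .inl (.inl haU), .inl (mR _ b hb)⟩
          · exact ⟨i, hi, hor a ha, .inr hbU⟩
      · obtain rfl | rfl : l = 2 * j + 1 ∨ l = 2 * j + 2 := by omega
        · exact ⟨j, by omega, .inl (mR _ a ha), .inl (mR _ b hb)⟩
        · refine ⟨j, by omega, .inl (mR _ a ha), ?_⟩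
          have := mL j b (by rwa [show nx q j = j + 1 by unfold nx; split <;> omega])
          rcases this with h' | h'
          exacts [.inl (.inr h'), .inr h']
    intro a b hab
    rcases h.cover a hab.mem_left with ha | ⟨k, hk, ha⟩
    · exact ⟨q - 1, by omega, by simp only [Finset.mem_union]; exact .inl (.inr (mO a ha)), hOe a ha b hab⟩
    rcases h.cover b hab.mem_right with hb | ⟨l, hl, hb⟩
    · exact ⟨q - 1, by omega, hOe b hb a hab.symm, by simp only [Finset.mem_union]; exact .inl (.inr (mO b hb))⟩
    rcases le_total k l with hkl | hkl
    · exact hLe k hk l hl hkl a ha b hb hab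
    · obtain ⟨i, hi, h1, h2⟩ := hLe l hl k hk hkl b hb a ha hab.symm
      exact ⟨i, hi, h2, h1⟩
  · intro i hi
    have hi' := hnx i hi
    obtain ⟨S, hS, hLS, hSc, x, hxS, hxU⟩ := (hU i hi).right
    obtain ⟨T, hT, hLT, hTc, y, hyT, hyU⟩ := (hU _ hi').left
    have hS' : S ⊆ U i ∪ blob q O L U i ∪ U (nx q i) := fun z hz => by
      simp only [Finset.mem_union]
      rcases Finset.mem_union.1 (hS hz) with h' | h'
      exacts [.inl (mR _ z h'), .inl (.inl h')]
    have hT' : T ⊆ U i ∪ blob q O L U i ∪ U (nx q i) := fun z hz => by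
      simp only [Finset.mem_union]
      rcases Finset.mem_union.1 (hT hz) with h' | h'
      · rcases mL i z h' with h' | h'
        exacts [.inl (.inr h'), .inr h']
      · exact .inr h'
    by_cases hlast : i + 1 = q
    · have hn0 : nx q i = 0 := by simp [nx, hlast]
      have hi1 : i = q - 1 := by omega
      obtain ⟨a, ha, b, hb, hab⟩ := h.top
      obtain ⟨c, hc, d, hd, hcd⟩ := h.bot
      rw [show 2 * q - 1 = 2 * i + 1 by omega] at hb
      have hdT : d ∈ T := hLT (by rw [hn0]; exact hd)
      have h1 := (hSc.union_edge h.connO (hLS hb) ha hab.symm).union_edge hTc (Finset.mem_union_right _ hc) hdT hcd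
      refine ⟨S ∪ O ∪ T, Finset.union_subset (Finset.union_subset hS' ?_) hT', h1, ⟨x, by simp [hxS], hxU⟩, y, by simp [hyT], hyU⟩
      intro z hz
      simp only [Finset.mem_union]
      exact .inl (.inr (hi1 ▸ mO z hz))
    · have hn1 : nx q i = i + 1 := by simp [nx, hlast]
      obtain ⟨a, ha, b, hb, hab⟩ := h.step (2 * i + 1) (by omega)
      exact ⟨S ∪ T, Finset.union_subset hS' hT', hSc.union_edge hTc (hLS ha)
        (hLT (by rw [hn1]; exact hb)) hab, ⟨x, by simp [hxS], hxU⟩, y, by simp [hyT], hyU⟩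

theorem Strand.good (hG : G.Conn2) (h : Strand G q O L) (hr : 1 ≤ r) (hq : r + 2 ≤ q) : Good r G := by
  have hex : ∀ j < q, ∃ U, G.Hub (L (2 * j)) (L (2 * j + 1)) U := by
    intro j hj
    obtain ⟨a, ha, c, hc, hac⟩ := h.step (2 * j) (by omega)
    exact hG.exists_hub (h.conn _ (by omega)) (h.conn _ (by omega)) (h.sub _ (by omega)) (h.sub _ (by omega))
      (h.dL _ (by omega) _ (by omega) (by omega)) (h.connS_compl hj) ha hc hac
  choose! U hU using hex
  exact (h.ring (by omega) hU).good hG hr hq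

end MGraph

end

section

namespace MGraph

variable {G H : MGraph} {A C F O S T X W Y Z K : Finset ℕ} {L U B : ℕ → Finset ℕ}
  {a b c u v x y e f g h i j k l m n r t q : ℕ}

/-- Vertices at distance at most `n` from `A` when the edges of `F` are deleted. -/
def layer (G : MGraph) (F A : Finset ℕ) : ℕ → Set ℕ
  | 0 => A
  | n + 1 => layer G F A n ∪ {v | ∃ u ∈ layer G F A n, G.Ed F u v}

theorem exists_dist (hA : A.Nonempty) (hAV : A ⊆ G.V) (hV : ∀ u ∈ G.V, ∀ v ∈ G.V, G.Jn F G.V u v) :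
    ∃ d : ℕ → ℕ, (∀ a ∈ A, d a = 0) ∧ (∀ v ∈ G.V, d v = 0 → v ∈ A) ∧
      (∀ u v, G.Ed F u v → d v ≤ d u + 1) ∧
      ∀ v ∈ G.V, ∀ n, d v = n + 1 → ∃ u, d u = n ∧ G.Ed F u v := by
  obtain ⟨a, ha⟩ := hA
  have hex : ∀ v ∈ G.V, ∃ n, v ∈ layer G F A n := by
    intro v hv
    have := hV a (hAV ha) v hv
    induction this with
    | refl => exact ⟨0, ha⟩
    | tail _ hs ih =>
      obtain ⟨n, hn⟩ := ih hs.1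
      exact ⟨n + 1, Or.inr ⟨_, hn, hs.2.2⟩⟩
  have hin : ∀ v ∈ G.V, v ∈ layer G F A (sInf {n | v ∈ layer G F A n}) := fun v hv => Nat.sInf_mem (hex v hv)
  refine ⟨fun v => sInf {n | v ∈ layer G F A n}, fun a ha => ?_, fun v hv h0 => ?_, fun u v huv => ?_,
    fun v hv n hn => ?_⟩
  · exact Nat.sInf_eq_zero.2 (Or.inl ha)
  · have := hin v hv
    simp only at h0
    rwa [h0] at this
  · exact Nat.sInf_le (Or.inr ⟨u, hin u huv.mem_left, huv⟩)
  · have h1 := hin v hv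
    simp only at hn
    rw [hn] at h1
    rcases h1 with h1 | ⟨u, hu, huv⟩
    · have := Nat.sInf_le (s := {n | v ∈ layer G F A n}) h1
      omega
    · refine ⟨u, le_antisymm (Nat.sInf_le hu) ?_, huv⟩
      have := Nat.sInf_le (s := {n | v ∈ layer G F A n}) (m := sInf {n | u ∈ layer G F A n} + 1)
        (Or.inr ⟨u, hin u huv.mem_left, huv⟩)
      show n ≤ sInf {n | u ∈ layer G F A n}
      omega

theorem ConnS.lipschitz (hK : G.ConnS K) {d : ℕ → ℕ} (hd : ∀ u ∈ K, ∀ v ∈ K, G.Ed ∅ u v → d v ≤ d u + 1)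
    (hu : u ∈ K) (hv : v ∈ K) : d v < d u + K.card := by
  by_contra hlt
  have hsub : Finset.Icc (d u) (d v) ⊆ K.image d := by
    intro t ht
    rw [Finset.mem_Icc] at ht
    by_contra hno
    have hne : ∀ x ∈ K, d x ≠ t := fun x hx he => hno (Finset.mem_image.2 ⟨x, hx, he⟩)
    obtain ⟨a, ha, b, hb, h1, h2, h3⟩ := hK.cut (fun x => d x < t) hu
      (by have := hne u hu; omega) hv (by omega)
    have := hd a ha b hb h3
    have := hne b hb
    omega
  have h1 := (Finset.card_le_card hsub).trans Finset.card_image_le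
  rw [Nat.card_Icc] at h1
  have := hK.1.card_pos
  omega

/-- A shortest way back to `A`, avoiding the edge `g`, from the end `b` of `g` outside `A`. -/
structure Geo (G : MGraph) (A : Finset ℕ) (g a b : ℕ) (d p : ℕ → ℕ) (n : ℕ) : Prop where
  two : G.TwoEC A
  sub : A ⊆ G.V
  conn : G.ConnS (G.V \ A)
  edge : g ∈ G.E
  ends : G.ends g = s(a, b)
  ha : a ∈ A
  hb : b ∈ G.V
  hbA : b ∉ A
  d0 : ∀ a ∈ A, d a = 0
  dV : ∀ v ∈ G.V, d v = 0 → v ∈ A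
  lip : ∀ u v, G.Ed {g} u v → d v ≤ d u + 1
  dp : ∀ i ≤ n, d (p i) = i
  pV : ∀ i ≤ n, p i ∈ G.V
  pn : p n = b
  step : ∀ i < n, G.Ed {g} (p i) (p (i + 1))

theorem exists_geo (hG : G.Conn2) (hA : G.TwoEC A) (hAV : A ⊆ G.V) (hB : G.ConnS (G.V \ A)) (hg : g ∈ G.E)
    (hends : G.ends g = s(a, b)) (ha : a ∈ A) (hb : b ∈ G.V) (hbA : b ∉ A) :
    ∃ d p n, Geo G A g a b d p n := by
  obtain ⟨d, h0, hV, hl, hs⟩ := exists_dist (F := {g}) hA.1 hAV (hG.twoEC.2 g)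
  have key : ∀ n, ∀ b ∈ G.V, d b = n → ∃ p : ℕ → ℕ, (∀ i ≤ n, d (p i) = i) ∧ (∀ i ≤ n, p i ∈ G.V) ∧ p n = b ∧
      ∀ i < n, G.Ed {g} (p i) (p (i + 1)) := by
    intro n
    induction n with
    | zero =>
      intro b hb hd
      refine ⟨fun _ => b, fun i hi => ?_, fun _ _ => hb, rfl, fun i hi => by omega⟩
      simp only [hd]; omega
    | succ n ih =>
      intro b hb hd
      obtain ⟨u, hu, hub⟩ := hs b hb n hd
      obtain ⟨p, h1, h2, h3, h4⟩ := ih u hub.mem_left hu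
      refine ⟨fun i => if i ≤ n then p i else b, fun i hi => ?_, fun i hi => ?_, by simp, fun i hi => ?_⟩
      · by_cases hin : i ≤ n
        · simpa [hin] using h1 i hin
        · simp only [hin, if_false, hd]; omega
      · by_cases hin : i ≤ n
        · simpa [hin] using h2 i hin
        · simpa [hin] using hb
      · by_cases hin : i < n
        · simpa [hin, hin.le, Nat.succ_le_iff.2 hin] using h4 i hin
        · have : i = n := by omega
          subst this
          simpa [h3] using hub
  obtain ⟨p, h1, h2, h3, h4⟩ := key (d b) b hb rfl
  exact ⟨d, p, d b, hA, hAV, hB, hg, hends, ha, hb, hbA, h0, hV, hl, h1, h2, h3, h4⟩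

variable {d p : ℕ → ℕ}

/-- The vertices of the geodesic outside `A`. -/
def arc (p : ℕ → ℕ) (n : ℕ) : Finset ℕ := (Finset.Icc 1 n).image p

theorem mem_arc : x ∈ arc p n ↔ ∃ i, 1 ≤ i ∧ i ≤ n ∧ p i = x := by
  simp [arc, and_assoc]

namespace Geo

theorem p0 (h : Geo G A g a b d p n) : p 0 ∈ A := h.dV _ (h.pV 0 (by omega)) (h.dp 0 (by omega))

theorem one_le (h : Geo G A g a b d p n) : 1 ≤ n := by
  by_contra h1
  have h2 : n = 0 := by omega
  have := h.p0
  rw [← h2, h.pn] at this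
  exact h.hbA this

theorem pA (h : Geo G A g a b d p n) (h1 : 1 ≤ i) (h2 : i ≤ n) : p i ∉ A := by
  intro h3
  have := h.d0 _ h3
  rw [h.dp i h2] at this
  omega

theorem arc_sub (h : Geo G A g a b d p n) : arc p n ⊆ G.V \ A := by
  intro x hx
  obtain ⟨i, h1, h2, rfl⟩ := mem_arc.1 hx
  exact Finset.mem_sdiff.2 ⟨h.pV i h2, h.pA h1 h2⟩

theorem b_mem (h : Geo G A g a b d p n) : b ∈ arc p n := mem_arc.2 ⟨n, h.one_le, le_rfl, h.pn⟩

theorem jn_arc (h : Geo G A g a b d p n) (hX : ∀ k, i ≤ k → k ≤ j → p k ∈ X) (hij : i ≤ j) (hj : j ≤ n) :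
    G.Jn {g} X (p i) (p j) := by
  induction j, hij using Nat.le_induction with
  | base => exact .refl
  | succ j hij ih =>
    exact (ih (fun k h1 h2 => hX k h1 (by omega)) (by omega)).trans
      (.step (hX j hij (by omega)) (hX _ (by omega) le_rfl) (h.step j (by omega)))

theorem twoEC (h : Geo G A g a b d p n) : G.TwoEC (A ∪ arc p n) := by
  have hX : ∀ k ≤ n, p k ∈ A ∪ arc p n := by
    intro k hk
    rcases Nat.eq_zero_or_pos k with rfl | h0
    · exact Finset.mem_union_left _ h.p0
    · exact Finset.mem_union_right _ (mem_arc.2 ⟨k, h0, hk, rfl⟩)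
  have hj : G.Jn {g} (A ∪ arc p n) a b := by
    have h1 := (h.two.2 g a h.ha _ h.p0).mono subset_rfl (Y := A ∪ arc p n) Finset.subset_union_left
    have h2 := h.jn_arc (X := A ∪ arc p n) (i := 0) (j := n) (fun k _ hk => hX k hk) (by omega) le_rfl
    rw [h.pn] at h2
    exact h1.trans h2
  obtain ⟨U, hU, haU, hbU, hU2⟩ := exists_twoEC_of_edge h.edge h.ends (Finset.mem_union_left _ h.ha)
    (Finset.mem_union_right _ h.b_mem) hj
  have h3 : A ∪ arc p n = A ∪ U := by
    refine subset_antisymm (Finset.union_subset Finset.subset_union_left fun x hx => ?_)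
      (Finset.union_subset Finset.subset_union_left hU)
    refine Finset.mem_union_right _ ?_
    obtain ⟨i, h1, h2, rfl⟩ := mem_arc.1 hx
    by_contra hiU
    have hin : i < n := by
      rcases h2.lt_or_eq with h2 | rfl
      · exact h2
      · exact absurd (h.pn ▸ hbU) hiU
    obtain ⟨x, hx, y, hy, hPx, hPy, he⟩ := hU2.cut g (fun x => i < d x) hbU
      (by show i < d b; rw [← h.pn, h.dp n le_rfl]; exact hin) haU (by rw [h.d0 _ h.ha]; omega)
    have hyi : d y ≠ i := by
      intro hyi
      rcases Finset.mem_union.1 (hU hy) with hyA | hyC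
      · have := h.d0 _ hyA; omega
      · obtain ⟨j, _, hj2, rfl⟩ := mem_arc.1 hyC
        rw [h.dp j hj2] at hyi
        exact hiU (hyi ▸ hy)
    have := h.lip _ _ he.symm
    omega
  rw [h3]
  exact h.two.union hU2 h.ha haU

end Geo

end MGraph

end

section

namespace MGraph

variable {G H : MGraph} {A C F O S T X W Y Z K : Finset ℕ} {L U B : ℕ → Finset ℕ}
  {a b c u v w x y e f g h i j k l m n r t q : ℕ} {d p : ℕ → ℕ}

/-- The vertices off both `A` and the geodesic. -/
abbrev Geo.rest (G : MGraph) (A : Finset ℕ) (p : ℕ → ℕ) (n : ℕ) : Finset ℕ := (G.V \ A) \ arc p n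

/-- The least distance to `A` of a geodesic vertex adjacent to the component of `w`. -/
def Geo.foot (G : MGraph) (A : Finset ℕ) (d p : ℕ → ℕ) (n w : ℕ) : ℕ :=
  if w ∈ arc p n then d w
  else sInf {t | ∃ c ∈ arc p n, d c = t ∧ ∃ x ∈ G.Cmp (Geo.rest G A p n) w, G.Ed ∅ x c}

/-- The level of `w` for windows of width `s`. -/
def Geo.lev (G : MGraph) (A : Finset ℕ) (d p : ℕ → ℕ) (n s q w : ℕ) : ℕ :=
  min ((Geo.foot G A d p n w - 1) / s) (2 * q - 1)

namespace Geo

theorem foot_arc (hw : w ∈ arc p n) : foot G A d p n w = d w := by simp [foot, hw]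

theorem foot_rest (hG : Geo G A g a b d p n) (hw : w ∈ rest G A p n) :
    ∃ c ∈ arc p n, d c = foot G A d p n w ∧ ∃ x ∈ G.Cmp (rest G A p n) w, G.Ed ∅ x c := by
  have h1 := (Finset.mem_sdiff.1 hw).2
  obtain ⟨x, hx, c, hc, hxc⟩ := Cmp_exit hG.conn hG.arc_sub ⟨b, hG.b_mem⟩ hw
  have := Nat.sInf_mem (s := {t | ∃ c ∈ arc p n, d c = t ∧ ∃ x ∈ G.Cmp (rest G A p n) w, G.Ed ∅ x c})
    ⟨d c, c, hc, rfl, x, hx, hxc⟩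
  simpa [foot, h1] using this

theorem foot_le (hw : w ∈ rest G A p n) (hx : x ∈ G.Cmp (rest G A p n) w) (hc : c ∈ arc p n)
    (hxc : G.Ed ∅ x c) : foot G A d p n w ≤ d c := by
  have h1 := (Finset.mem_sdiff.1 hw).2
  simp only [foot, h1, if_false]
  exact Nat.sInf_le ⟨c, hc, rfl, x, hx, hxc⟩

theorem foot_Cmp (hw : w ∈ rest G A p n) (hx : x ∈ G.Cmp (rest G A p n) w) :
    foot G A d p n x = foot G A d p n w := by
  have h1 := (Finset.mem_sdiff.1 hw).2
  have h2 := (Finset.mem_sdiff.1 (Cmp_subset hx)).2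
  simp only [foot, h1, h2, if_false, Cmp_eq hx]

theorem ed_rest (hG : Geo G A g a b d p n) (hx : x ∈ rest G A p n) (h : G.Ed ∅ x y) : G.Ed {g} x y := by
  obtain ⟨e, he, -, hends⟩ := h
  refine ⟨e, he, ?_, hends⟩
  rw [Finset.mem_singleton]
  rintro rfl
  rw [hG.ends] at hends
  have h1 := Finset.mem_sdiff.1 hx
  rcases Sym2.eq_iff.1 hends with ⟨rfl, _⟩ | ⟨_, rfl⟩
  · exact (Finset.mem_sdiff.1 h1.1).2 hG.ha
  · exact h1.2 hG.b_mem

theorem d_Cmp (hG : Geo G A g a b d p n) (hs : ∀ w ∈ rest G A p n, (G.Cmp (rest G A p n) w).card ≤ h)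
    (hw : w ∈ rest G A p n) (hx : x ∈ G.Cmp (rest G A p n) w) (hy : y ∈ G.Cmp (rest G A p n) w) :
    d y < d x + h := by
  have := (connS_Cmp (G := G) hw).lipschitz (d := d)
    (fun u hu v _ huv => hG.lip u v (hG.ed_rest (Cmp_subset hu) huv)) hx hy
  have := hs w hw
  omega

theorem foot_bound (hG : Geo G A g a b d p n) (hs : ∀ w ∈ rest G A p n, (G.Cmp (rest G A p n) w).card ≤ h)
    (hw : w ∈ rest G A p n) : foot G A d p n w ≤ d w + h := by
  obtain ⟨c, hc, h1, x, hx, hxc⟩ := hG.foot_rest hw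
  have h2 := hG.d_Cmp hs hw (self_mem_Cmp hw) hx
  have h3 := hG.lip _ _ (hG.ed_rest (Cmp_subset hx) hxc)
  omega

theorem foot_lip (hG : Geo G A g a b d p n) (hs : ∀ w ∈ rest G A p n, (G.Cmp (rest G A p n) w).card ≤ h)
    (hu : u ∈ G.V \ A) (hv : v ∈ G.V \ A) (huv : G.Ed ∅ u v) :
    foot G A d p n v ≤ foot G A d p n u + (h + 1) := by
  by_cases hu' : u ∈ arc p n
  · by_cases hv' : v ∈ arc p n
    · rw [foot_arc hu', foot_arc hv']
      obtain ⟨e, he, -, hends⟩ := huv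
      have := hG.lip u v ⟨e, he, by
        rw [Finset.mem_singleton]
        rintro rfl
        rw [hG.ends] at hends
        rcases Sym2.eq_iff.1 hends with ⟨rfl, _⟩ | ⟨rfl, _⟩
        · exact (Finset.mem_sdiff.1 hu).2 hG.ha
        · exact (Finset.mem_sdiff.1 hv).2 hG.ha, hends⟩
      omega
    · have hvr : v ∈ rest G A p n := Finset.mem_sdiff.2 ⟨hv, hv'⟩
      have := foot_le (d := d) hvr (self_mem_Cmp hvr) hu' huv.symm
      rw [foot_arc hu']
      omega
  · have hur : u ∈ rest G A p n := Finset.mem_sdiff.2 ⟨hu, hu'⟩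
    by_cases hv' : v ∈ arc p n
    · obtain ⟨c, hc, h1, x, hx, hxc⟩ := hG.foot_rest hur
      have h2 := hG.d_Cmp hs hur hx (self_mem_Cmp hur)
      have h3 := hG.lip _ _ (hG.ed_rest (Cmp_subset hx) hxc).symm
      have h4 := hG.lip _ _ (hG.ed_rest hur huv)
      rw [foot_arc hv']
      omega
    · have hvr : v ∈ rest G A p n := Finset.mem_sdiff.2 ⟨hv, hv'⟩
      have := foot_Cmp (d := d) hur (Cmp_closed (self_mem_Cmp hur) hvr huv)
      omega

theorem lev_p (hG : Geo G A g a b d p n) {s : ℕ} (h1 : 1 ≤ i) (h2 : i ≤ n) :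
    lev G A d p n s q (p i) = min ((i - 1) / s) (2 * q - 1) := by
  rw [lev, foot_arc (mem_arc.2 ⟨i, h1, h2, rfl⟩), hG.dp i h2]

theorem mul_lt_arc {s : ℕ} (hs : 1 ≤ s) (hn : 2 * q * s ≤ n) (hk : k < 2 * q) : k * s + 1 ≤ n := by
  have : k * s + 1 * s ≤ 2 * q * s := by rw [← add_mul]; exact Nat.mul_le_mul_right _ hk
  omega

theorem conn_lev (hG : Geo G A g a b d p n) {s : ℕ} (hs : 1 ≤ s) (hn : 2 * q * s ≤ n) (hk : k < 2 * q) :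
    G.ConnS ((G.V \ A).filter (lev G A d p n s q · = k)) := by
  set Lk := (G.V \ A).filter (lev G A d p n s q · = k) with hLk
  have hkn := mul_lt_arc hs hn hk
  have hmem : ∀ i, 1 ≤ i → i ≤ n → (p i ∈ Lk ↔ min ((i - 1) / s) (2 * q - 1) = k) := by
    intro i h1 h2
    rw [hLk, Finset.mem_filter, hG.lev_p h1 h2, and_iff_right_iff_imp]
    exact fun _ => hG.arc_sub (mem_arc.2 ⟨i, h1, h2, rfl⟩)
  have hbase : p (k * s + 1) ∈ Lk := by
    rw [hmem _ (by omega) hkn, Nat.add_sub_cancel, Nat.mul_div_cancel _ (by omega)]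
    omega
  have key : ∀ w ∈ Lk, G.Jn ∅ Lk w (p (k * s + 1)) := by
    have harc : ∀ i, 1 ≤ i → i ≤ n → p i ∈ Lk → G.Jn ∅ Lk (p i) (p (k * s + 1)) := by
      intro i h1 h2 hi
      have hi' := (hmem i h1 h2).1 hi
      have hle : k ≤ (i - 1) / s := by omega
      rw [Nat.le_div_iff_mul_le (by omega)] at hle
      refine ((hG.jn_arc (X := Lk) (i := k * s + 1) (j := i) (fun j h3 h4 => ?_) (by omega) h2).mono
        (Finset.empty_subset _) subset_rfl).symm
      rw [hmem j (by omega) (by omega)]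
      have e1 : (j - 1) / s ≤ (i - 1) / s := Nat.div_le_div_right (by omega)
      have e2 : k ≤ (j - 1) / s := (Nat.le_div_iff_mul_le (by omega)).2 (by omega)
      omega
    intro w hw
    have hw1 := Finset.mem_filter.1 hw
    by_cases hwa : w ∈ arc p n
    · obtain ⟨i, h1, h2, rfl⟩ := mem_arc.1 hwa
      exact harc i h1 h2 hw
    · have hwr : w ∈ rest G A p n := Finset.mem_sdiff.2 ⟨hw1.1, hwa⟩
      obtain ⟨c, hc, h1, x, hx, hxc⟩ := hG.foot_rest hwr
      have hsub : G.Cmp (rest G A p n) w ⊆ Lk := by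
        intro y hy
        refine Finset.mem_filter.2 ⟨(Finset.mem_sdiff.1 (Cmp_subset hy)).1, ?_⟩
        rw [← hw1.2, lev, lev, foot_Cmp hwr hy]
      have hcL : c ∈ Lk := by
        refine Finset.mem_filter.2 ⟨hG.arc_sub hc, ?_⟩
        rw [← hw1.2, lev, lev, foot_arc hc, h1]
      have h2 := ((connS_Cmp (G := G) hwr).2 w (self_mem_Cmp hwr) x hx).mono subset_rfl hsub
      obtain ⟨i, h3, h4, rfl⟩ := mem_arc.1 hc
      exact (h2.trans (.step (hsub hx) hcL hxc)).trans (harc i h3 h4 hcL)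
  exact ⟨⟨_, hbase⟩, fun u hu v hv => (key u hu).trans (key v hv).symm⟩

theorem strand (hG : Geo G A g a b d p n) (hs : ∀ w ∈ rest G A p n, (G.Cmp (rest G A p n) w).card ≤ h)
    (hq : 1 ≤ q) (hn : 2 * q * (h + 2) ≤ n) :
    Strand G q A fun k => (G.V \ A).filter (lev G A d p n (h + 2) q · = k) := by
  have hmem : ∀ i, 1 ≤ i → i ≤ n → p i ∈ (G.V \ A).filter
      (lev G A d p n (h + 2) q · = min ((i - 1) / (h + 2)) (2 * q - 1)) := fun i h1 h2 =>
    Finset.mem_filter.2 ⟨hG.arc_sub (mem_arc.2 ⟨i, h1, h2, rfl⟩), hG.lev_p h1 h2⟩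
  constructor
  · exact hG.two.connS
  · exact fun k hk => hG.conn_lev (by omega) hn hk
  · exact hG.sub
  · exact fun k _ => (Finset.filter_subset _ _).trans Finset.sdiff_subset
  · intro k _ l _ hkl
    refine Finset.disjoint_filter.2 fun x _ h1 h2 => hkl (h1.symm.trans h2)
  · exact fun k _ => (Finset.disjoint_sdiff).mono_right (Finset.filter_subset _ _)
  · intro v hv
    by_cases hvA : v ∈ A
    · exact Or.inl hvA
    · refine Or.inr ⟨lev G A d p n (h + 2) q v, ?_, Finset.mem_filter.2 ⟨Finset.mem_sdiff.2 ⟨hv, hvA⟩, rfl⟩⟩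
      have : lev G A d p n (h + 2) q v ≤ 2 * q - 1 := min_le_right _ _
      omega
  · intro k _ l _ u hu v hv huv
    rw [Finset.mem_filter] at hu hv
    have h1 := hG.foot_lip hs hu.1 hv.1 huv
    have h2 : (foot G A d p n v - 1) / (h + 2) ≤ (foot G A d p n u - 1) / (h + 2) + 1 := by
      rw [← Nat.add_div_right _ (by omega : 0 < h + 2)]
      exact Nat.div_le_div_right (by omega)
    rw [← hu.2, ← hv.2, lev, lev]
    omega
  · intro k hk
    have h1 := mul_lt_arc (s := h + 2) (by omega) hn (show k + 1 < 2 * q from hk)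
    have e1 : (k + 1) * (h + 2) = k * (h + 2) + (h + 2) := by ring
    have h2 := hmem ((k + 1) * (h + 2)) (by omega) (by omega)
    have h3 := hmem ((k + 1) * (h + 2) + 1) (by omega) h1
    have e2 : ((k + 1) * (h + 2) - 1) / (h + 2) = k := by
      rw [e1, show k * (h + 2) + (h + 2) - 1 = (h + 1) + k * (h + 2) by omega,
        Nat.add_mul_div_right _ _ (by omega), Nat.div_eq_of_lt (by omega), zero_add]
    rw [e2, show min k (2 * q - 1) = k by omega] at h2
    rw [Nat.add_sub_cancel, Nat.mul_div_cancel _ (by omega), show min (k + 1) (2 * q - 1) = k + 1 by omega] at h3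
    exact ⟨_, h2, _, h3, (hG.step _ (by omega)).to_empty⟩
  · intro u hu k _ v hv huv
    rw [Finset.mem_filter] at hv
    by_cases hva : v ∈ arc p n
    · obtain ⟨i, h1, h2, rfl⟩ := mem_arc.1 hva
      rw [hG.lev_p h1 h2] at hv
      obtain ⟨e, he, -, hends⟩ := huv
      by_cases heg : e = g
      · subst heg
        rw [hG.ends] at hends
        rcases Sym2.eq_iff.1 hends with ⟨_, h3⟩ | ⟨h3, _⟩
        · have hin : i = n := by rw [← hG.dp i h2, ← h3, ← hG.pn, hG.dp n le_rfl]
          have : 2 * q - 1 ≤ (i - 1) / (h + 2) := by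
            rw [Nat.le_div_iff_mul_le (by omega)]
            have := mul_lt_arc (s := h + 2) (k := 2 * q - 1) (by omega) hn (by omega)
            omega
          right; omega
        · exact absurd (h3 ▸ hG.ha) (hG.pA h1 h2)
      · have h3 := hG.lip _ _ ⟨e, he, by simpa using heg, hends⟩
        rw [hG.d0 _ hu, hG.dp i h2] at h3
        have : i - 1 = 0 := by omega
        rw [this, Nat.zero_div] at hv
        left; omega
    · have hvr : v ∈ rest G A p n := Finset.mem_sdiff.2 ⟨hv.1, hva⟩
      have h3 := hG.lip _ _ (hG.ed_rest hvr huv.symm).symm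
      rw [hG.d0 _ hu] at h3
      have h4 := hG.foot_bound hs hvr
      have h5 := hv.2
      rw [lev, Nat.div_eq_of_lt (by omega)] at h5
      left; omega
  · have h1 := hmem 1 le_rfl hG.one_le
    simp only [Nat.sub_self, Nat.zero_div, Nat.zero_min] at h1
    exact ⟨_, hG.p0, _, h1, (hG.step 0 hG.one_le).to_empty⟩
  · have h1 := hmem n hG.one_le le_rfl
    have : 2 * q - 1 ≤ (n - 1) / (h + 2) := by
      rw [Nat.le_div_iff_mul_le (by omega)]
      have := mul_lt_arc (s := h + 2) (k := 2 * q - 1) (by omega) hn (by omega)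
      omega
    rw [min_eq_right this, hG.pn] at h1
    exact ⟨a, hG.ha, b, h1, ed_of_edge hG.edge hG.ends⟩

end Geo

end MGraph

end

section

namespace MGraph

variable {G H : MGraph} {A C F O S T X W Y Z K : Finset ℕ} {L U B : ℕ → Finset ℕ}
  {a b c u v w x y e f g h i j k l m n r t q : ℕ} {d p : ℕ → ℕ}

theorem Conn2.card_nb_lt (hG : G.Conn2) (hr : 1 ≤ r) (hgood : ¬ Good r G) (hv : v ∈ G.V) :
    (G.nb v).card < Dg r := by
  refine (card_nb_le hG.loopless).trans_lt (hG.bdry_lt hr hgood (twoEC_singleton G v)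
    (Finset.singleton_subset_iff.2 hv) (hG.connS_compl hv))

theorem Geo.card_le (hG : G.Conn2) (hr : 1 ≤ r) (hgood : ¬ Good r G) (hP : Geo G A g a b d p n)
    (hs : ∀ w ∈ rest G A p n, (G.Cmp (rest G A p n) w).card ≤ h) :
    (G.V \ A).card ≤ n * (1 + Dg r * h) := by
  have hsub : G.V \ A ⊆ (arc p n).biUnion fun c => insert c
      (((G.nb c).filter (· ∈ rest G A p n)).biUnion fun x => G.Cmp (rest G A p n) x) := by
    intro w hw
    by_cases hwa : w ∈ arc p n
    · exact Finset.mem_biUnion.2 ⟨w, hwa, Finset.mem_insert_self _ _⟩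
    · have hwr : w ∈ rest G A p n := Finset.mem_sdiff.2 ⟨hw, hwa⟩
      obtain ⟨c, hc, h1, x, hx, hxc⟩ := hP.foot_rest hwr
      refine Finset.mem_biUnion.2 ⟨c, hc, Finset.mem_insert_of_mem (Finset.mem_biUnion.2 ⟨x,
        Finset.mem_filter.2 ⟨mem_nb.2 hxc.symm, Cmp_subset hx⟩, ?_⟩)⟩
      rw [Cmp_eq hx]
      exact self_mem_Cmp hwr
  have harc : (arc p n).card ≤ n := by
    refine Finset.card_image_le.trans ?_
    simp
  refine (Finset.card_le_card hsub).trans ((Finset.card_biUnion_le_card_mul _ _ (1 + Dg r * h) ?_).trans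
    (Nat.mul_le_mul_right _ harc))
  intro c hc
  refine (Finset.card_insert_le _ _).trans ?_
  have h1 : (((G.nb c).filter (· ∈ rest G A p n)).biUnion fun x => G.Cmp (rest G A p n) x).card ≤ Dg r * h := by
    refine (Finset.card_biUnion_le_card_mul _ _ h fun x hx => hs x (Finset.mem_filter.1 hx).2).trans
      (Nat.mul_le_mul_right _ ((Finset.card_filter_le _ _).trans
        (hG.card_nb_lt hr hgood (Finset.mem_sdiff.1 (hP.arc_sub hc)).1).le))
  omega

/-- The size of the complement needed to swallow one edge and keep a complement of size `h`. -/
def swl (r h : ℕ) : ℕ := 2 * (r + 2) * (h + 2) * (1 + Dg r * h)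

theorem le_swl (r h : ℕ) : h ≤ swl r h := by
  have h1 : h + 2 ≤ 2 * (r + 2) * (h + 2) := Nat.le_mul_of_pos_left _ (by omega)
  have h2 : 2 * (r + 2) * (h + 2) ≤ swl r h := Nat.le_mul_of_pos_right _ (by omega)
  omega

/-- `A` can be enlarged to `A'`, keeping a connected complement with at least `h` vertices. -/
structure Grows (G : MGraph) (h : ℕ) (A A' : Finset ℕ) : Prop where
  le : A ⊆ A'
  sub : A' ⊆ G.V
  two : G.TwoEC A'
  conn : G.ConnS (G.V \ A')
  card : h ≤ (G.V \ A').card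

theorem Conn2.swallow (hG : G.Conn2) (hr : 1 ≤ r) (hgood : ¬ Good r G) (hA : G.TwoEC A) (hAV : A ⊆ G.V)
    (hB : G.ConnS (G.V \ A)) (hg : g ∈ G.E) (hends : G.ends g = s(a, b)) (ha : a ∈ A) (hb : b ∈ G.V)
    (hbA : b ∉ A) (hcard : swl r h ≤ (G.V \ A).card) :
    ∃ A', G.Grows h A A' ∧ b ∈ A' := by
  obtain ⟨d, p, n, hP⟩ := exists_geo hG hA hAV hB hg hends ha hb hbA
  have hrest : Geo.rest G A p n = G.V \ (A ∪ arc p n) := sdiff_sdiff_left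
  have hUV : A ∪ arc p n ⊆ G.V := Finset.union_subset hAV (hP.arc_sub.trans Finset.sdiff_subset)
  by_cases hbig : ∃ w ∈ Geo.rest G A p n, h ≤ (G.Cmp (Geo.rest G A p n) w).card
  · obtain ⟨w, hw, hwh⟩ := hbig
    have h1 := twoEC_sdiff_Cmp hG.twoEC hP.twoEC hUV w
    rw [← hrest] at h1
    have hd : Disjoint (A ∪ arc p n) (G.Cmp (Geo.rest G A p n) w) := by
      refine Disjoint.mono_right Cmp_subset ?_
      rw [hrest]
      exact Finset.disjoint_sdiff
    have hsub : A ∪ arc p n ⊆ G.V \ G.Cmp (Geo.rest G A p n) w := fun x hx =>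
      Finset.mem_sdiff.2 ⟨hUV hx, Finset.disjoint_left.1 hd hx⟩
    have hc : G.V \ (G.V \ G.Cmp (Geo.rest G A p n) w) = G.Cmp (Geo.rest G A p n) w :=
      Finset.sdiff_sdiff_eq_self (Cmp_subset.trans (Finset.sdiff_subset.trans Finset.sdiff_subset))
    refine ⟨G.V \ G.Cmp (Geo.rest G A p n) w, ⟨Finset.subset_union_left.trans hsub, Finset.sdiff_subset, h1, ?_, ?_⟩,
      hsub (Finset.mem_union_right _ hP.b_mem)⟩
    · rw [hc]; exact connS_Cmp hw
    · rwa [hc]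
  · push Not at hbig
    have hs : ∀ w ∈ Geo.rest G A p n, (G.Cmp (Geo.rest G A p n) w).card ≤ h := fun w hw => (hbig w hw).le
    refine absurd (Strand.good hG (hP.strand (q := r + 2) hs (by omega) ?_) hr le_rfl) hgood
    have h1 := hcard.trans (hP.card_le hG hr hgood hs)
    rw [swl] at h1
    exact Nat.le_of_mul_le_mul_right h1 (by positivity)

theorem Grows.trans (h1 : G.Grows m A X) (h2 : G.Grows n X Y) : G.Grows n A Y :=
  ⟨h1.le.trans h2.le, h2.sub, h2.two, h2.conn, h2.card⟩

theorem Conn2.swallow_set (hG : G.Conn2) (hr : 1 ≤ r) (hgood : ¬ Good r G) (S : Finset ℕ) :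
    ∀ A, G.TwoEC A → A ⊆ G.V → G.ConnS (G.V \ A) →
      (∀ g ∈ S, ∃ a ∈ A, ∃ b ∈ G.V, g ∈ G.E ∧ G.ends g = s(a, b)) → (swl r)^[S.card] h ≤ (G.V \ A).card →
      ∃ A', G.Grows h A A' ∧ ∀ g ∈ S, ∀ x ∈ G.ends g, x ∈ A' := by
  induction S using Finset.induction_on with
  | empty =>
    intro A h1 h2 h3 h4 h5
    exact ⟨A, ⟨subset_rfl, h2, h1, h3, by simpa using h5⟩, by simp⟩
  | insert g S hgS ih =>
    intro A h1 h2 h3 h4 h5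
    rw [Finset.card_insert_of_notMem hgS, Function.iterate_succ_apply'] at h5
    obtain ⟨a, ha, b, hb, hg, hends⟩ := h4 g (Finset.mem_insert_self _ _)
    obtain ⟨A1, hA1, hbA1⟩ : ∃ A', G.Grows ((swl r)^[S.card] h) A A' ∧ b ∈ A' := by
      by_cases hbA : b ∈ A
      · exact ⟨A, ⟨subset_rfl, h2, h1, h3, (le_swl _ _).trans h5⟩, hbA⟩
      · exact hG.swallow hr hgood h1 h2 h3 hg hends ha hb hbA h5
    obtain ⟨A2, hA2, hS⟩ := ih A1 hA1.two hA1.sub hA1.conn (fun g hg => by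
      obtain ⟨a, ha, h⟩ := h4 g (Finset.mem_insert_of_mem hg)
      exact ⟨a, hA1.le ha, h⟩) hA1.card
    refine ⟨A2, hA1.trans hA2, fun g' hg' x hx => ?_⟩
    rcases Finset.mem_insert.1 hg' with rfl | hg'
    · rw [hends, Sym2.mem_iff] at hx
      rcases hx with rfl | rfl
      · exact hA2.le (hA1.le ha)
      · exact hA2.le hbA1
    · exact hS g' hg' x hx

theorem Conn2.swallow_bdry (hG : G.Conn2) (hr : 1 ≤ r) (hgood : ¬ Good r G) (hA : G.TwoEC A) (hAV : A ⊆ G.V)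
    (hB : G.ConnS (G.V \ A)) (hcard : (swl r)^[Dg r] h ≤ (G.V \ A).card) :
    ∃ A', G.Grows h A A' ∧ ∀ u ∈ A, ∀ v, G.Ed ∅ u v → v ∈ A' := by
  have h1 := (hG.bdry_lt hr hgood hA hAV hB).le
  obtain ⟨A', h2, h3⟩ := hG.swallow_set (h := h) hr hgood (G.bdry A) A hA hAV hB (fun g hg => by
    obtain ⟨hg, a, ha, b, hb, hends⟩ := mem_bdry.1 hg
    exact ⟨a, ha, b, G.ends_mem g hg b (by simp [hends]), hg, hends⟩)
    (le_trans (Function.monotone_iterate_of_id_le (le_swl r) h1 h) hcard)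
  refine ⟨A', h2, fun u hu v huv => ?_⟩
  by_cases hvA : v ∈ A
  · exact h2.le hvA
  · obtain ⟨e, he, -, hends⟩ := huv
    exact h3 e (mem_bdry.2 ⟨he, u, hu, v, hvA, hends⟩) v (by simp [hends])

/-- An increasing chain of sets `A 0, ..., A n`, each containing all neighbours of the previous one. -/
structure Chain (G : MGraph) (n : ℕ) (A : ℕ → Finset ℕ) : Prop where
  two : ∀ i ≤ n, G.TwoEC (A i)
  sub : ∀ i ≤ n, A i ⊆ G.V
  conn : ∀ i ≤ n, G.ConnS (G.V \ A i)
  le : ∀ i < n, A i ⊆ A (i + 1)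
  nbr : ∀ i < n, ∀ u ∈ A i, ∀ v, G.Ed ∅ u v → v ∈ A (i + 1)

theorem Conn2.exists_chain (hG : G.Conn2) (hr : 1 ≤ r) (hgood : ¬ Good r G) (n : ℕ) :
    ∀ h, (swl r)^[Dg r * n] h + 1 ≤ G.V.card → ∃ A, Chain G n A ∧ h ≤ (G.V \ A n).card := by
  induction n with
  | zero =>
    intro h hh
    obtain ⟨v, hv⟩ := hG.twoEC.1
    refine ⟨fun _ => {v}, ⟨fun _ _ => twoEC_singleton G v, fun _ _ => Finset.singleton_subset_iff.2 hv,
      fun _ _ => hG.connS_compl hv, fun i hi => by omega, fun i hi => by omega⟩, ?_⟩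
    rw [Finset.card_sdiff_of_subset (Finset.singleton_subset_iff.2 hv), Finset.card_singleton]
    simp only [mul_zero, Function.iterate_zero, id_eq] at hh
    omega
  | succ n ih =>
    intro h hh
    rw [mul_add, mul_one, Function.iterate_add_apply] at hh
    obtain ⟨A, hA, hc⟩ := ih _ hh
    obtain ⟨A', h1, h2⟩ := hG.swallow_bdry hr hgood (hA.two n le_rfl) (hA.sub n le_rfl) (hA.conn n le_rfl) hc
    have hle : ∀ i ≤ n, (if i ≤ n then A i else A') = A i := fun i hi => if_pos hi
    have hgt : (if n + 1 ≤ n then A (n + 1) else A') = A' := if_neg (by omega)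
    have cases : ∀ i ≤ n + 1, i ≤ n ∨ i = n + 1 := fun i hi => by omega
    refine ⟨fun i => if i ≤ n then A i else A', ⟨fun i hi => ?_, fun i hi => ?_, fun i hi => ?_, fun i hi => ?_,
      fun i hi => ?_⟩, by simpa using h1.card⟩
    · rcases cases i hi with hi | rfl
      · simpa only [hle i hi] using hA.two i hi
      · simpa only [hgt] using h1.two
    · rcases cases i hi with hi | rfl
      · simpa only [hle i hi] using hA.sub i hi
      · simpa only [hgt] using h1.sub
    · rcases cases i hi with hi | rfl
      · simpa only [hle i hi] using hA.conn i hi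
      · simpa only [hgt] using h1.conn
    · rcases cases (i + 1) (by omega) with hi | hi
      · simpa only [hle i (by omega), hle _ hi] using hA.le i hi
      · obtain rfl : i = n := by omega
        simpa only [hle i le_rfl, hgt] using h1.le
    · rcases cases (i + 1) (by omega) with hi | hi
      · simpa only [hle i (by omega), hle _ hi] using hA.nbr i hi
      · obtain rfl : i = n := by omega
        simpa only [hle i le_rfl, hgt] using h2

end MGraph

end

section

namespace MGraph

variable {G H : MGraph} {C F O S T X W Y Z K : Finset ℕ} {L U B A : ℕ → Finset ℕ}
  {a b c u v w x y e f g h i j k l m n r t q s i' j' : ℕ}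

/-- The components of the graph induced by `X`. -/
def comps (G : MGraph) (X : Finset ℕ) : Finset (Finset ℕ) := X.image (G.Cmp X)

theorem mem_comps : K ∈ G.comps X ↔ ∃ u ∈ X, G.Cmp X u = K := by simp [comps]

theorem comps_conn (h : K ∈ G.comps X) : G.ConnS K := by
  obtain ⟨u, hu, rfl⟩ := mem_comps.1 h
  exact connS_Cmp hu

theorem comps_sub (h : K ∈ G.comps X) : K ⊆ X := by
  obtain ⟨u, hu, rfl⟩ := mem_comps.1 h
  exact Cmp_subset

theorem comps_eq (h : K ∈ G.comps X) (hx : x ∈ K) : G.Cmp X x = K := by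
  obtain ⟨u, hu, rfl⟩ := mem_comps.1 h
  exact Cmp_eq hx

namespace Chain

theorem mono (h : Chain G n A) (hij : i ≤ j) (hj : j ≤ n) : A i ⊆ A j := by
  induction j, hij using Nat.le_induction with
  | base => rfl
  | succ j hij ih => exact (ih (by omega)).trans (h.le j (by omega))

theorem sdiff_slab (h : Chain G n A) (hj : j ≤ n) : (G.V \ A i) \ (G.V \ A j) = A j \ A i := by
  ext x
  have : x ∈ A j → x ∈ G.V := fun hx => h.sub j hj hx
  simp only [Finset.mem_sdiff]
  tauto

theorem exit_down (h : Chain G n A) (hij : i ≤ j) (hj : j ≤ n) (hK : K ∈ G.comps (A j \ A i)) :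
    ∃ a ∈ K, ∃ b ∈ A i, G.Ed ∅ a b := by
  obtain ⟨u, hu, rfl⟩ := mem_comps.1 hK
  exact Cmp_exit (h.two j hj).connS (h.mono hij hj) (h.two i (hij.trans hj)).1 hu

theorem exit_up (h : Chain G n A) (hij : i ≤ j) (hj : j ≤ n) (hK : K ∈ G.comps (A j \ A i)) :
    ∃ a ∈ K, ∃ b ∈ G.V \ A j, G.Ed ∅ a b := by
  obtain ⟨u, hu, rfl⟩ := mem_comps.1 hK
  have := Cmp_exit (X := G.V \ A j) (Y := G.V \ A i) (u := u) (h.conn i (hij.trans hj))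
    (Finset.sdiff_subset_sdiff subset_rfl (h.mono hij hj)) (h.conn j hj).1
  rw [h.sdiff_slab hj] at this
  exact this hu

theorem edge_in (h : Chain G n A) (hij : i < j) (hj : j ≤ n) (ha : a ∈ A i) (hab : G.Ed ∅ a b) : b ∈ A j :=
  h.mono hij hj (h.nbr i (by omega) a ha b hab)

/-- A connected set with a vertex of level at most `t` and one of level at least `t` has one of level `t`. -/
theorem pass (h : Chain G n A) (ht : t < n) (hZ : G.ConnS Z) (hx : x ∈ Z) (hxA : x ∈ A (t + 1)) (hy : y ∈ Z)
    (hyA : y ∉ A t) : ∃ z ∈ Z, z ∈ A (t + 1) \ A t := by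
  by_contra hno
  push Not at hno
  have hxt : x ∈ A t := by
    by_contra hxt
    exact hno x hx (Finset.mem_sdiff.2 ⟨hxA, hxt⟩)
  obtain ⟨a, ha, b, hb, h1, h2, h3⟩ := hZ.cut (· ∈ A t) hx hxt hy hyA
  exact hno b hb (Finset.mem_sdiff.2 ⟨h.nbr t ht a h1 b h3, h2⟩)

theorem meets (h : Chain G n A) (hi : i ≤ i') (hij : i' < j') (hj : j' ≤ j) (hjn : j ≤ n)
    (hK : K ∈ G.comps (A j \ A i)) : ∃ z ∈ K, z ∈ A j' \ A i' := by
  obtain ⟨x, hx, b, hb, hxb⟩ := h.exit_down (by omega) hjn hK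
  obtain ⟨y, hy, c, hc, hyc⟩ := h.exit_up (by omega) hjn hK
  have h1 : x ∈ A (i' + 1) := h.edge_in (by omega) (by omega) hb hxb.symm
  have h2 : y ∉ A i' := fun h2 => (Finset.mem_sdiff.1 hc).2 (h.edge_in (by omega) hjn h2 hyc)
  obtain ⟨z, hz, hz'⟩ := h.pass (by omega) (comps_conn hK) hx h1 hy h2
  rw [Finset.mem_sdiff] at hz'
  exact ⟨z, hz, Finset.mem_sdiff.2 ⟨h.mono hij (hj.trans hjn) hz'.1, hz'.2⟩⟩

theorem slab_sub (h : Chain G n A) (hi : i ≤ i') (hi' : i' ≤ n) (hj : j' ≤ j) (hjn : j ≤ n) :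
    A j' \ A i' ⊆ A j \ A i := Finset.sdiff_subset_sdiff (h.mono hj hjn) (h.mono hi hi')

theorem comps_image (h : Chain G n A) (hi : i ≤ i') (hij : i' < j') (hj : j' ≤ j) (hjn : j ≤ n) :
    (A j' \ A i').image (G.Cmp (A j \ A i)) = G.comps (A j \ A i) := by
  ext K
  constructor
  · intro hK
    obtain ⟨u, hu, rfl⟩ := Finset.mem_image.1 hK
    exact mem_comps.2 ⟨u, h.slab_sub hi (by omega) hj hjn hu, rfl⟩
  · intro hK
    obtain ⟨z, hz, hz'⟩ := h.meets hi hij hj hjn hK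
    exact Finset.mem_image.2 ⟨z, hz', comps_eq hK hz⟩

theorem comps_image' (h : Chain G n A) (hi : i ≤ i') (hij : i' < j') (hj : j' ≤ j) (hjn : j ≤ n) :
    (G.comps (A j' \ A i')).image (fun K => if hK : K.Nonempty then G.Cmp (A j \ A i) hK.choose else ∅)
      = G.comps (A j \ A i) := by
  rw [← h.comps_image hi hij hj hjn, comps, Finset.image_image]
  refine Finset.image_congr fun u hu => ?_
  have hne : (G.Cmp (A j' \ A i') u).Nonempty := ⟨u, self_mem_Cmp hu⟩
  simp only [Function.comp, dif_pos hne]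
  refine Cmp_eq ?_
  have h1 := mem_Cmp.1 hne.choose_spec
  exact mem_Cmp.2 ⟨h.slab_sub hi (by omega) hj hjn h1.1, h1.2.mono subset_rfl (h.slab_sub hi (by omega) hj hjn)⟩

theorem card_comps_le (h : Chain G n A) (hi : i ≤ i') (hij : i' < j') (hj : j' ≤ j) (hjn : j ≤ n) :
    (G.comps (A j \ A i)).card ≤ (G.comps (A j' \ A i')).card := by
  rw [← h.comps_image' hi hij hj hjn]
  exact Finset.card_image_le

theorem conn_inter (h : Chain G n A) (hi : i ≤ i') (hij : i' < j') (hj : j' ≤ j) (hjn : j ≤ n)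
    (hc : (G.comps (A j' \ A i')).card = (G.comps (A j \ A i)).card) (hK : K ∈ G.comps (A j \ A i)) :
    G.ConnS (K ∩ (A j' \ A i')) := by
  have hinj := Finset.card_image_iff.1 (by rw [h.comps_image' hi hij hj hjn, hc])
  have hsub := h.slab_sub hi (by omega : i' ≤ n) hj hjn
  have key : ∀ u ∈ A j' \ A i', (fun K : Finset ℕ => if hK : K.Nonempty then G.Cmp (A j \ A i) hK.choose else ∅)
      (G.Cmp (A j' \ A i') u) = G.Cmp (A j \ A i) u := by
    intro u hu
    have hne : (G.Cmp (A j' \ A i') u).Nonempty := ⟨u, self_mem_Cmp hu⟩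
    simp only [dif_pos hne]
    refine Cmp_eq ?_
    have h1 := mem_Cmp.1 hne.choose_spec
    exact mem_Cmp.2 ⟨hsub h1.1, h1.2.mono subset_rfl hsub⟩
  obtain ⟨z, hz, hz'⟩ := h.meets hi hij hj hjn hK
  have hC : K ∩ (A j' \ A i') = G.Cmp (A j' \ A i') z := by
    ext u
    rw [Finset.mem_inter]
    constructor
    · rintro ⟨hu, hu'⟩
      have h1 : G.Cmp (A j' \ A i') u = G.Cmp (A j' \ A i') z := by
        refine hinj (mem_comps.2 ⟨u, hu', rfl⟩) (mem_comps.2 ⟨z, hz', rfl⟩) ?_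
        rw [key u hu', key z hz', comps_eq hK hu, comps_eq hK hz]
      rw [← h1]
      exact self_mem_Cmp hu'
    · intro hu
      refine ⟨?_, Cmp_subset hu⟩
      rw [← comps_eq hK hz]
      have h1 := mem_Cmp.1 hu
      exact mem_Cmp.2 ⟨hsub h1.1, h1.2.mono subset_rfl hsub⟩
  rw [hC]
  exact connS_Cmp hz'

theorem card_comps_le_bdry (h : Chain G n A) (hij : i ≤ j) (hj : j ≤ n) :
    (G.comps (A j \ A i)).card ≤ (G.bdry (A i)).card := by
  have key : ∀ K ∈ G.comps (A j \ A i), ∃ e ∈ G.bdry (A i), ∃ a ∈ K, ∃ b ∈ A i, G.ends e = s(b, a) := by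
    intro K hK
    obtain ⟨a, ha, b, hb, e, he, -, hends⟩ := h.exit_down hij hj hK
    rw [Sym2.eq_swap] at hends
    exact ⟨e, mem_bdry.2 ⟨he, b, hb, a, (Finset.mem_sdiff.1 (comps_sub hK ha)).2, hends⟩, a, ha, b, hb, hends⟩
  choose! φ h1 h2 using key
  refine Finset.card_le_card_of_injOn φ h1 fun K hK K' hK' heq => ?_
  obtain ⟨a, ha, b, hb, hab⟩ := h2 K hK
  obtain ⟨a', ha', b', hb', hab'⟩ := h2 K' hK'
  rw [heq, hab'] at hab
  have : a' = a := by
    rcases Sym2.eq_iff.1 hab with ⟨_, h⟩ | ⟨_, rfl⟩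
    · exact h
    · exact absurd hb (Finset.mem_sdiff.1 (comps_sub hK' ha')).2
  subst this
  rw [← comps_eq hK ha, ← comps_eq hK' ha']

/-- Among long windows there is one cut into `q` equal slabs having the same number of components as the window. -/
theorem exists_window (h : Chain G n A) (hq : 1 ≤ q) (hD : ∀ i ≤ n, (G.bdry (A i)).card < c) (m : ℕ) :
    ∀ i, i + q ^ m ≤ n → c ≤ (G.comps (A (i + q ^ m) \ A i)).card + m →
      ∃ i' s, i ≤ i' ∧ 1 ≤ s ∧ i' + q * s ≤ n ∧ ∀ k < q,
        (G.comps (A (i' + (k + 1) * s) \ A (i' + k * s))).card = (G.comps (A (i' + q * s) \ A i')).card := by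
  induction m with
  | zero =>
    intro i hi hc
    have h1 := h.card_comps_le_bdry (i := i) (j := i + q ^ 0) (by omega) hi
    have h2 := hD i (by omega)
    omega
  | succ m ih =>
    intro i hi hc
    have hs : 1 ≤ q ^ m := Nat.one_le_pow _ _ hq
    rw [pow_succ, mul_comm] at hi hc
    by_cases hall : ∀ k < q, (G.comps (A (i + (k + 1) * q ^ m) \ A (i + k * q ^ m))).card
        = (G.comps (A (i + q * q ^ m) \ A i)).card
    · exact ⟨i, q ^ m, le_rfl, hs, hi, hall⟩
    · push Not at hall
      obtain ⟨k, hk, hne⟩ := hall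
      have e1 : (k + 1) * q ^ m = k * q ^ m + q ^ m := by ring
      have e2 : (k + 1) * q ^ m ≤ q * q ^ m := Nat.mul_le_mul_right _ hk
      have h1 := h.card_comps_le (i := i) (i' := i + k * q ^ m) (j' := i + (k + 1) * q ^ m) (j := i + q * q ^ m)
        (by omega) (by omega) (by omega) hi
      rw [e1, ← add_assoc] at h1 hne
      obtain ⟨i', s, h2, h3⟩ := ih (i + k * q ^ m) (by omega) (by omega)
      exact ⟨i', s, by omega, h3⟩

end Chain

end MGraph

end

section

namespace MGraph

variable {G H : MGraph} {C F O S T X W Y Z K : Finset ℕ} {L U B A : ℕ → Finset ℕ}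
  {a b c u v w x y e f g h i j k l m n r t q s i' j' : ℕ}

namespace Chain

theorem disjoint_slab (h : Chain G n A) (hn : i + q * s ≤ n) (hk : k < q) (hl : l < q) (hkl : k ≠ l) :
    Disjoint (A (i + (k + 1) * s) \ A (i + k * s)) (A (i + (l + 1) * s) \ A (i + l * s)) := by
  have key : ∀ k l, k < q → l < q → k < l → Disjoint (A (i + (k + 1) * s) \ A (i + k * s)) (A (i + (l + 1) * s) \ A (i + l * s)) := by
    intro k l hk hl hkl
    have h1 : (k + 1) * s ≤ l * s := Nat.mul_le_mul_right _ hkl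
    have h2 : l * s ≤ q * s := Nat.mul_le_mul_right _ hl.le
    refine Finset.disjoint_left.2 fun x hx hx' => ?_
    exact (Finset.mem_sdiff.1 hx').2 (h.mono (by omega) (by omega) (Finset.mem_sdiff.1 hx).1)
  rcases lt_or_gt_of_ne hkl with h1 | h1
  · exact key k l hk hl h1
  · exact (key l k hl hk h1).symm

theorem mem_slab (hx : x ∈ A (i + q * s) \ A i) : ∃ k < q, x ∈ A (i + (k + 1) * s) \ A (i + k * s) := by
  induction q with
  | zero => simp at hx
  | succ q ih =>
    by_cases hq : x ∈ A (i + q * s)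
    · obtain ⟨k, hk, h⟩ := ih (Finset.mem_sdiff.2 ⟨hq, (Finset.mem_sdiff.1 hx).2⟩)
      exact ⟨k, by omega, h⟩
    · exact ⟨q, by omega, Finset.mem_sdiff.2 ⟨(Finset.mem_sdiff.1 hx).1, hq⟩⟩

theorem strand (h : Chain G n A) (hG : G.Conn2) (hq : 1 ≤ q) (hs : 1 ≤ s) (hn : i + 2 * q * s ≤ n)
    (hc : ∀ k < 2 * q, (G.comps (A (i + (k + 1) * s) \ A (i + k * s))).card = (G.comps (A (i + 2 * q * s) \ A i)).card)
    (hK : K ∈ G.comps (A (i + 2 * q * s) \ A i)) (hC : C ∈ G.comps (A (i + 2 * q * s) \ A i)) (hKC : C ≠ K) :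
    Strand G q (G.V \ K) fun k => K ∩ (A (i + (k + 1) * s) \ A (i + k * s)) := by
  have hle : ∀ k < 2 * q, (k + 1) * s = k * s + s ∧ (k + 1) * s ≤ 2 * q * s := fun k hk =>
    ⟨by ring, Nat.mul_le_mul_right _ hk⟩
  have hKV : K ⊆ G.V := (comps_sub hK).trans (Finset.sdiff_subset.trans (h.sub _ hn))
  have hle0 : 1 ≤ 2 * q * s := Nat.mul_pos (by omega) hs
  have hout : ∀ u ∈ G.V \ K, ∀ v ∈ K, G.Ed ∅ u v → u ∉ A (i + 2 * q * s) \ A i := by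
    intro u hu v hv huv hux
    refine (Finset.mem_sdiff.1 hu).2 ?_
    rw [← comps_eq hK hv]
    exact Cmp_closed (self_mem_Cmp (comps_sub hK hv)) hux huv.symm
  have hconn : G.ConnS (G.V \ K) := by
    obtain ⟨a, ha, b, hb, hab⟩ := h.exit_down (by omega) hn hC
    obtain ⟨a', ha', b', hb', hab'⟩ := h.exit_up (by omega) hn hC
    have h1 := ((h.two i (by omega)).connS.union_edge (comps_conn hC) hb ha hab.symm).union_edge
      (h.conn _ hn) (Finset.mem_union_right _ ha') hb' hab'
    obtain ⟨w, hw⟩ := (comps_conn hK).1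
    have hsub : A i ∪ C ∪ (G.V \ A (i + 2 * q * s)) ⊆ G.V := Finset.union_subset (Finset.union_subset
      (h.sub i (by omega)) ((comps_sub hC).trans (Finset.sdiff_subset.trans (h.sub _ hn)))) Finset.sdiff_subset
    have h2 := connS_sdiff_Cmp (hG.twoEC.connS) h1 hsub w
    have hsub2 : G.V \ (A i ∪ C ∪ (G.V \ A (i + 2 * q * s))) ⊆ A (i + 2 * q * s) \ A i := by
      intro x hx
      simp only [Finset.mem_sdiff, Finset.mem_union, not_or, not_and, not_not] at hx ⊢
      exact ⟨hx.2.2 hx.1, hx.2.1.1⟩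
    have hsub3 : K ⊆ G.V \ (A i ∪ C ∪ (G.V \ A (i + 2 * q * s))) := by
      intro x hx
      have hx' := Finset.mem_sdiff.1 (comps_sub hK hx)
      simp only [Finset.mem_sdiff, Finset.mem_union, not_or, not_and, not_not]
      refine ⟨hKV hx, ⟨hx'.2, fun hxC => hKC ?_⟩, fun _ => hx'.1⟩
      rw [← comps_eq hC hxC, ← comps_eq hK hx]
    have h3 : G.Cmp (G.V \ (A i ∪ C ∪ (G.V \ A (i + 2 * q * s)))) w = K := by
      refine subset_antisymm (fun x hx => ?_) ((comps_conn hK).subset_Cmp hsub3 hw (self_mem_Cmp (hsub3 hw)))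
      rw [← comps_eq hK hw]
      have := mem_Cmp.1 hx
      exact mem_Cmp.2 ⟨hsub2 this.1, this.2.mono subset_rfl hsub2⟩
    rwa [h3] at h2
  have hdown := h.exit_down (by omega) hn hK
  have hup := h.exit_up (by omega) hn hK
  have hnK : ∀ x, x ∉ A (i + 2 * q * s) \ A i → x ∈ G.V → x ∈ G.V \ K := fun x hx hxV =>
    Finset.mem_sdiff.2 ⟨hxV, fun hxK => hx (comps_sub hK hxK)⟩
  constructor
  · exact hconn
  · intro k hk
    obtain ⟨e1, e2⟩ := hle k hk
    exact h.conn_inter (by omega) (by omega) (by omega) hn (hc k hk) hK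
  · exact Finset.sdiff_subset
  · exact fun k _ => Finset.inter_subset_left.trans hKV
  · exact fun k hk l hl hkl => (h.disjoint_slab hn hk hl hkl).mono Finset.inter_subset_right Finset.inter_subset_right
  · exact fun k _ => Finset.sdiff_disjoint.mono_right Finset.inter_subset_left
  · intro v hv
    by_cases hvK : v ∈ K
    · obtain ⟨k, hk, hvk⟩ := mem_slab (comps_sub hK hvK)
      exact Or.inr ⟨k, hk, Finset.mem_inter.2 ⟨hvK, hvk⟩⟩
    · exact Or.inl (Finset.mem_sdiff.2 ⟨hv, hvK⟩)
  · intro k hk l hl u hu v hv huv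
    by_contra hlk
    obtain ⟨e1, e2⟩ := hle k hk
    obtain ⟨e3, e4⟩ := hle l hl
    have e5 : (k + 2) * s ≤ l * s := Nat.mul_le_mul_right _ (by omega)
    have e6 : (k + 2) * s = k * s + 2 * s := by ring
    have h1 := (Finset.mem_sdiff.1 (Finset.mem_inter.1 hu).2).1
    have h2 := (Finset.mem_sdiff.1 (Finset.mem_inter.1 hv).2).2
    exact h2 (h.edge_in (by omega) (by omega) h1 huv)
  · intro k hk
    obtain ⟨e1, e2⟩ := hle k (by omega)
    obtain ⟨e3, e4⟩ := hle (k + 1) hk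
    obtain ⟨x, hx, hx'⟩ := h.meets (i := i) (i' := i + k * s) (j' := i + (k + 1) * s) (by omega) (by omega)
      (by omega) hn hK
    obtain ⟨y, hy, hy'⟩ := h.meets (i := i) (i' := i + (k + 1) * s) (j' := i + (k + 1 + 1) * s) (by omega) (by omega)
      (by omega) hn hK
    obtain ⟨a, ha, b, hb, h1, h2, h3⟩ := (comps_conn hK).cut (· ∈ A (i + (k + 1) * s)) hx
      (Finset.mem_sdiff.1 hx').1 hy (Finset.mem_sdiff.1 hy').2
    refine ⟨a, Finset.mem_inter.2 ⟨ha, Finset.mem_sdiff.2 ⟨h1, fun h4 => h2 (h.edge_in (by omega) (by omega) h4 h3)⟩⟩,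
      b, Finset.mem_inter.2 ⟨hb, Finset.mem_sdiff.2 ⟨h.edge_in (by omega) (by omega) h1 h3, h2⟩⟩, h3⟩
  · intro u hu k hk v hv huv
    obtain ⟨e1, e2⟩ := hle k hk
    have hv1 := Finset.mem_inter.1 hv
    have hv2 := Finset.mem_sdiff.1 hv1.2
    have hux := hout u hu v hv1.1 huv
    by_cases huA : u ∈ A i
    · left
      by_contra hk0
      have : 1 * s ≤ k * s := Nat.mul_le_mul_right _ (by omega)
      exact hv2.2 (h.edge_in (by omega) (by omega) huA huv)
    · right
      by_contra hk0
      have : (k + 2) * s ≤ 2 * q * s := Nat.mul_le_mul_right _ (by omega)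
      have e6 : (k + 2) * s = k * s + 2 * s := by ring
      exact hux (Finset.mem_sdiff.2 ⟨h.edge_in (by omega) (by omega) hv2.1 huv.symm, huA⟩)
  · obtain ⟨a, ha, b, hb, hab⟩ := hdown
    obtain ⟨e1, e2⟩ := hle 0 (by omega)
    refine ⟨b, hnK b (fun hb' => (Finset.mem_sdiff.1 hb').2 hb) (h.sub i (by omega) hb), a,
      Finset.mem_inter.2 ⟨ha, Finset.mem_sdiff.2 ⟨h.edge_in (i := i) (j := i + (0 + 1) * s) (by omega) (by omega) hb hab.symm, ?_⟩⟩, hab.symm⟩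
    simpa using (Finset.mem_sdiff.1 (comps_sub hK ha)).2
  · obtain ⟨a, ha, b, hb, hab⟩ := hup
    have hb' := (Finset.mem_sdiff.1 hb)
    refine ⟨b, hnK b (fun hb'' => hb'.2 (Finset.mem_sdiff.1 hb'').1) hb'.1, a,
      Finset.mem_inter.2 ⟨ha, Finset.mem_sdiff.2 ⟨?_, fun h4 => hb'.2 (h.edge_in ?_ hn h4 hab)⟩⟩, hab.symm⟩
    · rw [show 2 * q - 1 + 1 = 2 * q by omega]
      exact (Finset.mem_sdiff.1 (comps_sub hK ha)).1
    · obtain ⟨e1, e2⟩ := hle (2 * q - 1) (by omega)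
      omega

end Chain

/-- Disjoint connected slabs, each met by every connected set touching both `e` and `f`. -/
structure Slabs (G : MGraph) (q e f : ℕ) (T : ℕ → Finset ℕ) : Prop where
  conn : ∀ k < q, G.ConnS (T k)
  dT : ∀ k < q, ∀ l < q, k ≠ l → Disjoint (T k) (T l)
  sep : ∀ Z x y, G.ConnS Z → x ∈ Z → x ∈ G.ends e → y ∈ Z → y ∈ G.ends f → ∀ k < q, ∃ z ∈ Z, z ∈ T k

theorem ConnS.exists_edge (hX : G.ConnS X) (h2 : 2 ≤ X.card) : ∃ e ∈ G.E, ∃ a ∈ X, ∃ b ∈ X, G.ends e = s(a, b) := by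
  obtain ⟨u, hu, v, hv, huv⟩ := Finset.one_lt_card.1 h2
  obtain ⟨a, ha, b, hb, -, -, e, he, -, hends⟩ := hX.cut (· = u) hu rfl hv (Ne.symm huv)
  exact ⟨e, he, a, ha, b, hb, hends⟩

theorem Conn2.exists_slabs (hG : G.Conn2) (hr : 1 ≤ r) (hgood : ¬ Good r G)
    (hV : (swl r)^[Dg r * (1 + (2 * (r + 2)) ^ Dg r)] 2 + 1 ≤ G.V.card) :
    ∃ e ∈ G.E, ∃ f ∈ G.E, e ≠ f ∧ ∃ T, Slabs G (2 * (r + 2)) e f T := by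
  obtain ⟨A, h, h2⟩ := hG.exists_chain hr hgood _ 2 hV
  set n := 1 + (2 * (r + 2)) ^ Dg r with hn
  obtain ⟨i, s, hi, hs, hin, hc⟩ := h.exists_window (q := 2 * (r + 2)) (by omega)
    (fun i hi => hG.bdry_lt hr hgood (h.two i hi) (h.sub i hi) (h.conn i hi)) (Dg r) 1 le_rfl (by omega)
  have hle : ∀ k < 2 * (r + 2), (k + 1) * s = k * s + s ∧ (k + 1) * s ≤ 2 * (r + 2) * s := fun k hk =>
    ⟨by ring, Nat.mul_le_mul_right _ hk⟩
  have hle0 : 1 ≤ 2 * (r + 2) * s := Nat.mul_pos (by omega) hs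
  have hne : (A (i + 2 * (r + 2) * s) \ A i).Nonempty := by
    obtain ⟨x, hx⟩ := (h.two i (by omega)).1
    obtain ⟨y, hy⟩ := (h.conn _ hin).1
    rw [Finset.mem_sdiff] at hy
    obtain ⟨a, _, b, _, h3, h4, h5⟩ := hG.twoEC.connS.cut (· ∈ A i) (h.sub i (by omega) hx) hx hy.1
      (fun h6 => hy.2 (h.mono (by omega) hin h6))
    exact ⟨b, Finset.mem_sdiff.2 ⟨h.edge_in (by omega) hin h3 h5, h4⟩⟩
  obtain ⟨w, hw⟩ := hne
  have hK : G.Cmp _ w ∈ G.comps (A (i + 2 * (r + 2) * s) \ A i) := mem_comps.2 ⟨w, hw, rfl⟩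
  have hone : ∀ C ∈ G.comps (A (i + 2 * (r + 2) * s) \ A i), C = G.Cmp (A (i + 2 * (r + 2) * s) \ A i) w := by
    intro C hC
    by_contra hCK
    exact hgood ((h.strand hG (by omega) hs hin hc hK hC hCK).good hG hr le_rfl)
  have hall : G.Cmp (A (i + 2 * (r + 2) * s) \ A i) w = A (i + 2 * (r + 2) * s) \ A i := by
    refine subset_antisymm Cmp_subset fun x hx => ?_
    rw [← hone _ (mem_comps.2 ⟨x, hx, rfl⟩)]
    exact self_mem_Cmp hx
  have hA2 : 2 ≤ (A i).card := by
    obtain ⟨x, hx⟩ := (h.two 0 (by omega)).1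
    obtain ⟨y, hy⟩ := (h.conn 0 (by omega)).1
    rw [Finset.mem_sdiff] at hy
    obtain ⟨a, _, b, _, h3, h4, h5⟩ := hG.twoEC.connS.cut (· ∈ A 0) (h.sub 0 (by omega) hx) hx hy.1 hy.2
    exact Finset.one_lt_card.2 ⟨a, h.mono (by omega) (by omega) h3, b, h.edge_in (by omega) (by omega) h3 h5,
      fun hab => h4 (hab ▸ h3)⟩
  have hB2 : 2 ≤ (G.V \ A (i + 2 * (r + 2) * s)).card :=
    h2.trans (Finset.card_le_card (Finset.sdiff_subset_sdiff subset_rfl (h.mono hin le_rfl)))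
  obtain ⟨e, he, a, ha, a', ha', hea⟩ := (h.two i (by omega)).connS.exists_edge hA2
  obtain ⟨f, hf, b, hb, b', hb', hfb⟩ := (h.conn _ hin).exists_edge hB2
  refine ⟨e, he, f, hf, ?_, fun k => A (i + (k + 1) * s) \ A (i + k * s), fun k hk => ?_,
    fun k hk l hl hkl => h.disjoint_slab hin hk hl hkl, ?_⟩
  · rintro rfl
    rw [hea] at hfb
    have hx : a ∈ s(b, b') := by rw [← hfb]; simp
    rw [Sym2.mem_iff] at hx
    have := h.mono (i := i) (j := i + 2 * (r + 2) * s) (by omega) hin ha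
    rcases hx with rfl | rfl
    · exact (Finset.mem_sdiff.1 hb).2 this
    · exact (Finset.mem_sdiff.1 hb').2 this
  · obtain ⟨e1, e2⟩ := hle k hk
    have h3 := h.conn_inter (i := i) (by omega) (by omega) (by omega) hin (hc k hk) hK
    rwa [hall, Finset.inter_eq_right.2 (h.slab_sub (by omega) (by omega) (by omega) hin)] at h3
  · intro Z x y hZ hx hxe hy hyf k hk
    obtain ⟨e1, e2⟩ := hle k hk
    have hxA : x ∈ A i := by
      rw [hea, Sym2.mem_iff] at hxe
      rcases hxe with rfl | rfl <;> assumption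
    have hyA : y ∉ A (i + 2 * (r + 2) * s) := by
      rw [hfb, Sym2.mem_iff] at hyf
      rcases hyf with rfl | rfl
      · exact (Finset.mem_sdiff.1 hb).2
      · exact (Finset.mem_sdiff.1 hb').2
    obtain ⟨z, hz, hz'⟩ := h.pass (t := i + k * s) (by omega) hZ hx (h.mono (by omega) (by omega) hxA) hy
      (fun h4 => hyA (h.mono (by omega) hin h4))
    rw [Finset.mem_sdiff] at hz'
    exact ⟨z, hz, Finset.mem_sdiff.2 ⟨h.mono (by omega) (by omega) hz'.1, hz'.2⟩⟩

end MGraph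

end

section

namespace MGraph

variable {G H : MGraph} {C F O S T X W Y Z K Δ : Finset ℕ} {p q pe qe ci cj φ : ℕ → ℕ} {cI cD : ℕ → Finset ℕ}
  {a b c u v w x y e f g h i j k l m n r t s : ℕ}

theorem FP.jn_seg (h : FP G n p pe) (ha : a ≤ n) (hb : b ≤ n) (hX : ∀ i ≤ n, (a ≤ i ∨ b ≤ i) → (i ≤ a ∨ i ≤ b) → p i ∈ X)
    (hF : ∀ i < n, pe i ∉ F) : G.Jn F X (p a) (p b) := by
  rcases le_total a b with hab | hab
  · exact h.jn hab hb (fun i h1 h2 => hX i (by omega) (Or.inl h1) (Or.inr h2)) fun i _ h2 => hF i (by omega)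
  · exact (h.jn hab ha (fun i h1 h2 => hX i (by omega) (Or.inr h1) (Or.inl h2)) fun i _ h2 => hF i (by omega)).symm

theorem Shape.noTriple (hS : Shape H k p pe l q qe Δ ci cj cI cD) (hL : H.Loopless)
    (hmin : ∀ U ⊆ H.V, H.TwoEC U → H.Jn ∅ (H.V \ U) (p 0) (q l) → p 0 ∉ U → U.card ≤ 1) : NoTriple Δ ci cj := by
  intro g₁ hg₁ g₂ hg₂ g₃ hg₃ h12 hc1 hc2 hd1 hd2
  have h13 : g₁ ≠ g₃ := by rintro rfl; omega
  have h23 : g₂ ≠ g₃ := by rintro rfl; omega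
  have hck := fun g hg => hS.ci_le g hg
  have hdl := fun g hg => hS.cj_le g hg
  set M := (Finset.range (ci g₃ + 1)).image p ∪ (Finset.Icc (cj g₃) l).image q ∪ cI g₃ with hM
  have hmem : ∀ x, x ∈ M ↔ (∃ i ≤ ci g₃, p i = x) ∨ (∃ j, cj g₃ ≤ j ∧ j ≤ l ∧ q j = x) ∨ x ∈ cI g₃ := by
    intro x
    simp only [hM, Finset.mem_union, Finset.mem_image, Finset.mem_range, Nat.lt_succ_iff, Finset.mem_Icc, or_assoc, and_assoc]
  have hp : ∀ i ≤ k, ci g₃ < i → p i ∈ H.V \ M := by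
    intro i hi hi'
    rw [Finset.mem_sdiff, hmem]
    refine ⟨hS.P.mem i hi, ?_⟩
    rintro (⟨i', h1, h2⟩ | ⟨j, _, h1, h2⟩ | h1)
    · have := hS.P.inj i' (h1.trans (hck _ hg₃)) i hi h2; omega
    · exact hS.disj i hi j h1 h2.symm
    · exact hS.P_cI _ hg₃ i hi h1
  have hq : ∀ j ≤ l, j < cj g₃ → q j ∈ H.V \ M := by
    intro j hj hj'
    rw [Finset.mem_sdiff, hmem]
    refine ⟨hS.Q.mem j hj, ?_⟩
    rintro (⟨i', h1, h2⟩ | ⟨j', h0, h1, h2⟩ | h1)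
    · exact hS.disj i' (h1.trans (hck _ hg₃)) j hj h2
    · have := hS.Q.inj j' h1 j hj h2; omega
    · exact hS.Q_cI _ hg₃ j hj h1
  have hI : ∀ g ∈ Δ, g ≠ g₃ → cI g ⊆ H.V \ M := by
    intro g hg hne x hx
    rw [Finset.mem_sdiff, hmem]
    refine ⟨(hS.pth g hg).sub.2.2.1 hx, ?_⟩
    rintro (⟨i', h1, rfl⟩ | ⟨j', h0, h1, rfl⟩ | h1)
    · exact hS.P_cI g hg i' (h1.trans (hck _ hg₃)) hx
    · exact hS.Q_cI g hg j' h1 hx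
    · exact Finset.disjoint_left.1 (hS.cI_disj g hg g₃ hg₃ hne) hx h1
  have hYsub : ∀ g ∈ Δ, g ≠ g₃ → ci g₃ < ci g → cj g < cj g₃ →
      insert (p (ci g)) (insert (q (cj g)) (cI g)) ⊆ H.V \ M := by
    intro g hg hne h1 h2
    exact Finset.insert_subset (hp _ (hck _ hg) h1) (Finset.insert_subset (hq _ (hdl _ hg) h2) (hI g hg hne))
  obtain ⟨e, heD, v, hv, hends, hJ0⟩ := (hS.pth g₁ hg₁).first (F := ∅) (by simp)
  have hpn : p (ci g₁) ∉ insert (q (cj g₁)) (cI g₁) := by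
    rw [Finset.mem_insert, not_or]
    exact ⟨hS.disj _ (hck _ hg₁) _ (hdl _ hg₁), hS.P_cI _ hg₁ _ (hck _ hg₁)⟩
  have hJ1 : H.Jn {e} (insert (q (cj g₁)) (cI g₁)) v (q (cj g₁)) := hJ0.avoid fun x hx y hy h => by
    have hm : p (ci g₁) ∈ s(x, y) := by rw [← h, hends]; simp
    rcases Sym2.mem_iff.1 hm with h | h
    · exact hpn (h ▸ hx)
    · exact hpn (h ▸ hy)
  have hJ2 := (hS.pth g₂ hg₂).jn (F := {e}) (fun e' he' hee => by
    rw [Finset.mem_singleton] at hee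
    subst hee
    exact Finset.disjoint_left.1 (hS.cD_disj _ hg₁ _ hg₂ h12) heD he')
  have hJQ : H.Jn {e} (H.V \ M) (q (cj g₁)) (q (cj g₂)) := hS.Q.jn_seg (hdl _ hg₁) (hdl _ hg₂)
    (fun i hi h1 h2 => hq i hi (by omega)) fun i hi hie => by
      rw [Finset.mem_singleton] at hie
      exact hS.qe_cD g₁ hg₁ i hi (hie ▸ heD)
  have hJP : H.Jn {e} (H.V \ M) (p (ci g₂)) (p (ci g₁)) := hS.P.jn_seg (hck _ hg₂) (hck _ hg₁)
    (fun i hi h1 h2 => hp i hi (by omega)) fun i hi hie => by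
      rw [Finset.mem_singleton] at hie
      exact hS.pe_cD g₁ hg₁ i hi (hie ▸ heD)
  have hY1 := hYsub g₁ hg₁ h13 hc1 hd1
  have hY2 := hYsub g₂ hg₂ h23 hc2 hd2
  have hcyc : H.Jn {e} (H.V \ M) (p (ci g₁)) v :=
    ((hJ1.mono subset_rfl ((Finset.subset_insert _ _).trans hY1)).trans
      (hJQ.trans ((hJ2.symm.mono subset_rfl hY2).trans hJP))).symm
  obtain ⟨U, hU, h1, h2, h3⟩ := exists_twoEC_of_edge ((hS.pth g₁ hg₁).sub.2.2.2 heD) hends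
    (hY1 (Finset.mem_insert_self _ _)) (hY1 (Finset.mem_insert_of_mem hv)) hcyc
  have hne : p (ci g₁) ≠ v := by
    rintro rfl
    exact hL e ((hS.pth g₁ hg₁).sub.2.2.2 heD) (by simp [hends])
  have hMU : ∀ x ∈ M, x ∈ H.V → x ∈ H.V \ U := fun x hx hxV =>
    Finset.mem_sdiff.2 ⟨hxV, fun hxU => (Finset.mem_sdiff.1 (hU hxU)).2 hx⟩
  have hPm : ∀ i ≤ ci g₃, p i ∈ H.V \ U := fun i hi =>
    hMU _ ((hmem _).2 (Or.inl ⟨i, hi, rfl⟩)) (hS.P.mem i (hi.trans (hck _ hg₃)))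
  have hQm : ∀ j, cj g₃ ≤ j → j ≤ l → q j ∈ H.V \ U := fun j hj hj' =>
    hMU _ ((hmem _).2 (Or.inr (Or.inl ⟨j, hj, hj', rfl⟩))) (hS.Q.mem j hj')
  have hJ3 := ((hS.pth g₃ hg₃).jn (F := ∅) (by simp)).mono subset_rfl (Y := H.V \ U)
    (Finset.insert_subset (hPm _ le_rfl) (Finset.insert_subset (hQm _ le_rfl (hdl _ hg₃)) fun x hx =>
      hMU x ((hmem x).2 (Or.inr (Or.inr hx))) ((hS.pth g₃ hg₃).sub.2.2.1 hx)))
  have hJ4 : H.Jn ∅ (H.V \ U) (p 0) (p (ci g₃)) := hS.P.jn (by omega) (hck _ hg₃) (fun i _ hi => hPm i hi) (by simp)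
  have hJ5 : H.Jn ∅ (H.V \ U) (q (cj g₃)) (q l) := hS.Q.jn (hdl _ hg₃) le_rfl (fun j hj hj' => hQm j hj hj') (by simp)
  have := hmin U (hU.trans Finset.sdiff_subset) h3 (hJ4.trans (hJ3.trans hJ5)) (Finset.mem_sdiff.1 (hPm 0 (by omega))).2
  have := Finset.one_lt_card.2 ⟨_, h1, _, h2, hne⟩
  omega

end MGraph

end

section

namespace MGraph

variable {G H : MGraph} {A B U W X Y Δ : Finset ℕ} {p q pe qe ci cj φ : ℕ → ℕ} {cI cD T : ℕ → Finset ℕ}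
  {a b u v x y e f k l n r : ℕ}

theorem Conn2.extend_side (hG : G.Conn2) (hA : G.ConnS A) (hAV : A ⊆ G.V) (hB : G.ConnS (G.V \ A))
    (hy : y ∈ G.V \ A) (h2 : 2 ≤ (G.V \ A).card) :
    ∃ a ∈ G.V \ A, a ≠ y ∧ G.ConnS (insert a A) ∧ G.ConnS (G.V \ insert a A) := by
  set B := G.V \ A with hBdef
  set S := (B.erase y).filter fun v => ∃ a ∈ A, G.Ed ∅ v a with hSdef
  have hmemS : ∀ v, v ∈ S ↔ (v ≠ y ∧ v ∈ B) ∧ ∃ a ∈ A, G.Ed ∅ v a := by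
    intro v; rw [hSdef, Finset.mem_filter, Finset.mem_erase]
  have hBV : ∀ v, v ∈ B ↔ v ∈ G.V ∧ v ∉ A := fun v => Finset.mem_sdiff
  have hcross : ∀ z ∈ B, ∀ w ∈ B, w ≠ z → ∃ a' ∈ G.Cmp (B \ {z}) w, ∃ b ∈ A, G.Ed ∅ a' b := by
    intro z hz w hw hwz
    obtain ⟨a0, ha0⟩ := hA.1
    have ha0z : a0 ≠ z := by rintro rfl; exact ((hBV _).1 hz).2 ha0
    have hw' : w ∈ B \ {z} := Finset.mem_sdiff.2 ⟨hw, by simpa using hwz⟩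
    obtain ⟨a', ha', b, hb, h1, h3, h4⟩ := (hG.erase z ((hBV _).1 hz).1).cut (· ∈ G.Cmp (B \ {z}) w)
      (Finset.mem_erase.2 ⟨hwz, ((hBV _).1 hw).1⟩) (self_mem_Cmp hw')
      (Finset.mem_erase.2 ⟨ha0z, hAV ha0⟩)
      (fun h => ((hBV _).1 (Finset.mem_sdiff.1 (Cmp_subset h)).1).2 ha0)
    refine ⟨a', h1, b, ?_, h4⟩
    by_contra hbA
    rw [Finset.mem_erase] at hb
    exact h3 (Cmp_closed h1 (Finset.mem_sdiff.2 ⟨(hBV _).2 ⟨hb.2, hbA⟩, by simpa using hb.1⟩) h4)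
  have hSne : S.Nonempty := by
    obtain ⟨w, hw, hwy⟩ := Finset.exists_mem_ne (show 1 < B.card by omega) y
    obtain ⟨a', ha', b, hb, h⟩ := hcross y hy w hw hwy
    have := Finset.mem_sdiff.1 (Cmp_subset ha')
    exact ⟨a', (hmemS _).2 ⟨⟨by simpa using this.2, this.1⟩, b, hb, h⟩⟩
  obtain ⟨v, hvS, hmax⟩ := Finset.exists_max_image S (fun v => (G.Cmp (B \ {v}) y).card) hSne
  obtain ⟨⟨hvy, hvB⟩, b, hbA, hvb⟩ := (hmemS v).1 hvS
  have hy' : y ∈ B \ {v} := Finset.mem_sdiff.2 ⟨hy, by simpa using hvy.symm⟩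
  refine ⟨v, hvB, hvy, ?_, ?_⟩
  · rw [Finset.insert_eq]
    exact (connS_singleton G v).union_edge hA (Finset.mem_singleton_self v) hbA hvb
  have heq : G.V \ insert v A = B \ {v} := by
    ext z; simp only [Finset.mem_sdiff, Finset.mem_insert, Finset.mem_singleton, hBdef]; tauto
  rw [heq]
  suffices h : G.Cmp (B \ {v}) y = B \ {v} by rw [← h]; exact connS_Cmp hy'
  refine Cmp_subset.antisymm fun w hw => ?_
  by_contra hwK
  have hw' := Finset.mem_sdiff.1 hw
  obtain ⟨a', ha', b', hb', h'⟩ := hcross v hvB w hw'.1 (by simpa using hw'.2)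
  have ha'B := Finset.mem_sdiff.1 (Cmp_subset ha')
  have ha'K : a' ∉ G.Cmp (B \ {v}) y := fun h => hwK (by
    rw [← Cmp_eq h, Cmp_eq ha']; exact self_mem_Cmp hw)
  have ha'v : a' ≠ v := by simpa using ha'B.2
  have ha'y : a' ≠ y := by rintro rfl; exact ha'K (self_mem_Cmp hy')
  obtain ⟨c, hc, d, hd, hcd⟩ := Cmp_exit hB (Finset.singleton_subset_iff.2 hvB) (Finset.singleton_nonempty v) hy'
  have hconn := (connS_Cmp (G := G) hy').union_edge (connS_singleton G d) hc (Finset.mem_singleton_self d) hcd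
  rw [Finset.mem_singleton] at hd
  subst hd
  have hy'' : y ∈ B \ {a'} := Finset.mem_sdiff.2 ⟨hy, by simpa using ha'y.symm⟩
  have hsub := hconn.subset_Cmp (X := B \ {a'}) (u := y) (a := y) (fun z hz => by
    rw [Finset.mem_union, Finset.mem_singleton] at hz
    rw [Finset.mem_sdiff, Finset.mem_singleton]
    rcases hz with hz | rfl
    · exact ⟨(Finset.mem_sdiff.1 (Cmp_subset hz)).1, fun h => ha'K (h ▸ hz)⟩
    · exact ⟨hvB, fun h => ha'v h.symm⟩) (Finset.mem_union_left _ (self_mem_Cmp hy')) (self_mem_Cmp hy'')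
  have h1 := Finset.card_le_card hsub
  have h3 := hmax a' ((hmemS _).2 ⟨⟨ha'y, ha'B.1⟩, b', hb', h'⟩)
  rw [Finset.card_union_of_disjoint (Finset.disjoint_singleton_right.2 fun h =>
    (Finset.mem_sdiff.1 (Cmp_subset h)).2 (Finset.mem_singleton_self _)), Finset.card_singleton] at h1
  omega

/-- Any two edges of a 2-connected graph lie in a common bond. -/
theorem Conn2.exists_bond (hG : G.Conn2) (he : e ∈ G.E) (hf : f ∈ G.E) :
    ∃ A ⊆ G.V, G.ConnS A ∧ G.ConnS (G.V \ A) ∧ (∃ x ∈ A, ∃ y ∈ G.V \ A, G.ends e = s(x, y)) ∧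
      ∃ x ∈ A, ∃ y ∈ G.V \ A, G.ends f = s(x, y) := by
  obtain ⟨x, y, hxy⟩ : ∃ x y, G.ends e = s(x, y) := by
    induction h : G.ends e with | _ x y => exact ⟨x, y, rfl⟩
  obtain ⟨u, v, huv⟩ : ∃ u v, G.ends f = s(u, v) := by
    induction h : G.ends f with | _ x y => exact ⟨x, y, rfl⟩
  have hxV : x ∈ G.V := G.ends_mem e he x (by simp [hxy])
  have hyV : y ∈ G.V := G.ends_mem e he y (by simp [hxy])
  have huV : u ∈ G.V := G.ends_mem f hf u (by simp [huv])
  have hvV : v ∈ G.V := G.ends_mem f hf v (by simp [huv])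
  have hne : x ≠ y := by rintro rfl; exact hG.loopless e he (by simp [hxy])
  have hne' : u ≠ v := by rintro rfl; exact hG.loopless f hf (by simp [huv])
  set S := G.V.powerset.filter fun A => G.ConnS A ∧ G.ConnS (G.V \ A) ∧ x ∈ A ∧ y ∉ A ∧ ¬ (u ∈ A ∧ v ∈ A) with hS
  have hmem : ∀ A, A ∈ S ↔ A ⊆ G.V ∧ G.ConnS A ∧ G.ConnS (G.V \ A) ∧ x ∈ A ∧ y ∉ A ∧ ¬ (u ∈ A ∧ v ∈ A) := by
    intro A; rw [hS, Finset.mem_filter, Finset.mem_powerset]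
  have hSne : S.Nonempty := ⟨{x}, (hmem _).2 ⟨by simpa using hxV, connS_singleton G x, hG.connS_compl hxV,
    by simp, by simpa using hne.symm, by
      rw [Finset.mem_singleton, Finset.mem_singleton]
      rintro ⟨rfl, rfl⟩; exact hne' rfl⟩⟩
  obtain ⟨A, hAS, hmax⟩ := Finset.exists_max_image S Finset.card hSne
  obtain ⟨hAV, hA, hB, hxA, hyA, hn⟩ := (hmem A).1 hAS
  refine ⟨A, hAV, hA, hB, ⟨x, hxA, y, Finset.mem_sdiff.2 ⟨hyV, hyA⟩, hxy⟩, ?_⟩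
  by_cases huA : u ∈ A
  · exact ⟨u, huA, v, Finset.mem_sdiff.2 ⟨hvV, fun h => hn ⟨huA, h⟩⟩, huv⟩
  by_cases hvA : v ∈ A
  · exact ⟨v, hvA, u, Finset.mem_sdiff.2 ⟨huV, huA⟩, by rw [huv, Sym2.eq_swap]⟩
  exfalso
  obtain ⟨a, haB, hay, h1, h2⟩ := hG.extend_side hA hAV hB (Finset.mem_sdiff.2 ⟨hyV, hyA⟩)
    (Finset.one_lt_card.2 ⟨u, Finset.mem_sdiff.2 ⟨huV, huA⟩, v, Finset.mem_sdiff.2 ⟨hvV, hvA⟩, hne'⟩)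
  rw [Finset.mem_sdiff] at haB
  have := hmax (insert a A) ((hmem _).2 ⟨Finset.insert_subset haB.1 hAV, h1, h2, Finset.mem_insert_of_mem hxA,
    by rw [Finset.mem_insert, not_or]; exact ⟨hay.symm, hyA⟩, by
      rw [Finset.mem_insert, Finset.mem_insert]
      rintro ⟨h3 | h3, h4 | h4⟩
      · exact hne' (h3.trans h4.symm)
      · exact hvA h4
      · exact huA h3
      · exact huA h3⟩)
  rw [Finset.card_insert_of_notMem haB.2] at this
  omega

/-- The ends of two edges span a ladder, provided no nontrivial set can be contracted without
touching the connections between them. -/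
theorem Conn2.exists_shape_of_minimal (hG : G.Conn2) (he : e ∈ G.E) (hf : f ∈ G.E)
    (hmin : ∀ U ⊆ G.V, ∀ x y, G.TwoEC U → G.Jn ∅ (G.V \ U) x y → x ∉ U → x ∈ G.ends e →
      y ∈ G.ends f → U.card ≤ 1) :
    ∃ k p pe l q qe ci cj cI cD, Shape G k p pe l q qe (G.bdry (vset p k)) ci cj cI cD ∧
      NoTriple (G.bdry (vset p k)) ci cj ∧ NoTriple (G.bdry (vset p k)) cj ci ∧
      G.ends e = s(p 0, q 0) ∧ G.ends f = s(p k, q l) ∧ e ∈ G.bdry (vset p k) ∧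
      f ∈ G.bdry (vset p k) ∧ ci e = 0 ∧ cj e = 0 ∧ ci f = k ∧ cj f = l := by
  obtain ⟨A, hAV, hA, hB, ⟨x, hx, y, hy, hxy⟩, u, hu, v, hv, huv⟩ := hG.exists_bond he hf
  obtain ⟨k, p, pe, hP, rfl, rfl, hpA, -⟩ := (hA.2 x hx u hu).exists_fp hx hAV
  obtain ⟨l, q, qe, hQ, rfl, rfl, hqB, -⟩ := (hB.2 y hy v hv).exists_fp hy Finset.sdiff_subset
  have hd : ∀ i ≤ k, ∀ j ≤ l, p i ≠ q j := fun i hi j hj h =>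
    (Finset.mem_sdiff.1 (hqB j hj)).2 (h ▸ hpA i hi)
  have hacy : ∀ {n r re}, FP G n r re → r 0 ∈ G.ends e → r n ∈ G.ends f → G.Acy (G.V \ vset r n) := by
    intro n r re hR h0 hn
    by_contra h
    obtain ⟨U, hU, hUT, hU2⟩ := Acy.exists_of_not h
    have hm : ∀ i ≤ n, r i ∈ G.V \ U := fun i hi =>
      Finset.mem_sdiff.2 ⟨hR.mem i hi, fun hU' => (Finset.mem_sdiff.1 (hU hU')).2 (vset_mem hi)⟩
    have := hmin U (hU.trans Finset.sdiff_subset) (r 0) (r n) hUT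
      (hR.jn (Nat.zero_le n) le_rfl (fun i _ hi => hm i hi) (by simp)) (Finset.mem_sdiff.1 (hm 0 (by omega))).2 h0 hn
    omega
  obtain ⟨ci, cj, cI, cD, hS, -, hci, hcj⟩ := hG.exists_shape hP hQ hd
    (hacy hP (by simp [hxy]) (by simp [huv])) (hacy hQ (by simp [hxy]) (by simp [huv]))
  have hqv : ∀ j ≤ l, q j ∉ vset p k := fun j hj h => by
    obtain ⟨i, hi, h⟩ := mem_vset.1 h
    exact hd i hi j hj h
  have heb : e ∈ G.bdry (vset p k) := mem_bdry.2 ⟨he, p 0, vset_mem (by omega), q 0, hqv 0 (by omega), hxy⟩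
  have hfb : f ∈ G.bdry (vset p k) := mem_bdry.2 ⟨hf, p k, vset_mem le_rfl, q l, hqv l le_rfl, huv⟩
  refine ⟨k, p, pe, l, q, qe, ci, cj, cI, cD, hS, ?_, ?_, hxy, huv, heb, hfb, ?_, ?_, ?_, ?_⟩
  · exact hS.noTriple hG.loopless fun U hU hT hJ h0 => hmin U hU _ _ hT hJ h0 (by simp [hxy]) (by simp [huv])
  · exact hS.swap.noTriple hG.loopless fun U hU hT hJ h0 => hmin U hU _ _ hT hJ h0 (by simp [hxy]) (by simp [huv])
  · exact hci e heb 0 (by omega) (by simp [hxy])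
  · exact hcj e heb 0 (by omega) (by simp [hxy])
  · exact hci f hfb k le_rfl (by simp [huv])
  · exact hcj f hfb l le_rfl (by simp [huv])

/-- Contracting as much as possible while keeping `e` and `f`. -/
theorem Conn2.exists_minimal_contr (hG : G.Conn2) (he : e ∈ G.E) (hf : f ∈ G.E) :
    ∃ H φ, G.Contr H φ ∧ H.Conn2 ∧ e ∈ H.E ∧ f ∈ H.E ∧
      ∀ U ⊆ H.V, ∀ x y, H.TwoEC U → H.Jn ∅ (H.V \ U) x y → x ∉ U → x ∈ H.ends e →
        y ∈ H.ends f → U.card ≤ 1 := by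
  have hex : ∃ n H φ, G.Contr H φ ∧ H.Conn2 ∧ e ∈ H.E ∧ f ∈ H.E ∧ H.V.card = n :=
    ⟨_, G, id, Contr.refl hG.loopless, hG, he, hf, rfl⟩
  obtain ⟨H, φ, h1, hH, heH, hfH, hn⟩ := Nat.find_spec hex
  have hmin := fun m hm => Nat.find_min hex (m := m) hm
  refine ⟨H, φ, h1, hH, heH, hfH, fun U hU x y hT hJ hxU hxe hyf => ?_⟩
  by_contra hcard
  have hxV : x ∈ H.V \ U := Finset.mem_sdiff.2 ⟨H.ends_mem e heH x hxe, hxU⟩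
  have hW := twoEC_sdiff_Cmp hH.twoEC hT hU x
  have hKV : H.Cmp (H.V \ U) x ⊆ H.V := Cmp_subset.trans Finset.sdiff_subset
  set W := H.V \ H.Cmp (H.V \ U) x with hWdef
  have hWK : H.V \ W = H.Cmp (H.V \ U) x := Finset.sdiff_sdiff_eq_self hKV
  have hUW : U ⊆ W := fun z hz => Finset.mem_sdiff.2 ⟨hU hz, fun h => (Finset.mem_sdiff.1 (Cmp_subset h)).2 hz⟩
  have hxW : x ∉ W := fun h => (Finset.mem_sdiff.1 h).2 (self_mem_Cmp hxV)
  have hyV : y ∈ H.V \ U := hJ.mem hxV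
  have hyW : y ∉ W := fun h => (Finset.mem_sdiff.1 h).2 (mem_Cmp.2 ⟨hyV, hJ⟩)
  obtain ⟨H', u0, hu0, hc, hH', hV'⟩ := hH.exists_contr hW Finset.sdiff_subset (hWK ▸ connS_Cmp hxV)
  have hkeep : ∀ g ∈ H.E, ∀ z ∈ H.ends g, z ∉ W → g ∈ H'.E := by
    intro g hg z hz hzW
    rw [hc.E]
    refine ⟨hg, fun hdiag => ?_⟩
    obtain ⟨w, hw⟩ := Sym2.mem_iff_exists.1 hz
    rw [hw, Sym2.map_mk] at hdiag
    have h3 : mapf W u0 z = mapf W u0 w := by simpa using hdiag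
    simp only [mapf, hzW, if_false] at h3
    split_ifs at h3 with hwW
    · exact hzW (h3 ▸ hu0)
    · exact hH.loopless g hg (by simp [hw, h3])
  have hlt : H'.V.card < H.V.card := by
    rw [hV']
    exact card_insert_sdiff_lt Finset.sdiff_subset (by have := Finset.card_le_card hUW; omega)
  exact hmin H'.V.card (by rw [← hn]; exact hlt)
    ⟨H', _, h1.trans hc, hH', hkeep e heH x hxe hxW, hkeep f hfH y hyf hyW, rfl⟩

theorem Conn2.good_of_slabs {m : ℕ} (hG : G.Conn2) (hr : 1 ≤ r) (he : e ∈ G.E) (hf : f ∈ G.E) (hne : e ≠ f)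
    (hT : Slabs G m e f T) (hm : 2 * r + 2 ≤ m) : Good r G := by
  obtain ⟨H, φ, hc, hH, heH, hfH, hmin⟩ := hG.exists_minimal_contr he hf
  obtain ⟨k, p, pe, l, q, qe, ci, cj, cI, cD, hS, hN1, hN2, hee, hff, heb, hfb, h1, h2, h3, h4⟩ :=
    hH.exists_shape_of_minimal heH hfH hmin
  refine Good.of_contr hc (hS.good hr hN1 hN2 heb hfb hne h1 h2 h3 h4 (Or.inl (hm.trans ?_)))
  rw [hc.bdry]
  have hpre : ∀ {g z}, g ∈ H.E → z ∈ H.ends g → ∃ x ∈ G.V, x ∈ G.ends g ∧ φ x = z := by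
    intro g z hg hz
    rw [hc.ends g hg, Sym2.mem_map] at hz
    obtain ⟨x, hx, rfl⟩ := hz
    exact ⟨x, G.ends_mem g ((hc.E g).1 hg).1 x hx, hx, rfl⟩
  have hmeet : ∀ {X : Finset ℕ} {z w}, X ⊆ H.V → H.ConnS X → z ∈ X → z ∈ H.ends e → w ∈ X → w ∈ H.ends f →
      ∀ i < m, ∃ t ∈ T i, t ∈ G.V ∧ φ t ∈ X := by
    intro X z w hXV hX hz hze hw hwf i hi
    obtain ⟨x, hx, hxe, rfl⟩ := hpre heH hze
    obtain ⟨y, hy, hyf, rfl⟩ := hpre hfH hwf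
    obtain ⟨t, ht, htT⟩ := hT.sep _ x y (hc.pre_connS hXV hX) (Finset.mem_filter.2 ⟨hx, hz⟩) hxe
      (Finset.mem_filter.2 ⟨hy, hw⟩) hyf i hi
    exact ⟨t, htT, Finset.mem_filter.1 ht⟩
  have key : ∀ i, ∃ g, i < m → g ∈ G.bdry (G.V.filter (φ · ∈ vset p k)) ∧ ∃ a ∈ T i, ∃ b ∈ T i, G.ends g = s(a, b) := by
    intro i
    by_cases hi : i < m
    swap
    · exact ⟨0, fun h => absurd h hi⟩
    obtain ⟨t, htT, htV, htX⟩ := hmeet hS.P.vset_sub hS.P.vset_connS (vset_mem (Nat.zero_le k)) (by simp [hee])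
      (vset_mem le_rfl) (by simp [hff]) i hi
    obtain ⟨t', htT', -, htX'⟩ := hmeet hS.Q.vset_sub hS.Q.vset_connS (vset_mem (Nat.zero_le l)) (by simp [hee])
      (vset_mem le_rfl) (by simp [hff]) i hi
    obtain ⟨a, ha, b, hb, haP, hbP, g, hg, -, hgab⟩ := (hT.conn i hi).cut
      (· ∈ G.V.filter (φ · ∈ vset p k)) htT (Finset.mem_filter.2 ⟨htV, htX⟩) htT' (fun h => by
        obtain ⟨i, hi, h5⟩ := mem_vset.1 (Finset.mem_filter.1 h).2
        obtain ⟨j, hj, h6⟩ := mem_vset.1 htX'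
        exact hS.disj i hi j hj (h5.trans h6.symm))
    exact ⟨g, fun _ => ⟨mem_bdry.2 ⟨hg, a, haP, b, hbP, hgab⟩, a, ha, b, hb, hgab⟩⟩
  choose w hw using key
  rw [← Finset.card_range m]
  refine Finset.card_le_card_of_injOn w (fun i hi => (hw i (Finset.mem_range.1 hi)).1) ?_
  intro i hi j hj hij
  have hi' := Finset.mem_range.1 hi
  have hj' := Finset.mem_range.1 hj
  by_contra hne'
  obtain ⟨-, a, ha, b, hb, hab⟩ := hw i hi'
  obtain ⟨-, a', ha', b', hb', hab'⟩ := hw j hj'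
  have hm' : a ∈ s(a', b') := by rw [← hab', ← hij, hab]; simp
  refine Finset.disjoint_left.1 (hT.dT i hi' j hj' hne') ha ?_
  rcases Sym2.mem_iff.1 hm' with rfl | rfl <;> assumption

end MGraph

end

section

namespace MGraph

variable {G : MGraph}

theorem KConnected.conn2 (hL : G.Loopless) (hG : G.KConnected 2) : G.Conn2 := by
  obtain ⟨h2, hP⟩ := hG
  have hjn : ∀ {u v F vs es}, G.IsPathBetween u v vs es → (∀ e ∈ es, e ∉ F) → G.Jn F vs.toFinset u v := by
    intro u v F vs es h hF
    exact h.1.jn hF u (List.mem_of_mem_head? h.2.2.1) v (List.mem_of_mem_getLast? h.2.2.2)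
  have hsub : ∀ {u v vs es}, G.IsPathBetween u v vs es → vs.toFinset ⊆ G.V := fun h z hz =>
    h.1.mem_V z (List.mem_toFinset.1 hz)
  refine ⟨hL, h2, ⟨Finset.card_pos.1 (by omega), fun g u hu v hv => ?_⟩, fun v hv => ⟨?_, fun u hu w hw => ?_⟩⟩
  · by_cases huv : u = v
    · subst huv; exact .refl
    obtain ⟨P, hP1, hP2⟩ := hP u hu v hv huv
    obtain ⟨i, hi⟩ : ∃ i, g ∉ (P i).2 := by
      by_contra! h
      exact (hP2 0 1 (by decide)).2 g (h 0) (h 1)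
    refine (hjn (F := {g}) (hP1 i) fun e he heg => hi ?_).mono subset_rfl (hsub (hP1 i))
    rwa [Finset.mem_singleton.1 heg] at he
  · exact Finset.card_pos.1 (by rw [Finset.card_erase_of_mem hv]; omega)
  · by_cases huw : u = w
    · subst huw; exact .refl
    rw [Finset.mem_erase] at hu hw
    obtain ⟨P, hP1, hP2⟩ := hP u hu.2 w hw.2 huw
    obtain ⟨i, hi⟩ : ∃ i, v ∉ (P i).1 := by
      by_contra! h
      rcases (hP2 0 1 (by decide)).1 v (h 0) (h 1) with h | h
      · exact hu.1 h.symm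
      · exact hw.1 h.symm
    refine (hjn (F := ∅) (hP1 i) (by simp)).mono subset_rfl fun z hz => ?_
    refine Finset.mem_erase.2 ⟨?_, hsub (hP1 i) hz⟩
    rintro rfl
    exact hi (List.mem_toFinset.1 hz)

theorem Loopless.exists_card_bdry {d n : ℕ} (hL : G.Loopless) (hV : G.V.card ≤ n) (hE : n * d < G.E.card) :
    ∃ v ∈ G.V, d ≤ (G.bdry {v}).card := by
  by_contra! h
  have hsub : G.E ⊆ G.V.biUnion fun v => G.bdry {v} := by
    intro e he
    obtain ⟨x, y, hxy⟩ : ∃ x y, G.ends e = s(x, y) := by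
      induction h : G.ends e with | _ x y => exact ⟨x, y, rfl⟩
    refine Finset.mem_biUnion.2 ⟨x, G.ends_mem e he x (by simp [hxy]), mem_bdry.2
      ⟨he, x, Finset.mem_singleton_self x, y, ?_, hxy⟩⟩
    rw [Finset.mem_singleton]
    rintro rfl
    exact hL e he (by simp [hxy])
  have h1 := (Finset.card_le_card hsub).trans (Finset.card_biUnion_le_card_mul _ _ d fun v hv => (h v hv).le)
  have h2 := Nat.mul_le_mul_right d hV
  omega

end MGraph

end

/-- For every positive integer `r` there is an integer `g` such that every loopless
2-connected graph `G` with at least `g` edges has, as a cc-minor, a parallel-path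
extension of a graph having a tree decomposition whose underlying tree is a path on at
least `r` vertices, each vertex labeled by a copy of `K₃` or `B₃`, or by a copy of `K₄`
in which the basepoints form a matching. -/
theorem statement_19 (r : ℕ) (hr : 1 ≤ r) :
    ∃ g : ℕ, ∀ G : MGraph, G.Loopless → G.KConnected 2 → g ≤ G.E.card →
      ∃ H K m parts bp, G.CCMinor H ∧ IsPPE H K ∧ r ≤ m ∧
        IsPathDecompChain K m parts bp ∧ ∀ i < m, GoodLabel m parts bp i := by
  set N := (MGraph.swl r)^[MGraph.Dg r * (1 + (2 * (r + 2)) ^ MGraph.Dg r)] 2 + 1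
  refine ⟨N * MGraph.Dg r + 1, fun G hL hK hE => ?_⟩
  have hG := hK.conn2 hL
  change MGraph.Good r G
  rcases le_total N G.V.card with hV | hV
  · by_contra hgood
    obtain ⟨e, he, f, hf, hne, T, hT⟩ := hG.exists_slabs hr hgood hV
    exact hgood (hG.good_of_slabs hr he hf hne hT (by omega))
  · obtain ⟨v, hv, h⟩ := hL.exists_card_bdry hV hE
    exact MGraph.good_of_degree hr _ G v rfl hG hv h
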